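/- Let G be a finite almost simple group, i.e. G has a normal subgroup S that is a nonabelian simple group and whose centralizer in G is trivial. If x ∈ G has order 3, then there exist g₁, g₂, g₃ ∈ G such that the subgroup ⟨x, g₁⁻¹xg₁, g₂⁻¹xg₂, g₃⁻¹xg₃⟩ generated by x and these three conjugates is not solvable. -/

import Mathlib

namespace OrderThree
open Subgroup
open scoped commutatorElement

variable {G : Type*} [Group G]

/-- `g` has order a power of `p`. -/
def IsPElt (p : ℕ) (g : G) : Prop := ∃ k : ℕ, g ^ p ^ k = 1

theorem IsPElt.map {p : ℕ} {g : G} (h : IsPElt p g) {H F : Type*} [Group H] [FunLike F G H]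
    [MonoidHomClass F G H] (f : F) : IsPElt p (f g) := by
  obtain ⟨k, hk⟩ := h
  exact ⟨k, by rw [← map_pow, hk, map_one]⟩

theorem IsPElt.conj {p : ℕ} {g : G} (h : IsPElt p g) (a : G) : IsPElt p (a * g * a⁻¹) := by
  simpa using h.map (MulAut.conj a)

theorem IsPElt.of_mem {p : ℕ} {P : Subgroup G} (hP : IsPGroup p P) {g : G} (hg : g ∈ P) :
    IsPElt p g := by
  obtain ⟨k, hk⟩ := hP ⟨g, hg⟩
  exact ⟨k, by simpa [Subtype.ext_iff] using hk⟩

theorem isPGroup_of_forall {p : ℕ} {P : Subgroup G} (h : ∀ g ∈ P, IsPElt p g) : IsPGroup p P := by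
  rintro ⟨g, hg⟩
  obtain ⟨k, hk⟩ := h g hg
  exact ⟨k, by simpa [Subtype.ext_iff] using hk⟩

theorem IsPElt.orderOf {p : ℕ} (hp : p.Prime) {g : G} (h : IsPElt p g) : ∃ k, orderOf g = p ^ k := by
  obtain ⟨k, hk⟩ := h
  obtain ⟨j, -, hj⟩ := (Nat.dvd_prime_pow hp).1 (orderOf_dvd_of_pow_eq_one hk)
  exact ⟨j, hj⟩

theorem IsPElt.of_pow_three {g : G} (h : g ^ 3 = 1) : IsPElt 3 g := ⟨1, by simpa using h⟩

theorem IsPElt.coprime {p q : ℕ} (hp : p.Prime) (hq : q.Prime) (hpq : p ≠ q) {g h : G}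
    (hg : IsPElt p g) (hh : IsPElt q h) : (_root_.orderOf g).Coprime (_root_.orderOf h) := by
  obtain ⟨k, hk⟩ := hg.orderOf hp
  obtain ⟨j, hj⟩ := hh.orderOf hq
  rw [hk, hj]
  exact Nat.Coprime.pow _ _ ((Nat.coprime_primes hp hq).2 hpq)

theorem IsPElt.eq_one {p q : ℕ} (hp : p.Prime) (hq : q.Prime) (hpq : p ≠ q) {g : G}
    (hg : IsPElt p g) (hh : IsPElt q g) : g = 1 := by
  have := IsPElt.coprime hp hq hpq hg hh
  simpa using this

theorem isPGroup_zpowers {p : ℕ} {g : G} (h : IsPElt p g) : IsPGroup p (zpowers g) := by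
  refine isPGroup_of_forall fun x hx => ?_
  obtain ⟨n, rfl⟩ := hx
  obtain ⟨k, hk⟩ := h
  refine ⟨k, ?_⟩
  change (g ^ n) ^ p ^ k = 1
  rw [← zpow_natCast, ← zpow_mul, mul_comm, zpow_mul, zpow_natCast, hk, one_zpow]

theorem IsPElt.mem_sylow {p : ℕ} {g : G} (h : IsPElt p g) : ∃ P : Sylow p G, g ∈ P := by
  obtain ⟨Q, hQ⟩ := (isPGroup_zpowers h).exists_le_sylow
  exact ⟨Q, hQ (mem_zpowers g)⟩

/-- Every element of a finite group is a product of powers of itself of prime power order. -/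
theorem mem_closure_isPElt [Finite G] (g : G) :
    g ∈ closure {h | h ∈ zpowers g ∧ ∃ p : ℕ, p.Prime ∧ IsPElt p h} := by
  suffices H : ∀ n : ℕ, ∀ g : G, orderOf g = n →
      g ∈ closure {h | h ∈ zpowers g ∧ ∃ p : ℕ, p.Prime ∧ IsPElt p h} from H _ g rfl
  intro n
  induction n using Nat.recOnPosPrimePosCoprime with
  | zero => intro g hg; exact absurd hg (orderOf_pos g).ne'
  | one => intro g hg; rw [orderOf_eq_one_iff.1 hg]; exact one_mem _
  | prime_pow p n hp hn =>
    intro g hg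
    exact subset_closure ⟨mem_zpowers g, p, hp, n, by rw [← hg, pow_orderOf_eq_one]⟩
  | coprime a b ha hb hab iha ihb =>
    intro g hg
    have hA : orderOf (g ^ b) = a := by
      rw [orderOf_pow_of_dvd (by omega) (hg ▸ Dvd.intro_left a rfl), hg]
      exact Nat.mul_div_cancel _ (by omega)
    have hB : orderOf (g ^ a) = b := by
      rw [orderOf_pow_of_dvd (by omega) (hg ▸ Dvd.intro b rfl), hg]
      exact Nat.mul_div_cancel_left _ (by omega)
    have hle : ∀ h ∈ zpowers g, closure {k | k ∈ zpowers h ∧ ∃ p : ℕ, p.Prime ∧ IsPElt p k} ≤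
        closure {k | k ∈ zpowers g ∧ ∃ p : ℕ, p.Prime ∧ IsPElt p k} := fun h hh =>
      closure_mono fun k hk => ⟨(zpowers_le.2 hh) hk.1, hk.2⟩
    have h1 := hle _ (npow_mem_zpowers g b) (iha _ hA)
    have h2 := hle _ (npow_mem_zpowers g a) (ihb _ hB)
    have hbez := Nat.gcd_eq_gcd_ab a b
    rw [hab] at hbez
    have : g = (g ^ a) ^ (a.gcdA b) * (g ^ b) ^ (a.gcdB b) := by
      rw [← zpow_natCast, ← zpow_natCast, ← zpow_mul, ← zpow_mul, ← zpow_add, ← hbez]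
      simp
    have h3 := mul_mem (zpow_mem h2 (a.gcdA b)) (zpow_mem h1 (a.gcdB b))
    rwa [← this] at h3

/-- A `p'`-element whose commutator with `v` is a `p`-element commuting with it commutes
with `v`. -/
theorem commute_of_commutator {r v : G} (h : Commute ⁅r, v⁆ r)
    (hc : (orderOf ⁅r, v⁆).Coprime (orderOf r)) : Commute r v := by
  have key : ∀ n : ℕ, r ^ n * v * (r ^ n)⁻¹ = ⁅r, v⁆ ^ n * v := by
    intro n
    induction n with
    | zero => simp
    | succ n ih =>
      have h1 : r ^ (n + 1) * v * (r ^ (n + 1))⁻¹ = r * (r ^ n * v * (r ^ n)⁻¹) * r⁻¹ := by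
        rw [pow_succ']; group
      have h2 : r * ⁅r, v⁆ ^ n = ⁅r, v⁆ ^ n * r := (h.pow_left n).symm.eq
      rw [h1, ih, ← mul_assoc, h2, pow_succ]
      simp only [commutatorElement_def]
      group
  have h1 := key (orderOf r)
  rw [pow_orderOf_eq_one] at h1
  have h2 : ⁅r, v⁆ ^ orderOf r = 1 := by simpa using h1.symm
  have h3 : ⁅r, v⁆ = 1 := by
    have := Nat.dvd_gcd (dvd_refl _) (orderOf_dvd_of_pow_eq_one h2)
    rw [hc] at this
    simpa using this
  exact commutatorElement_eq_one_iff_commute.1 h3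

theorem commute_of_isPElt {p q : ℕ} (hp : p.Prime) (hq : q.Prime) (hpq : p ≠ q) {r v : G}
    (hr : IsPElt q r) (hc : IsPElt p ⁅r, v⁆) (h : Commute ⁅r, v⁆ r) : Commute r v :=
  commute_of_commutator h (IsPElt.coprime hp hq hpq hc hr)

section normalizer

variable {H K L : Subgroup G}

theorem le_normalizer_sup (hK : H ≤ normalizer K) (hL : H ≤ normalizer L) :
    H ≤ normalizer (K ⊔ L : Subgroup G) :=
  (le_inf hK hL).trans (normalizer_inf_normalizer_le_normalizer_sup K L)

theorem le_normalizer_inf (hK : H ≤ normalizer K) (hL : H ≤ normalizer L) :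
    H ≤ normalizer (K ⊓ L : Subgroup G) :=
  le_normalizer_iff.2 fun h hh _ hk =>
    ⟨le_normalizer_iff.1 hK h hh _ hk.1, le_normalizer_iff.1 hL h hh _ hk.2⟩

theorem le_normalizer_commutator (hK : H ≤ normalizer K) (hL : H ≤ normalizer L) :
    H ≤ normalizer (⁅K, L⁆ : Subgroup G) := by
  intro h hh
  have h1 := mem_normalizer_iff_map_conj_eq.1 (hK hh)
  have h2 := mem_normalizer_iff_map_conj_eq.1 (hL hh)
  rw [mem_normalizer_iff_map_conj_eq, map_commutator, h1, h2]

theorem le_normalizer_centralizer (hK : H ≤ normalizer K) :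
    H ≤ normalizer (centralizer (K : Set G) : Subgroup G) := by
  refine le_normalizer_iff.2 fun h hh c hc => mem_centralizer_iff.2 fun k hk => ?_
  have h1 := (mem_normalizer_iff''.1 (hK hh) k).1 hk
  have h2 := mem_centralizer_iff.1 hc _ h1
  calc k * (h * c * h⁻¹) = h * ((h⁻¹ * k * h) * c) * h⁻¹ := by group
    _ = h * (c * (h⁻¹ * k * h)) * h⁻¹ := by rw [h2]
    _ = _ := by group

theorem le_normalizer_closure {s : Set G} (h : ∀ g ∈ H, ∀ k ∈ s, g * k * g⁻¹ ∈ s) :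
    H ≤ normalizer (closure s : Subgroup G) :=
  le_normalizer_closure_iff.2 fun g hg k hk => subset_closure (h g hg k hk)

theorem exists_of_mem_sup (hH : H ≤ normalizer K) {g : G} (hg : g ∈ H ⊔ K) :
    ∃ h ∈ H, ∃ k ∈ K, h * k = g := by
  have : g ∈ ((H ⊔ K : Subgroup G) : Set G) := hg
  rwa [coe_mul_of_left_le_normalizer_right _ _ hH] at this

theorem conj_mem_of_le_normalizer (hH : H ≤ normalizer K) {h k : G} (hh : h ∈ H) (hk : k ∈ K) :
    h * k * h⁻¹ ∈ K := le_normalizer_iff.1 hH h hh k hk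

/-- The elements `g` normalizing `V` for which `v⁻¹ v^g ∈ C` for all `v ∈ V` form a subgroup. -/
theorem mem_of_closure_conj [Finite G] {V C : Subgroup G} {s : Set G} (hs : closure s ≤ normalizer V)
    (h : ∀ g ∈ s, ∀ v ∈ V, v⁻¹ * (g * v * g⁻¹) ∈ C) {g : G} (hg : g ∈ closure s) {v : G}
    (hv : v ∈ V) : v⁻¹ * (g * v * g⁻¹) ∈ C := by
  induction hg using closure_induction generalizing v with
  | mem g hg => exact h g hg v hv
  | one => simp
  | mul a b ha hb iha ihb =>
    have h1 := ihb hv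
    have h2 := iha (conj_mem_of_le_normalizer hs hb hv)
    have := mul_mem h1 h2
    convert this using 1
    group
  | inv a ha iha =>
    have h2 := iha (v := a⁻¹ * v * a) (by simpa using conj_mem_of_le_normalizer hs (inv_mem ha) hv)
    have := inv_mem h2
    convert this using 1
    group

end normalizer

section pcore

/-- The largest normal `p`-subgroup. -/
def pcore (p : ℕ) (G : Type*) [Group G] : Subgroup G := sSup {N | N.Normal ∧ IsPGroup p N}

variable [Finite G] (p : ℕ)

theorem pcore_spec : (pcore p G).Normal ∧ IsPGroup p (pcore p G) := by
  obtain ⟨M, hM⟩ := Set.Finite.exists_maximal (s := {N : Subgroup G | N.Normal ∧ IsPGroup p N})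
    (Set.toFinite _) ⟨⊥, inferInstance, IsPGroup.of_bot⟩
  have : pcore p G = M := by
    refine le_antisymm (sSup_le fun N hN => ?_) (le_sSup hM.1)
    have h1 := hM.1.1
    have h2 := hN.1
    have : M ⊔ N ∈ {N : Subgroup G | N.Normal ∧ IsPGroup p N} :=
      ⟨inferInstance, hM.1.2.to_sup_of_normal_right hN.2⟩
    exact le_sup_right.trans (hM.2 this le_sup_left)
  rw [this]
  exact hM.1

instance : (pcore p G).Normal := (pcore_spec p).1

theorem isPGroup_pcore : IsPGroup p (pcore p G) := (pcore_spec p).2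

theorem le_pcore {N : Subgroup G} (hN : N.Normal) (h : IsPGroup p N) : N ≤ pcore p G :=
  le_sSup ⟨hN, h⟩

theorem pcore_quotient_pcore [Fact p.Prime] : pcore p (G ⧸ pcore p G) = ⊥ := by
  set f := QuotientGroup.mk' (pcore p G)
  have h1 : IsPGroup p ((pcore p (G ⧸ pcore p G)).comap f) := by
    refine (isPGroup_pcore (G := G ⧸ pcore p G) p).comap_of_ker_isPGroup f ?_
    rw [QuotientGroup.ker_mk']
    exact isPGroup_pcore p
  have h2 := le_pcore p (inferInstance : ((pcore p (G ⧸ pcore p G)).comap f).Normal) h1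
  rw [eq_bot_iff]
  intro y hy
  obtain ⟨x, rfl⟩ := QuotientGroup.mk'_surjective _ y
  exact (QuotientGroup.eq_one_iff x).2 (h2 hy)

/-- A `p`-element of a nilpotent normal subgroup lies in the `p`-core. -/
theorem mem_pcore_of_nilpotent [Fact p.Prime] {D : Subgroup G} [D.Normal] [Group.IsNilpotent D]
    {d : G} (hd : d ∈ D) (h : IsPElt p d) : d ∈ pcore p G := by
  obtain ⟨k, hk⟩ := h
  obtain ⟨P, hP⟩ := IsPElt.mem_sylow (p := p) (g := (⟨d, hd⟩ : D))
    ⟨k, by simpa [Subtype.ext_iff] using hk⟩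
  have h0 := (Group.isNilpotent_of_finite_tfae (G := D)).out 0 3
  have h1 : (P : Subgroup D).Normal := h0.1 ‹_› p ‹_› P
  have h2 := Sylow.characteristic_of_normal P h1
  have h3 : (map D.subtype (P : Subgroup D)).Normal :=
    ConjAct.normal_of_characteristic_of_normal
  exact le_pcore p h3 (P.isPGroup'.map _) ⟨⟨d, hd⟩, hP, rfl⟩

end pcore

/-- In a finite solvable group with trivial `q`-core, a `q`-element centralizing every normal
`p`-subgroup for `p ≠ q` is trivial. -/
theorem exists_pcore_not_commute [Finite G] [Group.IsSolvable G] {q : ℕ} [Fact q.Prime]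
    (hq : pcore q G = ⊥) {r : G} (hr : IsPElt q r) (hr1 : r ≠ 1) :
    ∃ p : ℕ, p.Prime ∧ p ≠ q ∧ ∃ v ∈ pcore p G, ¬ Commute r v := by
  by_contra! hcon
  let C : Subgroup G := ⨅ p : {p : ℕ // p.Prime}, centralizer (pcore p G : Set G)
  have hCn : C.Normal := by
    refine normal_iInf_normal fun p => ?_
    infer_instance
  have hC : ∀ c ∈ C, ∀ p : ℕ, p.Prime → ∀ v ∈ pcore p G, Commute c v := by
    intro c hc p hp v hv
    have := (mem_iInf.1 hc) ⟨p, hp⟩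
    exact (mem_centralizer_iff.1 this v hv).symm
  have hrC : r ∈ C := by
    refine mem_iInf.2 fun p => mem_centralizer_iff.2 fun v hv => ?_
    by_cases hpq : (p : ℕ) = q
    · rw [hpq, hq] at hv
      have : v = 1 := by simpa using hv
      simp [this]
    · exact (hcon p p.2 hpq v hv).symm
  have key : ∀ D : Subgroup G, D.Normal → D ≤ C → Group.IsNilpotent D → D ≤ centralizer (C : Set G) := by
    intro D hD hDC hDn d hd
    have h1 : closure {h | h ∈ zpowers d ∧ ∃ p : ℕ, p.Prime ∧ IsPElt p h} ≤
        centralizer (C : Set G) := by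
      rw [closure_le]
      rintro h ⟨h1, p, hp, h2⟩
      have : Fact p.Prime := ⟨hp⟩
      have h3 := mem_pcore_of_nilpotent p ((zpowers_le.2 hd) h1) h2
      exact mem_centralizer_iff.2 fun c hc => hC c hc p hp h h3
    exact h1 (mem_closure_isPElt d)
  have hder : ∀ n : ℕ, (derivedSeries C n).map C.subtype ≤ centralizer (C : Set G) →
      C ≤ centralizer (C : Set G) := by
    intro n
    induction n with
    | zero => intro h; simpa [← MonoidHom.range_eq_map] using h
    | succ n ih =>
      intro h
      refine ih (key _ ConjAct.normal_of_characteristic_of_normal (map_subtype_le _) ?_)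
      set D := (derivedSeries C n).map C.subtype with hD
      have h1 : ⁅D, D⁆ ≤ centralizer (C : Set G) := by
        rw [hD, ← map_commutator]
        simpa using h
      refine isNilpotent_of_lowerCentralSeries_eq_bot (n := 2) ?_
      change ⁅⁅D, D⁆, D⁆ = ⊥
      rw [commutator_eq_bot_iff_le_centralizer]
      exact h1.trans (centralizer_le (map_subtype_le _))
  obtain ⟨n, hn⟩ := (inferInstance : Group.IsSolvable C).solvable
  have hCC := hder n (by simp [hn])
  have hCcomm : Group.IsNilpotent C := by
    refine isNilpotent_of_lowerCentralSeries_eq_bot (n := 1) ?_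
    change ⁅C, C⁆ = ⊥
    rwa [commutator_eq_bot_iff_le_centralizer]
  have := mem_pcore_of_nilpotent q hrC hr
  rw [hq] at this
  exact hr1 (by simpa using this)

end OrderThree

namespace OrderThree
open Subgroup
open scoped commutatorElement

variable {G : Type*} [Group G]

theorem IsPElt.inv {p : ℕ} {g : G} (h : IsPElt p g) : IsPElt p g⁻¹ := by
  obtain ⟨k, hk⟩ := h
  exact ⟨k, by rw [inv_pow, hk, inv_one]⟩

theorem isPGroup_closure_conj {p : ℕ} {s : Set G} (h : IsPGroup p (closure s)) (g : G) :
    IsPGroup p (closure ((fun a => g * a * g⁻¹) '' s)) := by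
  have h1 := h.map (MulAut.conj g).toMonoidHom
  rwa [MonoidHom.map_closure] at h1

theorem conj_mem_sylow_smul {p : ℕ} {P : Sylow p G} {a : G} (h : a ∈ P) (g : G) :
    g * a * g⁻¹ ∈ g • P := by
  have h1 : g * a * g⁻¹ ∈ ((g • P : Sylow p G) : Set G) := by
    rw [Sylow.coe_smul]
    exact Set.smul_mem_smul_set h
  exact h1

section BaerSuzuki

variable [Finite G] {q : ℕ} [Fact q.Prime]

theorem exists_normalizing {X : Set G} (hX : ∀ a ∈ X, ∀ g : G, g * a * g⁻¹ ∈ X) {S T : Subgroup G}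
    (hS : IsPGroup q S) (hne : ¬ X ∩ S ⊆ T) :
    ∃ x ∈ X, x ∈ S ∧ x ∉ T ∧ x ∈ normalizer (closure (X ∩ S ∩ T) : Subgroup G) := by
  obtain ⟨Q, hQ, hmax⟩ := Set.Finite.exists_le_maximal
    (s := {Q : Subgroup G | Q ≤ S ∧ X ∩ Q ⊆ T}) (Set.toFinite _)
    (a := S ⊓ T) ⟨inf_le_left, fun x hx => hx.2.2⟩
  have hQS : Q.subgroupOf S < ⊤ := by
    rw [lt_top_iff_ne_top, Ne, subgroupOf_eq_top]
    exact fun h => hne fun a ha => hmax.1.2 ⟨ha.1, h ha.2⟩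
  have := hS.isNilpotent
  obtain ⟨n, hn, hnQ⟩ := SetLike.exists_of_lt (Group.normalizerCondition_of_isNilpotent _ hQS)
  have hnn : (n : G) ∈ normalizer (Q : Set G) := by
    rw [mem_normalizer_iff] at hn ⊢
    intro h
    constructor
    · intro hh
      exact (hn ⟨h, hmax.1.1 hh⟩).1 hh
    · intro hh
      have : h ∈ S := by
        have h1 := hmax.1.1 hh
        have h2 := mul_mem (mul_mem (inv_mem n.2) h1) n.2
        simpa [mul_assoc] using h2
      exact (hn ⟨h, this⟩).2 hh
  have h1 : Q ⊔ zpowers (n : G) ≤ normalizer (Q : Set G) :=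
    sup_le le_normalizer (zpowers_le.2 hnn)
  have h2 : ¬ (X ∩ (Q ⊔ zpowers (n : G) : Subgroup G) ⊆ (T : Set G)) := by
    intro h
    have h3 := hmax.2 (y := Q ⊔ zpowers (n : G))
      ⟨sup_le hmax.1.1 (zpowers_le.2 n.2), h⟩ le_sup_left
    exact hnQ (h3 (le_sup_right (a := Q) (mem_zpowers (n : G))))
  obtain ⟨x, ⟨hxX, hxQ⟩, hxT⟩ := Set.not_subset.1 h2
  refine ⟨x, hxX, ?_, hxT, ?_⟩
  · exact (sup_le hmax.1.1 (zpowers_le.2 n.2) : Q ⊔ zpowers (n : G) ≤ S) hxQ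
  · refine le_normalizer_closure (H := normalizer (Q : Set G)) ?_ (h1 hxQ)
    rintro g hg k ⟨⟨hk1, hk2⟩, hk3⟩
    have hkQ : k ∈ Q := hQ ⟨hk2, hk3⟩
    have h4 := (mem_normalizer_iff.1 hg k).1 hkQ
    have h5 := hX k hk1 g
    exact ⟨⟨h5, hmax.1.1 h4⟩, hmax.1.2 ⟨h5, h4⟩⟩

/-- The Baer–Suzuki theorem. -/
theorem baer_suzuki {r : G} (h : ∀ g : G, IsPGroup q (closure {r, g * r * g⁻¹})) :
    r ∈ pcore q G := by
  set X : Set G := {a | ∃ g : G, g * r * g⁻¹ = a} with hXdef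
  have hX : ∀ a ∈ X, ∀ g : G, g * a * g⁻¹ ∈ X := by
    rintro _ ⟨b, rfl⟩ g
    exact ⟨g * b, by group⟩
  have hrX : r ∈ X := ⟨1, by simp⟩
  have hpair : ∀ a ∈ X, ∀ b ∈ X, IsPGroup q (closure {a, b}) := by
    rintro _ ⟨a, rfl⟩ _ ⟨b, rfl⟩
    have h1 := isPGroup_closure_conj (h (a⁻¹ * b)) a
    rw [Set.image_pair] at h1
    have h2 : a * (a⁻¹ * b * r * (a⁻¹ * b)⁻¹) * a⁻¹ = b * r * b⁻¹ := by group
    rwa [h2] at h1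
  by_cases hall : ∀ S T : Sylow q G, X ∩ S ⊆ T
  · have hXS : ∀ S : Sylow q G, X ⊆ S := by
      intro S a ha
      obtain ⟨T, hT⟩ := IsPElt.mem_sylow (IsPElt.of_mem (hpair a ha a ha)
        (subset_closure (Set.mem_insert a _)))
      exact hall T S ⟨ha, hT⟩
    have hn : (closure X).Normal := by
      rw [← normalizer_eq_top_iff, eq_top_iff]
      exact le_normalizer_closure fun g _ k hk => hX k hk g
    obtain ⟨S⟩ : Nonempty (Sylow q G) := inferInstance
    exact le_pcore q hn (S.isPGroup'.to_le ((closure_le _).2 (hXS S))) (subset_closure hrX)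
  · exfalso
    push Not at hall
    obtain ⟨S₀, T₀, h0⟩ := hall
    obtain ⟨⟨S, T⟩, hST, hmax⟩ := Set.exists_max_image
      {P : Sylow q G × Sylow q G | ¬ X ∩ P.1 ⊆ P.2} (fun P => (X ∩ P.1 ∩ P.2 : Set G).ncard)
      (Set.toFinite _) ⟨(S₀, T₀), h0⟩
    simp only [Set.mem_ofPred_eq, Prod.forall] at hST hmax
    have hcard : ∀ P Q : Sylow q G, (X ∩ P : Set G).ncard ≤ (X ∩ Q : Set G).ncard := by
      intro P Q
      obtain ⟨g, rfl⟩ := MulAction.exists_smul_eq G P Q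
      refine Set.ncard_le_ncard_of_injOn (fun a => g * a * g⁻¹) ?_ ?_ (Set.toFinite _)
      · rintro a ⟨h1, h2⟩
        exact ⟨hX a h1 g, conj_mem_sylow_smul h2 g⟩
      · intro a _ b _ hab
        simpa using hab
    have hsub : ∀ P Q : Sylow q G, X ∩ P ⊆ Q → X ∩ Q ⊆ P := by
      intro P Q hPQ
      have := Set.eq_of_subset_of_ncard_le (s := X ∩ P) (t := X ∩ Q)
        (fun a ha => ⟨ha.1, hPQ ha⟩) (hcard Q P) (Set.toFinite _)
      rw [← this]
      exact Set.inter_subset_right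
    have hTS : ¬ X ∩ T ⊆ S := fun h => hST (hsub T S h)
    obtain ⟨x, hxX, hxS, hxT, hxn⟩ := exists_normalizing hX S.isPGroup' hST
    obtain ⟨y, hyX, hyT, hyS, hyn⟩ := exists_normalizing hX T.isPGroup' hTS
    have hYY : (X ∩ (T : Subgroup G) ∩ (S : Subgroup G) : Set G) =
        X ∩ (S : Subgroup G) ∩ (T : Subgroup G) := Set.inter_right_comm _ _ _
    rw [hYY] at hyn
    have hD : IsPGroup q (closure (X ∩ S ∩ T : Set G)) :=
      S.isPGroup'.to_le ((closure_le _).2 fun a ha => ha.1.2)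
    have hU := (hpair x hxX y hyX).to_sup_of_normal_right' hD
      ((closure_le _).2 (by rintro _ (rfl | rfl) <;> assumption))
    obtain ⟨U, hU⟩ := hU.exists_le_sylow
    have hYU : ∀ a ∈ (X ∩ S ∩ T : Set G), a ∈ U := fun a ha =>
      hU ((le_sup_right : _ ≤ closure {x, y} ⊔ _) (subset_closure ha))
    have hxU : x ∈ U := hU ((le_sup_left : closure {x, y} ≤ _) (subset_closure (by simp)))
    have hyU : y ∈ U := hU ((le_sup_left : closure {x, y} ≤ _) (subset_closure (by simp)))
    have hUS : X ∩ U ⊆ S := by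
      by_contra hcon
      refine absurd (hmax U S hcon) (not_le.2 ?_)
      refine Set.ncard_lt_ncard ⟨fun a ha => ⟨⟨ha.1.1, hYU a ha⟩, ha.1.2⟩, fun h => ?_⟩
        (Set.toFinite _)
      exact hxT (h ⟨⟨hxX, hxU⟩, hxS⟩).2
    have hUT : X ∩ U ⊆ T := by
      by_contra hcon
      refine absurd (hmax U T hcon) (not_le.2 ?_)
      refine Set.ncard_lt_ncard ⟨fun a ha => ⟨⟨ha.1.1, hYU a ha⟩, ha.2⟩, fun h => ?_⟩
        (Set.toFinite _)
      exact hyS (h ⟨⟨hyX, hyU⟩, hyT⟩).1.2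
    exact hST fun a ha => hUT ⟨ha.1, hsub U S hUS ha⟩

end BaerSuzuki

section InO

/-- `r` lies in a normal `q`-subgroup of `H`. -/
def InO (q : ℕ) (H : Subgroup G) (r : G) : Prop :=
  ∃ N ≤ H, IsPGroup q N ∧ H ≤ normalizer N ∧ r ∈ N

theorem InO.map {q : ℕ} {H : Subgroup G} {r : G} (h : InO q H r) {G' : Type*} [Group G']
    (f : G →* G') : InO q (H.map f) (f r) := by
  obtain ⟨N, hN, hp, hn, hr⟩ := h
  refine ⟨N.map f, map_mono hN, hp.map f, ?_, mem_map_of_mem f hr⟩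
  rw [le_normalizer_iff]
  rintro _ ⟨a, ha, rfl⟩ _ ⟨b, hb, rfl⟩
  exact ⟨a * b * a⁻¹, conj_mem_of_le_normalizer hn ha hb, by simp⟩

theorem InO.commutator {q : ℕ} {H : Subgroup G} {r : G} (h : InO q H r) {a : G} (ha : a ∈ H) :
    IsPElt q ⁅r, a⁆ := by
  obtain ⟨N, hN, hp, hn, hr⟩ := h
  refine IsPElt.of_mem hp ?_
  have := mul_mem hr (conj_mem_of_le_normalizer hn ha (inv_mem hr))
  convert this using 1
  rw [commutatorElement_def]
  group

theorem inO_of_mem_pcore [Finite G] {q : ℕ} {X : Subgroup G} {r : X} (h : r ∈ pcore q X) :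
    InO q X r := by
  have := InO.map (G := X) (H := ⊤) (r := r) (q := q) ⟨pcore q X, le_top, isPGroup_pcore q,
    by rw [normalizer_eq_top]; , h⟩ X.subtype
  simpa [← MonoidHom.range_eq_map] using this

theorem InO.closure_pair [Finite G] {q : ℕ} [Fact q.Prime] {X : Subgroup G} {r s : G}
    (hr : InO q X r) (hs : InO q X s) : IsPGroup q (closure {r, s}) := by
  obtain ⟨N, hN, hp, hn, hr⟩ := hr
  obtain ⟨N', hN', hp', hn', hs⟩ := hs
  refine (hp.to_sup_of_normal_right' hp' (hN.trans hn')).to_le ((closure_le _).2 ?_)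
  rintro _ (rfl | rfl)
  · exact (le_sup_left : N ≤ N ⊔ N') hr
  · exact (le_sup_right : N' ≤ N ⊔ N') hs

variable [Finite G] {q : ℕ} [Fact q.Prime]

theorem exists_pcore_quot [Group.IsSolvable G] {r : G} (hr : IsPElt q r) (hr1 : r ∉ pcore q G) :
    ∃ p : ℕ, p.Prime ∧ p ≠ q ∧ ∃ v ∈ pcore p (G ⧸ pcore q G), ¬ Commute (r : G ⧸ pcore q G) v :=
  exists_pcore_not_commute (pcore_quotient_pcore q) (hr.map (QuotientGroup.mk' _))
    fun h => hr1 ((QuotientGroup.eq_one_iff r).1 h)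

theorem mem_pcore_of_inO [Group.IsSolvable G] {s : Set G} {r : G} (hr : IsPElt q r)
    (hrs : r ∈ closure s)
    (h : ∀ a ∈ s, ∀ g : G, ∃ H : Subgroup G, a ∈ H ∧ g * a * g⁻¹ ∈ H ∧ InO q H r) :
    r ∈ pcore q G := by
  by_contra hcon
  obtain ⟨p, hp, hpq, v, hv, hrv⟩ := exists_pcore_quot hr hcon
  set f := QuotientGroup.mk' (pcore q G) with hf
  have hr' : IsPElt q (f r) := hr.map f
  set V := pcore p (G ⧸ pcore q G) with hV
  have : Fact p.Prime := ⟨hp⟩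
  have hVp : IsPGroup p V := isPGroup_pcore p
  have h1 : ∀ a ∈ f '' s, ∀ v ∈ V, v⁻¹ * (a * v * a⁻¹) ∈ centralizer {f r} := by
    rintro _ ⟨a, ha, rfl⟩ v hv
    obtain ⟨g, hg⟩ := QuotientGroup.mk'_surjective (pcore q G) v⁻¹
    obtain ⟨H, h1, h2, h3⟩ := h a ha g
    have h4 : v⁻¹ * (f a * v * (f a)⁻¹) = f (g * a * g⁻¹ * a⁻¹) := by
      simp only [map_mul, map_inv, hf, hg]
      group
    have h5 : v⁻¹ * (f a * v * (f a)⁻¹) ∈ V :=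
      mul_mem (inv_mem hv) ((inferInstance : V.Normal).conj_mem _ hv _)
    have h6 : IsPElt q ⁅f r, v⁻¹ * (f a * v * (f a)⁻¹)⁆ := by
      rw [h4, ← map_commutatorElement]
      exact (h3.commutator (mul_mem h2 (inv_mem h1))).map f
    have h7 : IsPElt p ⁅f r, v⁻¹ * (f a * v * (f a)⁻¹)⁆ :=
      IsPElt.of_mem hVp (mul_mem ((inferInstance : V.Normal).conj_mem _ h5 _) (inv_mem h5))
    have h8 := h7.eq_one hp Fact.out hpq h6
    rw [commutatorElement_eq_one_iff_commute] at h8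
    exact mem_centralizer_singleton_iff.2 h8.symm.eq
  have hrs' : f r ∈ closure (f '' s) := by
    rw [← MonoidHom.map_closure]
    exact mem_map_of_mem f hrs
  have h2 := mem_of_closure_conj (V := V) (by rw [normalizer_eq_top]; exact le_top) h1 hrs' (inv_mem hv)
  have h3 : Commute (f r) (v⁻¹⁻¹ * (f r * v⁻¹ * (f r)⁻¹)) :=
    (mem_centralizer_singleton_iff.1 h2).symm
  have h4 : v⁻¹⁻¹ * (f r * v⁻¹ * (f r)⁻¹) = ⁅f r, v⁆⁻¹ := by
    rw [commutatorElement_def]; group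
  rw [h4] at h3
  refine hrv (commute_of_isPElt hp Fact.out hpq hr' ?_ (Commute.inv_left_iff.1 h3.symm))
  exact IsPElt.of_mem hVp (mul_mem ((inferInstance : V.Normal).conj_mem _ hv _) (inv_mem hv))

end InO

/-- A conjugation-invariant set of elements of order dividing three, any four of which generate
a solvable subgroup, in a group without nontrivial normal `p`-subgroups. -/
structure Bad (C : Set G) : Prop where
  conj : ∀ x ∈ C, ∀ g : G, g * x * g⁻¹ ∈ C
  cube : ∀ x ∈ C, x ^ 3 = 1
  solv : ∀ a ∈ C, ∀ b ∈ C, ∀ c ∈ C, ∀ d ∈ C, Group.IsSolvable (closure {a, b, c, d})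
  core : ∀ p : ℕ, p.Prime → pcore p G = ⊥

variable [Finite G]

theorem Bad.exists_not_inO {C : Set G} (hC : Bad C) {q : ℕ} [Fact q.Prime] {x z r : G} (hx : x ∈ C)
    (hz : z ∈ C) (hr : r ∈ closure {x, z}) (hrq : IsPElt q r) (hr1 : r ≠ 1) :
    ∃ w ∈ C, ¬ InO q (closure {x, z, w}) r := by
  by_contra! hcon
  have hcon' : ∀ g : G, ∀ w ∈ C, InO q (closure {g * x * g⁻¹, g * z * g⁻¹, w}) (g * r * g⁻¹) := by
    intro g w hw
    have h1 := (hcon (g⁻¹ * w * g) (by simpa using hC.conj w hw g⁻¹)).map (MulAut.conj g).toMonoidHom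
    rw [MonoidHom.map_closure, Set.image_insert_eq, Set.image_pair] at h1
    have h2 : (MulAut.conj g).toMonoidHom (g⁻¹ * w * g) = w := by simp [mul_assoc]
    rw [h2] at h1
    exact h1
  have key : ∀ X : Subgroup G, Group.IsSolvable X → ∀ g : G, g * x * g⁻¹ ∈ X → g * z * g⁻¹ ∈ X →
      InO q X (g * r * g⁻¹) := by
    intro X hX g hxX hzX
    have hrg : g * r * g⁻¹ ∈ closure {g * x * g⁻¹, g * z * g⁻¹} := by
      have := mem_map_of_mem (MulAut.conj g).toMonoidHom hr
      rwa [MonoidHom.map_closure, Set.image_pair] at this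
    have hrX : g * r * g⁻¹ ∈ X :=
      (closure_le X).2 (by rintro _ (rfl | rfl) <;> assumption) hrg
    refine inO_of_mem_pcore (r := ⟨_, hrX⟩) (mem_pcore_of_inO (s := {⟨_, hxX⟩, ⟨_, hzX⟩}) ?_ ?_ ?_)
    · obtain ⟨k, hk⟩ := hrq.conj g
      exact ⟨k, by simpa [Subtype.ext_iff] using hk⟩
    · rw [← mem_map_iff_mem X.subtype_injective, MonoidHom.map_closure, Set.image_pair]
      exact hrg
    · have h1 : ∀ w ∈ C, (hw : w ∈ X) → InO q ((closure {g * x * g⁻¹, g * z * g⁻¹, w}).subgroupOf X)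
          ⟨_, hrX⟩ := by
        intro w hw hwX
        obtain ⟨N, hN, hp, hn, hr⟩ := hcon' g w hw
        refine ⟨N.subgroupOf X, comap_mono hN, hp.comap_subtype, ?_, hr⟩
        rw [le_normalizer_iff] at hn ⊢
        exact fun a ha b hb => hn a ha b hb
      rintro a ha b
      refine ⟨_, ?_, ?_, h1 (b * a * b⁻¹ : X) ?_ (b * a * b⁻¹ : X).2⟩
      · refine subset_closure ?_
        rcases ha with rfl | rfl <;> simp
      · exact subset_closure (by simp)
      · rcases ha with rfl | rfl
        · exact hC.conj _ (hC.conj _ hx _) _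
        · exact hC.conj _ (hC.conj _ hz _) _
  have hmem : r ∈ pcore q G := by
    refine baer_suzuki fun g => ?_
    set X := closure {x, z, g * x * g⁻¹, g * z * g⁻¹} with hX
    have hXs : Group.IsSolvable X := hC.solv _ hx _ hz _ (hC.conj _ hx g) _ (hC.conj _ hz g)
    have h1 := key X hXs 1 (by simpa [hX] using Subgroup.subset_closure (by simp))
      (by simpa [hX] using Subgroup.subset_closure (by simp))
    have h2 := key X hXs g (subset_closure (by simp)) (subset_closure (by simp))
    exact InO.closure_pair (by simpa using h1) h2
  rw [hC.core q Fact.out] at hmem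
  exact hr1 (by simpa using hmem)

end OrderThree

namespace OrderThree
open Subgroup
open scoped commutatorElement

variable {G : Type*} [Group G] {H K : Subgroup G}

section nres

/-- The nilpotent residual of `H`. -/
def nres (H : Subgroup G) : Subgroup G := sSup {U | U ≤ H ∧ U ≤ ⁅U, H⁆}

theorem nres_le : nres H ≤ H := sSup_le fun _ hU => hU.1

theorem le_nres {U : Subgroup G} (h1 : U ≤ H) (h2 : U ≤ ⁅U, H⁆) : U ≤ nres H := le_sSup ⟨h1, h2⟩

theorem nres_le_commutator : nres H ≤ ⁅nres H, H⁆ :=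
  sSup_le fun _ hU => hU.2.trans (commutator_mono (le_sSup hU) le_rfl)

theorem nres_mono (h : H ≤ K) : nres H ≤ nres K :=
  le_nres (nres_le.trans h) (nres_le_commutator.trans (commutator_mono le_rfl h))

theorem nres_le_lowerCentralSeries (n : ℕ) : nres H ≤ H.lowerCentralSeries n := by
  induction n with
  | zero => exact nres_le
  | succ n ih => exact nres_le_commutator.trans (commutator_mono ih le_rfl)

variable (H) in
theorem exists_lowerCentralSeries_eq_nres [Finite G] :
    ∃ n, ∀ m, n ≤ m → H.lowerCentralSeries m = nres H := by
  obtain ⟨n, hn⟩ := WellFoundedLT.antitone_chain_condition H.lowerCentralSeries_antitone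
  refine ⟨n, fun m hm => le_antisymm ?_ (nres_le_lowerCentralSeries m)⟩
  refine le_nres (H.lowerCentralSeries_le_self m) ?_
  rw [← Subgroup.lowerCentralSeries_succ, ← hn m hm, ← hn (m + 1) (by omega)]

theorem map_nres [Finite G] {G' : Type*} [Group G'] [Finite G'] (f : G →* G') (H : Subgroup G) :
    (nres H).map f = nres (H.map f) := by
  obtain ⟨n, hn⟩ := exists_lowerCentralSeries_eq_nres H
  obtain ⟨n', hn'⟩ := exists_lowerCentralSeries_eq_nres (H.map f)
  rw [← hn (max n n') (le_max_left _ _), ← hn' (max n n') (le_max_right _ _),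
    map_lowerCentralSeries]

theorem nres_eq_bot_iff [Finite G] : nres H = ⊥ ↔ Group.IsNilpotent H := by
  constructor
  · intro h
    obtain ⟨n, hn⟩ := exists_lowerCentralSeries_eq_nres H
    exact isNilpotent_of_lowerCentralSeries_eq_bot (n := n) ((hn n le_rfl).trans h)
  · intro h
    obtain ⟨n, hn⟩ := (isNilpotent_iff_lowerCentralSeries _).1 h
    exact eq_bot_iff.2 ((nres_le_lowerCentralSeries n).trans hn.le)

theorem le_normalizer_of_map {f : Subgroup G → Subgroup G} (hf : ∀ (e : MulAut G) L,
    (f L).map e.toMonoidHom = f (L.map e.toMonoidHom)) (h : K ≤ normalizer H) :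
    K ≤ normalizer (f H : Subgroup G) := by
  intro k hk
  have h1 := mem_normalizer_iff_map_conj_eq.1 (h hk)
  rw [mem_normalizer_iff_map_conj_eq]
  exact (hf (MulAut.conj k) H).trans (congrArg f h1)

/-- The iterated nilpotent residual. -/
def gam (n : ℕ) (H : Subgroup G) : Subgroup G := nres^[n] H

theorem gam_zero : gam 0 H = H := rfl

theorem gam_succ (n : ℕ) : gam (n + 1) H = nres (gam n H) := Function.iterate_succ_apply' _ _ _

theorem gam_one : gam 1 H = nres H := rfl

theorem gam_two : gam 2 H = nres (nres H) := rfl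

theorem gam_succ_le (n : ℕ) : gam (n + 1) H ≤ gam n H := by
  rw [gam_succ]; exact nres_le

theorem gam_antitone : Antitone fun n => gam n H := antitone_nat_of_succ_le gam_succ_le

theorem gam_le (n : ℕ) : gam n H ≤ H := gam_antitone (Nat.zero_le n)

theorem gam_mono (n : ℕ) (h : H ≤ K) : gam n H ≤ gam n K := by
  induction n with
  | zero => exact h
  | succ n ih => rw [gam_succ, gam_succ]; exact nres_mono ih

theorem map_gam [Finite G] {G' : Type*} [Group G'] [Finite G'] (f : G →* G') (n : ℕ)
    (H : Subgroup G) : (gam n H).map f = gam n (H.map f) := by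
  induction n with
  | zero => rfl
  | succ n ih => rw [gam_succ, gam_succ, map_nres, ih]

theorem le_normalizer_gam [Finite G] (n : ℕ) (h : K ≤ normalizer H) :
    K ≤ normalizer (gam n H : Subgroup G) :=
  le_normalizer_of_map (fun _ _ => map_gam _ _ _) h

theorem commutator_self_lt [Group.IsSolvable H] (h : H ≠ ⊥) : ⁅H, H⁆ < H := by
  rw [← nontrivial_iff_ne_bot] at h
  rw [← H.range_subtype, MonoidHom.range_eq_map, ← map_commutator, map_subtype_lt_map_subtype]
  exact Group.IsSolvable.commutator_lt_top_of_nontrivial H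

theorem nres_lt [Group.IsSolvable H] (h : H ≠ ⊥) : nres H < H :=
  (nres_le_commutator.trans (commutator_mono nres_le le_rfl)).trans_lt (commutator_self_lt h)

theorem isSolvable_of_le (h : H ≤ K) [Group.IsSolvable K] : Group.IsSolvable H :=
  Group.isSolvable_of_isSolvable_injective (f := inclusion h) (inclusion_injective h)

theorem exists_gam_eq_bot [Finite G] [Group.IsSolvable H] : ∃ n, gam n H = ⊥ := by
  obtain ⟨n, hn⟩ := WellFoundedLT.antitone_chain_condition (gam_antitone (H := H))
  refine ⟨n, ?_⟩
  by_contra hne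
  have : Group.IsSolvable (gam n H) := isSolvable_of_le (gam_le n)
  have h1 := nres_lt hne
  rw [← gam_succ] at h1
  exact h1.ne (hn (n + 1) (by omega)).symm

end nres

/-- `K` is generated by `x` and by its conjugates `y`, `z` under `K`. -/
structure Conn (K : Subgroup G) (x y z : G) : Prop where
  eq : K = closure {x, y, z}
  two : ∃ k ∈ K, y = k * x * k⁻¹
  three : ∃ k ∈ K, z = k * x * k⁻¹

namespace Conn

variable {x y z : G}

theorem mem₁ (h : Conn K x y z) : x ∈ K := h.eq ▸ Subgroup.subset_closure (by simp)
theorem mem₂ (h : Conn K x y z) : y ∈ K := h.eq ▸ Subgroup.subset_closure (by simp)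
theorem mem₃ (h : Conn K x y z) : z ∈ K := h.eq ▸ Subgroup.subset_closure (by simp)

theorem le (h : Conn K x y z) {L : Subgroup G} (hx : x ∈ L) (hy : y ∈ L) (hz : z ∈ L) : K ≤ L := by
  rw [h.eq, closure_le]
  rintro _ (rfl | rfl | rfl) <;> assumption

theorem map (h : Conn K x y z) {G' : Type*} [Group G'] (f : G →* G') :
    Conn (K.map f) (f x) (f y) (f z) := by
  refine ⟨?_, ?_, ?_⟩
  · rw [h.eq, MonoidHom.map_closure, Set.image_insert_eq, Set.image_pair]
  · obtain ⟨k, hk, rfl⟩ := h.two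
    exact ⟨f k, mem_map_of_mem f hk, by simp⟩
  · obtain ⟨k, hk, rfl⟩ := h.three
    exact ⟨f k, mem_map_of_mem f hk, by simp⟩

theorem le_of_normal (h : Conn K x y z) {L : Subgroup G} (hL : K ≤ normalizer L) (hx : x ∈ L) :
    K ≤ L := by
  obtain ⟨k, hk, rfl⟩ := h.two
  obtain ⟨l, hl, rfl⟩ := h.three
  exact h.le hx (conj_mem_of_le_normalizer hL hk hx) (conj_mem_of_le_normalizer hL hl hx)

theorem le_lowerCentralSeries (h : Conn K x y z) (n : ℕ) :
    K ≤ zpowers x ⊔ K.lowerCentralSeries n := by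
  induction n with
  | zero => exact le_sup_right
  | succ n ih =>
    have hn : K ≤ normalizer (K.lowerCentralSeries n : Set G) :=
      K.self_le_normalizer_lowerCentralSeries n
    have key : ∀ k ∈ K, k * x * k⁻¹ ∈ zpowers x ⊔ K.lowerCentralSeries (n + 1) := by
      intro k hk
      obtain ⟨a, ⟨i, rfl⟩, l, hl, rfl⟩ :=
        exists_of_mem_sup ((zpowers_le.2 h.mem₁).trans hn) (ih hk)
      simp only
      have h1 : ⁅l, x⁆ ∈ K.lowerCentralSeries (n + 1) := commutator_mem_commutator hl h.mem₁
      have h2 : x ^ i * l * x * (x ^ i * l)⁻¹ = x ^ i * (⁅l, x⁆ * x) * (x ^ i)⁻¹ := by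
        rw [commutatorElement_def]; group
      rw [h2]
      have hx : ∀ j : ℤ, x ^ j ∈ zpowers x ⊔ K.lowerCentralSeries (n + 1) := fun j =>
        (le_sup_left : zpowers x ≤ _) (zpow_mem (mem_zpowers x) j)
      exact mul_mem (mul_mem (hx i) (mul_mem
        ((le_sup_right : K.lowerCentralSeries (n + 1) ≤ _) h1) (by simpa using hx 1))) (inv_mem (hx i))
    obtain ⟨k, hk, hy⟩ := h.two
    obtain ⟨l, hl, hz⟩ := h.three
    exact h.le ((le_sup_left : zpowers x ≤ _) (mem_zpowers x)) (hy ▸ key k hk) (hz ▸ key l hl)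

theorem le_nres [Finite G] (h : Conn K x y z) : K ≤ zpowers x ⊔ nres K := by
  obtain ⟨n, hn⟩ := exists_lowerCentralSeries_eq_nres K
  rw [← hn n le_rfl]
  exact h.le_lowerCentralSeries n

theorem of_mem_closure (hy : ∃ k ∈ closure {x, y, z}, y = k * x * k⁻¹)
    (hz : ∃ k ∈ closure {x, y, z}, z = k * x * k⁻¹) : Conn (closure {x, y, z}) x y z :=
  ⟨rfl, hy, hz⟩

/-- Connected triples lift through homomorphisms. -/
theorem lift [Finite G] {Q : Type*} [Group Q] (φ : G →* Q) {C : Set G}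
    (hC : ∀ c ∈ C, ∀ g : G, g * c * g⁻¹ ∈ C) {K : Subgroup Q} {x y z : Q} (h : Conn K x y z)
    (hx : x ∈ φ '' C) (hy : y ∈ φ '' C) (hz : z ∈ φ '' C) :
    ∃ (L : Subgroup G) (a b c : G), Conn L a b c ∧ a ∈ C ∧ b ∈ C ∧ c ∈ C ∧ φ a = x ∧ φ b = y ∧
      φ c = z ∧ L.map φ = K := by
  obtain ⟨a₀, ha₀, hax⟩ := hx
  obtain ⟨b₀, hb₀, hby⟩ := hy
  obtain ⟨c₀, hc₀, hcz⟩ := hz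
  obtain ⟨⟨a, b, c⟩, ⟨ha, hb, hc, rfl, rfl, rfl⟩, hmin⟩ := Set.exists_min_image
    {t : G × G × G | t.1 ∈ C ∧ t.2.1 ∈ C ∧ t.2.2 ∈ C ∧ φ t.1 = x ∧ φ t.2.1 = y ∧ φ t.2.2 = z}
    (fun t => Nat.card (closure {t.1, t.2.1, t.2.2})) (Set.toFinite _)
    ⟨(a₀, b₀, c₀), ha₀, hb₀, hc₀, hax, hby, hcz⟩
  simp only at *
  have hK : (closure {a, b, c}).map φ = K := by
    rw [h.eq, MonoidHom.map_closure, Set.image_insert_eq, Set.image_pair]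
  obtain ⟨k, hk, hky⟩ := h.two
  obtain ⟨l, hl, hlz⟩ := h.three
  rw [← hK] at hk hl
  obtain ⟨k, hk, rfl⟩ := hk
  obtain ⟨l, hl, rfl⟩ := hl
  have haK : a ∈ closure {a, b, c} := Subgroup.subset_closure (by simp)
  have hle : closure {a, k * a * k⁻¹, l * a * l⁻¹} ≤ closure {a, b, c} := by
    rw [closure_le]
    rintro _ (rfl | rfl | rfl)
    · exact haK
    · exact mul_mem (mul_mem hk haK) (inv_mem hk)
    · exact mul_mem (mul_mem hl haK) (inv_mem hl)
  have h1 : φ (k * a * k⁻¹) = φ b := by rw [hky]; simp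
  have h2 : φ (l * a * l⁻¹) = φ c := by rw [hlz]; simp
  have heq : closure {a, k * a * k⁻¹, l * a * l⁻¹} = closure {a, b, c} :=
    eq_of_le_of_card_ge hle (hmin (a, k * a * k⁻¹, l * a * l⁻¹)
      ⟨ha, hC _ ha _, hC _ ha _, rfl, h1, h2⟩)
  refine ⟨closure {a, b, c}, a, k * a * k⁻¹, l * a * l⁻¹, ⟨heq.symm, ⟨k, hk, rfl⟩, ⟨l, hl, rfl⟩⟩,
    ha, hC _ ha _, hC _ ha _, rfl, h1, h2, hK⟩

end Conn

universe u

/-- `D` consists of images of elements of `C` in a section of `G`. -/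
def IsSec {G : Type u} [Group G] (C : Set G) {Q : Type*} [Group Q] (D : Set Q) : Prop :=
  ∃ (M : Type u) (_ : Group M) (i : M →* G) (φ : M →* Q), Function.Injective i ∧
    D ⊆ φ '' (i ⁻¹' C)

section IsSec

variable {G : Type u} [Group G] {C : Set G} {Q : Type*} [Group Q] {D : Set Q}

theorem IsSec.refl (C : Set G) : IsSec C C :=
  ⟨G, _, MonoidHom.id G, MonoidHom.id G, Function.injective_id, by simp⟩

theorem IsSec.image (h : IsSec C D) {Q' : Type*} [Group Q'] (f : Q →* Q') : IsSec C (f '' D) := by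
  obtain ⟨M, _, i, φ, hi, hD⟩ := h
  refine ⟨M, _, i, f.comp φ, hi, ?_⟩
  rw [MonoidHom.coe_comp, Set.image_comp]
  exact Set.image_mono hD

theorem IsSec.subgroup (h : IsSec C D) (N : Subgroup Q) : IsSec C (N.subtype ⁻¹' D) := by
  obtain ⟨M, _, i, φ, hi, hD⟩ := h
  refine ⟨N.comap φ, inferInstance, i.comp (N.comap φ).subtype,
    (φ.comp (N.comap φ).subtype).codRestrict N fun m => m.2,
    hi.comp (Subtype.val_injective), ?_⟩
  rintro ⟨n, hn⟩ hnD
  obtain ⟨m, hm, hmn⟩ := hD hnD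
  exact ⟨⟨m, by simpa [hmn] using hn⟩, hm, Subtype.ext hmn⟩

theorem IsSec.pow_three (h : IsSec C D) (hC : ∀ c ∈ C, c ^ 3 = 1) : ∀ d ∈ D, d ^ 3 = 1 := by
  obtain ⟨M, _, i, φ, hi, hD⟩ := h
  intro d hd
  obtain ⟨m, hm, rfl⟩ := hD hd
  rw [← map_pow, hi (a₁ := m ^ 3) (a₂ := 1) (by rw [map_pow, hC _ hm, map_one]), map_one]

/-- Groups generated by connected triples from `C` have height at most `m`. -/
def Ht (C : Set G) (m : ℕ) : Prop :=
  ∀ K x y z, x ∈ C → y ∈ C → z ∈ C → Conn K x y z → gam m K = ⊥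

theorem Ht.sec [Finite G] [Finite Q] {m : ℕ} (h : Ht C m)
    (hC : ∀ c ∈ C, ∀ g : G, g * c * g⁻¹ ∈ C) (hD : IsSec C D) {K : Subgroup Q} {x y z : Q}
    (hx : x ∈ D) (hy : y ∈ D) (hz : z ∈ D) (hK : Conn K x y z) : gam m K = ⊥ := by
  obtain ⟨M, _, i, φ, hi, hD⟩ := hD
  have : Finite M := Finite.of_injective i hi
  obtain ⟨L, a, b, c, hL, ha, hb, hc, -, -, -, rfl⟩ := hK.lift φ (C := i ⁻¹' C)
    (fun c hc g => by simpa using hC _ hc (i g)) (hD hx) (hD hy) (hD hz)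
  have h1 := h _ _ _ _ ha hb hc (hL.map i)
  rw [← map_gam, map_eq_bot_iff_of_injective _ hi] at h1
  rw [← map_gam, h1, Subgroup.map_bot]

end IsSec

end OrderThree

namespace OrderThree
open Subgroup
open scoped commutatorElement

variable {G : Type*} [Group G]

theorem IsPElt.of_ne {p q : ℕ} (hp : p.Prime) (hq : q.Prime) (hpq : p ≠ q) {V W : Subgroup G}
    (hV : IsPGroup p V) (hW : IsPGroup q W) : V ⊓ W = ⊥ := by
  rw [eq_bot_iff]
  rintro g ⟨h1, h2⟩
  exact (IsPElt.of_mem hV h1).eq_one hp hq hpq (IsPElt.of_mem hW h2)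

theorem commute_of_isNilpotent [Finite G] {H : Subgroup G} [Group.IsNilpotent H] {p q : ℕ}
    (hp : p.Prime) (hq : q.Prime) (hpq : p ≠ q) {a b : G} (ha : a ∈ H) (hb : b ∈ H)
    (hap : IsPElt p a) (hbq : IsPElt q b) : Commute a b := by
  have : Fact p.Prime := ⟨hp⟩
  have : Fact q.Prime := ⟨hq⟩
  have : Group.IsNilpotent (⊤ : Subgroup H) := Group.isNilpotent_top.2 inferInstance
  have hap' : IsPElt p (⟨a, ha⟩ : H) := by
    obtain ⟨k, hk⟩ := hap
    exact ⟨k, by simpa [Subtype.ext_iff] using hk⟩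
  have hbq' : IsPElt q (⟨b, hb⟩ : H) := by
    obtain ⟨k, hk⟩ := hbq
    exact ⟨k, by simpa [Subtype.ext_iff] using hk⟩
  have h1 := mem_pcore_of_nilpotent p (mem_top (⟨a, ha⟩ : H)) hap'
  have h2 := mem_pcore_of_nilpotent q (mem_top (⟨b, hb⟩ : H)) hbq'
  have h3 := commute_of_normal_of_disjoint (pcore p H) (pcore q H) inferInstance inferInstance
    (disjoint_iff.2 (IsPElt.of_ne hp hq hpq (isPGroup_pcore p) (isPGroup_pcore q))) _ _ h1 h2
  exact congrArg Subtype.val h3.eq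

theorem exists_conj_isPGroup [Finite G] {p : ℕ} [Fact p.Prime] {A B : Subgroup G}
    (hA : IsPGroup p A) (hB : IsPGroup p B) {P : Subgroup G} (hAP : A ≤ P) (hBP : B ≤ P) :
    ∃ k ∈ P, ∃ S ≤ P, IsPGroup p S ∧ B ≤ S ∧ ∀ a ∈ A, k * a * k⁻¹ ∈ S := by
  obtain ⟨S₁, hS₁⟩ := (hA.comap_subtype (K := P)).exists_le_sylow
  obtain ⟨S₂, hS₂⟩ := (hB.comap_subtype (K := P)).exists_le_sylow
  obtain ⟨g, rfl⟩ := MulAction.exists_smul_eq P S₁ S₂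
  refine ⟨g, g.2, ((g • S₁ : Sylow p P) : Subgroup P).map P.subtype, map_subtype_le _,
    (g • S₁).isPGroup'.map _, ?_, ?_⟩
  · intro b hb
    exact ⟨⟨b, hBP hb⟩, hS₂ hb, rfl⟩
  · intro a ha
    have h1 : (⟨a, hAP ha⟩ : P) ∈ S₁ := hS₁ ha
    exact ⟨_, conj_mem_sylow_smul h1 g, rfl⟩

theorem conn_of_isPGroup [Finite G] {p : ℕ} (hp : p.Prime) (hp3 : p ≠ 3) {V : Subgroup G}
    (hV : IsPGroup p V) {x v : G} (hx : x ^ 3 = 1) (hxV : x ∈ normalizer (V : Set G))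
    (hv : v ∈ V) : Conn (closure {x, v * x * v⁻¹, v * x * v⁻¹}) x (v * x * v⁻¹) (v * x * v⁻¹) := by
  have : Fact (Nat.Prime 3) := ⟨Nat.prime_three⟩
  set P := closure {x, v * x * v⁻¹, v * x * v⁻¹} with hP
  have hxP : x ∈ P := Subgroup.subset_closure (by simp)
  have hyP : v * x * v⁻¹ ∈ P := Subgroup.subset_closure (by simp)
  have h3 : IsPElt 3 x := .of_pow_three hx
  obtain ⟨k, hk, S, hSP, hS, h1, h2⟩ := exists_conj_isPGroup (isPGroup_zpowers h3)
    (isPGroup_zpowers (h3.conj v)) (zpowers_le.2 hxP) (zpowers_le.2 hyP)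
  have hxn : zpowers x ≤ normalizer (V : Set G) := zpowers_le.2 hxV
  have key : ∀ g ∈ P, ∃ w ∈ V, g * x * g⁻¹ = w * x := by
    intro g hg
    have hle : P ≤ zpowers x ⊔ V := by
      rw [hP, closure_le]
      have a1 : x ∈ zpowers x ⊔ V := (le_sup_left : _ ≤ zpowers x ⊔ V) (mem_zpowers x)
      have a2 : v ∈ zpowers x ⊔ V := (le_sup_right : _ ≤ zpowers x ⊔ V) hv
      have a3 := mul_mem (mul_mem a2 a1) (inv_mem a2)
      rintro _ (rfl | rfl | rfl) <;> assumption
    obtain ⟨_, ⟨i, rfl⟩, l, hl, rfl⟩ := exists_of_mem_sup hxn (hle hg)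
    refine ⟨x ^ i * (l * (x * l⁻¹ * x⁻¹)) * (x ^ i)⁻¹, ?_, ?_⟩
    · exact conj_mem_of_le_normalizer hxn (zpow_mem (mem_zpowers x) i)
        (mul_mem hl (conj_mem_of_le_normalizer hxn (mem_zpowers x) (inv_mem hl)))
    · group
  obtain ⟨w, hw, hkw⟩ := key k hk
  have hvw : v * x * v⁻¹ = v * (x * v⁻¹ * x⁻¹) * x := by group
  have hmem : (v * x * v⁻¹) * (k * x * k⁻¹)⁻¹ ∈ V ⊓ S := by
    refine mem_inf.2 ⟨?_, mul_mem (h1 (mem_zpowers _)) (inv_mem (h2 _ (mem_zpowers _)))⟩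
    rw [hkw, hvw]
    have := mul_mem (mul_mem hv (conj_mem_of_le_normalizer hxn (mem_zpowers x) (inv_mem hv)))
      (inv_mem hw)
    convert this using 1
    group
  rw [IsPElt.of_ne hp Nat.prime_three hp3 hV hS, mem_bot, mul_inv_eq_one] at hmem
  exact ⟨rfl, ⟨k, hk, hmem⟩, ⟨k, hk, hmem⟩⟩

/-- `D` is a minimal `K`-invariant `p`-group on which `T` acts nontrivially. -/
structure MinAct (p : ℕ) (K T D : Subgroup G) : Prop where
  norm : K ≤ normalizer D
  le : T ≤ K
  normT : K ≤ normalizer T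
  isPGroup : IsPGroup p D
  comm : ⁅D, T⁆ = D
  min : ∀ U ≤ D, K ≤ normalizer U → U ≠ D → U ≤ centralizer T
  cent : D ⊓ centralizer T ≤ centralizer D
  der : ⁅D, D⁆ ≤ centralizer T
  pow : ∀ d ∈ D, d ^ p ∈ centralizer (T : Set G)
  cop : ∀ d ∈ D, (∀ t ∈ T, ⁅t, d⁆ ∈ centralizer (T : Set G)) → d ∈ centralizer (T : Set G)
  ne : ¬ D ≤ centralizer T

theorem commutator_le_left {D T : Subgroup G} (h : T ≤ normalizer D) : ⁅D, T⁆ ≤ D :=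
  le_normalizer_iff_commutator_le_left.1 h

theorem commutator_le_right' {D T : Subgroup G} (h : D ≤ normalizer T) : ⁅D, T⁆ ≤ T := by
  rw [commutator_comm]; exact commutator_le_left h

theorem isSolvable_of_isPGroup [Finite G] {p : ℕ} [Fact p.Prime] {D : Subgroup G}
    (h : IsPGroup p D) : Group.IsSolvable D := by
  have := h.isNilpotent
  infer_instance

theorem exists_minAct [Finite G] {p : ℕ} [Fact p.Prime] {K T V : Subgroup G} (hV : IsPGroup p V)
    (hKV : K ≤ normalizer V) (hTK : T ≤ K) (hKT : K ≤ normalizer T)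
    (hT : T ≤ closure {t | t ∈ T ∧ ∃ q : ℕ, q.Prime ∧ p ≠ q ∧ IsPElt q t})
    (hVT : ¬ V ≤ centralizer T) : ∃ D ≤ V, MinAct p K T D := by
  obtain ⟨D, ⟨hDV, hKD, hDT⟩, hmin⟩ := Set.Finite.exists_minimal
    (s := {D : Subgroup G | D ≤ V ∧ K ≤ normalizer D ∧ ¬ D ≤ centralizer T}) (Set.toFinite _)
    ⟨V, le_rfl, hKV, hVT⟩
  have hDp : IsPGroup p D := hV.to_le hDV
  have hsolv := isSolvable_of_isPGroup hDp
  have hTD : T ≤ normalizer D := hTK.trans hKD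
  have min : ∀ U ≤ D, K ≤ normalizer U → U ≠ D → U ≤ centralizer T := by
    intro U hUD hKU hne
    by_contra hcon
    exact hne (le_antisymm hUD (hmin ⟨hUD.trans hDV, hKU, hcon⟩ hUD))
  have cop : ∀ d ∈ D, (∀ t ∈ T, ⁅t, d⁆ ∈ centralizer (T : Set G)) → d ∈ centralizer (T : Set G) := by
    intro d hd h
    have h1 : T ≤ centralizer {d} := by
      refine hT.trans ((closure_le _).2 ?_)
      rintro t ⟨ht, q, hq, hpq, htq⟩
      have h2 : ⁅t, d⁆ ∈ D := mul_mem (conj_mem_of_le_normalizer hTD ht hd) (inv_mem hd)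
      have h3 : Commute ⁅t, d⁆ t := (mem_centralizer_iff.1 (h t ht) t ht).symm
      exact mem_centralizer_singleton_iff.2
        (commute_of_isPElt Fact.out hq hpq htq (IsPElt.of_mem hDp h2) h3).eq
    exact mem_centralizer_iff.2 fun t ht => mem_centralizer_singleton_iff.1 (h1 ht)
  have hDbot : D ≠ ⊥ := fun h => hDT (h ▸ bot_le)
  have hDD : ⁅D, D⁆ < D := commutator_self_lt hDbot
  have der : ⁅D, D⁆ ≤ centralizer T := min _ hDD.le (le_normalizer_commutator hKD hKD) hDD.ne
  have cent : D ⊓ centralizer T ≤ centralizer D := by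
    set Z := D ⊓ centralizer (T : Set G) with hZ
    have hKZ : K ≤ normalizer Z := le_normalizer_inf hKD (le_normalizer_centralizer hKT)
    have h1 : ⁅Z, D⁆ ≤ ⁅D, D⁆ := commutator_mono inf_le_left le_rfl
    have h2 : ⁅Z, D⁆ ≤ centralizer T := h1.trans der
    have hcomm : ⁅D, T⁆ = D := by
      by_contra hne
      have h3 := min _ (commutator_le_left hTD) (le_normalizer_commutator hKD hKT) hne
      refine hDT fun d hd => cop d hd fun t ht => h3 ?_
      rw [commutator_comm]
      exact commutator_mem_commutator ht hd
    have h3 : ⁅⁅D, T⁆, Z⁆ = ⊥ := by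
      refine commutator_commutator_eq_bot_of_rotate ?_ ?_
      · have : ⁅T, Z⁆ = ⊥ := by
          rw [commutator_comm, commutator_eq_bot_iff_le_centralizer]
          exact inf_le_right
        rw [this]
        exact commutator_bot_left _
      · rwa [commutator_eq_bot_iff_le_centralizer]
    rw [hcomm, commutator_comm, commutator_eq_bot_iff_le_centralizer] at h3
    exact h3
  have comm : ⁅D, T⁆ = D := by
    by_contra hne
    have h3 := min _ (commutator_le_left hTD) (le_normalizer_commutator hKD hKT) hne
    refine hDT fun d hd => cop d hd fun t ht => h3 ?_
    rw [commutator_comm]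
    exact commutator_mem_commutator ht hd
  refine ⟨D, hDV, hKD, hTK, hKT, hDp, comm, min, cent, der, ?_, cop, hDT⟩
  set Z := D ⊓ centralizer (T : Set G) with hZ
  have hderZ : ⁅D, D⁆ ≤ Z := le_inf hDD.le der
  have hn : (Z.subgroupOf D).Normal := by
    refine normal_subgroupOf_iff_le_normalizer inf_le_left |>.2 ?_
    rw [le_normalizer_iff_commutator_le_left]
    exact (commutator_mono inf_le_left le_rfl).trans hderZ
  let f := QuotientGroup.mk' (Z.subgroupOf D)
  have hf : ∀ a b : D, Commute (f a) (f b) := by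
    intro a b
    rw [← commutatorElement_eq_one_iff_commute, ← map_commutatorElement]
    exact (QuotientGroup.eq_one_iff _).2 (hderZ (commutator_mem_commutator a.2 b.2))
  have hf' : ∀ a : D, f a = 1 ↔ (a : G) ∈ Z := fun a => QuotientGroup.eq_one_iff _
  let B : Subgroup G :=
    { carrier := {d | d ∈ D ∧ d ^ p ∈ Z}
      one_mem' := ⟨one_mem _, by rw [one_pow]; exact one_mem _⟩
      inv_mem' := fun {a} ha => ⟨inv_mem ha.1, by rw [inv_pow]; exact inv_mem ha.2⟩
      mul_mem' := by
        rintro a b ⟨ha, hap⟩ ⟨hb, hbp⟩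
        refine ⟨mul_mem ha hb, ?_⟩
        have h1 := (hf' (⟨a, ha⟩ ^ p)).2 hap
        have h2 := (hf' (⟨b, hb⟩ ^ p)).2 hbp
        refine (hf' ((⟨a, ha⟩ * ⟨b, hb⟩) ^ p)).1 ?_
        rw [map_pow] at h1 h2
        rw [map_pow, map_mul, (hf _ _).mul_pow, h1, h2, one_mul] }
  have hKB : K ≤ normalizer B := by
    refine le_normalizer_iff.2 fun k hk b hb => ⟨conj_mem_of_le_normalizer hKD hk hb.1, ?_⟩
    rw [conj_pow]
    exact conj_mem_of_le_normalizer (le_normalizer_inf hKD (le_normalizer_centralizer hKT)) hk hb.2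
  by_cases hB : B = D
  · intro d hd
    rw [← hB] at hd
    exact hd.2.2
  · exfalso
    have hBT := min B (fun b hb => hb.1) hKB hB
    refine hDT fun d hd => ?_
    obtain ⟨k, hk⟩ := IsPElt.of_mem hDp hd
    have : ∀ k : ℕ, d ^ p ^ k ∈ centralizer (T : Set G) → d ∈ centralizer (T : Set G) := by
      intro k
      induction k with
      | zero => simp
      | succ k ih =>
        intro h
        refine ih (hBT ⟨pow_mem hd _, pow_mem (pow_mem hd _) _, ?_⟩)
        rwa [← pow_mul, ← pow_succ]
    exact this k (by rw [hk]; exact one_mem _)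

end OrderThree

namespace OrderThree
open Subgroup
open scoped commutatorElement

variable {G : Type*} [Group G]

theorem IsPElt.of_subtype {p : ℕ} {M : Subgroup G} {a : M} (h : IsPElt p (a : G)) : IsPElt p a := by
  obtain ⟨k, hk⟩ := h
  exact ⟨k, by simpa [Subtype.ext_iff] using hk⟩

theorem le_closure_of_isPGroup {p q : ℕ} (hq : q.Prime) (hpq : p ≠ q) {T : Subgroup G}
    (hT : IsPGroup q T) : T ≤ closure {t | t ∈ T ∧ ∃ q : ℕ, q.Prime ∧ p ≠ q ∧ IsPElt q t} :=
  fun _ ht => Subgroup.subset_closure ⟨ht, q, hq, hpq, IsPElt.of_mem hT ht⟩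

theorem subgroupOf_le_normalizer {H K : Subgroup G} (h : H ≤ normalizer K) (M : Subgroup G) :
    H.subgroupOf M ≤ normalizer (K.subgroupOf M : Subgroup M) :=
  le_normalizer_iff.2 fun _ ha _ hb => conj_mem_of_le_normalizer h ha hb

theorem map_le_normalizer {H K : Subgroup G} (h : H ≤ normalizer K) {Q : Type*} [Group Q]
    (f : G →* Q) : H.map f ≤ normalizer (K.map f : Subgroup Q) := by
  refine le_normalizer_iff.2 ?_
  rintro _ ⟨a, ha, rfl⟩ _ ⟨b, hb, rfl⟩
  exact ⟨a * b * a⁻¹, conj_mem_of_le_normalizer h ha hb, by simp⟩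

theorem MinAct.subgroupOf [Finite G] {p q : ℕ} [Fact p.Prime] (hq : q.Prime) (hpq : p ≠ q)
    {K T D : Subgroup G} (hT : IsPGroup q T) (h : MinAct p K T D) {M : Subgroup G} (hD : D ≤ M)
    (hK : K ≤ M) : MinAct p (K.subgroupOf M) (T.subgroupOf M) (D.subgroupOf M) := by
  have hne : ¬ D.subgroupOf M ≤ centralizer (T.subgroupOf M : Set M) := by
    intro hcon
    refine h.ne fun d hd => mem_centralizer_iff.2 fun t ht => ?_
    have h1 : (⟨d, hD hd⟩ : M) ∈ D.subgroupOf M := hd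
    have h2 := mem_centralizer_iff.1 (hcon h1) ⟨t, hK (h.le ht)⟩ ht
    exact congrArg Subtype.val h2
  obtain ⟨D', hD', h'⟩ := exists_minAct (G := M) (p := p) (K := K.subgroupOf M)
    (T := T.subgroupOf M) (V := D.subgroupOf M) h.isPGroup.comap_subtype
    (subgroupOf_le_normalizer h.norm M) (comap_mono h.le) (subgroupOf_le_normalizer h.normT M)
    (le_closure_of_isPGroup hq hpq hT.comap_subtype) hne
  · have hDD : D'.map M.subtype ≤ D := by
      rw [map_le_iff_le_comap]; exact hD'
    have h1 : D'.map M.subtype = D := by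
      by_contra hne
      have h2 := h.min _ hDD ?_ hne
      · refine h'.ne fun d hd => mem_centralizer_iff.2 fun t ht => Subtype.ext ?_
        exact mem_centralizer_iff.1 (h2 ⟨d, hd, rfl⟩) t ht
      · have := map_le_normalizer h'.norm M.subtype
        rwa [map_subgroupOf_eq_of_le hK] at this
    have : D' = D.subgroupOf M := by
      rw [← h1]; exact (comap_map_eq_self_of_injective M.subtype_injective D').symm
    rwa [← this]

/-- `U` is an irreducible elementary abelian `p`-group with an action of `K` in which
the fixed points of `T` are trivial. -/
structure Irr (p : ℕ) (K T U : Subgroup G) : Prop where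
  norm : K ≤ normalizer U
  le : T ≤ K
  normT : K ≤ normalizer T
  isPGroup : IsPGroup p U
  comm : U ≤ centralizer U
  irr : ∀ W ≤ U, K ≤ normalizer W → W = ⊥ ∨ W = U
  cop : U ⊓ centralizer T = ⊥
  pow : ∀ u ∈ U, u ^ p = 1
  ne : U ≠ ⊥

theorem MinAct.irr {p : ℕ} {K T D : Subgroup G} (h : MinAct p K T D) {Q : Type*} [Group Q]
    (f : G →* Q)
    (hf : f.ker = D ⊓ centralizer T) : Irr p (K.map f) (T.map f) (D.map f) where
  norm := map_le_normalizer h.norm f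
  le := map_mono h.le
  normT := map_le_normalizer h.normT f
  isPGroup := h.isPGroup.map f
  comm := by
    rw [← commutator_eq_bot_iff_le_centralizer, ← map_commutator, Subgroup.map_eq_bot_iff, hf]
    exact le_inf (commutator_le_left le_normalizer) h.der
  irr := by
    intro W hW hKW
    by_cases hD : D ⊓ W.comap f = D
    · right
      refine le_antisymm hW (map_le_iff_le_comap.2 (inf_eq_left.1 hD))
    · left
      have h1 := h.min _ inf_le_left (le_normalizer_inf h.norm (le_normalizer_iff.2 ?_)) hD
      · rw [eq_bot_iff]
        intro w hw
        obtain ⟨d, hd, rfl⟩ := hW hw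
        have : d ∈ f.ker := by rw [hf]; exact ⟨hd, h1 ⟨hd, hw⟩⟩
        exact this
      · intro k hk w hw
        change f (k * w * k⁻¹) ∈ W
        rw [map_mul, map_mul, map_inv]
        exact conj_mem_of_le_normalizer hKW (mem_map_of_mem f hk) hw
  cop := by
    rw [eq_bot_iff]
    rintro _ ⟨⟨d, hd, rfl⟩, hdT⟩
    have h1 : d ∈ f.ker := by
      rw [hf]
      refine ⟨hd, h.cop d hd fun t ht => ?_⟩
      have h2 := mem_centralizer_iff.1 hdT _ (mem_map_of_mem f ht)
      have h3 : ⁅t, d⁆ ∈ f.ker := by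
        rw [MonoidHom.mem_ker, map_commutatorElement, commutatorElement_eq_one_iff_commute]
        exact h2
      rw [hf] at h3
      exact h3.2
    exact h1
  pow := by
    rintro _ ⟨d, hd, rfl⟩
    have : d ^ p ∈ f.ker := by rw [hf]; exact ⟨pow_mem hd _, h.pow d hd⟩
    rwa [MonoidHom.mem_ker, map_pow] at this
  ne := by
    intro hcon
    rw [Subgroup.map_eq_bot_iff, hf] at hcon
    exact h.ne (hcon.trans inf_le_right)

/-- If no conjugates of `x`, `y`, `z` by elements of `U` generate a subgroup containing `U`, then
any such conjugates are conjugate simultaneously. -/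
theorem Irr.simultaneous [Finite G] {p q : ℕ} (hp : p.Prime) (hq : q.Prime) (hpq : p ≠ q)
    {K T U : Subgroup G} (h : Irr p K T U) (hT : IsPGroup q T) {x y z : G}
    (hK : K = closure {x, y, z})
    {a b c : G} (ha : a ∈ U) (hb : b ∈ U) (hc : c ∈ U)
    (hyp : ¬ U ≤ closure {a * x * a⁻¹, b * y * b⁻¹, c * z * c⁻¹}) :
    ∃ u ∈ U, a * x * a⁻¹ = u * x * u⁻¹ ∧ b * y * b⁻¹ = u * y * u⁻¹ ∧
      c * z * c⁻¹ = u * z * u⁻¹ := by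
  have : Fact q.Prime := ⟨hq⟩
  set L := closure {a * x * a⁻¹, b * y * b⁻¹, c * z * c⁻¹} with hL
  have hxK : x ∈ K := hK ▸ Subgroup.subset_closure (by simp)
  have hyK : y ∈ K := hK ▸ Subgroup.subset_closure (by simp)
  have hzK : z ∈ K := hK ▸ Subgroup.subset_closure (by simp)
  have hUK : ∀ u ∈ U, u ∈ K ⊔ U := fun u hu => (le_sup_right : _ ≤ K ⊔ U) hu
  have hKK : ∀ u ∈ K, u ∈ K ⊔ U := fun u hu => (le_sup_left : _ ≤ K ⊔ U) hu
  have hUL : ∀ u ∈ U, u ∈ L ⊔ U := fun u hu => (le_sup_right : _ ≤ L ⊔ U) hu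
  have hLL : ∀ u ∈ L, u ∈ L ⊔ U := fun u hu => (le_sup_left : _ ≤ L ⊔ U) hu
  have hLK : L ≤ K ⊔ U := by
    rw [hL, closure_le]
    rintro _ (rfl | rfl | rfl)
    · exact mul_mem (mul_mem (hUK _ ha) (hKK _ hxK)) (inv_mem (hUK _ ha))
    · exact mul_mem (mul_mem (hUK _ hb) (hKK _ hyK)) (inv_mem (hUK _ hb))
    · exact mul_mem (mul_mem (hUK _ hc) (hKK _ hzK)) (inv_mem (hUK _ hc))
  have hx' : a * x * a⁻¹ ∈ L := Subgroup.subset_closure (by simp)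
  have hy' : b * y * b⁻¹ ∈ L := Subgroup.subset_closure (by simp)
  have hz' : c * z * c⁻¹ ∈ L := Subgroup.subset_closure (by simp)
  have hKL : K ≤ L ⊔ U := by
    have : ∀ g a : G, a ∈ U → a * g * a⁻¹ ∈ L → g ∈ L ⊔ U := by
      intro g a ha h
      have h1 := mul_mem (mul_mem (inv_mem (hUL a ha)) (hLL _ h)) (hUL a ha)
      have h2 : a⁻¹ * (a * g * a⁻¹) * a = g := by group
      rwa [h2] at h1
    rw [hK, closure_le]
    rintro _ (rfl | rfl | rfl)
    exacts [this _ a ha hx', this _ b hb hy', this _ c hc hz']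
  have hKUn : K ⊔ U ≤ normalizer U := sup_le h.norm le_normalizer
  have hUcomm : ∀ W ≤ U, U ≤ normalizer W := by
    intro W hW
    refine le_normalizer_iff.2 fun u hu w hw => ?_
    rw [mem_centralizer_iff.1 (h.comm (hW hw)) u hu]
    simpa using hw
  have hLU : L ⊓ U = ⊥ := by
    have h1 : K ≤ normalizer (L ⊓ U : Subgroup G) := hKL.trans (sup_le
      (le_normalizer_inf le_normalizer (hLK.trans hKUn)) (hUcomm _ inf_le_right))
    refine (h.irr _ inf_le_right h1).resolve_right fun h2 => hyp ?_
    exact inf_eq_right.1 h2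
  set T' := L ⊓ (T ⊔ U) with hT'
  have hTU : T ≤ normalizer U := h.le.trans h.norm
  have hmod : ∀ g ∈ T ⊔ U, ∃ t ∈ T, ∃ u ∈ U, g = u * t := by
    intro g hg
    obtain ⟨t, ht, u, hu, rfl⟩ := exists_of_mem_sup hTU hg
    exact ⟨t, ht, t * u * t⁻¹, conj_mem_of_le_normalizer hTU ht hu, by group⟩
  have hT'q : IsPGroup q T' := by
    refine isPGroup_of_forall fun g hg => ?_
    obtain ⟨t, ht, u, hu, hgt⟩ := hmod g hg.2
    obtain ⟨k, hk⟩ := IsPElt.of_mem hT ht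
    refine ⟨k, ?_⟩
    have h1 : ∀ n : ℕ, ∃ u ∈ U, g ^ n = u * t ^ n := by
      intro n
      induction n with
      | zero => exact ⟨1, one_mem _, by simp⟩
      | succ n ih =>
        obtain ⟨w, hw, hn⟩ := ih
        refine ⟨w * (t ^ n * u * (t ^ n)⁻¹),
          mul_mem hw (conj_mem_of_le_normalizer hTU (pow_mem ht n) hu), ?_⟩
        rw [pow_succ, hn, hgt, pow_succ]; group
    obtain ⟨w, hw, hn⟩ := h1 (q ^ k)
    rw [hk, mul_one] at hn
    have h2 : g ^ q ^ k ∈ L ⊓ U := ⟨pow_mem hg.1 _, hn ▸ hw⟩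
    rwa [hLU, mem_bot] at h2
  obtain ⟨g, hg, S, hSP, hS, hTS', hTS⟩ := exists_conj_isPGroup hT hT'q
    (le_sup_left : T ≤ T ⊔ U) (inf_le_right : T' ≤ T ⊔ U)
  obtain ⟨t₀, ht₀, u, hu, rfl⟩ := hmod g hg
  have hSU : S ⊓ U = ⊥ := IsPElt.of_ne hq hp hpq.symm hS h.isPGroup
  have hTS : ∀ t ∈ T, u * t * u⁻¹ ∈ S := by
    intro t ht
    have := hTS (t₀⁻¹ * t * t₀) (mul_mem (mul_mem (inv_mem ht₀) ht) ht₀)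
    have h2 : u * t₀ * (t₀⁻¹ * t * t₀) * (u * t₀)⁻¹ = u * t * u⁻¹ := by group
    rwa [h2] at this
  have hconj : ∀ t ∈ T, ∀ s ∈ S, (∃ w ∈ U, s = w * t) → s = u * t * u⁻¹ := by
    rintro t ht s hs ⟨w, hw, hst⟩
    have h1 : s * (u * t * u⁻¹)⁻¹ ∈ S ⊓ U := by
      refine mem_inf.2 ⟨mul_mem hs (inv_mem (hTS t ht)), ?_⟩
      have h2 : s * (u * t * u⁻¹)⁻¹ = w * (t * u * t⁻¹) * u⁻¹ := by rw [hst]; group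
      rw [h2]
      exact mul_mem (mul_mem hw (conj_mem_of_le_normalizer hTU ht hu)) (inv_mem hu)
    rw [hSU, mem_bot, mul_inv_eq_one] at h1
    exact h1
  have hTT' : ∀ t ∈ T, u * t * u⁻¹ ∈ T' := by
    intro t ht
    have h1 : L ≤ normalizer (U : Set G) := hLK.trans hKUn
    obtain ⟨l, hl, w, hw, hlw⟩ := exists_of_mem_sup h1 (hKL (h.le ht))
    have h2 : l ∈ T ⊔ U := by
      have : l = t * w⁻¹ := by rw [← hlw]; group
      rw [this]
      exact mul_mem ((le_sup_left : T ≤ T ⊔ U) ht) ((le_sup_right : U ≤ T ⊔ U) (inv_mem hw))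
    have h3 : l ∈ T' := ⟨hl, h2⟩
    have h4 := hconj t ht l (hTS' h3) ⟨t * w⁻¹ * t⁻¹, conj_mem_of_le_normalizer hTU ht
      (inv_mem hw), by rw [← hlw]; group⟩
    rwa [← h4]
  have hT'T : ∀ s ∈ T', u⁻¹ * s * u ∈ T := by
    intro s hs
    obtain ⟨t, ht, w, hw, hst⟩ := hmod s hs.2
    have := hconj t ht s (hTS' hs) ⟨w, hw, hst⟩
    rw [this]
    have h2 : u⁻¹ * (u * t * u⁻¹) * u = t := by group
    rwa [h2]
  have hLT : L ≤ normalizer (T' : Set G) := by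
    refine le_normalizer_inf le_normalizer (hLK.trans (sup_le
      (le_normalizer_sup h.normT h.norm) ?_))
    exact le_sup_right.trans le_normalizer
  have hfin : ∀ g a : G, g ∈ K → a ∈ U → a * g * a⁻¹ ∈ L → a * g * a⁻¹ = u * g * u⁻¹ := by
    intro g a hg ha hgL
    set w := u⁻¹ * (a * (g * (a⁻¹ * u) * g⁻¹)) with hw
    have hgn : g ∈ normalizer (U : Set G) := h.norm hg
    have hwU : w ∈ U := mul_mem (inv_mem hu) (mul_mem ha
      ((mem_normalizer_iff.1 hgn _).1 (mul_mem (inv_mem ha) hu)))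
    have h1 : w ∈ U ⊓ centralizer (T : Set G) := by
      refine mem_inf.2 ⟨hwU, mem_centralizer_iff.2 fun t ht => ?_⟩
      have h2 : w * t * w⁻¹ ∈ T := by
        have h3 := conj_mem_of_le_normalizer h.normT (inv_mem hg) ht
        have h4 := hT'T _ (conj_mem_of_le_normalizer hLT hgL (hTT' _ h3))
        have h5 : u⁻¹ * (a * g * a⁻¹ * (u * (g⁻¹ * t * g⁻¹⁻¹) * u⁻¹) * (a * g * a⁻¹)⁻¹) * u =
            w * t * w⁻¹ := by rw [hw]; group
        rwa [h5] at h4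
      have h6 : ⁅w, t⁆ ∈ T ⊓ U := by
        refine mem_inf.2 ⟨mul_mem h2 (inv_mem ht), ?_⟩
        have := mul_mem hwU (conj_mem_of_le_normalizer hTU ht (inv_mem hwU))
        rw [commutatorElement_def]
        simpa [mul_assoc] using this
      rw [IsPElt.of_ne hq hp hpq.symm hT h.isPGroup, mem_bot,
        commutatorElement_eq_one_iff_commute] at h6
      exact h6.symm
    rw [h.cop, mem_bot] at h1
    have h2 : a * g * a⁻¹ = u * w * g * u⁻¹ := by rw [hw]; group
    rw [h2, h1, mul_one]
  exact ⟨u, hu, hfin x a hxK ha hx', hfin y b hyK hb hy', hfin z c hzK hc hz'⟩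

end OrderThree

namespace OrderThree
open Subgroup
open scoped commutatorElement

theorem exists_not_commute_of_normal {Γ : Type*} [Group Γ] {M : Subgroup Γ} [M.Normal]
    (hM : ∀ a ∈ M, ∀ b ∈ M, a * b = b * a) {x a : Γ} (hx : x ^ 3 = 1) (ha : a ∈ M)
    (hax : ¬ Commute a x) : ∃ b ∈ M, ¬ Commute b x ∧ ¬ Commute (a⁻¹ * b) x := by
  by_cases h2 : Commute (a * a) x
  · refine ⟨x * a * x⁻¹, Normal.conj_mem inferInstance _ ha _, fun h => hax ?_, fun h => hax ?_⟩
    · have h1 := h.eq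
      have h3 : a * x = x⁻¹ * (x * a * x⁻¹ * x) * x := by group
      rw [Commute, SemiconjBy, h3, h1]; group
    · set s := a⁻¹ * (x * a * x⁻¹) with hs
      have hsM : s ∈ M := mul_mem (inv_mem ha) (Normal.conj_mem inferInstance _ ha _)
      have h4 : x * a * x⁻¹ = a * s := by rw [hs]; group
      have h5 : x * s * x⁻¹ = s := by rw [← h.eq]; group
      have h6 : s * s = 1 := by
        have h7 : x * (a * a) * x⁻¹ = a * a := by rw [← h2.eq]; group
        have h8 : x * (a * a) * x⁻¹ = (x * a * x⁻¹) * (x * a * x⁻¹) := by group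
        have h9 : a * s * (a * s) = a * a * (s * s) := by
          rw [mul_assoc, ← mul_assoc s, hM s hsM a ha]; group
        rw [h8, h4, h9, mul_eq_left] at h7
        exact h7
      have h7 : s * s * s = 1 := by
        have h8 : x ^ 3 * a * (x ^ 3)⁻¹ = x * (x * (x * a * x⁻¹) * x⁻¹) * x⁻¹ := by
          simp only [pow_succ, pow_zero]; group
        have h9 : x * (x * (a * s) * x⁻¹) * x⁻¹ =
            (x * (x * a * x⁻¹) * x⁻¹) * (x * (x * s * x⁻¹) * x⁻¹) := by group
        have h10 : x * (a * s) * x⁻¹ = (x * a * x⁻¹) * (x * s * x⁻¹) := by group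
        rw [h4, h9, h5, h5, h4, h10, h5, h4, hx] at h8
        simpa [mul_assoc] using h8
      have h8 : s = 1 := by rwa [h6, one_mul] at h7
      rw [h8, mul_one, mul_inv_eq_iff_eq_mul] at h4
      exact h4.symm
  · refine ⟨a * a, mul_mem ha ha, h2, ?_⟩
    simpa using hax

theorem card_conj_mem_lt {Γ : Type*} [Group Γ] [Finite Γ] [Group.IsSolvable Γ] {x : Γ}
    (hx : x ^ 3 = 1) (hgen : ∀ H : Subgroup Γ, (∀ g, g⁻¹ * x * g ∈ H) → H = ⊤) {H : Subgroup Γ}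
    (hH : H ≠ ⊤) : 2 * Nat.card {g : Γ // g⁻¹ * x * g ∈ H} < Nat.card Γ := by
  classical
  have hpos : 0 < Nat.card Γ := Nat.card_pos
  -- replace `H` by a maximal subgroup
  obtain ⟨L, hL, hHL⟩ := (eq_top_or_exists_le_coatom H).resolve_left hH
  have hmono : Nat.card {g : Γ // g⁻¹ * x * g ∈ H} ≤ Nat.card {g : Γ // g⁻¹ * x * g ∈ L} :=
    Nat.card_le_card_of_injective (fun g => ⟨g.1, hHL g.2⟩) fun a b h => by
      simpa [Subtype.ext_iff] using h
  refine lt_of_le_of_lt (Nat.mul_le_mul_left 2 hmono) ?_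
  by_cases hemp : IsEmpty {g : Γ // g⁻¹ * x * g ∈ L}
  · simp
  rw [not_isEmpty_iff] at hemp
  obtain ⟨k, hk⟩ := hemp
  suffices h3 : 3 * Nat.card {g : Γ // g⁻¹ * x * g ∈ L} ≤ Nat.card Γ by
    have : 0 < Nat.card {g : Γ // g⁻¹ * x * g ∈ L} := by
      have : Nonempty {g : Γ // g⁻¹ * x * g ∈ L} := ⟨k, hk⟩
      exact Nat.card_pos
    omega
  -- the last term of the derived series not contained in `L`
  obtain ⟨n, hn, hn'⟩ : ∃ n, ¬ derivedSeries Γ n ≤ L ∧ derivedSeries Γ (n + 1) ≤ L := by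
    obtain ⟨n, hn⟩ := (Group.isSolvable_def Γ).1 inferInstance
    by_contra! hcon
    have : ∀ n, ¬ derivedSeries Γ n ≤ L := by
      intro n
      induction n with
      | zero =>
        intro h
        exact hL.1 (top_le_iff.1 (by simpa using h))
      | succ n ih => exact hcon n ih
    exact this n (hn ▸ bot_le)
  set M := derivedSeries Γ n with hM
  have hMn : M.Normal := derivedSeries_normal Γ n
  rw [derivedSeries_succ, ← hM] at hn'
  have hML : ∀ g : Γ, ∃ m ∈ M, ∃ h ∈ L, m * h = g := by
    intro g
    have h1 : M ⊔ L = ⊤ := by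
      refine hL.2 _ (lt_of_le_of_ne le_sup_right fun h => hn ?_)
      rw [h]; exact le_sup_left
    have h2 : g ∈ M ⊔ L := h1 ▸ mem_top g
    obtain ⟨m, hm, h, hh, rfl⟩ := mem_sup_of_normal_left.1 h2
    exact ⟨m, hm, h, hh, rfl⟩
  have hMM : ∀ a ∈ M, ∀ b ∈ M, ⁅a, b⁆ ∈ M ⊓ L := fun a ha b hb =>
    mem_inf.2 ⟨commutator_le_left le_normalizer (commutator_mem_commutator ha hb),
      hn' (commutator_mem_commutator ha hb)⟩
  have hN : (M ⊓ L).Normal := by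
    refine ⟨fun b hb g => ?_⟩
    obtain ⟨m, hm, h, hh, rfl⟩ := hML g
    have h1 : h * b * h⁻¹ ∈ M ⊓ L :=
      mem_inf.2 ⟨hMn.conj_mem _ hb.1 _, mul_mem (mul_mem hh hb.2) (inv_mem hh)⟩
    have h2 := mul_mem (hMM m hm _ h1.1) h1
    have h3 : ⁅m, h * b * h⁻¹⁆ * (h * b * h⁻¹) = m * h * b * (m * h)⁻¹ := by
      rw [commutatorElement_def]; group
    rwa [h3] at h2
  set π := QuotientGroup.mk' (M ⊓ L) with hπ
  have hπ1 : ∀ g, π g = 1 ↔ g ∈ M ⊓ L := fun g => QuotientGroup.eq_one_iff g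
  have hMbar : (M.map π).Normal := hMn.map π (QuotientGroup.mk'_surjective _)
  have hMab : ∀ a ∈ M.map π, ∀ b ∈ M.map π, a * b = b * a := by
    rintro _ ⟨a, ha, rfl⟩ _ ⟨b, hb, rfl⟩
    rw [← commutatorElement_eq_one_iff_mul_comm, ← map_commutatorElement, hπ1]
    exact hMM a ha b hb
  -- replace `x` by a conjugate in `L`
  set x' := k⁻¹ * x * k with hx'
  have hx'3 : x' ^ 3 = 1 := by
    have : x' ^ 3 = k⁻¹ * x ^ 3 * k := by rw [hx']; simp only [pow_succ, pow_zero]; group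
    rw [this, hx]; group
  have hF : ∀ m ∈ M, ∀ h ∈ L, (m * h)⁻¹ * x' * (m * h) ∈ L ↔ Commute (π m) (π x') := by
    intro m hm h hh
    have h1 : (m * h)⁻¹ * x' * (m * h) ∈ L ↔ ⁅m⁻¹, x'⁆ ∈ L := by
      have e1 : (m * h)⁻¹ * x' * (m * h) = h⁻¹ * (⁅m⁻¹, x'⁆ * x') * h := by
        rw [commutatorElement_def]; group
      rw [e1, mul_mem_cancel_right hh, mul_mem_cancel_left (inv_mem hh), mul_mem_cancel_right hk]
    rw [h1]
    have h2 : ⁅m⁻¹, x'⁆ ∈ M := by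
      have := mul_mem (inv_mem hm) (hMn.conj_mem _ hm x')
      have e : ⁅m⁻¹, x'⁆ = m⁻¹ * (x' * m * x'⁻¹) := by rw [commutatorElement_def]; group
      rwa [e]
    have h3 : ⁅m⁻¹, x'⁆ ∈ L ↔ ⁅m⁻¹, x'⁆ ∈ M ⊓ L := ⟨fun h => mem_inf.2 ⟨h2, h⟩, fun h => h.2⟩
    rw [h3, ← hπ1, map_commutatorElement, map_inv, commutatorElement_eq_one_iff_commute,
      Commute.inv_left_iff]
  obtain ⟨a, ha, hax⟩ : ∃ a ∈ M, ¬ Commute (π a) (π x') := by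
    by_contra! hcon
    refine hL.1 (hgen L fun g => ?_)
    obtain ⟨m, hm, h, hh, hg⟩ := hML (k⁻¹ * g)
    have h1 := (hF m hm h hh).2 (hcon m hm)
    have h2 : (m * h)⁻¹ * x' * (m * h) = g⁻¹ * x * g := by rw [hg, hx']; group
    rwa [h2] at h1
  obtain ⟨_, ⟨b, hb, rfl⟩, hbx, habx⟩ := exists_not_commute_of_normal hMab (x := π x')
    (by rw [← map_pow, hx'3, map_one]) ⟨a, ha, rfl⟩ hax
  let v : Fin 3 → Γ := ![1, a, b]
  have hinj : Function.Injective (fun p : Fin 3 × {g : Γ // g⁻¹ * x * g ∈ L} =>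
      v p.1 * (k⁻¹ * p.2.1)) := by
    have key : ∀ g : Γ, g⁻¹ * x * g ∈ L → ∃ m ∈ M, ∃ h ∈ L, m * h = k⁻¹ * g ∧
        Commute (π m) (π x') := by
      intro g hg
      obtain ⟨m, hm, h, hh, hmh⟩ := hML (k⁻¹ * g)
      refine ⟨m, hm, h, hh, hmh, (hF m hm h hh).1 ?_⟩
      have h2 : (m * h)⁻¹ * x' * (m * h) = g⁻¹ * x * g := by rw [hmh, hx']; group
      rwa [h2]
    have key2 : ∀ c ∈ M, ∀ c' ∈ M, ∀ g g' : Γ, g⁻¹ * x * g ∈ L → g'⁻¹ * x * g' ∈ L →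
        c * (k⁻¹ * g) = c' * (k⁻¹ * g') → Commute (π (c⁻¹ * c')) (π x') := by
      intro c hc c' hc' g g' hg hg' hcc
      obtain ⟨m, hm, h, hh, hmh, hmx⟩ := key g hg
      obtain ⟨m', hm', h', hh', hmh', hmx'⟩ := key g' hg'
      rw [← hmh, ← hmh'] at hcc
      have e1 : c⁻¹ * c' = m * (h * h'⁻¹) * m'⁻¹ := by
        have : c * (m * h) * h'⁻¹ * m'⁻¹ = c' := by rw [hcc]; group
        rw [← this]; group
      have e2 : h * h'⁻¹ ∈ M ⊓ L := by
        refine mem_inf.2 ⟨?_, mul_mem hh (inv_mem hh')⟩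
        have : h * h'⁻¹ = m⁻¹ * (c⁻¹ * c') * m' := by rw [e1]; group
        rw [this]
        exact mul_mem (mul_mem (inv_mem hm) (mul_mem (inv_mem hc) hc')) hm'
      rw [e1, map_mul, map_mul, (hπ1 _).2 e2, mul_one, map_inv]
      exact hmx.mul_left hmx'.inv_left
    have hv : ∀ i, v i ∈ M := by
      intro i; fin_cases i
      exacts [one_mem _, ha, hb]
    have hv2 : ∀ i j, Commute (π ((v i)⁻¹ * v j)) (π x') → i = j := by
      intro i j hij
      have hsymm : Commute (π ((v j)⁻¹ * v i)) (π x') := by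
        have := hij.inv_left
        rwa [← map_inv, mul_inv_rev, inv_inv] at this
      have habx' : ¬ Commute (π (a⁻¹ * b)) (π x') := by rwa [map_mul, map_inv]
      have e1 : ¬ Commute (π ((1 : Γ)⁻¹ * a)) (π x') := by rwa [inv_one, one_mul]
      have e2 : ¬ Commute (π ((1 : Γ)⁻¹ * b)) (π x') := by rwa [inv_one, one_mul]
      fin_cases i <;> fin_cases j
      exacts [rfl, (e1 hij).elim, (e2 hij).elim, (e1 hsymm).elim, rfl, (habx' hij).elim,
        (e2 hsymm).elim, (habx' hsymm).elim, rfl]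
    rintro ⟨i, g, hg⟩ ⟨j, g', hg'⟩ h
    have hij : i = j := hv2 i j (key2 _ (hv i) _ (hv j) g g' hg hg' h)
    subst hij
    simpa using h
  have := Nat.card_le_card_of_injective _ hinj
  simpa using this

theorem exists_orbit_representatives {α : Type*} [Fintype α] [DecidableEq α] (σ : α → α)
    (hσ : ∀ a, σ (σ (σ a)) = a) : ∃ R : Finset α,
      (∀ a, a ∈ R ∨ σ a ∈ R ∨ σ (σ a) ∈ R) ∧
      3 * R.card ≤ Fintype.card α + 2 * (Finset.univ.filter fun a => σ a = a).card := by
  obtain ⟨R, hR, hmin⟩ := Set.exists_min_image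
    {R : Finset α | ∀ a, a ∈ R ∨ σ a ∈ R ∨ σ (σ a) ∈ R} Finset.card (Set.toFinite _)
    ⟨Finset.univ, fun a => Or.inl (Finset.mem_univ a)⟩
  refine ⟨R, hR, ?_⟩
  let O : α → Finset α := fun a => {a, σ a, σ (σ a)}
  have hdisj : ∀ a ∈ R, ∀ b ∈ R, a ≠ b → Disjoint (O a) (O b) := by
    intro a ha b hb hab
    by_contra hcon
    have h1 : b = σ a ∨ b = σ (σ a) := by
      rw [Finset.not_disjoint_iff] at hcon
      obtain ⟨c, hca, hcb⟩ := hcon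
      simp only [O, Finset.mem_insert, Finset.mem_singleton] at hca hcb
      have ha3 := hσ a
      have hb3 := hσ b
      grind
    have h2 : ∀ c, c ∈ R.erase b ∨ σ c ∈ R.erase b ∨ σ (σ c) ∈ R.erase b := by
      intro c
      have h3 : ∀ d, d ∈ R → d ∈ R.erase b ∨ σ d ∈ R.erase b ∨ σ (σ d) ∈ R.erase b := by
        intro d hd
        by_cases hdb : d = b
        · subst hdb
          right
          rcases h1 with h1 | h1
          · right; rw [h1, hσ]; exact Finset.mem_erase.2 ⟨by grind, ha⟩
          · left; rw [h1, hσ]; exact Finset.mem_erase.2 ⟨by grind, ha⟩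
        · exact Or.inl (Finset.mem_erase.2 ⟨hdb, hd⟩)
      rcases hR c with h | h | h
      · exact h3 c h
      · have := h3 _ h
        rw [hσ] at this
        tauto
      · have := h3 _ h
        rw [hσ] at this
        tauto
    have h4 := hmin _ h2
    have h5 := Finset.card_erase_lt_of_mem hb
    omega
  set F := Finset.univ.filter fun a => σ a = a
  have h1 : (R.biUnion O).card = ∑ a ∈ R, (O a).card := Finset.card_biUnion hdisj
  have h2 : (R.biUnion fun a => O a ∩ F).card = ∑ a ∈ R, (O a ∩ F).card :=
    Finset.card_biUnion fun a ha b hb hab => (hdisj a ha b hb hab).mono Finset.inter_subset_left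
      Finset.inter_subset_left
  have h3 : (R.biUnion O).card ≤ Fintype.card α := Finset.card_le_univ _
  have h4 : (R.biUnion fun a => O a ∩ F).card ≤ F.card := Finset.card_le_card
    (Finset.biUnion_subset.2 fun a _ => Finset.inter_subset_right)
  have h5 : ∀ a ∈ R, 3 ≤ (O a).card + 2 * (O a ∩ F).card := by
    intro a _
    by_cases haf : σ a = a
    · have h6 : a ∈ O a ∩ F := by simp [O, F, haf]
      have h7 : 0 < (O a ∩ F).card := Finset.card_pos.2 ⟨a, h6⟩
      have h8 : 0 < (O a).card := Finset.card_pos.2 ⟨a, (Finset.mem_inter.1 h6).1⟩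
      omega
    · have : (O a).card = 3 := Finset.card_eq_three.2 ⟨a, σ a, σ (σ a), by grind, by grind,
        by grind, rfl⟩
      omega
  have h6 := Finset.sum_le_sum h5
  rw [Finset.sum_add_distrib, ← Finset.mul_sum, Finset.sum_const, smul_eq_mul] at h6
  omega

end OrderThree

namespace OrderThree
open Subgroup
open scoped commutatorElement

section
variable {Γ : Type*} [Group Γ] (A : Type*) [AddCommGroup A] [DistribMulAction Γ A]

/-- The fixed points in `A` of a set of group elements. -/
def fx (s : Set Γ) : AddSubgroup A where
  carrier := {a | ∀ g ∈ s, g • a = a}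
  add_mem' ha hb g hg := by rw [smul_add, ha g hg, hb g hg]
  zero_mem' g _ := smul_zero g
  neg_mem' ha g hg := by rw [smul_neg, ha g hg]

variable {A}

theorem mem_fx {s : Set Γ} {a : A} : a ∈ fx A s ↔ ∀ g ∈ s, g • a = a := Iff.rfl

theorem mem_fx_singleton {g : Γ} {a : A} : a ∈ fx A {g} ↔ g • a = a := by simp [mem_fx]

theorem fx_anti {s t : Set Γ} (h : s ⊆ t) : fx A t ≤ fx A s := fun _ ha g hg => ha g (h hg)

theorem fx_closure (s : Set Γ) : fx A (closure s : Set Γ) = fx A s := by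
  refine le_antisymm (fx_anti Subgroup.subset_closure) fun a ha g hg => ?_
  have : closure s ≤ MulAction.stabilizer Γ a := (closure_le _).2 fun g hg => ha g hg
  exact this hg

theorem fx_zpowers (g : Γ) : fx A (zpowers g : Set Γ) = fx A {g} := by
  rw [zpowers_eq_closure, fx_closure]

theorem smul_mem_fx {s t : Set Γ} {g : Γ} (h : ∀ b ∈ t, g⁻¹ * b * g ∈ s) {a : A} (ha : a ∈ fx A s) :
    g • a ∈ fx A t := by
  intro b hb
  have := ha _ (h b hb)
  rw [mul_smul, mul_smul, inv_smul_eq_iff] at this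
  exact this

theorem card_fx_conj [Finite A] {s t : Set Γ} {g : Γ} (h : ∀ b, b ∈ t ↔ g⁻¹ * b * g ∈ s) :
    Nat.card (fx A t) = Nat.card (fx A s) := by
  have h2 : ∀ b ∈ s, g⁻¹⁻¹ * b * g⁻¹ ∈ t := fun b hb => by
    rw [h]
    have : g⁻¹ * (g⁻¹⁻¹ * b * g⁻¹) * g = b := by group
    rwa [this]
  exact (Nat.card_congr
    { toFun := fun a => ⟨g • a.1, smul_mem_fx (fun b hb => (h b).1 hb) a.2⟩
      invFun := fun a => ⟨g⁻¹ • a.1, smul_mem_fx h2 a.2⟩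
      left_inv := fun a => by simp
      right_inv := fun a => by simp }).symm

theorem card_fx_conj_singleton [Finite A] (g x : Γ) :
    Nat.card (fx A {g * x * g⁻¹}) = Nat.card (fx A {x}) := by
  refine card_fx_conj (g := g) fun b => ?_
  simp only [Set.mem_singleton_iff]
  constructor
  · rintro rfl; group
  · rintro rfl; group

/-- A finite family of commuting coprime subgroups whose fixed point spaces are pairwise disjoint
has independent fixed point spaces. -/
theorem fx_independent [Finite Γ] [Finite A] {ι : Type*} [Fintype ι] (B : ι → Subgroup Γ)
    (hcomm : ∀ i j, ∀ b ∈ B i, ∀ b' ∈ B j, b * b' = b' * b)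
    (hcop : ∀ i, (Nat.card (B i)).Coprime (Nat.card A))
    (hdisj : ∀ i j, i ≠ j → ∀ a, a ∈ fx A (B i : Set Γ) → a ∈ fx A (B j : Set Γ) → a = 0)
    (a : ι → A) (ha : ∀ i, a i ∈ fx A (B i : Set Γ)) (hsum : ∑ i, a i = 0) (i : ι) : a i = 0 := by
  classical
  have := Fintype.ofFinite Γ
  let E : A →+ A := ∑ b : B i, DistribSMul.toAddMonoidHom A (b : Γ)
  have hE : ∀ v, E v = ∑ b : B i, (b : Γ) • v := fun v => by simp [E]
  have hEfix : ∀ v, E v ∈ fx A (B i : Set Γ) := by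
    intro v g hg
    rw [hE, Finset.smul_sum]
    exact Fintype.sum_equiv (Equiv.mulLeft (⟨g, hg⟩ : B i)) _ _ fun b => by simp [mul_smul]
  have h1 : ∀ j, j ≠ i → E (a j) = 0 := by
    intro j hj
    refine hdisj j i hj _ (fun g hg => ?_) (hEfix _)
    rw [hE, Finset.smul_sum]
    refine Finset.sum_congr rfl fun b _ => ?_
    rw [← mul_smul, hcomm j i g hg b b.2, mul_smul, ha j g hg]
  have h2 : E (a i) = Nat.card (B i) • a i := by
    rw [hE, Finset.sum_congr rfl fun (b : B i) _ => ha i b.1 b.2, Finset.sum_const, Finset.card_univ,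
      Nat.card_eq_fintype_card]
  have h3 : E (∑ j, a j) = E (a i) := by
    rw [map_sum]
    exact Finset.sum_eq_single i (fun j _ hj => h1 j hj) fun h => (h (Finset.mem_univ _)).elim
  rw [hsum, map_zero, h2] at h3
  have h4 : addOrderOf (a i) ∣ Nat.card (B i) := addOrderOf_dvd_of_nsmul_eq_zero h3.symm
  have h5 : addOrderOf (a i) ∣ Nat.card A := addOrderOf_dvd_natCard (a i)
  exact AddMonoid.addOrderOf_eq_one_iff.1 (Nat.eq_one_of_dvd_coprimes (hcop i) h4 h5)

theorem sum_injective_of_independent {ι : Type*} [Fintype ι] {V : ι → AddSubgroup A}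
    (h : ∀ a : ι → A, (∀ i, a i ∈ V i) → ∑ i, a i = 0 → ∀ i, a i = 0) :
    Function.Injective fun a : ∀ i, V i => ∑ i, (a i : A) := by
  intro a b hab
  funext i
  have := h (fun i => (a i : A) - b i) (fun i => sub_mem (a i).2 (b i).2)
    (by simpa [sub_eq_zero] using hab) i
  exact Subtype.ext (sub_eq_zero.1 this)

theorem prod_card_le_of_independent [Finite A] {ι : Type*} [Fintype ι] {V : ι → AddSubgroup A}
    (h : ∀ a : ι → A, (∀ i, a i ∈ V i) → ∑ i, a i = 0 → ∀ i, a i = 0) :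
    ∏ i, Nat.card (V i) ≤ Nat.card A := by
  rw [← Nat.card_pi]
  exact Nat.card_le_card_of_injective _ (sum_injective_of_independent h)

theorem exists_sum_of_independent [Finite A] {ι : Type*} [Fintype ι] {V : ι → AddSubgroup A}
    (h : ∀ a : ι → A, (∀ i, a i ∈ V i) → ∑ i, a i = 0 → ∀ i, a i = 0)
    (hc : ∏ i, Nat.card (V i) = Nat.card A) (v : A) :
    ∃ a : ι → A, (∀ i, a i ∈ V i) ∧ ∑ i, a i = v := by
  have hinj := sum_injective_of_independent h
  rw [← Nat.card_pi] at hc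
  obtain ⟨a, ha⟩ := ((Nat.bijective_iff_injective_and_card _).2 ⟨hinj, hc⟩).2 v
  exact ⟨fun i => a i, fun i => (a i).2, ha⟩

end

/-- An irreducible action of a group generated by three conjugate elements of order three,
on a group of order `d ^ 3`, such that the generators have `d ^ 2` fixed points. -/
structure Tri {Γ : Type*} [Group Γ] (A : Type*) [AddCommGroup A] [DistribMulAction Γ A]
    (x y z : Γ) (d : ℕ) : Prop where
  conn : Conn (⊤ : Subgroup Γ) x y z
  cube : x ^ 3 = 1
  irr : ∀ W : AddSubgroup A, (∀ g : Γ, ∀ w ∈ W, g • w ∈ W) → W = ⊥ ∨ W = ⊤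
  card : Nat.card A = d ^ 3
  fix : Nat.card (fx A {x}) = d ^ 2
  one_lt : 1 < d

namespace Tri
variable {Γ : Type*} [Group Γ] [Finite Γ] {A : Type*} [AddCommGroup A] [Finite A]
  [DistribMulAction Γ A] [FaithfulSMul Γ A] {x y z : Γ} {d : ℕ}

theorem index (h : Tri A x y z d) (e : Γ) : (fx A {e * x * e⁻¹}).index = d := by
  have h1 := AddSubgroup.card_mul_index (fx A {e * x * e⁻¹})
  rw [card_fx_conj_singleton, h.fix, h.card, pow_succ d 2] at h1
  exact Nat.eq_of_mul_eq_mul_left (pow_pos (by have := h.one_lt; omega) 2) h1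

theorem le_card_fx (h : Tri A x y z d) (e f : Γ) :
    d ≤ Nat.card (fx A {e * x * e⁻¹, f * x * f⁻¹}) := by
  have h1 : fx A {e * x * e⁻¹, f * x * f⁻¹} = fx A {e * x * e⁻¹} ⊓ fx A {f * x * f⁻¹} := by
    ext a; simp [mem_fx]
  have h2 := AddSubgroup.index_inf_le (H := fx A {e * x * e⁻¹}) (K := fx A {f * x * f⁻¹})
  rw [h.index, h.index, ← h1] at h2
  have h3 := AddSubgroup.card_mul_index (fx A {e * x * e⁻¹, f * x * f⁻¹})
  rw [h.card] at h3
  have hd : 0 < d := by have := h.one_lt; omega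
  have h4 := Nat.mul_le_mul_left (Nat.card (fx A {e * x * e⁻¹, f * x * f⁻¹})) h2
  rw [h3, pow_three, mul_comm d (d * d)] at h4
  have h5 : d * d * d ≤ d * d * Nat.card (fx A {e * x * e⁻¹, f * x * f⁻¹}) := by linarith
  exact Nat.le_of_mul_le_mul_left h5 (by positivity)

theorem exists_ne_zero (h : Tri A x y z d) (e : Γ) :
    ∃ a : A, a ≠ 0 ∧ x • a = a ∧ (e * x * e⁻¹) • a = a := by
  have h1 := h.le_card_fx 1 e
  have h2 := h.one_lt
  have : Nontrivial (fx A {1 * x * 1⁻¹, e * x * e⁻¹}) :=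
    (Finite.one_lt_card_iff_nontrivial).1 (by omega)
  obtain ⟨a, ha⟩ := exists_ne (0 : fx A {1 * x * 1⁻¹, e * x * e⁻¹})
  have h3 := mem_fx.1 a.2
  refine ⟨a, fun h0 => ha (Subtype.ext h0), ?_, h3 _ (Set.mem_insert_of_mem _ rfl)⟩
  have h4 := h3 (1 * x * 1⁻¹) (Set.mem_insert _ _)
  have h5 : 1 * x * 1⁻¹ = x := by group
  exact (congrArg (· • (a : A)) h5).symm.trans h4

theorem eq_bot_of_fixed (h : Tri A x y z d) {N : Subgroup Γ} (hN : N.Normal) {a : A} (ha : a ≠ 0)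
    (hNa : ∀ n ∈ N, n • a = a) : N = ⊥ := by
  have h1 := (h.irr (fx A (N : Set Γ)) fun g w hw => smul_mem_fx (fun b hb => ?_) hw).resolve_left
    fun hbot => ha ?_
  · rw [eq_bot_iff]
    intro n hn
    refine FaithfulSMul.eq_of_smul_eq_smul (α := A) fun a => ?_
    have h2 : a ∈ fx A (N : Set Γ) := h1 ▸ AddSubgroup.mem_top a
    rw [h2 n hn, one_smul]
  · simpa using hN.conj_mem b hb g⁻¹
  · have : a ∈ fx A (N : Set Γ) := hNa
    rwa [hbot] at this

theorem eq_one_of_center (h : Tri A x y z d) {c : Γ} (hc : c ∈ center Γ) {a : A} (ha : a ≠ 0)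
    (hca : c • a = a) : c = 1 := by
  have hn : (zpowers c).Normal := ⟨fun n hn g => by
    have h1 : n ∈ center Γ := (zpowers_le.2 hc) hn
    rw [mem_center_iff.1 h1 g]; simpa using hn⟩
  rw [← zpowers_eq_bot]
  refine h.eq_bot_of_fixed hn ha fun n hn => ?_
  have : a ∈ fx A (zpowers c : Set Γ) := by rw [fx_zpowers, mem_fx_singleton]; exact hca
  exact this n hn

theorem eq_top_of_conj_mem (h : Tri A x y z d) (H : Subgroup Γ) (hH : ∀ g, g⁻¹ * x * g ∈ H) :
    H = ⊤ := by
  obtain ⟨k, -, hk⟩ := h.conn.two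
  obtain ⟨l, -, hl⟩ := h.conn.three
  refine top_le_iff.1 (h.conn.le ?_ ?_ ?_)
  · simpa using hH 1
  · simpa [hk] using hH k⁻¹
  · simpa [hl] using hH l⁻¹

theorem mem_center_of_commute (h : Tri A x y z d) {N : Subgroup Γ} (hN : N.Normal)
    (hc : ∀ n ∈ N, Commute x n) : N ≤ center Γ := by
  have h1 : centralizer (N : Set Γ) = ⊤ := h.eq_top_of_conj_mem _ fun g => by
    refine mem_centralizer_iff.2 fun n hn => ?_
    have h2 := (hc _ (hN.conj_mem n hn g)).eq
    have h3 : n * (g⁻¹ * x * g) = g⁻¹ * ((g * n * g⁻¹) * x) * g := by group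
    rw [h3, ← h2]; group
  intro n hn
  refine mem_center_iff.2 fun g => ?_
  exact (mem_centralizer_iff.1 (h1 ▸ mem_top g : g ∈ centralizer (N : Set Γ)) n hn).symm

theorem normal_of_fixed [Group.IsSolvable Γ] (h : Tri A x y z d) {B : Subgroup Γ}
    (hcomm : ∀ g g' : Γ, ∀ b ∈ B, ∀ b' ∈ B, (g * b * g⁻¹) * (g' * b' * g'⁻¹) =
      (g' * b' * g'⁻¹) * (g * b * g⁻¹))
    (hcop : (Nat.card B).Coprime (Nat.card A)) (hB : fx A (B : Set Γ) ≠ ⊥)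
    (hdisj : ∀ g g' : Γ, B.map (MulAut.conj g).toMonoidHom ≠ B.map (MulAut.conj g').toMonoidHom →
      ∀ a, a ∈ fx A (B.map (MulAut.conj g).toMonoidHom : Set Γ) →
        a ∈ fx A (B.map (MulAut.conj g').toMonoidHom : Set Γ) → a = 0) : B.Normal := by
  classical
  have := Fintype.ofFinite Γ
  let cj : Γ → Subgroup Γ → Subgroup Γ := fun g L => L.map (MulAut.conj g).toMonoidHom
  have hcjm : ∀ g L b, b ∈ cj g L ↔ g⁻¹ * b * g ∈ L := by
    intro g L b
    constructor
    · rintro ⟨c, hc, rfl⟩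
      have : g⁻¹ * (MulAut.conj g).toMonoidHom c * g = c := by simp [MulAut.conj_apply]; group
      rwa [this]
    · intro hb
      exact ⟨_, hb, by simp [MulAut.conj_apply]; group⟩
  have hcj : ∀ g g' L, cj g (cj g' L) = cj (g * g') L := by
    intro g g' L; ext b; rw [hcjm, hcjm, hcjm]
    have : g'⁻¹ * (g⁻¹ * b * g) * g' = (g * g')⁻¹ * b * (g * g') := by group
    rw [this]
  have hcj1 : ∀ L, cj 1 L = L := fun L => by ext b; rw [hcjm]; simp
  let α := {L : Subgroup Γ // ∃ g, cj g B = L}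
  have : Finite α := inferInstance
  have := Fintype.ofFinite α
  let tr : Γ → α → α := fun g L => ⟨cj g L.1, by
    obtain ⟨k, hk⟩ := L.2; exact ⟨g * k, by rw [← hk, hcj]⟩⟩
  let σ : α → α := tr x
  have htr : ∀ g g' L, tr g (tr g' L) = tr (g * g') L := fun g g' L => Subtype.ext (hcj _ _ _)
  have hσ : ∀ a, σ (σ (σ a)) = a := by
    intro a
    change tr x (tr x (tr x a)) = a
    have : x * x * x = 1 := by rw [← h.cube]; simp [pow_succ]
    rw [htr, htr, this]
    exact Subtype.ext (hcj1 _)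
  have hind := fx_independent (A := A) (fun L : α => L.1) (by
      rintro ⟨_, g, rfl⟩ ⟨_, g', rfl⟩ b hb b' hb'
      have := hcomm g g' _ ((hcjm _ _ _).1 hb) _ ((hcjm _ _ _).1 hb')
      have e : ∀ g b : Γ, g * (g⁻¹ * b * g) * g⁻¹ = b := fun g b => by group
      rwa [e, e] at this) (by
      rintro ⟨_, g, rfl⟩
      have : Nat.card (cj g B) = Nat.card B := (Nat.card_congr
        (B.equivMapOfInjective _ (MulAut.conj g).injective).toEquiv).symm
      rwa [this]) (by
      rintro ⟨_, g, rfl⟩ ⟨_, g', rfl⟩ hne a ha ha'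
      exact hdisj g g' (fun hh => hne (Subtype.ext hh)) a ha ha')
  let V : α → AddSubgroup A := fun L => fx A (L.1 : Set Γ)
  have hV : ∀ L, Nat.card (V L) = Nat.card (fx A (B : Set Γ)) := by
    rintro ⟨_, g, rfl⟩
    exact card_fx_conj (g := g) fun b => hcjm _ _ _
  set u := Nat.card (fx A (B : Set Γ)) with hu
  have hu1 : 1 < u := by
    rw [hu, Finite.one_lt_card_iff_nontrivial]
    exact (AddSubgroup.nontrivial_iff_ne_bot _).2 hB
  have hsup : (⨆ L, V L) = ⊤ := by
    refine (h.irr _ fun g w hw => ?_).resolve_left fun hbot => hB ?_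
    · have : (⨆ L, V L) ≤ (⨆ L, V L).comap (DistribSMul.toAddMonoidHom A g) := by
        refine iSup_le fun L w hw => ?_
        refine AddSubgroup.mem_iSup_of_mem (tr g L) ?_
        exact smul_mem_fx (s := (L.1 : Set Γ)) (fun b hb => (hcjm _ _ _).1 hb) hw
      exact this hw
    · rw [eq_bot_iff, ← hbot]
      have := le_iSup V ⟨B, 1, hcj1 B⟩
      exact this
  have hex : ∀ a : A, ∃ c : ∀ L, V L, ∑ L, (c L : A) = a := by
    intro a
    have ha : a ∈ ⨆ L, V L := hsup ▸ AddSubgroup.mem_top a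
    induction ha using AddSubgroup.iSup_induction' with
    | hp L a ha =>
      refine ⟨fun L' => if hL : L' = L then ⟨a, hL ▸ ha⟩ else 0, ?_⟩
      rw [Finset.sum_eq_single L]
      · simp
      · intro L' _ hne; simp [hne]
      · simp
    | h1 => exact ⟨0, by simp⟩
    | hadd a b _ _ iha ihb =>
      obtain ⟨c, hc⟩ := iha
      obtain ⟨c', hc'⟩ := ihb
      exact ⟨c + c', by simp [Finset.sum_add_distrib, hc, hc']⟩
  choose comp hcomp using hex
  have hcard : u ^ Fintype.card α = d ^ 3 := by
    rw [← h.card, ← Nat.card_congr (Equiv.ofBijective _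
      ⟨sum_injective_of_independent hind, fun a => ⟨comp a, hcomp a⟩⟩), Nat.card_pi]
    simp only [V] at hV
    rw [Finset.prod_congr rfl fun L _ => hV L, Finset.prod_const, Finset.card_univ]
  obtain ⟨R, hR, hRc⟩ := exists_orbit_representatives σ hσ
  have hfix : d ^ 2 ≤ u ^ R.card := by
    have hcard2 : Nat.card (∀ L : R, V L.1) = u ^ R.card := by
      rw [Nat.card_pi, Finset.prod_congr rfl fun L _ => hV _, Finset.prod_const, Finset.card_univ,
        Fintype.card_coe]
    rw [← h.fix, ← hcard2]
    refine Nat.card_le_card_of_injective (fun a (L : R) => comp a.1 L.1) ?_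
    intro a a' haa
    have hstep : ∀ a : A, x • a = a → ∀ L, x • (comp a L : A) = comp a (σ L) := by
      intro a ha
      have hbij : Function.Bijective σ := (Finite.injective_iff_bijective).1 fun L L' hL => by
        rw [← hσ L, ← hσ L', hL]
      let e := Equiv.ofBijective σ hbij
      have h1 : (fun L => (⟨x • (comp a (e.symm L) : A), by
          have := smul_mem_fx (t := (L.1 : Set Γ)) (g := x) (fun b hb => by
            have hL : σ (e.symm L) = L := e.apply_symm_apply L
            rw [← hL] at hb
            exact (hcjm _ _ _).1 hb) (comp a (e.symm L)).2
          exact this⟩ : V L)) = comp a := by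
        refine sum_injective_of_independent hind ?_
        change ∑ L, x • (comp a (e.symm L) : A) = ∑ L, (comp a L : A)
        rw [hcomp, Equiv.sum_comp e.symm fun L => x • (comp a L : A), ← Finset.smul_sum, hcomp, ha]
      intro L
      have h2 : x • (comp a (e.symm (σ L)) : A) = comp a (σ L) :=
        congrArg Subtype.val (congrFun h1 (σ L))
      have h3 : e.symm (σ L) = L := e.symm_apply_apply L
      rwa [h3] at h2
    have hback : ∀ L, (comp a.1 (σ L) : A) = comp a'.1 (σ L) → (comp a.1 L : A) = comp a'.1 L := by
      intro L hL
      rw [← hstep _ (mem_fx_singleton.1 a.2), ← hstep _ (mem_fx_singleton.1 a'.2)] at hL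
      exact smul_left_cancel _ hL
    have hall : ∀ L, (comp a.1 L : A) = comp a'.1 L := by
      have hRR : ∀ L ∈ R, (comp a.1 L : A) = comp a'.1 L := fun L hL =>
        congrArg Subtype.val (congrFun haa ⟨L, hL⟩)
      intro L
      rcases hR L with hL | hL | hL
      · exact hRR L hL
      · exact hback _ (hRR _ hL)
      · exact hback _ (hback _ (hRR _ hL))
    refine Subtype.ext ?_
    rw [← hcomp a.1, ← hcomp a'.1]
    exact Finset.sum_congr rfl fun L _ => hall L
  set n := Fintype.card α with hn
  have hRn : 2 * n ≤ 3 * R.card := by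
    have h1 := Nat.pow_le_pow_left hfix 3
    rw [← pow_mul, ← pow_mul, mul_comm 2 3, pow_mul, ← hcard, ← pow_mul] at h1
    have := (Nat.pow_le_pow_iff_right hu1).1 h1
    omega
  -- compare with the number of fixed points
  let N : Subgroup Γ :=
    { carrier := {g | cj g B = B}
      one_mem' := hcj1 B
      mul_mem' := fun {a b} ha hb => by
        change cj (a * b) B = B
        rw [← hcj, show cj b B = B from hb, show cj a B = B from ha]
      inv_mem' := fun {a} ha => by
        change cj a⁻¹ B = B
        conv_lhs => rw [← (show cj a B = B from ha)]
        rw [hcj, inv_mul_cancel, hcj1] }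
  have hNm : ∀ g, g ∈ N ↔ cj g B = B := fun g => Iff.rfl
  by_cases hNt : N = ⊤
  · refine ⟨fun b hb g => ?_⟩
    have h1 : cj g B = B := (hNm g).1 (hNt ▸ mem_top g)
    rw [← h1, hcjm]
    have : g⁻¹ * (g * b * g⁻¹) * g = b := by group
    rwa [this]
  exfalso
  have hlt := card_conj_mem_lt h.cube h.eq_top_of_conj_mem hNt
  let π : Γ → α := fun g => ⟨cj g B, g, rfl⟩
  have hfib : ∀ s : Finset α, (Finset.univ.filter fun g => π g ∈ s).card = s.card * Nat.card N := by
    intro s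
    rw [Finset.card_eq_sum_card_fiberwise (f := π) (t := s) (fun g hg => by simpa using hg),
      Finset.sum_const_nat]
    rintro ⟨_, k, rfl⟩ hk
    rw [Nat.card_eq_fintype_card, ← Finset.card_univ]
    refine Finset.card_bij' (fun g hg => ⟨k⁻¹ * g, ?_⟩) (fun g _ => k * g.1) ?_ ?_ ?_ ?_
    · rw [hNm, ← hcj]
      have h1 : cj g B = cj k B := congrArg Subtype.val (Finset.mem_filter.1 hg).2
      rw [h1, hcj, inv_mul_cancel, hcj1]
    · intro g _; simp
    · intro g _
      have h1 : π (k * g.1) = ⟨cj k B, k, rfl⟩ := Subtype.ext (by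
        change cj (k * g.1) B = cj k B
        rw [← hcj, (hNm _).1 g.2])
      simp only [Finset.mem_filter, Finset.mem_univ, true_and]
      exact ⟨by rw [h1]; exact hk, h1⟩
    · intro g _; simp
    · intro g _; simp
  have h1 := hfib Finset.univ
  simp only [Finset.mem_univ, Finset.filter_true, Finset.card_univ] at h1
  have h2 := hfib (Finset.univ.filter fun a => σ a = a)
  have h3 : Nat.card {g : Γ // g⁻¹ * x * g ∈ N} =
      (Finset.univ.filter fun g => π g ∈ Finset.univ.filter fun a => σ a = a).card := by
    rw [Nat.card_eq_fintype_card, Fintype.card_subtype]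
    congr 1
    ext g
    simp only [Finset.mem_filter, Finset.mem_univ, true_and]
    rw [hNm, ← hcj, ← hcj]
    constructor
    · intro hg
      refine Subtype.ext ?_
      change cj x (cj g B) = cj g B
      have h6 := congrArg (cj g) hg
      rwa [hcj, mul_inv_cancel, hcj1] at h6
    · intro hg
      have : cj x (cj g B) = cj g B := congrArg Subtype.val hg
      rw [this, hcj, inv_mul_cancel, hcj1]
  have h0 : Nat.card Γ = Fintype.card Γ := Nat.card_eq_fintype_card
  rw [h3, h2, h0, h1] at hlt
  have h4 : 2 * (Finset.univ.filter fun a => σ a = a).card * Nat.card N <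
      Fintype.card α * Nat.card N := by linarith
  have h5 := Nat.lt_of_mul_lt_mul_right h4
  omega

end Tri
end OrderThree

namespace OrderThree
open Subgroup
open scoped commutatorElement

section central
variable {Γ : Type*} [Group Γ] {a b f : Γ}

theorem commutator_mul_left_of_center (h : ⁅b, f⁆ ∈ center Γ) : ⁅a * b, f⁆ = ⁅a, f⁆ * ⁅b, f⁆ := by
  have h1 : ⁅a * b, f⁆ = a * ⁅b, f⁆ * a⁻¹ * ⁅a, f⁆ := by simp only [commutatorElement_def]; group
  rw [h1, mem_center_iff.1 h a, mul_inv_cancel_right, mem_center_iff.1 h]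

theorem commutator_pow_left_of_center (h : ⁅a, f⁆ ∈ center Γ) (n : ℕ) : ⁅a ^ n, f⁆ = ⁅a, f⁆ ^ n := by
  induction n with
  | zero => simp
  | succ n ih => rw [pow_succ, commutator_mul_left_of_center h, ih, pow_succ]

theorem commutator_mul_right_of_center (h : ⁅f, b⁆ ∈ center Γ) : ⁅f, a * b⁆ = ⁅f, a⁆ * ⁅f, b⁆ := by
  have h1 : ⁅f, a * b⁆ = ⁅f, a⁆ * (a * ⁅f, b⁆ * a⁻¹) := by simp only [commutatorElement_def]; group
  rw [h1, mem_center_iff.1 h a, mul_inv_cancel_right]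

theorem commutator_pow_right_of_center (h : ⁅f, a⁆ ∈ center Γ) (n : ℕ) :
    ⁅f, a ^ n⁆ = ⁅f, a⁆ ^ n := by
  induction n with
  | zero => simp
  | succ n ih => rw [pow_succ, commutator_mul_right_of_center h, ih, pow_succ]

theorem commutator_eq_one_of_center (h : a ∈ center Γ) (f : Γ) : ⁅a, f⁆ = 1 := by
  rw [commutatorElement_eq_one_iff_mul_comm, mem_center_iff.1 h]

theorem conj_pow_of_center {r f : Γ} (h : ⁅r, f⁆ ∈ center Γ) (i : ℕ) :
    (f ^ i)⁻¹ * r * f ^ i = ⁅r, f⁆ ^ i * r := by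
  rw [← commutator_pow_right_of_center h]
  have h1 : ⁅r, f ^ i⁆ ∈ center Γ := by
    rw [commutator_pow_right_of_center h]; exact pow_mem h i
  have h2 : (f ^ i)⁻¹ * r * f ^ i = (f ^ i)⁻¹ * ⁅r, f ^ i⁆ * f ^ i * r := by
    simp only [commutatorElement_def]; group
  rw [h2, mem_center_iff.1 h1]; group

end central

namespace Tri
variable {Γ : Type*} [Group Γ] [Finite Γ] {A : Type*} [AddCommGroup A] [Finite A]
  [DistribMulAction Γ A] [FaithfulSMul Γ A] {x y z : Γ} {d : ℕ}

theorem commutator_smul (x e : Γ) {a : A} (h1 : x • a = a) (h2 : (e * x * e⁻¹) • a = a) :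
    ⁅x, e⁆ • a = a := by
  have h3 : ⁅x, e⁆ = x * (e * x * e⁻¹)⁻¹ := by simp only [commutatorElement_def]; group
  rw [h3, mul_smul, inv_smul_eq_iff.2 h2.symm, h1]

theorem le_center_of_comm [Group.IsSolvable Γ] (h : Tri A x y z d) {N : Subgroup Γ}
    (hN : N.Normal) (hab : ∀ a ∈ N, ∀ b ∈ N, a * b = b * a)
    (hcop : (Nat.card N).Coprime (Nat.card A)) : N ≤ center Γ := by
  refine h.mem_center_of_commute hN fun n hn => ?_
  obtain ⟨a, ha, hxa, hna⟩ := h.exists_ne_zero n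
  have hr : ⁅x, n⁆ ∈ N := by
    rw [commutatorElement_def]
    exact mul_mem (hN.conj_mem n hn x) (inv_mem hn)
  obtain ⟨B, ⟨hBN, hB⟩, hmax⟩ := Set.exists_max_image
    {B : Subgroup Γ | B ≤ N ∧ fx A (B : Set Γ) ≠ ⊥} (fun B => Nat.card B) (Set.toFinite _)
    ⟨zpowers ⁅x, n⁆, zpowers_le.2 hr, fun hbot => ha (by
      have : a ∈ fx A (zpowers ⁅x, n⁆ : Set Γ) := by
        rw [fx_zpowers, mem_fx_singleton]; exact commutator_smul x n hxa hna
      rwa [hbot] at this)⟩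
  have hconj : ∀ g, B.map (MulAut.conj g).toMonoidHom ≤ N := by
    rintro g _ ⟨b, hb, rfl⟩
    exact hN.conj_mem b (hBN hb) g
  have hcard : ∀ g : Γ, Nat.card (B.map (MulAut.conj g).toMonoidHom) = Nat.card B := fun g =>
    (Nat.card_congr (B.equivMapOfInjective _ (MulAut.conj g).injective).toEquiv).symm
  have hBn : B.Normal := by
    refine h.normal_of_fixed (fun g g' b hb b' hb' => hab _ (hN.conj_mem b (hBN hb) g) _
      (hN.conj_mem b' (hBN hb') g')) (hcop.coprime_dvd_left (card_dvd_of_le hBN)) hB ?_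
    intro g g' hne a ha ha'
    by_contra ha0
    set B1 := B.map (MulAut.conj g).toMonoidHom
    set B2 := B.map (MulAut.conj g').toMonoidHom
    have hsup : a ∈ fx A ((B1 ⊔ B2 : Subgroup Γ) : Set Γ) := by
      rw [sup_eq_closure, fx_closure]
      rintro b (hb | hb)
      · exact ha b hb
      · exact ha' b hb
    have hle := hmax (B1 ⊔ B2) ⟨sup_le (hconj g) (hconj g'), fun hbot => ha0 (by
      rwa [hbot] at hsup)⟩
    have e1 : B1 = B1 ⊔ B2 := eq_of_le_of_card_ge le_sup_left (by rw [hcard]; exact hle)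
    have e2 : B2 = B1 ⊔ B2 := eq_of_le_of_card_ge le_sup_right (by rw [hcard]; exact hle)
    exact hne (e1.trans e2.symm)
  obtain ⟨⟨b, hb⟩, hb1⟩ := AddSubgroup.ne_bot_iff_exists_ne_zero.1 hB
  have hb0 : b ≠ 0 := fun h0 => hb1 (Subtype.ext h0)
  have hBbot := h.eq_bot_of_fixed hBn hb0 fun n hn => hb n hn
  have h1 := hmax (zpowers ⁅x, n⁆) ⟨zpowers_le.2 hr, fun hbot => ha (by
      have : a ∈ fx A (zpowers ⁅x, n⁆ : Set Γ) := by
        rw [fx_zpowers, mem_fx_singleton]; exact commutator_smul x n hxa hna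
      rwa [hbot] at this)⟩
  rw [hBbot, card_bot] at h1
  have h2 : zpowers ⁅x, n⁆ = ⊥ := eq_bot_of_card_le _ h1
  rw [zpowers_eq_bot, commutatorElement_eq_one_iff_mul_comm] at h2
  exact h2

end Tri

/-- A noncentral normal `q`-subgroup which is abelian modulo the center. -/
structure Core {Γ : Type*} [Group Γ] (A : Type*) (q : ℕ) (N : Subgroup Γ) : Prop where
  prime : q.Prime
  normal : N.Normal
  isPGroup : IsPGroup q N
  cop : q.Coprime (Nat.card A)
  der : ∀ a ∈ N, ∀ b ∈ N, ⁅a, b⁆ ∈ center Γ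
  pow : ∀ a ∈ N, a ^ q ∈ center Γ
  cent : ∀ a ∈ N, (∀ b ∈ N, ⁅a, b⁆ = 1) → a ∈ center Γ
  ne : ¬ N ≤ center Γ

theorem card_coprime_of_isPGroup {Γ : Type*} [Group Γ] [Finite Γ] {q n : ℕ} (hq : q.Prime)
    {N : Subgroup Γ} (h : IsPGroup q N) (hn : q.Coprime n) : (Nat.card N).Coprime n := by
  have := Fact.mk hq
  obtain ⟨k, hk⟩ := IsPGroup.iff_card.1 h
  rw [hk]
  exact hn.pow_left k

theorem Tri.exists_core {Γ : Type*} [Group Γ] [Finite Γ] {A : Type*} [AddCommGroup A] [Finite A]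
    [DistribMulAction Γ A] [FaithfulSMul Γ A] {x y z : Γ} {d : ℕ} [Group.IsSolvable Γ]
    (h : Tri A x y z d) {q : ℕ} (hq : q.Prime) {T S : Subgroup Γ} (hT : T.Normal) (hS : S.Normal)
    (hTq : IsPGroup q T) (hTS : ⁅T, S⁆ = T) (hT1 : T ≠ ⊥) (hcop : q.Coprime (Nat.card A)) :
    ∃ N ≤ T, Core A q N ∧
      ⁅N, closure {t | t ∈ S ∧ ∃ p : ℕ, p.Prime ∧ q ≠ p ∧ IsPElt p t}⁆ = N := by
  have := Fact.mk hq
  have := hT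
  have := hS
  set R := closure {t | t ∈ S ∧ ∃ p : ℕ, p.Prime ∧ q ≠ p ∧ IsPElt p t} with hRdef
  have hRS : R ≤ S := (closure_le _).2 fun t ht => ht.1
  have hRn : R.Normal := by
    rw [← normalizer_eq_top_iff]
    exact top_le_iff.1 (le_normalizer_closure fun g _ k hk =>
      ⟨hS.conj_mem k hk.1 g, hk.2.imp fun p hp => ⟨hp.1, hp.2.1, hp.2.2.conj g⟩⟩)
  have hcentral : ∀ U : Subgroup Γ, U.Normal → U ≤ T → (∀ a ∈ U, ∀ b ∈ U, a * b = b * a) →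
      U ≤ center Γ := fun U hU hUT hab => h.le_center_of_comm hU hab
        (card_coprime_of_isPGroup hq (hTq.to_le hUT) hcop)
  have hTR : ¬ T ≤ centralizer R := by
    intro hle
    -- `T` lies in `R`, since `S ⧸ R` is a `q`-group
    let π := QuotientGroup.mk' R
    have hSq : IsPGroup q (S.map π) := by
      refine isPGroup_of_forall ?_
      rintro _ ⟨s, hs, rfl⟩
      have h1 := mem_closure_isPElt s
      have h2 : π s ∈ closure (π '' {h | h ∈ zpowers s ∧ ∃ p : ℕ, p.Prime ∧ IsPElt p h}) := by
        rw [← MonoidHom.map_closure]; exact mem_map_of_mem _ h1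
      have h3 : ∀ u ∈ closure (π '' {h | h ∈ zpowers s ∧ ∃ p : ℕ, p.Prime ∧ IsPElt p h}),
          u ∈ zpowers (π s) ∧ IsPElt q u := by
        intro u hu
        induction hu using Subgroup.closure_induction with
        | mem u hu =>
          obtain ⟨t, ⟨ht, p, hp, htp⟩, rfl⟩ := hu
          refine ⟨by rw [← MonoidHom.map_zpowers]; exact mem_map_of_mem _ ht, ?_⟩
          by_cases hpq : q = p
          · rw [hpq]; exact htp.map π
          · have : π t = 1 := (QuotientGroup.eq_one_iff _).2
              (Subgroup.subset_closure ⟨zpowers_le.2 hs ht, p, hp, hpq, htp⟩)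
            exact ⟨0, by simp [this]⟩
        | one => exact ⟨one_mem _, 0, by simp⟩
        | mul a b _ _ ha hb =>
          refine ⟨mul_mem ha.1 hb.1, ?_⟩
          obtain ⟨k, hk⟩ := ha.2
          obtain ⟨l, hl⟩ := hb.2
          have hc : Commute a b := by
            obtain ⟨i, rfl⟩ := ha.1
            obtain ⟨j, rfl⟩ := hb.1
            exact (Commute.refl _).zpow_zpow _ _
          refine ⟨k + l, ?_⟩
          rw [hc.mul_pow, pow_add, pow_mul, hk, one_pow, one_mul, mul_comm, pow_mul, hl, one_pow]
        | inv a _ ha => exact ⟨inv_mem ha.1, ha.2.inv⟩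
      exact (h3 _ h2).2
    have hTn : (T.map π).Normal := hT.map π (QuotientGroup.mk'_surjective _)
    have hTSq : IsPGroup q (T.map π ⊔ S.map π : Subgroup (Γ ⧸ R)) :=
      (hTq.map π).to_sup_of_normal_left hSq
    have hnil : Group.IsNilpotent (T.map π ⊔ S.map π : Subgroup (Γ ⧸ R)) := hTSq.isNilpotent
    have h4 : T.map π ≤ nres (T.map π ⊔ S.map π) := by
      refine le_nres le_sup_left ?_
      conv_lhs => rw [← hTS, map_commutator]
      exact commutator_mono le_rfl le_sup_right
    rw [nres_eq_bot_iff.2 hnil, le_bot_iff, Subgroup.map_eq_bot_iff, QuotientGroup.ker_mk'] at h4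
    have h5 := hcentral T hT le_rfl fun a ha b hb => (mem_centralizer_iff.1 (hle ha) b (h4 hb)).symm
    refine hT1 ?_
    rw [← hTS, eq_bot_iff, commutator_le]
    intro t ht s hs
    exact commutator_eq_one_of_center (h5 ht) s
  obtain ⟨N, hNT, hN⟩ := exists_minAct (K := ⊤) (T := R) hTq
    (by rw [normalizer_eq_top_iff.2 hT]) le_top (by rw [normalizer_eq_top_iff.2 hRn])
    (by
      refine (closure_le _).2 fun t ht => Subgroup.subset_closure ⟨Subgroup.subset_closure ht, ht.2⟩)
    hTR
  have hNn : N.Normal := normalizer_eq_top_iff.1 (top_le_iff.1 hN.norm)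
  have hZ : N ⊓ centralizer (R : Set Γ) ≤ center Γ := by
    refine hcentral _ inferInstance (inf_le_left.trans hNT) fun a ha b hb => ?_
    exact (mem_centralizer_iff.1 (hN.cent ha) b hb.1).symm
  have hne : ¬ N ≤ center Γ := fun hc => hN.ne (hc.trans (center_le_centralizer _))
  refine ⟨N, hNT, ⟨hq, hNn, hTq.to_le hNT, hcop, fun a ha b hb => ?_, fun a ha => ?_,
    fun a ha hab => ?_, hne⟩, hN.comm⟩
  · have := commutator_mem_commutator ha hb
    exact hZ ⟨commutator_le_left (le_normalizer) this, hN.der this⟩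
  · exact hZ ⟨pow_mem ha q, hN.pow a ha⟩
  · have : N ⊓ centralizer (N : Set Γ) ≤ center Γ := by
      refine hcentral _ inferInstance (inf_le_left.trans hNT) fun a ha b hb => ?_
      exact (mem_centralizer_iff.1 ha.2 b hb.1).symm
    refine this (mem_inf.2 ⟨ha, mem_centralizer_iff.2 fun b hb => ?_⟩)
    exact (commutatorElement_eq_one_iff_mul_comm.1 (hab b hb)).symm

end OrderThree

namespace OrderThree
open Subgroup
open scoped commutatorElement

section
variable {Γ : Type*} [Group Γ] [Finite Γ] {A : Type*} [AddCommGroup A] [Finite A]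
  [DistribMulAction Γ A] {q : ℕ} {N : Subgroup Γ}

theorem Core.fx_independent (hN : Core A q N) {ι : Type*} [Fintype ι] (t : ι → Set Γ)
    (ht : ∀ i, t i ⊆ N) (hcomm : ∀ i j, ∀ b ∈ t i, ∀ b' ∈ t j, b * b' = b' * b)
    (hdisj : ∀ i j, i ≠ j → ∀ a, a ∈ fx A (t i) → a ∈ fx A (t j) → a = 0)
    (a : ι → A) (ha : ∀ i, a i ∈ fx A (t i)) (hsum : ∑ i, a i = 0) (i : ι) : a i = 0 := by
  refine OrderThree.fx_independent (fun i => closure (t i)) (fun i j b hb b' hb' => ?_) (fun i => ?_)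
    (fun i j hij a ha ha' => ?_) a (fun i => ?_) hsum i
  · have h1 : closure (t i) ≤ centralizer (t j) := (closure_le _).2 fun b hb =>
      mem_centralizer_iff.2 fun b' hb' => (hcomm i j b hb b' hb').symm
    have h2 : closure (t j) ≤ centralizer (closure (t i) : Set Γ) := (closure_le _).2 fun b' hb' =>
      mem_centralizer_iff.2 fun b hb => (mem_centralizer_iff.1 (h1 hb) b' hb').symm
    exact mem_centralizer_iff.1 (h2 hb') b hb
  · exact card_coprime_of_isPGroup hN.prime (hN.isPGroup.to_le ((closure_le _).2 (ht i))) hN.cop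
  · rw [fx_closure] at ha ha'
    exact hdisj i j hij a ha ha'
  · rw [fx_closure]; exact ha i

theorem Core.card_fx_pow_le (hN : Core A q N) {ι : Type*} [Fintype ι] {s : Set Γ} (t : ι → Set Γ)
    (g : ι → Γ) (hg : ∀ i b, b ∈ t i ↔ (g i)⁻¹ * b * g i ∈ s)
    (ht : ∀ i, t i ⊆ N) (hcomm : ∀ i j, ∀ b ∈ t i, ∀ b' ∈ t j, b * b' = b' * b)
    (hdisj : ∀ i j, i ≠ j → ∀ a, a ∈ fx A (t i) → a ∈ fx A (t j) → a = 0) :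
    Nat.card (fx A s) ^ Fintype.card ι ≤ Nat.card A := by
  have h1 := prod_card_le_of_independent (hN.fx_independent t ht hcomm hdisj)
  rwa [Finset.prod_congr rfl fun i _ => card_fx_conj (hg i), Finset.prod_const,
    Finset.card_univ] at h1

end

namespace Tri
variable {Γ : Type*} [Group Γ] [Finite Γ] {A : Type*} [AddCommGroup A] [Finite A]
  [DistribMulAction Γ A] [FaithfulSMul Γ A] {x y z : Γ} {d q : ℕ} {N : Subgroup Γ}

theorem eq_of_mul_fix (h : Tri A x y z d) {u v r : Γ} (hu : u ∈ center Γ) (hv : v ∈ center Γ) {a : A}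
    (ha : a ≠ 0) (h1 : (u * r) • a = a) (h2 : (v * r) • a = a) : u = v := by
  have h3 : u * v⁻¹ = 1 := by
    refine h.eq_one_of_center (mul_mem hu (inv_mem hv)) ha ?_
    have h4 : v⁻¹ • a = r • a := by rw [inv_smul_eq_iff, ← mul_smul, h2]
    rw [mul_smul, h4, ← mul_smul, h1]
  exact mul_inv_eq_one.1 h3

theorem pow_eq_one (h : Tri A x y z d) (hN : Core A q N) {r : Γ} (hr : r ∈ N) {a : A}
    (ha : a ≠ 0) (hra : r • a = a) : r ^ q = 1 := by
  refine h.eq_one_of_center (hN.pow r hr) ha ?_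
  have h1 : ∀ n : ℕ, r ^ n • a = a := fun n => by
    induction n with
    | zero => simp
    | succ n ih => rw [pow_succ, mul_smul, hra, ih]
  exact h1 q

theorem exists_commutator_ne_one (h : Tri A x y z d) (hN : Core A q N) {r : Γ} (hr : r ∈ N)
    (hr1 : r ≠ 1) {a : A} (ha : a ≠ 0) (hra : r • a = a) : ∃ f ∈ N, ⁅r, f⁆ ≠ 1 := by
  by_contra hcon
  push Not at hcon
  exact hr1 (h.eq_one_of_center (hN.cent r hr hcon) ha hra)

theorem commutator_pow_eq_one (hN : Core A q N) {r f : Γ} (hr : r ∈ N)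
    (hf : f ∈ N) : ⁅r, f⁆ ^ q = 1 := by
  rw [← commutator_pow_left_of_center (hN.der r hr f hf)]
  exact commutator_eq_one_of_center (hN.pow r hr) f

theorem orderOf_commutator (hN : Core A q N) {r f : Γ} (hr : r ∈ N)
    (hf : f ∈ N) (hc : ⁅r, f⁆ ≠ 1) : orderOf ⁅r, f⁆ = q :=
  have := Fact.mk hN.prime
  orderOf_eq_prime (commutator_pow_eq_one hN hr hf) hc

theorem exists_not_commute (h : Tri A x y z d) (hN : Core A q N) : ∃ e ∈ N, ⁅x, e⁆ ≠ 1 := by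
  by_contra hcon
  push Not at hcon
  exact hN.ne (h.mem_center_of_commute hN.normal fun n hn =>
    commutatorElement_eq_one_iff_mul_comm.1 (hcon n hn))

theorem commutator_mem (hN : Core A q N) (x : Γ) {e : Γ} (he : e ∈ N) : ⁅x, e⁆ ∈ N := by
  rw [commutatorElement_def]
  exact mul_mem (hN.normal.conj_mem e he x) (inv_mem he)

theorem pow_mul_disjoint (h : Tri A x y z d) (hN : Core A q N) {r f : Γ} (hr : r ∈ N) (hf : f ∈ N)
    (hc : ⁅r, f⁆ ≠ 1) (i j : Fin q) (hij : i ≠ j) (r' : Γ) (a : A)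
    (h1 : (⁅r, f⁆ ^ (i : ℕ) * r') • a = a) (h2 : (⁅r, f⁆ ^ (j : ℕ) * r') • a = a) : a = 0 := by
  by_contra ha
  have h3 := h.eq_of_mul_fix (pow_mem (hN.der r hr f hf) i) (pow_mem (hN.der r hr f hf) j) ha h1 h2
  refine hij (Fin.ext (pow_injOn_Iio_orderOf ?_ ?_ h3)) <;>
    simp [orderOf_commutator hN hr hf hc]

theorem pow_mul_independent (h : Tri A x y z d) (hN : Core A q N) {r f : Γ} (hr : r ∈ N)
    (hf : f ∈ N) (hc : ⁅r, f⁆ ≠ 1) (a : Fin q → A)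
    (ha : ∀ i : Fin q, a i ∈ fx A {⁅r, f⁆ ^ (i : ℕ) * r}) (hsum : ∑ i, a i = 0) (i : Fin q) :
    a i = 0 := by
  have hcen := hN.der r hr f hf
  refine hN.fx_independent (fun i : Fin q => {⁅r, f⁆ ^ (i : ℕ) * r}) (fun i => ?_) ?_ ?_ a ha hsum i
  · rw [Set.singleton_subset_iff]
    exact mul_mem (pow_mem (by
      rw [commutatorElement_def]
      exact mul_mem (hN.normal.conj_mem f hf r) (inv_mem hf)) _) hr
  · rintro i j _ rfl _ rfl
    have h1 : Commute r (⁅r, f⁆ ^ (j : ℕ)) := mem_center_iff.1 (pow_mem hcen j) r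
    have h2 : Commute r (⁅r, f⁆ ^ (i : ℕ)) := mem_center_iff.1 (pow_mem hcen i) r
    exact ((((Commute.refl _).pow_pow _ _).mul_right h2.symm).mul_left
      (h1.mul_right (Commute.refl r))).eq
  · intro i j hij a ha ha'
    exact h.pow_mul_disjoint hN hr hf hc i j hij r a (mem_fx_singleton.1 ha) (mem_fx_singleton.1 ha')

theorem card_fx_pow_mul (hN : Core A q N) {r f : Γ} (hr : r ∈ N) (hf : f ∈ N) (i : ℕ) :
    Nat.card (fx A {⁅r, f⁆ ^ i * r}) = Nat.card (fx A {r}) := by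
  rw [← conj_pow_of_center (hN.der r hr f hf), ← card_fx_conj_singleton (f ^ i)⁻¹ r, inv_inv]

theorem card_fx_pow (h : Tri A x y z d) (hN : Core A q N) {r f : Γ} (hr : r ∈ N)
    (hf : f ∈ N) (hc : ⁅r, f⁆ ≠ 1) : Nat.card (fx A {r}) ^ q ≤ d ^ 3 := by
  have h1 := prod_card_le_of_independent (h.pow_mul_independent hN hr hf hc)
  rwa [Finset.prod_congr rfl fun (i : Fin q) _ => card_fx_pow_mul hN hr hf (i : ℕ), Finset.prod_const,
    Finset.card_univ, Fintype.card_fin, h.card] at h1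

theorem fx_pair_le (x e : Γ) : fx A {1 * x * 1⁻¹, e * x * e⁻¹} ≤ fx A {⁅x, e⁆} := by
  intro a ha
  rw [mem_fx_singleton]
  refine commutator_smul x e ?_ (ha _ (Set.mem_insert_of_mem _ rfl))
  have h4 := ha (1 * x * 1⁻¹) (Set.mem_insert _ _)
  rwa [one_mul, inv_one, mul_one] at h4

theorem le_card_fx_commutator (h : Tri A x y z d) (e : Γ) : d ≤ Nat.card (fx A {⁅x, e⁆}) :=
  (h.le_card_fx 1 e).trans (Nat.card_le_card_of_injective _
    (AddSubgroup.inclusion_injective (fx_pair_le x e)))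

theorem prime_le_three (h : Tri A x y z d) (hN : Core A q N) : q ≤ 3 := by
  obtain ⟨e, he, hxe⟩ := h.exists_not_commute hN
  obtain ⟨a, ha, hxa, hea⟩ := h.exists_ne_zero e
  have hr := commutator_mem hN x he
  obtain ⟨f, hf, hc⟩ := h.exists_commutator_ne_one hN hr hxe ha (commutator_smul x e hxa hea)
  have h1 := h.card_fx_pow hN hr hf hc
  exact (Nat.pow_le_pow_iff_right h.one_lt).1
    ((Nat.pow_le_pow_left (h.le_card_fx_commutator e) q).trans h1)

theorem smul_mem_pair (e : Γ) {a : A} (ha : a ∈ fx A {1 * x * 1⁻¹, e * x * e⁻¹}) :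
    x • a = a := by
  have h4 := ha (1 * x * 1⁻¹) (Set.mem_insert _ _)
  rwa [one_mul, inv_one, mul_one] at h4

theorem conj_commutator_smul (x e : Γ) {a : A} (h1 : x • a = a) (h2 : (e * x * e⁻¹) • a = a) :
    (x * ⁅x, e⁆ * x⁻¹) • a = a := by
  rw [mul_smul, mul_smul, inv_smul_eq_iff.2 h1.symm, commutator_smul x e h1 h2, h1]

/-- If `x` centralizes `⁅x, e⁆` then it commutes with its conjugate. -/
theorem commutator_pow_three (h : Tri A x y z d) {e : Γ} (hc : x * ⁅x, e⁆ * x⁻¹ = ⁅x, e⁆) :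
    Commute x (e * x * e⁻¹) ∧ ⁅x, e⁆ ^ 3 = 1 := by
  have h3 : e * x * e⁻¹ = ⁅x, e⁆⁻¹ * x := by simp only [commutatorElement_def]; group
  have hcx : Commute x ⁅x, e⁆ := by
    have := congrArg (· * x) hc
    rwa [inv_mul_cancel_right] at this
  have h4 : Commute x (e * x * e⁻¹) := by
    rw [h3]; exact hcx.inv_right.mul_right (Commute.refl x)
  refine ⟨h4, ?_⟩
  have h5 : ⁅x, e⁆ = x * (e * x * e⁻¹)⁻¹ := by simp only [commutatorElement_def]; group
  rw [h5, h4.inv_right.mul_pow, inv_pow, conj_pow, h.cube]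
  group

theorem prime_ne_two (h : Tri A x y z d) (hN : Core A q N) : q ≠ 2 := by
  rintro rfl
  obtain ⟨e, he, hxe⟩ := h.exists_not_commute hN
  obtain ⟨a, ha, hxa, hea⟩ := h.exists_ne_zero e
  have hr := commutator_mem hN x he
  have hra := commutator_smul x e hxa hea
  set r := ⁅x, e⁆ with hrdef
  have hr' : x * r * x⁻¹ ∈ N := hN.normal.conj_mem r hr x
  have hra' : (x * r * x⁻¹) • a = a := conj_commutator_smul x e hxa hea
  have hne : x * r * x⁻¹ ≠ r := by
    intro heq
    have h3 := (h.commutator_pow_three heq).2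
    have h2 := h.pow_eq_one hN hr ha hra
    rw [pow_succ, ← hrdef, h2, one_mul] at h3
    exact hxe h3
  have hr2 := h.pow_eq_one hN hr ha hra
  have hL : fx A {1 * x * 1⁻¹, e * x * e⁻¹} ≤ fx A {r, x * r * x⁻¹} := by
    intro b hb g hg
    have hb1 := smul_mem_pair e hb
    have hb2 := hb _ (Set.mem_insert_of_mem _ rfl)
    rcases hg with rfl | rfl
    · exact commutator_smul x e hb1 hb2
    · exact conj_commutator_smul x e hb1 hb2
  set r' := x * r * x⁻¹ with hrdef'
  have hcomm : ⁅r, r'⁆ = 1 := by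
    refine h.eq_one_of_center (hN.der r hr r' hr') ha ?_
    rw [commutatorElement_def, mul_smul, mul_smul, mul_smul, inv_smul_eq_iff.2 hra'.symm,
      inv_smul_eq_iff.2 hra.symm, hra', hra]
  have hs1 : r * r' ≠ 1 := by
    intro h1
    refine hne ?_
    rw [eq_inv_of_mul_eq_one_right h1]
    exact inv_eq_of_mul_eq_one_left (by rw [← sq, hr2])
  have hsa : (r * r') • a = a := by rw [mul_smul, hra', hra]
  obtain ⟨f, hf, hc⟩ := h.exists_commutator_ne_one hN hr hxe ha hra
  set c := ⁅r, f⁆ with hcdef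
  have hneg : ∀ c ∈ center Γ, c ^ 2 = 1 → c ≠ 1 → ∀ b : A, c • b = -b := by
    intro c hc hc2 hc1 b
    by_contra hb
    refine hc1 (h.eq_one_of_center hc (a := c • b + b) (fun h0 => hb (eq_neg_of_add_eq_zero_left h0)) ?_)
    rw [smul_add, ← mul_smul, ← sq, hc2, one_smul, add_comm]
  have huniq : ∀ g ∈ N, ∀ g' ∈ N, ⁅g, g'⁆ ≠ 1 → ⁅g, g'⁆ = c := by
    intro g hg g' hg' h1
    refine FaithfulSMul.eq_of_smul_eq_smul (α := A) fun b => ?_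
    rw [hneg _ (hN.der g hg g' hg') (commutator_pow_eq_one hN hg hg') h1,
      hneg _ (hN.der r hr f hf) (commutator_pow_eq_one hN hr hf) hc]
  have hc2 : c * c = 1 := by rw [← sq]; exact commutator_pow_eq_one hN hr hf
  have hmulr : ∀ u ∈ N, ∀ g ∈ N, ∀ g' ∈ N, ⁅u, g * g'⁆ = ⁅u, g⁆ * ⁅u, g'⁆ := fun u hu g _ g' hg' =>
    commutator_mul_right_of_center (hN.der u hu g' hg')
  have hsplit : (∃ g ∈ N, ⁅r, g⁆ = c ∧ ⁅r', g⁆ = 1) ∧ ∃ g ∈ N, ⁅r, g⁆ = 1 ∧ ⁅r', g⁆ = c := by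
    obtain ⟨g, hg, hgc⟩ := h.exists_commutator_ne_one hN (mul_mem hr hr') hs1 ha hsa
    have hr1' : r' ≠ 1 := by
      intro h0; rw [hrdef', conj_eq_one_iff] at h0; exact hxe h0
    obtain ⟨f', hf', hc'⟩ := h.exists_commutator_ne_one hN hr' hr1' ha hra'
    have hc'' := huniq _ hr' _ hf' hc'
    rw [commutator_mul_left_of_center (hN.der r' hr' g hg)] at hgc
    by_cases h1 : ⁅r, g⁆ = 1
    · have h2 : ⁅r', g⁆ = c := huniq _ hr' _ hg (by rw [h1, one_mul] at hgc; exact hgc)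
      refine ⟨?_, g, hg, h1, h2⟩
      by_cases h3 : ⁅r', f⁆ = 1
      · exact ⟨f, hf, rfl, h3⟩
      · refine ⟨f * g, mul_mem hf hg, ?_, ?_⟩
        · rw [hmulr r hr f hf g hg, h1, mul_one]
        · rw [hmulr r' hr' f hf g hg, h2, huniq _ hr' _ hf h3, hc2]
    · have h1' := huniq _ hr _ hg h1
      have h2 : ⁅r', g⁆ = 1 := by
        by_contra h2
        rw [h1', huniq _ hr' _ hg h2, hc2] at hgc
        exact hgc rfl
      refine ⟨⟨g, hg, h1', h2⟩, ?_⟩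
      by_cases h3 : ⁅r, f'⁆ = 1
      · exact ⟨f', hf', h3, hc''⟩
      · refine ⟨f' * g, mul_mem hf' hg, ?_, ?_⟩
        · rw [hmulr r hr f' hf' g hg, huniq _ hr _ hf' h3, h1', hc2]
        · rw [hmulr r' hr' f' hf' g hg, h2, mul_one, hc'']
  obtain ⟨⟨g1, hg1, h11, h12⟩, g2, hg2, h21, h22⟩ := hsplit
  have hccen : c ∈ center Γ := hN.der r hr f hf
  have hcN : c ∈ N := commutator_mem hN r hf
  have hbr : ∀ i j : ℕ, ⁅r, g1 ^ i * g2 ^ j⁆ = c ^ i ∧ ⁅r', g1 ^ i * g2 ^ j⁆ = c ^ j := by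
    intro i j
    rw [hmulr r hr _ (pow_mem hg1 i) _ (pow_mem hg2 j), hmulr r' hr' _ (pow_mem hg1 i) _ (pow_mem hg2 j),
      commutator_pow_right_of_center (hN.der r hr g1 hg1),
      commutator_pow_right_of_center (hN.der r hr g2 hg2),
      commutator_pow_right_of_center (hN.der r' hr' g1 hg1),
      commutator_pow_right_of_center (hN.der r' hr' g2 hg2), h11, h12, h21, h22]
    simp
  have h4 := hN.card_fx_pow_le (ι := Fin 2 × Fin 2) (s := {r, r'})
    (fun i => {c ^ (i.1 : ℕ) * r, c ^ (i.2 : ℕ) * r'})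
    (fun i => (g1 ^ (i.1 : ℕ) * g2 ^ (i.2 : ℕ))⁻¹) (by
      rintro ⟨i, j⟩ b
      obtain ⟨hi, hj⟩ := hbr i j
      set g := g1 ^ (i : ℕ) * g2 ^ (j : ℕ)
      have e1 : ∀ u k, ⁅u, g⁆ = c ^ (k : ℕ) → (b = c ^ k * u ↔ g⁻¹⁻¹ * b * g⁻¹ = u) := by
        intro u k hk
        have hcen : ⁅u, g⁆ ∈ center Γ := hk ▸ pow_mem hccen k
        have := conj_pow_of_center (r := u) (f := g) hcen 1
        rw [pow_one, pow_one, hk] at this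
        rw [← this]
        constructor
        · rintro rfl; group
        · rintro rfl; group
      simp only [Set.mem_insert_iff, Set.mem_singleton_iff]
      rw [e1 r i hi, e1 r' j hj]) (by
      rintro ⟨i, j⟩ b (rfl | rfl)
      · exact mul_mem (pow_mem hcN _) hr
      · exact mul_mem (pow_mem hcN _) hr') (by
      have hcomm' := commutatorElement_eq_one_iff_mul_comm.1 hcomm
      have key : ∀ u u' : Γ, u * u' = u' * u → ∀ k l : ℕ,
          c ^ k * u * (c ^ l * u') = c ^ l * u' * (c ^ k * u) := by
        intro u u' hu k l
        have e1 : Commute u (c ^ l) := mem_center_iff.1 (pow_mem hccen l) u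
        have e2 : Commute u' (c ^ k) := mem_center_iff.1 (pow_mem hccen k) u'
        exact ((((Commute.refl _).pow_pow _ _).mul_right e2.symm).mul_left (e1.mul_right hu)).eq
      rintro ⟨i, j⟩ ⟨k, l⟩ b (rfl | rfl) b' (rfl | rfl)
      · exact key _ _ rfl _ _
      · exact key _ _ hcomm' _ _
      · exact key _ _ hcomm'.symm _ _
      · exact key _ _ rfl _ _) (by
      rintro ⟨i, j⟩ ⟨k, l⟩ hne b hb hb'
      by_cases hik : i = k
      · have hjl : j ≠ l := fun hjl => hne (by rw [hik, hjl])
        exact h.pow_mul_disjoint hN hr hf hc j l hjl r' b (hb _ (Set.mem_insert_of_mem _ rfl))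
          (hb' _ (Set.mem_insert_of_mem _ rfl))
      · exact h.pow_mul_disjoint hN hr hf hc i k hik r b (hb _ (Set.mem_insert _ _))
          (hb' _ (Set.mem_insert _ _)))
  have h5 : d ≤ Nat.card (fx A {r, r'}) := (h.le_card_fx 1 e).trans
    (Nat.card_le_card_of_injective _ (AddSubgroup.inclusion_injective hL))
  have h6 := (Nat.pow_le_pow_left h5 _).trans h4
  rw [h.card] at h6
  have h7 := (Nat.pow_le_pow_iff_right h.one_lt).1 h6
  simp at h7

end Tri
end OrderThree

namespace OrderThree
open Subgroup
open scoped commutatorElement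

namespace Tri
variable {Γ : Type*} [Group Γ] [Finite Γ] {A : Type*} [AddCommGroup A] [Finite A]
  [DistribMulAction Γ A] [FaithfulSMul Γ A] {x y z : Γ} {d : ℕ} {N : Subgroup Γ}

theorem fx_commutator_eq (h : Tri A x y z d) (hN : Core A 3 N) {e : Γ} (he : e ∈ N)
    (hxe : ⁅x, e⁆ ≠ 1) : fx A {1 * x * 1⁻¹, e * x * e⁻¹} = fx A {⁅x, e⁆} ∧
      Nat.card (fx A {⁅x, e⁆}) = d := by
  obtain ⟨a, ha, hxa, hea⟩ := h.exists_ne_zero e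
  have hr := commutator_mem hN x he
  obtain ⟨f, hf, hc⟩ := h.exists_commutator_ne_one hN hr hxe ha (commutator_smul x e hxa hea)
  have h1 : Nat.card (fx A {⁅x, e⁆}) ≤ d :=
    (Nat.pow_le_pow_iff_left (by norm_num)).1 (h.card_fx_pow hN hr hf hc)
  have h2 := h.le_card_fx 1 e
  exact ⟨AddSubgroup.eq_of_le_of_card_ge (fx_pair_le x e) (h1.trans h2),
    le_antisymm h1 (h.le_card_fx_commutator e)⟩

theorem eq_zero_of_three (hN : Core A 3 N) {a : A} (ha : 3 • a = 0) : a = 0 := by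
  have h4 : addOrderOf a ∣ 3 := addOrderOf_dvd_of_nsmul_eq_zero ha
  exact AddMonoid.addOrderOf_eq_one_iff.1
    (Nat.eq_one_of_dvd_coprimes hN.cop h4 (addOrderOf_dvd_natCard a))

theorem sum_eq_zero_of_center (h : Tri A x y z d) {c : Γ} (hc : c ∈ center Γ) (hc3 : c ^ 3 = 1)
    (hc1 : c ≠ 1) (a : A) : a + c • a + c • c • a = 0 := by
  by_contra hne
  refine hc1 (h.eq_one_of_center hc hne ?_)
  have h1 : c • c • c • a = a := by
    rw [← mul_smul, ← mul_smul]
    have : c * (c * c) = 1 := by rw [← hc3]; simp only [pow_succ, pow_zero]; group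
    rw [← mul_assoc] at this
    rw [mul_assoc] at this ⊢
    rw [this, one_smul]
  rw [smul_add, smul_add, h1]
  abel

theorem center_unique (h : Tri A x y z d) (hN : Core A 3 N) {c c' : Γ} (hc : c ∈ center Γ)
    (hc3 : c ^ 3 = 1) (hc1 : c ≠ 1) (hc' : c' ∈ center Γ) (hc3' : c' ^ 3 = 1) :
    ∃ i : ℕ, c' = c ^ i := by
  by_cases hc1' : c' = 1
  · exact ⟨0, by simpa using hc1'⟩
  by_cases h1 : c * c' = 1
  · refine ⟨2, ?_⟩
    rw [eq_inv_of_mul_eq_one_right h1]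
    exact inv_eq_of_mul_eq_one_right (by rw [← hc3]; simp only [pow_succ, pow_zero]; group)
  by_cases h2 : c * (c' * c') = 1
  · refine ⟨1, ?_⟩
    have h3 : c' * (c' * c') = 1 := by rw [← hc3']; simp only [pow_succ, pow_zero]; group
    rw [pow_one]
    exact mul_right_cancel (h3.trans h2.symm)
  exfalso
  have hcc : ∀ g, c * g = g * c := fun g => (mem_center_iff.1 hc g).symm
  have hcc' : ∀ g, c' * g = g * c' := fun g => (mem_center_iff.1 hc' g).symm
  have hcm : Commute c c' := hcc c'
  have key : ∀ a : A, a = 0 := by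
    intro a
    have e1 := h.sum_eq_zero_of_center hc hc3 hc1 a
    have e2 := h.sum_eq_zero_of_center hc' hc3' hc1' a
    have e3 := h.sum_eq_zero_of_center (mul_mem hc hc')
      (by rw [hcm.mul_pow, hc3, hc3', one_mul]) h1 a
    have e4 := h.sum_eq_zero_of_center (mul_mem hc (mul_mem hc' hc'))
      (by rw [(hcm.mul_right hcm).mul_pow, (Commute.refl c').mul_pow, hc3, hc3', one_mul, one_mul]) h2 a
    have e5 := h.sum_eq_zero_of_center hc hc3 hc1 (c' • a)
    have e6 := h.sum_eq_zero_of_center hc hc3 hc1 (c' • c' • a)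
    have s1 : ∀ b : A, c' • c • b = c • c' • b := fun b => by
      rw [← mul_smul, ← mul_smul, hcm.eq]
    have s2 : ∀ b : A, c' • c' • c' • b = b := fun b => by
      rw [← mul_smul, ← mul_smul, ← pow_two, ← pow_succ, hc3', one_smul]
    simp only [mul_smul, s1, s2] at e3 e4
    refine eq_zero_of_three hN ?_
    have : 3 • a = (a + c • a + c • c • a) + (a + c' • a + c' • c' • a) +
        (a + c • c' • a + c • c • c' • c' • a) + (a + c • c' • c' • a + c • c • c' • a) -
        (a + c • a + c • c • a) - (c' • a + c • c' • a + c • c • c' • a) -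
        (c' • c' • a + c • c' • c' • a + c • c • c' • c' • a) := by abel
    rw [this, e1, e2, e5, e6, e3, e4]; simp
  obtain ⟨a, ha, -⟩ := h.exists_ne_zero 1
  exact ha (key a)

theorem commutator_eq_pow (h : Tri A x y z d) (hN : Core A 3 N) {c : Γ} (hc : c ∈ center Γ)
    (hc3 : c ^ 3 = 1) (hc1 : c ≠ 1) {g g' : Γ} (hg : g ∈ N) (hg' : g' ∈ N) :
    ∃ i : ℕ, ⁅g, g'⁆ = c ^ i :=
  h.center_unique hN hc hc3 hc1 (hN.der g hg g' hg') (commutator_pow_eq_one hN hg hg')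

/-- An element of `N` acting trivially on the fixed points of `⁅x, e⁆` is a power of `⁅x, e⁆`. -/
theorem eq_pow_of_fx (h : Tri A x y z d) (hN : Core A 3 N) {e : Γ} (he : e ∈ N)
    (hxe : ⁅x, e⁆ ≠ 1) {s : Γ} (hs : s ∈ N) (hsa : ∀ a : A, ⁅x, e⁆ • a = a → s • a = a) :
    ∃ i : ℕ, s = ⁅x, e⁆ ^ i := by
  obtain ⟨a, ha, hxa, hea⟩ := h.exists_ne_zero e
  have hra := commutator_smul x e hxa hea
  have hr := commutator_mem hN x he
  have hcard := (h.fx_commutator_eq hN he hxe).2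
  set r := ⁅x, e⁆
  obtain ⟨f, hf, hc⟩ := h.exists_commutator_ne_one hN hr hxe ha hra
  have hr3 := h.pow_eq_one hN hr ha hra
  have hcen := hN.der r hr f hf
  have hc3 := commutator_pow_eq_one hN hr hf
  obtain ⟨i, hi⟩ := h.commutator_eq_pow hN hcen hc3 hc hs hf
  refine ⟨i, ?_⟩
  have hs' : ⁅s * r ^ (2 * i), f⁆ = 1 := by
    have h1 : ⁅r ^ (2 * i), f⁆ ∈ center Γ := hN.der _ (pow_mem hr _) f hf
    rw [commutator_mul_left_of_center h1, commutator_pow_left_of_center hcen, hi, ← pow_add]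
    have : i + 2 * i = 3 * i := by ring
    rw [this, pow_mul, hc3, one_pow]
  have hfix : ∀ a : A, r • a = a → (s * r ^ (2 * i)) • a = a := by
    intro a hra
    have h1 : ∀ n : ℕ, r ^ n • a = a := fun n => by
      induction n with
      | zero => simp
      | succ n ih => rw [pow_succ, mul_smul, hra, ih]
    rw [mul_smul, h1, hsa a hra]
  have hone : s * r ^ (2 * i) = 1 := by
    refine FaithfulSMul.eq_of_smul_eq_smul (α := A) fun b => ?_
    rw [one_smul]
    obtain ⟨w, hw, rfl⟩ := exists_sum_of_independent (h.pow_mul_independent hN hr hf hc) (by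
      rw [Finset.prod_congr rfl fun (i : Fin 3) _ => card_fx_pow_mul hN hr hf (i : ℕ),
        Finset.prod_const, Finset.card_univ, Fintype.card_fin, hcard, h.card]) b
    rw [Finset.smul_sum]
    refine Finset.sum_congr rfl fun j _ => ?_
    have h1 : r • (f ^ (j : ℕ) • w j) = f ^ (j : ℕ) • w j := by
      have h2 := mem_fx_singleton.1 (hw j)
      rw [← conj_pow_of_center hcen, mul_smul, mul_smul, inv_smul_eq_iff] at h2
      exact h2
    have h3 := hfix _ h1
    have h4 : Commute (s * r ^ (2 * i)) (f ^ (j : ℕ)) :=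
      (show Commute _ f from commutatorElement_eq_one_iff_mul_comm.1 hs').pow_right _
    rw [← mul_smul, h4.eq, mul_smul] at h3
    exact smul_left_cancel _ h3
  have h5 : s * r ^ (2 * i) * r ^ i = r ^ i := by rw [hone, one_mul]
  rw [mul_assoc, ← pow_add, show 2 * i + i = 3 * i by ring, pow_mul, hr3, one_pow, mul_one] at h5
  exact h5

theorem commute_conj (h : Tri A x y z d) (hN : Core A 3 N) {e : Γ} (he : e ∈ N) :
    Commute x (e * x * e⁻¹) := by
  by_cases hxe : ⁅x, e⁆ = 1
  · have h1 := commutatorElement_eq_one_iff_mul_comm.1 hxe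
    rw [← h1, mul_inv_cancel_right]
  have hr := commutator_mem hN x he
  obtain ⟨a, ha, hxa, hea⟩ := h.exists_ne_zero e
  have hr3 := h.pow_eq_one hN hr ha (commutator_smul x e hxa hea)
  obtain ⟨i, hi⟩ := h.eq_pow_of_fx hN he hxe (hN.normal.conj_mem _ hr x) fun a ha => by
    have h1 : a ∈ fx A {1 * x * 1⁻¹, e * x * e⁻¹} := by
      rw [(h.fx_commutator_eq hN he hxe).1, mem_fx_singleton]; exact ha
    exact conj_commutator_smul x e (smul_mem_pair e h1) (h1 _ (Set.mem_insert_of_mem _ rfl))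
  set r := ⁅x, e⁆ with hrdef
  rw [pow_eq_pow_mod i hr3] at hi
  have hi3 : i % 3 < 3 := Nat.mod_lt _ (by norm_num)
  have hr1 : r ≠ 1 := hxe
  interval_cases i % 3
  · rw [pow_zero, conj_eq_one_iff] at hi; exact (hr1 hi).elim
  · rw [pow_one] at hi; exact (h.commutator_pow_three hi).1
  · exfalso
    refine hr1 ?_
    have h1 : x * (x * (x * r * x⁻¹) * x⁻¹) * x⁻¹ = r := by
      have : x * (x * (x * r * x⁻¹) * x⁻¹) * x⁻¹ = x ^ 3 * r * (x ^ 3)⁻¹ := by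
        simp only [pow_succ, pow_zero]; group
      rw [this, h.cube]; group
    have h2 : ∀ n : ℕ, x * r ^ n * x⁻¹ = r ^ (2 * n) := fun n => by
      rw [← conj_pow, hi, ← pow_mul]
    rw [hi, h2, h2, pow_eq_pow_mod _ hr3] at h1
    norm_num at h1
    have h3 : r * r = r * 1 := by rw [← sq, h1, mul_one]
    exact mul_left_cancel h3

theorem sup_fx (h : Tri A x y z d) (hN : Core A 3 N) {e : Γ} (he : e ∈ N)
    (hxe : ⁅x, e⁆ ≠ 1) : fx A {x} ⊔ fx A {e * x * e⁻¹} = ⊤ := by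
  have h1 := h.fx_commutator_eq hN he hxe
  have h2 : fx A {x} ⊓ fx A {e * x * e⁻¹} = fx A {1 * x * 1⁻¹, e * x * e⁻¹} := by
    ext a; simp [mem_fx]
  have hd : 0 < d := by have := h.one_lt; omega
  have h3 : Nat.card (fx A {x} ⊓ fx A {e * x * e⁻¹} : AddSubgroup A) = d := by
    rw [h2, h1.1]; exact h1.2
  have h4 := AddSubgroup.relIndex_mul_index (H := fx A {e * x * e⁻¹})
    (K := fx A {x} ⊔ fx A {e * x * e⁻¹}) le_sup_right
  rw [AddSubgroup.relIndex_sup_right, h.index e] at h4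
  have h5 := AddSubgroup.card_mul_index ((fx A {e * x * e⁻¹}).addSubgroupOf (fx A {x}))
  have h6 : Nat.card ((fx A {e * x * e⁻¹}).addSubgroupOf (fx A {x})) = d := by
    rw [← AddSubgroup.inf_addSubgroupOf_left, ← h3]
    exact Nat.card_congr (AddSubgroup.addSubgroupOfEquivOfLe inf_le_left).toEquiv
  rw [h6, h.fix, sq] at h5
  have h7 : (fx A {e * x * e⁻¹}).relIndex (fx A {x}) = d := Nat.eq_of_mul_eq_mul_left hd h5
  rw [h7] at h4
  exact AddSubgroup.index_eq_one.1 (Nat.eq_of_mul_eq_mul_left hd (by rw [h4, mul_one]))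

theorem smul_sub_mem (h : Tri A x y z d) (hN : Core A 3 N) {e : Γ} (he : e ∈ N)
    (hxe : ⁅x, e⁆ ≠ 1) (a : A) : (e * x * e⁻¹) • (x • a - a) = x • a - a := by
  have h1 : a ∈ fx A {x} ⊔ fx A {e * x * e⁻¹} := h.sup_fx hN he hxe ▸ AddSubgroup.mem_top a
  obtain ⟨v, hv, w, hw, rfl⟩ := AddSubgroup.mem_sup.1 h1
  rw [mem_fx_singleton] at hv hw
  rw [smul_add, hv, add_sub_add_left_eq_sub, smul_sub, ← mul_smul, ← (h.commute_conj hN he).eq,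
    mul_smul, hw]

theorem conj_smul_sub_mem (h : Tri A x y z d) (hN : Core A 3 N) {e e' : Γ} (he : e ∈ N)
    (he' : e' ∈ N) (hne : e * x * e⁻¹ ≠ e' * x * e'⁻¹) (a : A) :
    (e' * x * e'⁻¹) • ((e * x * e⁻¹) • a - a) = (e * x * e⁻¹) • a - a := by
  have h1 : ⁅x, e⁻¹ * e'⁆ ≠ 1 := by
    intro h0
    have h2 := commutatorElement_eq_one_iff_mul_comm.1 h0
    refine hne ?_
    have h3 : e' * x * e'⁻¹ = e * ((e⁻¹ * e') * x) * e'⁻¹ := by group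
    rw [h3, ← h2]; group
  have h4 := h.smul_sub_mem hN (mul_mem (inv_mem he) he') h1 (e⁻¹ • a)
  have h5 : (e * x * e⁻¹) • a - a = e • (x • e⁻¹ • a - e⁻¹ • a) := by
    rw [smul_sub, mul_smul, mul_smul, smul_inv_smul]
  rw [h5, ← mul_smul]
  have h6 : e' * x * e'⁻¹ * e = e * ((e⁻¹ * e') * x * (e⁻¹ * e')⁻¹) := by group
  rw [h6, mul_smul, h4]

theorem card_conj_le_three (h : Tri A x y z d) (hN : Core A 3 N) :
    Nat.card {w : Γ // ∃ n ∈ N, w = n * x * n⁻¹} ≤ 3 := by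
  classical
  have := Fintype.ofFinite {w : Γ // ∃ n ∈ N, w = n * x * n⁻¹}
  let D : Γ → A →+ A := fun g => DistribSMul.toAddMonoidHom A g - AddMonoidHom.id A
  have hD : ∀ g a, D g a = g • a - a := fun g a => rfl
  have hker : ∀ g, (D g).ker = fx A {g} := fun g => by
    ext a; rw [AddMonoidHom.mem_ker, hD, sub_eq_zero, mem_fx_singleton]
  have hcard : ∀ w : {w : Γ // ∃ n ∈ N, w = n * x * n⁻¹}, Nat.card (D w.1).range = d := by
    rintro ⟨_, n, hn, rfl⟩
    rw [← AddSubgroup.index_ker, hker]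
    exact h.index n
  have h1 := prod_card_le_of_independent
    (V := fun w : {w : Γ // ∃ n ∈ N, w = n * x * n⁻¹} => (D w.1).range) (by
    intro a ha hsum w
    have hfix : ∀ u v : {w : Γ // ∃ n ∈ N, w = n * x * n⁻¹}, u ≠ v → v.1 • a u = a u := by
      rintro ⟨_, n, hn, rfl⟩ ⟨_, n', hn', rfl⟩ hne
      obtain ⟨b, hb⟩ := ha ⟨_, n, hn, rfl⟩
      rw [← hb]
      exact h.conj_smul_sub_mem hN hn hn' (fun h0 => hne (Subtype.ext h0)) b
    have hself : w.1 • a w = a w := by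
      rw [← Finset.add_sum_erase _ _ (Finset.mem_univ w)] at hsum
      rw [eq_neg_of_add_eq_zero_left hsum, smul_neg, Finset.smul_sum]
      congr 1
      exact Finset.sum_congr rfl fun u hu => hfix u w (Finset.mem_erase.1 hu).1
    obtain ⟨b, hb⟩ := ha w
    refine eq_zero_of_three hN ?_
    have hw3 : w.1 * w.1 * w.1 = 1 := by
      obtain ⟨_, n, hn, rfl⟩ := w
      have : n * x * n⁻¹ * (n * x * n⁻¹) * (n * x * n⁻¹) = n * x ^ 3 * n⁻¹ := by
        simp only [pow_succ, pow_zero]; group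
      rw [this, h.cube]; group
    rw [hD] at hb
    have e2 : w.1 • w.1 • b - w.1 • b = a w := by rw [← smul_sub, hb, hself]
    have e3 : w.1 • w.1 • w.1 • b - w.1 • w.1 • b = a w := by rw [← smul_sub, e2, hself]
    rw [← mul_smul, ← mul_smul, hw3, one_smul] at e3
    have : 3 • a w = a w + a w + a w := by abel
    rw [this]
    nth_rewrite 1 [← hb]
    nth_rewrite 1 [← e2]
    rw [← e3]
    abel)
  rw [Finset.prod_congr rfl fun w _ => hcard w, Finset.prod_const, Finset.card_univ, h.card] at h1
  rw [Nat.card_eq_fintype_card]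
  exact (Nat.pow_le_pow_iff_right h.one_lt).1 h1

end Tri
end OrderThree

namespace OrderThree
open Subgroup
open scoped commutatorElement

namespace Core
variable {Γ : Type*} [Group Γ] {A : Type*} [AddCommGroup A] {q : ℕ} {N : Subgroup Γ}

theorem commutator_mul (hN : Core A q N) {a b f : Γ} (hb : b ∈ N) (hf : f ∈ N) :
    ⁅a * b, f⁆ = ⁅a, f⁆ * ⁅b, f⁆ := commutator_mul_left_of_center (hN.der b hb f hf)

theorem commutator_pow (hN : Core A q N) {a f : Γ} (ha : a ∈ N) (hf : f ∈ N) (n : ℕ) :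
    ⁅a ^ n, f⁆ = ⁅a, f⁆ ^ n := commutator_pow_left_of_center (hN.der a ha f hf) n

theorem commutator_pow_mul_pow (hN : Core A q N) {a b f : Γ} (ha : a ∈ N) (hb : b ∈ N)
    (hf : f ∈ N) (i j : ℕ) : ⁅a ^ i * b ^ j, f⁆ = ⁅a, f⁆ ^ i * ⁅b, f⁆ ^ j := by
  rw [hN.commutator_mul (pow_mem hb j) hf, hN.commutator_pow ha hf, hN.commutator_pow hb hf]

theorem commutator_four (hN : Core A q N) {a b n m f : Γ} (ha : a ∈ N) (hb : b ∈ N) (hn : n ∈ N)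
    (hm : m ∈ N) (hf : f ∈ N) (i j k l : ℕ) :
    ⁅a ^ i * b ^ j * (n ^ k * m ^ l), f⁆ = ⁅a, f⁆ ^ i * ⁅b, f⁆ ^ j * (⁅n, f⁆ ^ k * ⁅m, f⁆ ^ l) := by
  rw [hN.commutator_mul (mul_mem (pow_mem hn k) (pow_mem hm l)) hf,
    hN.commutator_pow_mul_pow ha hb hf, hN.commutator_pow_mul_pow hn hm hf]

theorem eq_of_pow_eq {u : Γ} (hu : orderOf u = 3) {i j : Fin 3} (h : u ^ (i : ℕ) = u ^ (j : ℕ)) :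
    i = j := by
  rw [pow_inj_mod, hu] at h
  exact Fin.ext (by omega)

end Core

namespace Tri
variable {Γ : Type*} [Group Γ] [Finite Γ] {A : Type*} [AddCommGroup A] [Finite A]
  [DistribMulAction Γ A] [FaithfulSMul Γ A] {x y z : Γ} {d : ℕ} {N : Subgroup Γ}

theorem card_conj_conj_le_three (h : Tri A x y z d) (hN : Core A 3 N) (g : Γ) :
    Nat.card {w : Γ // ∃ n ∈ N, w = n * (g * x * g⁻¹) * n⁻¹} ≤ 3 := by
  refine le_trans ?_ (h.card_conj_le_three hN)
  have := hN.normal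
  refine Nat.card_le_card_of_injective (fun w => ⟨g⁻¹ * w.1 * g, ?_⟩) fun w w' hw => ?_
  · obtain ⟨n, hn, hw⟩ := w.2
    refine ⟨g⁻¹ * n * g, by simpa using this.conj_mem n hn g⁻¹, ?_⟩
    rw [hw]; group
  · simpa [Subtype.ext_iff] using hw

theorem card_le (h : Tri A x y z d) (hN : Core A 3 N) {ι : Type*} [Fintype ι] (e : ι → Γ)
    (he : ∀ i, e i ∈ N) (hinj : ∀ i j, ∀ u ∈ center Γ, e i = e j * u → i = j) :
    Fintype.card ι ≤ 27 := by
  obtain ⟨k, -, hy⟩ := h.conn.two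
  obtain ⟨l, -, hz⟩ := h.conn.three
  have h1 := h.card_conj_conj_le_three hN 1
  have h2 := h.card_conj_conj_le_three hN k
  have h3 := h.card_conj_conj_le_three hN l
  rw [← hy] at h2
  rw [← hz] at h3
  simp only [one_mul, inv_one, mul_one] at h1
  let W : Γ → Type _ := fun w => {v : Γ // ∃ n ∈ N, v = n * w * n⁻¹}
  have h4 : Nat.card (W x × W y × W z) ≤ 27 := by
    rw [Nat.card_prod, Nat.card_prod]
    calc _ ≤ 3 * (3 * 3) := Nat.mul_le_mul h1 (Nat.mul_le_mul h2 h3)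
      _ = 27 := rfl
  rw [← Nat.card_eq_fintype_card]
  refine le_trans (Nat.card_le_card_of_injective
    (fun i => ((⟨_, e i, he i, rfl⟩, ⟨_, e i, he i, rfl⟩, ⟨_, e i, he i, rfl⟩) : W x × W y × W z))
    fun i j hij => ?_) h4
  simp only [Prod.mk.injEq] at hij
  refine hinj i j ((e j)⁻¹ * e i) ?_ (by group)
  have key : ∀ w, e i * w * (e i)⁻¹ = e j * w * (e j)⁻¹ → w ∈ centralizer {(e j)⁻¹ * e i} := by
    intro w hw
    rw [mem_centralizer_singleton_iff]
    calc w * ((e j)⁻¹ * e i) = (e j)⁻¹ * (e j * w * (e j)⁻¹) * e i := by group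
      _ = (e j)⁻¹ * e i * w := by rw [← hw]; group
  have htop : (⊤ : Subgroup Γ) ≤ centralizer {(e j)⁻¹ * e i} := by
    rw [h.conn.eq, closure_le]
    rintro w (rfl | rfl | rfl)
    · exact key _ (congrArg Subtype.val hij.1)
    · exact key _ (congrArg Subtype.val hij.2.1)
    · exact key _ (congrArg Subtype.val hij.2.2)
  rw [mem_center_iff]
  exact fun g => mem_centralizer_singleton_iff.1 (htop (mem_top g))

theorem mem_center_of_commute_pair (h : Tri A x y z d) (hN : Core A 3 N) {a b : Γ} (ha : a ∈ N)
    (hb : b ∈ N) (hab : ⁅a, b⁆ ≠ 1) {n : Γ} (hn : n ∈ N) (hna : ⁅n, a⁆ = 1) (hnb : ⁅n, b⁆ = 1) :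
    n ∈ center Γ := by
  by_contra hnc
  obtain ⟨m, hm, hnm⟩ : ∃ m ∈ N, ⁅n, m⁆ ≠ 1 := by
    by_contra! hcon
    exact hnc (hN.cent n hn hcon)
  have hc := hN.der a ha b hb
  have hc3 := commutator_pow_eq_one hN ha hb
  obtain ⟨k, hk⟩ := h.commutator_eq_pow hN hc hc3 hab hm hb
  obtain ⟨l, hl⟩ := h.commutator_eq_pow hN hc hc3 hab hm ha
  have hba : ⁅b, a⁆ = ⁅a, b⁆⁻¹ := (commutatorElement_inv a b).symm
  set m' := m * (a ^ (2 * k) * b ^ l) with hm'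
  have hpow : a ^ (2 * k) * b ^ l ∈ N := mul_mem (pow_mem ha _) (pow_mem hb _)
  have hmN : m' ∈ N := mul_mem hm hpow
  have hmb : ⁅m', b⁆ = 1 := by
    rw [hm', hN.commutator_mul hpow hb, hN.commutator_pow_mul_pow ha hb hb, hk,
      commutatorElement_self, one_pow, mul_one, ← pow_add, show k + 2 * k = 3 * k by ring, pow_mul,
      hc3, one_pow]
  have hma : ⁅m', a⁆ = 1 := by
    rw [hm', hN.commutator_mul hpow ha, hN.commutator_pow_mul_pow ha hb ha, hl,
      commutatorElement_self, one_pow, one_mul, hba, inv_pow, mul_inv_cancel]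
  have hna' : ⁅a, n⁆ = 1 := by rw [← commutatorElement_inv, hna, inv_one]
  have hnb' : ⁅b, n⁆ = 1 := by rw [← commutatorElement_inv, hnb, inv_one]
  have hnm' : ⁅n, m'⁆ ≠ 1 := by
    rw [← inv_ne_one, commutatorElement_inv, hm', hN.commutator_mul hpow hn,
      hN.commutator_pow_mul_pow ha hb hn, hna', hnb', one_pow, one_pow, mul_one, mul_one,
      ← commutatorElement_inv, inv_ne_one]
    exact hnm
  have hmn' : ⁅m', n⁆ ≠ 1 := by rwa [← commutatorElement_inv, inv_ne_one]
  have hma' : ⁅a, m'⁆ = 1 := by rw [← commutatorElement_inv, hma, inv_one]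
  have hmb' : ⁅b, m'⁆ = 1 := by rw [← commutatorElement_inv, hmb, inv_one]
  have hba' : ⁅b, a⁆ ≠ 1 := by rw [hba, inv_ne_one]; exact hab
  have hle := h.card_le hN (ι := Fin 3 × Fin 3 × Fin 3 × Fin 3)
    (fun i => a ^ (i.1 : ℕ) * b ^ (i.2.1 : ℕ) * (n ^ (i.2.2.1 : ℕ) * m' ^ (i.2.2.2 : ℕ)))
    (fun i => mul_mem (mul_mem (pow_mem ha _) (pow_mem hb _))
      (mul_mem (pow_mem hn _) (pow_mem hmN _))) ?_
  · simp at hle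
  rintro ⟨i, j, k, l⟩ ⟨i', j', k', l'⟩ u hu heq
  have key : ∀ f ∈ N, ⁅a, f⁆ ^ (i : ℕ) * ⁅b, f⁆ ^ (j : ℕ) * (⁅n, f⁆ ^ (k : ℕ) * ⁅m', f⁆ ^ (l : ℕ)) =
      ⁅a, f⁆ ^ (i' : ℕ) * ⁅b, f⁆ ^ (j' : ℕ) * (⁅n, f⁆ ^ (k' : ℕ) * ⁅m', f⁆ ^ (l' : ℕ)) := by
    intro f hf
    have h1 : ⁅u, f⁆ = 1 := commutator_eq_one_of_center hu f
    have h2 := congrArg (⁅·, f⁆) heq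
    simp only at h2
    rw [commutator_mul_left_of_center (b := u) (by rw [h1]; exact one_mem _), h1, mul_one,
      hN.commutator_four ha hb hn hmN hf, hN.commutator_four ha hb hn hmN hf] at h2
    exact h2
  have e1 := key b hb
  have e2 := key a ha
  have e3 := key m' hmN
  have e4 := key n hn
  simp only [commutatorElement_self, hna, hnb, hma, hmb, hna', hnb', hma', hmb', one_pow, mul_one,
    one_mul] at e1 e2 e3 e4
  have h1 := Core.eq_of_pow_eq (orderOf_commutator hN ha hb hab) e1
  have h2 := Core.eq_of_pow_eq (orderOf_commutator hN hb ha hba') e2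
  have h3 := Core.eq_of_pow_eq (orderOf_commutator hN hn hmN hnm') e3
  have h4 := Core.eq_of_pow_eq (orderOf_commutator hN hmN hn hmn') e4
  rw [h1, h2, h3, h4]

theorem exists_mul_pow_mem_center (h : Tri A x y z d) (hN : Core A 3 N) {a b : Γ} (ha : a ∈ N)
    (hb : b ∈ N) (hab : ⁅a, b⁆ ≠ 1) {n : Γ} (hn : n ∈ N) :
    ∃ i j : ℕ, ∃ u ∈ center Γ, n = u * (a ^ i * b ^ j) := by
  have hc := hN.der a ha b hb
  have hc3 := commutator_pow_eq_one hN ha hb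
  obtain ⟨k, hk⟩ := h.commutator_eq_pow hN hc hc3 hab hn hb
  obtain ⟨l, hl⟩ := h.commutator_eq_pow hN hc hc3 hab hn ha
  have hba : ⁅b, a⁆ = ⁅a, b⁆⁻¹ := (commutatorElement_inv a b).symm
  have hpow : a ^ k * b ^ (2 * l) ∈ N := mul_mem (pow_mem ha _) (pow_mem hb _)
  have h1 : ∀ f ∈ N, ⁅n, f⁆ = ⁅a ^ k * b ^ (2 * l), f⁆ → ⁅n * (a ^ k * b ^ (2 * l))⁻¹, f⁆ = 1 := by
    intro f hf hnf
    have h2 : ⁅n, f⁆ = ⁅n * (a ^ k * b ^ (2 * l))⁻¹ * (a ^ k * b ^ (2 * l)), f⁆ := by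
      rw [inv_mul_cancel_right]
    rw [hN.commutator_mul hpow hf, hnf, right_eq_mul] at h2
    exact h2
  refine ⟨k, 2 * l, n * (a ^ k * b ^ (2 * l))⁻¹, h.mem_center_of_commute_pair hN ha hb hab
    (mul_mem hn (inv_mem hpow)) (h1 a ha ?_) (h1 b hb ?_), by group⟩
  · rw [hN.commutator_pow_mul_pow ha hb ha, hl, hba, commutatorElement_self, one_pow, one_mul,
      inv_pow, eq_inv_iff_mul_eq_one, ← pow_add, show l + 2 * l = 3 * l by ring, pow_mul, hc3,
      one_pow]
  · rw [hN.commutator_pow_mul_pow ha hb hb, hk, commutatorElement_self, one_pow, mul_one]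

end Tri

end OrderThree

namespace OrderThree
open Subgroup
open scoped commutatorElement

open Classical in
/-- The discrete logarithm to a base of order three. -/
noncomputable def dlog {Γ : Type*} [Group Γ] (c u : Γ) : ZMod 3 :=
  if u = 1 then 0 else if u = c then 1 else 2

theorem dlog_pow {Γ : Type*} [Group Γ] {c : Γ} (hc : orderOf c = 3) (k : ℕ) : dlog c (c ^ k) = k := by
  have h1 : c ^ k = c ^ (k % 3) := by rw [← hc, pow_mod_orderOf]
  have h2 : (k : ZMod 3) = ((k % 3 : ℕ) : ZMod 3) := by simp
  have hc1 : c ≠ 1 := by rintro rfl; simp at hc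
  have hc2 : c ^ 2 ≠ 1 := fun h => by
    have := orderOf_dvd_of_pow_eq_one h
    rw [hc] at this
    omega
  have hc3 : c ^ 2 ≠ c := fun h => hc1 (by rwa [pow_two, mul_eq_left] at h)
  rw [h1, h2]
  have h3 : k % 3 < 3 := Nat.mod_lt _ (by norm_num)
  generalize k % 3 = r at h3
  unfold dlog
  interval_cases r
  · simp
  · simp [hc1]
  · simp [hc2, hc3]

theorem eq_one_of_dlog {Γ : Type*} [Group Γ] {c u : Γ} (h : dlog c u = 0) : u = 1 := by
  unfold dlog at h
  split_ifs at h with h1 h2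
  · exact h1
  · exact absurd h (by decide)
  · exact absurd h (by decide)

namespace Tri
variable {Γ : Type*} [Group Γ] [Finite Γ] {A : Type*} [AddCommGroup A] [Finite A]
  [DistribMulAction Γ A] [FaithfulSMul Γ A] {x y z : Γ} {d : ℕ} {N : Subgroup Γ}

theorem exists_coordinates (h : Tri A x y z d) (hN : Core A 3 N) :
    ∃ (v : Γ → Fin 2 → ZMod 3) (e : Fin 2 → Γ), (∀ a ∈ N, ∀ b ∈ N, v (a * b) = v a + v b) ∧
      (∀ n ∈ N, v n = 0 → n ∈ center Γ) ∧ (∀ i, e i ∈ N) ∧ (∀ i, v (e i) = Pi.single i 1) ∧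
      (∀ u ∈ center Γ, ∀ n, v (u * n) = v n) ∧
      ∀ n ∈ N, ∃ i j : ℕ, ∃ u ∈ center Γ, n = u * (e 0 ^ i * e 1 ^ j) := by
  obtain ⟨a, ha, b, hb, hab⟩ : ∃ a ∈ N, ∃ b ∈ N, ⁅a, b⁆ ≠ 1 := by
    by_contra! hcon
    exact hN.ne fun a ha => hN.cent a ha fun b hb => hcon a ha b hb
  have hc := hN.der a ha b hb
  have hc3 := commutator_pow_eq_one hN ha hb
  have hord := orderOf_commutator hN ha hb hab
  have hL : ∀ f ∈ N, ∀ n ∈ N, ∀ m ∈ N,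
      dlog ⁅a, b⁆ ⁅n * m, f⁆ = dlog ⁅a, b⁆ ⁅n, f⁆ + dlog ⁅a, b⁆ ⁅m, f⁆ := by
    intro f hf n hn m hm
    obtain ⟨k, hk⟩ := h.commutator_eq_pow hN hc hc3 hab hn hf
    obtain ⟨l, hl⟩ := h.commutator_eq_pow hN hc hc3 hab hm hf
    rw [hN.commutator_mul hm hf, hk, hl, ← pow_add, dlog_pow hord, dlog_pow hord, dlog_pow hord,
      Nat.cast_add]
  have hba : ⁅b, a⁆ = ⁅a, b⁆ ^ 2 := by
    rw [← commutatorElement_inv, inv_eq_iff_mul_eq_one, ← pow_succ']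
    exact hc3
  refine ⟨fun n => ![dlog ⁅a, b⁆ ⁅n, b⁆, - dlog ⁅a, b⁆ ⁅n, a⁆], ![a, b], fun n hn m hm => ?_,
    fun n hn hv => ?_, fun i => ?_, fun i => ?_, fun u hu n => ?_, fun n hn => ?_⟩
  · simp only [hL b hb n hn m hm, hL a ha n hn m hm, Matrix.cons_add_cons, neg_add,
      Matrix.empty_add_empty]
  · have h0 := congrFun hv 0
    have h1 := congrFun hv 1
    simp at h0 h1
    exact h.mem_center_of_commute_pair hN ha hb hab hn (eq_one_of_dlog h1) (eq_one_of_dlog h0)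
  · fin_cases i <;> simp [ha, hb]
  · have d0 : dlog ⁅a, b⁆ 1 = 0 := by simpa using dlog_pow hord 0
    have d1 : dlog ⁅a, b⁆ ⁅a, b⁆ = 1 := by simpa using dlog_pow hord 1
    have d2 : dlog ⁅a, b⁆ ⁅b, a⁆ = 2 := by rw [hba, dlog_pow hord]; rfl
    have d3 : (-2 : ZMod 3) = 1 := by decide
    fin_cases i <;> funext j <;> fin_cases j <;> simp [d0, d1, d2, d3]
  · have key : ∀ f, ⁅u * n, f⁆ = ⁅n, f⁆ := fun f => by
      have := mem_center_iff.1 hu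
      rw [commutatorElement_def, commutatorElement_def]
      calc u * n * f * (u * n)⁻¹ * f⁻¹ = u * (n * f * n⁻¹) * u⁻¹ * f⁻¹ := by group
        _ = _ := by rw [← this]; group
    exact congrArg₂ (fun s t : Γ => ![dlog ⁅a, b⁆ s, - dlog ⁅a, b⁆ t]) (key b) (key a)
  · exact h.exists_mul_pow_mem_center hN ha hb hab hn

theorem exists_representation (h : Tri A x y z d) (hN : Core A 3 N) :
    ∃ θ : Γ →* GL (Fin 2) (ZMod 3), ∀ g ∈ θ.ker, ∀ n ∈ N, ⁅g, n⁆ ∈ center Γ := by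
  obtain ⟨v, e, hadd, hker, he, hve, hcen, hdec⟩ := h.exists_coordinates hN
  have hnorm := hN.normal
  have hone : v 1 = 0 := by simpa using hadd 1 (one_mem _) 1 (one_mem _)
  have hpow : ∀ n ∈ N, ∀ k : ℕ, v (n ^ k) = k • v n := by
    intro n hn k
    induction k with
    | zero => simp [hone]
    | succ k ih => rw [pow_succ, hadd _ (pow_mem hn k) _ hn, ih, succ_nsmul]
  let M : Γ → Matrix (Fin 2) (Fin 2) (ZMod 3) := fun g => Matrix.of fun r s => v (g * e s * g⁻¹) r
  have hM : ∀ g, ∀ n ∈ N, v (g * n * g⁻¹) = (M g).mulVec (v n) := by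
    intro g n hn
    have hg : ∀ i, g * e i * g⁻¹ ∈ N := fun i => hnorm.conj_mem _ (he i) g
    obtain ⟨i, j, u, hu, rfl⟩ := hdec n hn
    have h1 : g * (u * (e 0 ^ i * e 1 ^ j)) * g⁻¹ =
        u * ((g * e 0 * g⁻¹) ^ i * (g * e 1 * g⁻¹) ^ j) := by
      rw [conj_pow, conj_pow, ← mul_assoc g u, mem_center_iff.1 hu g]
      group
    rw [h1, hcen u hu, hcen u hu, hadd _ (pow_mem (hg 0) i) _ (pow_mem (hg 1) j),
      hadd _ (pow_mem (he 0) i) _ (pow_mem (he 1) j), hpow _ (hg 0), hpow _ (hg 1),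
      hpow _ (he 0), hpow _ (he 1), hve, hve]
    funext r
    simp [M, Matrix.mulVec, dotProduct, Fin.sum_univ_two, mul_comm]
  have hM1 : M 1 = 1 := by
    ext r s
    simp [M, hve, Pi.single_apply, Matrix.one_apply]
  have hMmul : ∀ g g', M (g * g') = M g * M g' := by
    intro g g'
    ext r s
    have h1 : g * g' * e s * (g * g')⁻¹ = g * (g' * e s * g'⁻¹) * g⁻¹ := by group
    simp only [M, Matrix.of_apply, Matrix.mul_apply]
    rw [h1, hM g _ (hnorm.conj_mem _ (he s) g')]
    simp [Matrix.mulVec, dotProduct, M]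
  let θ : Γ →* Matrix (Fin 2) (Fin 2) (ZMod 3) := { toFun := M, map_one' := hM1, map_mul' := hMmul }
  refine ⟨θ.toHomUnits, fun g hg n hn => ?_⟩
  have hg1 : M g = 1 := by
    rw [MonoidHom.mem_ker] at hg
    have := congrArg Units.val hg
    exact this
  refine hker _ (by have := hnorm.conj_mem n hn g; exact mul_mem this (inv_mem hn)) ?_
  rw [commutatorElement_def, hadd _ (hnorm.conj_mem n hn g) _ (inv_mem hn), hM g n hn, hg1,
    Matrix.one_mulVec, ← hadd _ hn _ (inv_mem hn), mul_inv_cancel, hone]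

end Tri

end OrderThree

namespace OrderThree
open Subgroup
open scoped commutatorElement

theorem card_GL_two_three : Nat.card (GL (Fin 2) (ZMod 3)) = 48 := by
  have : Fact (Nat.Prime 3) := ⟨Nat.prime_three⟩
  rw [Matrix.card_GL_field]
  simp [Fin.prod_univ_two]

theorem gam_two_eq_bot {R : Type*} [Group R] [Finite R] [Group.IsSolvable R] {x y z : R}
    (h : Conn (⊤ : Subgroup R) x y z) (hx : x ^ 3 = 1) {k : ℕ} (hR : Nat.card R ∣ 3 * 2 ^ k) :
    gam 2 (⊤ : Subgroup R) = ⊥ := by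
  have hM : (nres (⊤ : Subgroup R)).Normal := by
    rw [← normalizer_eq_top_iff, ← top_le_iff]
    exact le_normalizer_gam 1 (normalizer_eq_top (⊤ : Subgroup R)).ge
  have h1 : (nres (⊤ : Subgroup R)).index ∣ 3 := by
    have h2 : zpowers x ⊔ nres ⊤ = ⊤ := top_le_iff.1 h.le_nres
    have h4 := relIndex_sup_right (H := zpowers x) (K := nres (⊤ : Subgroup R))
    rw [h2, relIndex_top_right] at h4
    rw [h4]
    exact ((relIndex_dvd_card _ _).trans (by rw [Nat.card_zpowers])).trans
      (orderOf_dvd_of_pow_eq_one hx)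
  rcases (Nat.dvd_prime Nat.prime_three).1 h1 with h3 | h3
  · rw [index_eq_one] at h3
    by_contra hne
    have htop : (⊤ : Subgroup R) ≠ ⊥ := by
      intro h0
      exact hne (eq_bot_iff.2 ((gam_le 2).trans h0.le))
    have : Group.IsSolvable (⊤ : Subgroup R) := inferInstance
    exact (nres_lt htop).ne h3
  · have h4 : Nat.card (nres (⊤ : Subgroup R)) ∣ 2 ^ k := by
      have h5 := card_mul_index (nres (⊤ : Subgroup R))
      rw [h3] at h5
      rw [← h5, mul_comm] at hR
      exact Nat.dvd_of_mul_dvd_mul_left (by norm_num) hR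
    obtain ⟨j, -, hj⟩ := (Nat.dvd_prime_pow Nat.prime_two).1 h4
    have : Fact (Nat.Prime 2) := ⟨Nat.prime_two⟩
    have h5 : IsPGroup 2 (nres (⊤ : Subgroup R)) := IsPGroup.of_card hj
    rw [gam_two]
    exact nres_eq_bot_iff.2 h5.isNilpotent

theorem Tri.exists_of_normal {Γ : Type*} [Group Γ] [Finite Γ] {A : Type*} [AddCommGroup A] [Finite A]
    [DistribMulAction Γ A] [FaithfulSMul Γ A] {x y z : Γ} {d : ℕ} [Group.IsSolvable Γ]
    (h : Tri A x y z d) {q : ℕ} (hq : q.Prime) {T S : Subgroup Γ} (hT : T.Normal) (hS : S.Normal)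
    (hTq : IsPGroup q T) (hTS : ⁅T, S⁆ = T) (hT1 : T ≠ ⊥) (hcop : q.Coprime (Nat.card A)) :
    q = 3 ∧ ¬ S ≤ gam 2 ⊤ ∧ 2 ∣ Nat.card Γ ∧ ∃ e ∈ T, e * x * e⁻¹ ≠ x ∧ Commute x (e * x * e⁻¹) ∧
      (∀ a : A, (e * x * e⁻¹) • (x • a - a) = x • a - a) ∧
      ∀ a : A, x • ((e * x * e⁻¹) • a - a) = (e * x * e⁻¹) • a - a := by
  obtain ⟨N, hNT, hN, hNS⟩ := h.exists_core hq hT hS hTq hTS hT1 hcop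
  obtain rfl : q = 3 := by
    have h1 := h.prime_le_three hN
    have h2 := h.prime_ne_two hN
    have h3 := hq.two_le
    omega
  obtain ⟨θ, hθ⟩ := h.exists_representation hN
  obtain ⟨s, hs, p, hp, hp3, hsp, hsθ⟩ :
      ∃ s ∈ S, ∃ p : ℕ, p.Prime ∧ 3 ≠ p ∧ IsPElt p s ∧ θ s ≠ 1 := by
    by_contra! hcon
    refine hN.ne ?_
    rw [← hNS, commutator_comm, commutator_le]
    have hle : closure {t | t ∈ S ∧ ∃ p : ℕ, p.Prime ∧ 3 ≠ p ∧ IsPElt p t} ≤ θ.ker := by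
      rw [closure_le]
      rintro t ⟨ht, p, hp, hp3, htp⟩
      exact hcon t ht p hp hp3 htp
    exact fun g hg n hn => hθ g (hle hg) n hn
  obtain ⟨k, hk⟩ := hsp
  have hord : orderOf (θ s) ∣ p ^ k := orderOf_dvd_of_pow_eq_one (by rw [← map_pow, hk, map_one])
  obtain ⟨j, -, hj⟩ := (Nat.dvd_prime_pow hp).1 hord
  have hj0 : j ≠ 0 := by
    rintro rfl
    exact hsθ (orderOf_eq_one_iff.1 (by rw [hj, pow_zero]))
  have hpd : p ∣ orderOf (θ s) := by rw [hj]; exact dvd_pow_self p hj0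
  have h48 : p ∣ 48 := hpd.trans (card_GL_two_three ▸ orderOf_dvd_natCard _)
  have hp2 : p = 2 := by
    rw [show 48 = 2 ^ 4 * 3 by norm_num, hp.dvd_mul] at h48
    rcases h48 with h1 | h1
    · exact (Nat.prime_dvd_prime_iff_eq hp Nat.prime_two).1 (hp.dvd_of_dvd_pow h1)
    · exact absurd ((Nat.prime_dvd_prime_iff_eq hp Nat.prime_three).1 h1).symm hp3
  subst hp2
  refine ⟨rfl, fun hle => hsθ ?_, ?_, ?_⟩
  · have h1 : Conn (⊤ : Subgroup θ.range) (θ.rangeRestrict x) (θ.rangeRestrict y)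
        (θ.rangeRestrict z) := by
      have h1 := h.conn.map θ.rangeRestrict
      rwa [map_top_of_surjective _ θ.rangeRestrict_surjective] at h1
    have hsol : Group.IsSolvable θ.range := Group.isSolvable_of_surjective θ.rangeRestrict_surjective
    have h2 := gam_two_eq_bot h1 (by rw [← map_pow, h.cube, map_one]) (k := 4)
      ((card_subgroup_dvd_card θ.range).trans (by rw [card_GL_two_three]; norm_num))
    rw [← map_top_of_surjective _ θ.rangeRestrict_surjective, ← map_gam] at h2
    have h3 := mem_map_of_mem θ.rangeRestrict (hle hs)
    rw [h2, mem_bot] at h3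
    exact congrArg Subtype.val h3
  · exact hpd.trans ((orderOf_map_dvd θ s).trans (orderOf_dvd_natCard s))
  · obtain ⟨e, he, hxe⟩ := h.exists_not_commute hN
    have hne : e * x * e⁻¹ ≠ x := by
      intro h0
      refine hxe (commutatorElement_eq_one_iff_mul_comm.2 ?_)
      rw [mul_inv_eq_iff_eq_mul] at h0
      exact h0.symm
    refine ⟨e, hNT he, hne, h.commute_conj hN he, h.smul_sub_mem hN he hxe, fun a => ?_⟩
    have := h.conj_smul_sub_mem hN he (one_mem N) (by simpa using hne) a
    simpa using this

end OrderThree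

namespace OrderThree
open Subgroup
open scoped commutatorElement

universe u

section
variable {G : Type*} [Group G] {H K : Subgroup G}

theorem Conn.subgroupOf {x y z : G} (h : Conn K x y z) (hK : K ≤ H) :
    Conn (K.subgroupOf H) (⟨x, hK h.mem₁⟩ : H) ⟨y, hK h.mem₂⟩ ⟨z, hK h.mem₃⟩ := by
  refine ⟨map_injective H.subtype_injective ?_, ?_, ?_⟩
  · rw [map_subgroupOf_eq_of_le hK, MonoidHom.map_closure, Set.image_insert_eq, Set.image_pair]
    exact h.eq
  · obtain ⟨k, hk, hy⟩ := h.two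
    exact ⟨⟨k, hK hk⟩, hk, Subtype.ext hy⟩
  · obtain ⟨k, hk, hz⟩ := h.three
    exact ⟨⟨k, hK hk⟩, hk, Subtype.ext hz⟩

theorem gam_subgroupOf [Finite G] (hK : K ≤ H) (n : ℕ) :
    (gam n K).subgroupOf H = gam n (K.subgroupOf H) := by
  refine map_injective H.subtype_injective ?_
  rw [map_subgroupOf_eq_of_le ((gam_le n).trans hK), map_gam, map_subgroupOf_eq_of_le hK]

theorem commutator_subgroupOf {L : Subgroup G} (hK : K ≤ H) (hL : L ≤ H) :
    ⁅K.subgroupOf H, L.subgroupOf H⁆ = ⁅K, L⁆.subgroupOf H := by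
  refine map_injective H.subtype_injective ?_
  rw [map_commutator, map_subgroupOf_eq_of_le hK, map_subgroupOf_eq_of_le hL,
    map_subgroupOf_eq_of_le]
  exact commutator_le.2 fun a ha b hb => commutatorElement_def a b ▸
    mul_mem (mul_mem (mul_mem (hK ha) (hL hb)) (inv_mem (hK ha))) (inv_mem (hL hb))

end

/-- `D` is a conjugation-closed set of images of elements of `C` in a section. -/
structure NSec {G : Type u} [Group G] (C : Set G) {Q : Type u} [Group Q] (D : Set Q) : Prop where
  sec : IsSec C D
  conj : ∀ d ∈ D, ∀ g : Q, g * d * g⁻¹ ∈ D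

namespace NSec
variable {G : Type u} [Group G] {C : Set G} {Q : Type u} [Group Q] {D : Set Q}

theorem refl (hC : ∀ c ∈ C, ∀ g : G, g * c * g⁻¹ ∈ C) : NSec C C := ⟨.refl C, hC⟩

theorem image (h : NSec C D) {Q' : Type u} [Group Q'] (f : Q →* Q') (hf : Function.Surjective f) :
    NSec C (f '' D) := by
  refine ⟨h.sec.image f, ?_⟩
  rintro _ ⟨d, hd, rfl⟩ g
  obtain ⟨g, rfl⟩ := hf g
  exact ⟨_, h.conj d hd g, by simp⟩

theorem subgroup (h : NSec C D) (N : Subgroup Q) : NSec C (N.subtype ⁻¹' D) :=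
  ⟨h.sec.subgroup N, fun _ hd g => h.conj _ hd (g : Q)⟩

end NSec

section
variable {Q : Type*} [Group Q] [Finite Q] {p q : ℕ} {K T U : Subgroup Q}

theorem Irr.commutator_eq (h : Irr p K T U) : ⁅U, T⁆ = U := by
  have hTU := h.le.trans h.norm
  rcases h.irr _ (commutator_le_left hTU) (le_normalizer_commutator h.norm h.normT) with h1 | h1
  · exact absurd (eq_bot_iff.2 ((le_inf le_rfl (commutator_eq_bot_iff_le_centralizer.1 h1)).trans
      h.cop.le)) h.ne
  · exact h1

theorem Irr.le_gam (h : Irr p K T U) {m : ℕ} (hT : T ≤ gam (m - 1) K) {L : Subgroup Q} (hKL : K ≤ L)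
    (hUL : U ≤ L) : U ≤ gam m L := by
  have key : ∀ j ≤ m, U ≤ gam j L := by
    intro j hj
    induction j with
    | zero => exact hUL
    | succ j ih =>
      rw [gam_succ]
      refine le_nres (ih (by omega)) ?_
      have h1 : T ≤ gam j L := (hT.trans (gam_antitone (show j ≤ m - 1 by omega))).trans (gam_mono j hKL)
      exact h.commutator_eq.ge.trans (commutator_mono le_rfl h1)
  exact key m le_rfl

/-- No conjugates of the generators of `K` under `U` generate a subgroup containing `U`. -/
theorem Conn.of_le_closure {G : Type*} [Group G] {K U : Subgroup G} {x y z : G} (hK : Conn K x y z)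
    {a b c : G} (ha : a ∈ U) (hb : b ∈ U) (hc : c ∈ U)
    (hU : U ≤ closure {a * x * a⁻¹, b * y * b⁻¹, c * z * c⁻¹}) :
    Conn (closure {a * x * a⁻¹, b * y * b⁻¹, c * z * c⁻¹}) (a * x * a⁻¹) (b * y * b⁻¹)
      (c * z * c⁻¹) ∧ K ≤ closure {a * x * a⁻¹, b * y * b⁻¹, c * z * c⁻¹} := by
  set L := closure {a * x * a⁻¹, b * y * b⁻¹, c * z * c⁻¹} with hL
  have back : ∀ u ∈ U, ∀ w, u * w * u⁻¹ ∈ L → w ∈ L := by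
    intro u hu w hw
    have h1 : w = u⁻¹ * (u * w * u⁻¹) * u := by group
    rw [h1]
    exact mul_mem (mul_mem (inv_mem (hU hu)) hw) (hU hu)
  have hKL : K ≤ L := hK.le (back a ha _ (Subgroup.subset_closure (by simp)))
    (back b hb _ (Subgroup.subset_closure (by simp)))
    (back c hc _ (Subgroup.subset_closure (by simp)))
  refine ⟨⟨rfl, ?_, ?_⟩, hKL⟩
  · obtain ⟨k, hk, rfl⟩ := hK.two
    exact ⟨b * k * a⁻¹, mul_mem (mul_mem (hU hb) (hKL hk)) (inv_mem (hU ha)), by group⟩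
  · obtain ⟨k, hk, rfl⟩ := hK.three
    exact ⟨c * k * a⁻¹, mul_mem (mul_mem (hU hc) (hKL hk)) (inv_mem (hU ha)), by group⟩

theorem Irr.not_le_closure {G : Type u} [Group G] [Finite G] {C : Set G} {Q : Type u} [Group Q]
    [Finite Q] {D : Set Q} {p m : ℕ} {K T U : Subgroup Q} (h : Irr p K T U)
    (hC : ∀ c ∈ C, ∀ g : G, g * c * g⁻¹ ∈ C) (hD : NSec C D) (hm : Ht C m)
    (hT : T ≤ gam (m - 1) K) {x y z : Q} (hK : Conn K x y z) (hx : x ∈ D) (hy : y ∈ D)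
    (hz : z ∈ D) {a b c : Q} (ha : a ∈ U) (hb : b ∈ U) (hc : c ∈ U) :
    ¬ U ≤ closure {a * x * a⁻¹, b * y * b⁻¹, c * z * c⁻¹} := by
  intro hU
  obtain ⟨hconn, hKL⟩ := hK.of_le_closure ha hb hc hU
  have h1 := hm.sec hC hD.sec (hD.conj x hx a) (hD.conj y hy b) (hD.conj z hz c) hconn
  have h2 := h.le_gam hT hKL hU
  rw [h1, le_bot_iff] at h2
  exact h.ne h2

end

end OrderThree

namespace OrderThree
open Subgroup
open scoped commutatorElement

universe u

section
variable {Q : Type*} [Group Q] [Finite Q] {p q : ℕ} {K T U : Subgroup Q}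

theorem card_centralizer_le {k : Q} (hk : k ∈ normalizer (U : Set Q)) (x : Q) :
    Nat.card ((centralizer {x}).subgroupOf U) ≤
      Nat.card ((centralizer {k * x * k⁻¹}).subgroupOf U) := by
  refine Nat.card_le_card_of_injective (fun u => ⟨⟨k * u.1.1 * k⁻¹, ?_⟩, ?_⟩) fun u v huv => ?_
  · exact (mem_normalizer_iff.1 hk _).1 u.1.2
  · have h1 := mem_centralizer_singleton_iff.1 (mem_subgroupOf.1 u.2)
    rw [mem_subgroupOf, mem_centralizer_singleton_iff]
    calc k * u.1.1 * k⁻¹ * (k * x * k⁻¹) = k * (u.1.1 * x) * k⁻¹ := by group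
      _ = k * x * k⁻¹ * (k * u.1.1 * k⁻¹) := by rw [h1]; group
  · have h1 : k * u.1.1 * k⁻¹ = k * v.1.1 * k⁻¹ := congrArg (fun w => (w.1.1 : Q)) huv
    exact Subtype.ext (Subtype.ext (mul_left_cancel (mul_right_cancel h1)))

theorem card_centralizer_eq {k : Q} (hk : k ∈ normalizer (U : Set Q)) (x : Q) :
    Nat.card ((centralizer {k * x * k⁻¹}).subgroupOf U) =
      Nat.card ((centralizer {x}).subgroupOf U) := by
  refine le_antisymm ?_ (card_centralizer_le hk x)
  have h1 := card_centralizer_le (U := U) (inv_mem hk) (k * x * k⁻¹)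
  have h2 : k⁻¹ * (k * x * k⁻¹) * k⁻¹⁻¹ = x := by group
  rwa [h2] at h1

theorem index_centralizer_eq {k : Q} (hk : k ∈ normalizer (U : Set Q)) (x : Q) :
    ((centralizer {k * x * k⁻¹}).subgroupOf U).index =
      ((centralizer {x}).subgroupOf U).index := by
  have h1 := card_mul_index ((centralizer {k * x * k⁻¹}).subgroupOf U)
  have h2 := card_mul_index ((centralizer {x}).subgroupOf U)
  rw [card_centralizer_eq hk, ← h2] at h1
  exact Nat.eq_of_mul_eq_mul_left Nat.card_pos h1

theorem Irr.card_eq (h : Irr p K T U) {x y z : Q} (hK : Conn K x y z)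
    (hs : ∀ a ∈ U, ∀ b ∈ U, ∀ c ∈ U, ∃ u ∈ U, a * x * a⁻¹ = u * x * u⁻¹ ∧
      b * y * b⁻¹ = u * y * u⁻¹ ∧ c * z * c⁻¹ = u * z * u⁻¹) :
    Nat.card U = ((centralizer {x}).subgroupOf U).index ^ 3 := by
  let F : Q → Subgroup U := fun w => (centralizer {w}).subgroupOf U
  have hF : ∀ (w : Q) (a b : U), (a : U ⧸ F w) = b ↔ a.1 * w * a.1⁻¹ = b.1 * w * b.1⁻¹ := by
    intro w a b
    rw [QuotientGroup.eq, mem_subgroupOf, mem_centralizer_singleton_iff]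
    push_cast
    constructor
    · intro hab
      calc a.1 * w * a.1⁻¹ = a.1 * (w * (a.1⁻¹ * b.1)) * b.1⁻¹ := by group
        _ = _ := by rw [← hab]; group
    · intro hab
      calc a.1⁻¹ * b.1 * w = a.1⁻¹ * (b.1 * w * b.1⁻¹) * b.1 := by group
        _ = _ := by rw [← hab]; group
  have hinj : Function.Bijective
      (fun a : U => ((a, a, a) : (U ⧸ F x) × (U ⧸ F y) × (U ⧸ F z))) := by
    constructor
    · intro a b hab
      simp only [Prod.mk.injEq, hF] at hab
      have key : ∀ w, a.1 * w * a.1⁻¹ = b.1 * w * b.1⁻¹ → w ∈ centralizer {(b.1)⁻¹ * a.1} := by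
        intro w hw
        rw [mem_centralizer_singleton_iff]
        calc w * ((b.1)⁻¹ * a.1) = (b.1)⁻¹ * (b.1 * w * (b.1)⁻¹) * a.1 := by group
          _ = (b.1)⁻¹ * a.1 * w := by rw [← hw]; group
      have h1 := hK.le (key x hab.1) (key y hab.2.1) (key z hab.2.2)
      have h2 : b.1⁻¹ * a.1 ∈ U ⊓ centralizer (T : Set Q) := by
        refine mem_inf.2 ⟨mul_mem (inv_mem b.2) a.2, mem_centralizer_iff.2 fun t ht => ?_⟩
        exact mem_centralizer_singleton_iff.1 (h1 (h.le ht))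
      rw [h.cop, mem_bot, inv_mul_eq_one] at h2
      exact Subtype.ext h2.symm
    · rintro ⟨a, b, c⟩
      obtain ⟨a, rfl⟩ := QuotientGroup.mk_surjective a
      obtain ⟨b, rfl⟩ := QuotientGroup.mk_surjective b
      obtain ⟨c, rfl⟩ := QuotientGroup.mk_surjective c
      obtain ⟨u, hu, h1, h2, h3⟩ := hs a a.2 b b.2 c c.2
      exact ⟨⟨u, hu⟩, by simp only [Prod.mk.injEq, hF]; exact ⟨h1.symm, h2.symm, h3.symm⟩⟩
  have hcard := Nat.card_congr (Equiv.ofBijective _ hinj)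
  rw [Nat.card_prod, Nat.card_prod] at hcard
  obtain ⟨k, hk, hy⟩ := hK.two
  obtain ⟨l, hl, hz⟩ := hK.three
  have e1 : Nat.card (U ⧸ F x) = ((centralizer {x}).subgroupOf U).index := rfl
  have e2 : Nat.card (U ⧸ F y) = ((centralizer {x}).subgroupOf U).index := by
    rw [← index_centralizer_eq (h.norm hk) x, ← hy]; rfl
  have e3 : Nat.card (U ⧸ F z) = ((centralizer {x}).subgroupOf U).index := by
    rw [← index_centralizer_eq (h.norm hl) x, ← hz]; rfl
  rw [hcard, e1, e2, e3]
  ring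

end

theorem Irr.eq_three {Q : Type*} [Group Q] [Finite Q] [Group.IsSolvable Q] {p q m : ℕ}
    {K T U : Subgroup Q} [hU : U.Normal] (hp : p.Prime) (hq : q.Prime) (hpq : p ≠ q)
    (h : Irr p K T U)
    (hTq : IsPGroup q T) {x y z : Q} (hK : Conn K x y z) (hx : x ^ 3 = 1)
    (hs : ∀ a ∈ U, ∀ b ∈ U, ∀ c ∈ U, ∃ u ∈ U, a * x * a⁻¹ = u * x * u⁻¹ ∧
      b * y * b⁻¹ = u * y * u⁻¹ ∧ c * z * c⁻¹ = u * z * u⁻¹)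
    (hTS : ⁅T, gam (m - 2) K⁆ = T) :
    q = 3 ∧ m ≤ 3 ∧ 2 ∣ Nat.card K ∧ (∃ u ∈ U, ⁅x, u⁆ ≠ 1) ∧ ∃ e ∈ T,
      (∀ u ∈ U, ⁅e * x * e⁻¹, ⁅x, u⁆⁆ = 1) ∧ ∀ u ∈ U, ⁅x, ⁅e * x * e⁻¹, u⁆⁆ = 1 := by
  classical
  let ψ : K →* MulAut U := MulAut.conjNormal.comp K.subtype
  let Γ := ψ.range
  let ρ : K →* Γ := ψ.rangeRestrict
  have hρ : Function.Surjective ρ := ψ.rangeRestrict_surjective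
  let _ : CommGroup U := { (inferInstance : Group U) with
    mul_comm := fun a b => Subtype.ext (mem_centralizer_iff.1 (h.comm b.2) a a.2) }
  let _ : DistribMulAction Γ (Additive U) :=
    { smul := fun g a => Additive.ofMul (g • a.toMul)
      one_smul := fun a => congrArg Additive.ofMul (one_smul Γ a.toMul)
      mul_smul := fun g g' a => congrArg Additive.ofMul (mul_smul g g' a.toMul)
      smul_zero := fun g => congrArg Additive.ofMul (smul_one g)
      smul_add := fun g a b => congrArg Additive.ofMul (smul_mul' g a.toMul b.toMul) }
  have hfaith : FaithfulSMul Γ (Additive U) :=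
    ⟨fun {g g'} hgg => FaithfulSMul.eq_of_smul_eq_smul (α := U) fun u =>
      congrArg Additive.toMul (hgg (Additive.ofMul u))⟩
  have hval : ∀ (k : K) (a : Additive U), ((ρ k • a).toMul : Q) = k * a.toMul * (k : Q)⁻¹ :=
    fun k a => MulAut.conjNormal_apply (H := U) (k : Q) a.toMul
  have hext : ∀ a b : Additive U, (a.toMul : Q) = b.toMul → a = b := fun a b hab => Subtype.ext hab
  have hsub : ∀ (k : K) (a : Additive U), ((ρ k • a - a).toMul : Q) = ⁅(k : Q), (a.toMul : Q)⁆ := by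
    intro k a
    rw [commutatorElement_def, ← hval, toMul_sub, div_eq_mul_inv]
    rfl
  have hconn := (hK.subgroupOf le_rfl).map ρ
  rw [subgroupOf_self, map_top_of_surjective _ hρ] at hconn
  set x' : K := ⟨x, hK.mem₁⟩
  have hfx : Nat.card (fx (Additive U) {ρ x'}) = Nat.card ((centralizer {x}).subgroupOf U) := by
    refine Nat.card_congr ⟨fun a => ⟨a.1.toMul, ?_⟩, fun u => ⟨Additive.ofMul u.1, ?_⟩,
      fun _ => rfl, fun _ => rfl⟩
    · have h1 := mem_fx_singleton.1 a.2
      have h2 : ((ρ x' • a.1).toMul : Q) = a.1.toMul := by rw [h1]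
      rw [hval, mul_inv_eq_iff_eq_mul] at h2
      rw [mem_subgroupOf, mem_centralizer_singleton_iff]
      exact h2.symm
    · rw [mem_fx_singleton]
      refine hext _ _ ?_
      rw [hval, mul_inv_eq_iff_eq_mul]
      exact (mem_centralizer_singleton_iff.1 (mem_subgroupOf.1 u.2)).symm
  set d := ((centralizer {x}).subgroupOf U).index with hd
  have hUd : Nat.card U = d ^ 3 := h.card_eq hK hs
  have hd0 : 0 < d := Nat.pos_of_ne_zero index_ne_zero_of_finite
  have hd1 : 1 < d := by
    by_contra hcon
    have hd1 : d = 1 := by omega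
    rw [hd1, one_pow, card_eq_one] at hUd
    exact h.ne hUd
  have htri : Tri (Additive U) (ρ x') (ρ ⟨y, hK.mem₂⟩) (ρ ⟨z, hK.mem₃⟩) d := by
    refine ⟨hconn, ?_, fun W hW => ?_, hUd, ?_, hd1⟩
    · rw [← map_pow]
      have : x' ^ 3 = 1 := Subtype.ext hx
      rw [this, map_one]
    · let W' : Subgroup U := AddSubgroup.toSubgroup' W
      have h1 := h.irr (W'.map U.subtype) (map_subtype_le W') (by
        rw [le_normalizer_iff]
        rintro k hk _ ⟨w, hw, rfl⟩
        exact ⟨(ρ ⟨k, hk⟩ • Additive.ofMul w).toMul, hW _ _ hw, hval ⟨k, hk⟩ _⟩)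
      rcases h1 with h1 | h1
      · left
        rw [eq_bot_iff]
        intro w hw
        have h2 : (w.toMul : Q) ∈ W'.map U.subtype := mem_map_of_mem U.subtype hw
        rw [h1, mem_bot] at h2
        exact hext _ _ h2
      · right
        rw [eq_top_iff]
        intro w _
        have h2 := h1.ge (w.toMul.2 : (w.toMul : Q) ∈ U)
        obtain ⟨v, hv, hvw⟩ := h2
        have h3 : Additive.ofMul v = w := hext _ _ hvw
        exact h3 ▸ hv
    · rw [hfx]
      have h1 := card_mul_index ((centralizer {x}).subgroupOf U)
      rw [← hd, hUd, pow_succ d 2] at h1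
      exact Nat.eq_of_mul_eq_mul_right hd0 h1
  have hsolv : Group.IsSolvable Γ := Group.isSolvable_of_surjective hρ
  have hcop : q.Coprime (Nat.card (Additive U)) := by
    have : Fact p.Prime := ⟨hp⟩
    obtain ⟨n, hn⟩ := IsPGroup.iff_card.1 h.isPGroup
    have h1 : Nat.card (Additive U) = p ^ n := hn
    rw [h1]
    exact Nat.Coprime.pow_right n ((Nat.coprime_primes hq hp).2 hpq.symm)
  have hTn : ((T.subgroupOf K).map ρ).Normal :=
    Normal.map (normal_subgroupOf_iff_le_normalizer h.le |>.2 h.normT) ρ hρ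
  have hgn : (gam (m - 2) (⊤ : Subgroup Γ)).Normal := by
    rw [← normalizer_eq_top_iff, ← top_le_iff]
    exact le_normalizer_gam _ (normalizer_eq_top (⊤ : Subgroup Γ)).ge
  have hgmap : ((gam (m - 2) K).subgroupOf K).map ρ = gam (m - 2) (⊤ : Subgroup Γ) := by
    rw [gam_subgroupOf le_rfl, map_gam, subgroupOf_self, map_top_of_surjective _ hρ]
  have hT1 : (T.subgroupOf K).map ρ ≠ ⊥ := by
    intro h0
    refine h.ne (eq_bot_iff.2 ((le_inf le_rfl fun u hu => mem_centralizer_iff.2 fun t ht => ?_).trans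
      h.cop.le))
    have h1 : ρ ⟨t, h.le ht⟩ = 1 := by
      rw [← mem_bot, ← h0]
      exact mem_map_of_mem ρ ht
    have h2 := hval ⟨t, h.le ht⟩ (Additive.ofMul ⟨u, hu⟩)
    rw [h1, one_smul] at h2
    exact mul_inv_eq_iff_eq_mul.1 h2.symm
  obtain ⟨h3, hm, h2, e, he, -, -, h4, h5⟩ := htri.exists_of_normal hq hTn hgn
    ((hTq.comap_of_injective K.subtype K.subtype_injective).map ρ)
    (by rw [← hgmap, ← map_commutator, commutator_subgroupOf h.le (gam_le _), hTS]) hT1 hcop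
  refine ⟨h3, ?_, h2.trans (card_dvd_of_surjective ρ hρ), ?_, ?_⟩
  · by_contra hcon
    exact hm (gam_antitone (show 2 ≤ m - 2 by omega))
  · by_contra! hcon
    refine hd1.ne' (index_eq_one.2 (eq_top_iff.2 fun u _ => ?_))
    rw [mem_subgroupOf, mem_centralizer_singleton_iff]
    exact (commutatorElement_eq_one_iff_mul_comm.1 (hcon u u.2)).symm
  · obtain ⟨e, he, rfl⟩ := he
    have hconj : ρ e * ρ x' * (ρ e)⁻¹ = ρ (e * x' * e⁻¹) := by simp
    rw [hconj] at h4 h5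
    have key : ∀ k l : K, (∀ a : Additive U, ρ l • (ρ k • a - a) = ρ k • a - a) →
        ∀ u ∈ U, ⁅(l : Q), ⁅(k : Q), u⁆⁆ = 1 := by
      intro k l hkl u hu
      have h6 := hsub l (ρ k • Additive.ofMul ⟨u, hu⟩ - Additive.ofMul ⟨u, hu⟩)
      rw [hsub k, hkl, sub_self] at h6
      exact h6.symm
    exact ⟨e, he, key x' (e * x' * e⁻¹) h4, key (e * x' * e⁻¹) x' h5⟩

end OrderThree

namespace OrderThree
open Subgroup
open scoped commutatorElement

universe u

theorem MinAct.exists_irr {Q : Type u} [Group Q] [Finite Q] {p q : ℕ} (hp : p.Prime) (hq : q.Prime)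
    (hpq : p ≠ q) {K T D : Subgroup Q} (hT : IsPGroup q T) (h : MinAct p K T D) :
    ∃ M : Subgroup Q, D ≤ M ∧ K ≤ M ∧ M ≤ K ⊔ D ∧ ∃ (R : Type u) (_ : Group R) (_ : Finite R) (f : M →* R),
      Function.Surjective f ∧ f.ker = (D ⊓ centralizer T).subgroupOf M ∧
      Irr p ((K.subgroupOf M).map f) ((T.subgroupOf M).map f) ((D.subgroupOf M).map f) ∧
      ((D.subgroupOf M).map f).Normal := by
  have : Fact p.Prime := ⟨hp⟩
  set M := D ⊔ K with hM
  have hD : D ≤ M := le_sup_left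
  have hK : K ≤ M := le_sup_right
  have h' := h.subgroupOf hq hpq hT hD hK
  have hMn : M ≤ normalizer (D ⊓ centralizer (T : Set Q) : Subgroup Q) := by
    refine sup_le (fun d hd => ?_)
      (le_normalizer_inf h.norm (le_normalizer_centralizer h.normT))
    have key : ∀ w ∈ D ⊓ centralizer (T : Set Q), d * w * d⁻¹ = w := fun w hw => by
      rw [mul_inv_eq_iff_eq_mul]
      exact mem_centralizer_iff.1 (h.cent hw) d hd
    rw [mem_normalizer_iff]
    intro w
    refine ⟨fun hw => (key w hw).symm ▸ hw, fun hw => ?_⟩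
    have h1 := key _ hw
    have h2 : d * w * d⁻¹ = w := by
      have h3 : d⁻¹ * (d * (d * w * d⁻¹) * d⁻¹) * d = d⁻¹ * (d * w * d⁻¹) * d := by rw [h1]
      have h4 : d⁻¹ * (d * (d * w * d⁻¹) * d⁻¹) * d = d * w * d⁻¹ := by group
      have h5 : d⁻¹ * (d * w * d⁻¹) * d = w := by group
      rw [← h4, h3, h5]
    exact h2 ▸ hw
  have hZ0 : (D ⊓ centralizer (T : Set Q)).subgroupOf M =
      D.subgroupOf M ⊓ centralizer (T.subgroupOf M : Set M) := by
    ext w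
    simp only [mem_subgroupOf, mem_inf, mem_centralizer_iff]
    refine and_congr_right fun _ => ⟨fun hw t ht => Subtype.ext (hw t ht), fun hw t ht => ?_⟩
    exact congrArg Subtype.val (hw ⟨t, hK (h.le ht)⟩ ht)
  have hn : ((D ⊓ centralizer (T : Set Q)).subgroupOf M).Normal :=
    normal_subgroupOf_of_le_normalizer hMn
  have hDn : (D.subgroupOf M).Normal :=
    normal_subgroupOf_of_le_normalizer (sup_le le_normalizer h.norm)
  refine ⟨M, hD, hK, (sup_comm D K).le, M ⧸ (D ⊓ centralizer (T : Set Q)).subgroupOf M, inferInstance, inferInstance,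
    QuotientGroup.mk' _, QuotientGroup.mk'_surjective _, QuotientGroup.ker_mk' _, ?_,
    hDn.map _ (QuotientGroup.mk'_surjective _)⟩
  exact h'.irr _ ((QuotientGroup.ker_mk' _).trans hZ0)

theorem Irr.not_conn {Q : Type*} [Group Q] [Finite Q] {p : ℕ} {K T U : Subgroup Q} (h : Irr p K T U) {x y : Q}
    (hs : ∀ a ∈ U, ∀ b ∈ U, ∀ c ∈ U, ∃ u ∈ U, a * x * a⁻¹ = u * x * u⁻¹ ∧
      b * y * b⁻¹ = u * y * u⁻¹ ∧ c * y * c⁻¹ = u * y * u⁻¹) : ¬ Conn K x y y := by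
  intro hK
  have h1 : y ∈ centralizer (U : Set Q) := mem_centralizer_iff.2 fun u hu => by
    obtain ⟨v, -, -, h2, h3⟩ := hs 1 (one_mem _) 1 (one_mem _) u hu
    rw [← h2, one_mul, inv_one, mul_one, mul_inv_eq_iff_eq_mul] at h3
    exact h3
  have hn := le_normalizer_centralizer h.norm
  obtain ⟨k, hk, hky⟩ := hK.two
  have hx : x ∈ centralizer (U : Set Q) := by
    have h2 := conj_mem_of_le_normalizer hn (inv_mem hk) h1
    have h3 : k⁻¹ * y * k⁻¹⁻¹ = x := by rw [hky]; group
    rwa [h3] at h2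
  have h4 := hK.le_of_normal hn hx
  have h5 : ⁅U, T⁆ = ⊥ := by
    rw [commutator_comm, commutator_eq_bot_iff_le_centralizer]
    exact h.le.trans h4
  exact h.ne (h.commutator_eq.symm.trans h5)

theorem MinAct.eq_three {G : Type u} [Group G] [Finite G] {C : Set G}
    (hC : ∀ c ∈ C, ∀ g : G, g * c * g⁻¹ ∈ C) (hC3 : ∀ c ∈ C, c ^ 3 = 1) {Q : Type u} [Group Q]
    [Finite Q] [Group.IsSolvable Q] {E : Set Q} (hE : NSec C E) {p q m : ℕ} (hm : Ht C m)
    (hp : p.Prime) (hq : q.Prime) (hpq : p ≠ q) {K T D : Subgroup Q} (hT : IsPGroup q T)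
    (h : MinAct p K T D) {x y z : Q} (hx : x ∈ E) (hy : y ∈ E) (hz : z ∈ E) (hK : Conn K x y z)
    (hTm : T ≤ gam (m - 1) K) (hTS : ⁅T, gam (m - 2) K⁆ = T) :
    q = 3 ∧ m ≤ 3 ∧ 2 ∣ Nat.card K ∧ y ≠ z ∧ (∃ d ∈ D, ⁅x, d⁆ ∉ centralizer (T : Set Q)) ∧
      ∃ e ∈ T,
      (∀ d ∈ D, ⁅e * x * e⁻¹, ⁅x, d⁆⁆ ∈ centralizer (T : Set Q)) ∧
      ∀ d ∈ D, ⁅x, ⁅e * x * e⁻¹, d⁆⁆ ∈ centralizer (T : Set Q) := by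
  obtain ⟨M, hDM, hKM, -, R, _, _, f, hf, hker, hirr, hn⟩ := h.exists_irr hp hq hpq hT
  have hTK := h.le
  have hconn := (hK.subgroupOf hKM).map f
  have hE' := (hE.subgroup M).image f hf
  have hsolv : Group.IsSolvable R := Group.isSolvable_of_surjective hf
  have hTq : IsPGroup q ((T.subgroupOf M).map f) :=
    (hT.comap_of_injective M.subtype M.subtype_injective).map f
  have hg : ∀ n, ((gam n K).subgroupOf M).map f = gam n ((K.subgroupOf M).map f) := fun n => by
    rw [gam_subgroupOf hKM, map_gam]
  have hyp : ∀ a ∈ (D.subgroupOf M).map f, ∀ b ∈ (D.subgroupOf M).map f,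
      ∀ c ∈ (D.subgroupOf M).map f, _ := fun a ha b hb c hc =>
    hirr.not_le_closure hC hE' hm (by rw [← hg]; exact map_mono (comap_mono hTm)) hconn
      ⟨_, hx, rfl⟩ ⟨_, hy, rfl⟩ ⟨_, hz, rfl⟩ ha hb hc
  have hs := fun a ha b hb c hc => hirr.simultaneous hp hq hpq hTq hconn.eq ha hb hc
    (hyp a ha b hb c hc)
  have hx3 : f ⟨x, hKM hK.mem₁⟩ ^ 3 = 1 := by
    rw [← map_pow]
    have : (⟨x, hKM hK.mem₁⟩ : M) ^ 3 = 1 := Subtype.ext (hE.sec.pow_three hC3 x hx)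
    rw [this, map_one]
  obtain ⟨h3, hm3, h2, ⟨u, hu, hxu⟩, e, he, h4, h5⟩ := hirr.eq_three hp hq hpq hTq hconn hx3
    (fun a ha b hb c hc => hs a ha b hb c hc)
    (by rw [← hg, ← map_commutator, commutator_subgroupOf (hTK.trans hKM) ((gam_le _).trans hKM),
      hTS])
  have key : ∀ w : M, f w = 1 ↔ (w : Q) ∈ D ⊓ centralizer (T : Set Q) := fun w => by
    rw [← MonoidHom.mem_ker, hker, mem_subgroupOf]
  have hcard : Nat.card ((K.subgroupOf M).map f) ∣ Nat.card K := by
    refine (card_map_dvd _ f).trans ?_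
    rw [Nat.card_congr (subgroupOfEquivOfLe hKM).toEquiv]
  refine ⟨h3, hm3, h2.trans hcard, ?_, ?_, ?_⟩
  · rintro rfl
    exact hirr.not_conn hs hconn
  · obtain ⟨d, hd, rfl⟩ := hu
    refine ⟨d, hd, fun hxd => hxu ?_⟩
    rw [← map_commutatorElement, key]
    refine mem_inf.2 ⟨?_, hxd⟩
    change ⁅x, (d : Q)⁆ ∈ D
    rw [commutatorElement_def]
    exact mul_mem (conj_mem_of_le_normalizer h.norm hK.mem₁ hd) (inv_mem hd)
  · obtain ⟨e, he, rfl⟩ := he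
    refine ⟨e, he, fun d hd => ?_, fun d hd => ?_⟩
    · have h6 := h4 _ (mem_map_of_mem f (show (⟨d, hDM hd⟩ : M) ∈ D.subgroupOf M from hd))
      rw [← map_inv, ← map_mul, ← map_mul, ← map_commutatorElement, ← map_commutatorElement,
        key] at h6
      exact h6.2
    · have h6 := h5 _ (mem_map_of_mem f (show (⟨d, hDM hd⟩ : M) ∈ D.subgroupOf M from hd))
      rw [← map_inv, ← map_mul, ← map_mul, ← map_commutatorElement, ← map_commutatorElement,
        key] at h6
      exact h6.2

end OrderThree

namespace OrderThree
open Subgroup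
open scoped commutatorElement

universe u

section
variable {G : Type*} [Group G]

theorem InO.mono {q : ℕ} {H L : Subgroup G} {r : G} (h : InO q H r) (hL : L ≤ H) (hr : r ∈ L) :
    InO q L r := by
  obtain ⟨N, hN, hq, hn, hrN⟩ := h
  exact ⟨N ⊓ L, inf_le_right, hq.to_le inf_le_left,
    le_normalizer_inf (hL.trans hn) le_normalizer, mem_inf.2 ⟨hrN, hr⟩⟩

theorem commutator_iSup_le {ι : Type*} {A : ι → Subgroup G} {K S : Subgroup G} (hA : ∀ i, A i ≤ K)
    (hKA : ∀ i, K ≤ normalizer (A i : Set G)) (hKS : K ≤ normalizer (S : Set G)) :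
    ⁅⨆ i, A i, S⁆ ≤ ⨆ i, ⁅A i, S⁆ := by
  have hn : K ≤ normalizer ((⨆ i, ⁅A i, S⁆ : Subgroup G) : Set G) := by
    rw [le_normalizer_iff]
    intro k hk w hw
    induction hw using iSup_induction' with
    | hp i w hw =>
      exact mem_iSup_of_mem i
        (conj_mem_of_le_normalizer (le_normalizer_commutator (hKA i) hKS) hk hw)
    | h1 => simp
    | hmul v w _ _ hv hw => simpa [mul_assoc] using mul_mem hv hw
  rw [commutator_le]
  intro a ha s hs
  have key : a ∈ K ∧ ∀ s ∈ S, ⁅a, s⁆ ∈ ⨆ i, ⁅A i, S⁆ := by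
    induction ha using iSup_induction' with
    | hp i a ha =>
      exact ⟨hA i ha, fun s hs => mem_iSup_of_mem i (commutator_mem_commutator ha hs)⟩
    | h1 => exact ⟨one_mem _, fun s _ => by simp⟩
    | hmul a b _ _ ha hb =>
      refine ⟨mul_mem ha.1 hb.1, fun s hs => ?_⟩
      have h1 : ⁅a * b, s⁆ = a * ⁅b, s⁆ * a⁻¹ * ⁅a, s⁆ := by
        simp only [commutatorElement_def]; group
      rw [h1]
      exact mul_mem (conj_mem_of_le_normalizer hn ha.1 (hb.2 s hs)) (ha.2 s hs)
  exact key.2 s hs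

theorem isPGroup_closure_of_isNilpotent [Finite G] {R : Subgroup G} [Group.IsNilpotent R] {q : ℕ}
    (hq : q.Prime) : IsPGroup q (closure {g | g ∈ R ∧ IsPElt q g}) := by
  have : Fact q.Prime := ⟨hq⟩
  have : Group.IsNilpotent (⊤ : Subgroup R) := Group.isNilpotent_top.2 inferInstance
  refine ((isPGroup_pcore q (G := R)).map R.subtype).to_le ((closure_le _).2 ?_)
  rintro g ⟨hg, hgq⟩
  exact ⟨⟨g, hg⟩, mem_pcore_of_nilpotent (D := ⊤) q (mem_top _) (.of_subtype hgq), rfl⟩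

theorem isPGroup_of_forall_commutator [Finite G] {K R S : Subgroup G} [Group.IsNilpotent R]
    (hRK : R ≤ K) (hSK : S ≤ K) (hKR : K ≤ normalizer (R : Set G))
    (hKS : K ≤ normalizer (S : Set G)) (hRS : R ≤ ⁅R, S⁆) {q₀ : ℕ} (hq₀ : q₀.Prime)
    (h : ∀ q : ℕ, q.Prime → q ≠ q₀ → ∀ T ≤ R, K ≤ normalizer (T : Set G) → IsPGroup q T →
      ⁅T, S⁆ = T → T = ⊥) : IsPGroup q₀ R := by
  let ι := Fin (Nat.card G + 1)
  let A : ℕ → ι → Subgroup G := fun n i =>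
    (fun U => ⁅U, S⁆)^[n] (closure {g | g ∈ R ∧ (i : ℕ).Prime ∧ IsPElt i g})
  have hA : ∀ n i, A (n + 1) i = ⁅A n i, S⁆ := fun n i => Function.iterate_succ_apply' _ _ _
  have hA0 : ∀ i, A 0 i ≤ R := fun i => (closure_le _).2 fun g hg => hg.1
  have hKA : ∀ n i, K ≤ normalizer (A n i : Set G) := by
    intro n i
    induction n with
    | zero => exact le_normalizer_closure fun g hg k hk =>
        ⟨conj_mem_of_le_normalizer hKR hg hk.1, hk.2.1, hk.2.2.conj g⟩
    | succ n ih =>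
      rw [hA]
      exact le_normalizer_commutator ih hKS
  have hanti : Antitone A := antitone_nat_of_succ_le fun n i => by
    rw [hA]
    exact commutator_le_left (hSK.trans (hKA n i))
  have hAR : ∀ n i, A n i ≤ R := fun n i => (hanti (Nat.zero_le n) i).trans (hA0 i)
  have hsup : ∀ n, R ≤ ⨆ i, A n i := by
    intro n
    induction n with
    | zero =>
      intro g hg
      refine (closure_le _).2 ?_ (mem_closure_isPElt g)
      rintro k ⟨hk, p, hp, hpk⟩
      have hkR : k ∈ R := zpowers_le.2 hg hk
      by_cases hk1 : k = 1
      · exact hk1 ▸ one_mem _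
      · have hpc : p < Nat.card G + 1 := by
          obtain ⟨n, hn⟩ := hpk.orderOf hp
          have hn0 : n ≠ 0 := by
            rintro rfl
            exact hk1 (orderOf_eq_one_iff.1 (by simpa using hn))
          exact Nat.lt_succ_of_le (Nat.le_of_dvd Nat.card_pos
            ((dvd_pow_self p hn0).trans (hn ▸ orderOf_dvd_natCard k)))
        exact mem_iSup_of_mem (⟨p, hpc⟩ : ι) (Subgroup.subset_closure ⟨hkR, hp, hpk⟩)
    | succ n ih =>
      calc R ≤ ⁅R, S⁆ := hRS
        _ ≤ ⁅⨆ i, A n i, S⁆ := commutator_mono ih le_rfl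
        _ ≤ ⨆ i, ⁅A n i, S⁆ := commutator_iSup_le (fun i => (hAR n i).trans hRK) (hKA n) hKS
        _ = ⨆ i, A (n + 1) i := by simp only [hA]
  obtain ⟨n, hn⟩ := WellFoundedGT.monotone_chain_condition
    (α := (ι → Subgroup G)ᵒᵈ) ⟨fun n => OrderDual.toDual (A n), fun _ _ hab => hanti hab⟩
  have hstab : ∀ i, ⁅A n i, S⁆ = A n i := fun i => by
    rw [← hA]
    exact congrFun (hn (n + 1) (Nat.le_succ n)).symm i
  have hbound : ⨆ i, A n i ≤ closure {g | g ∈ R ∧ IsPElt q₀ g} := by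
    refine iSup_le fun i => ?_
    by_cases hi : (i : ℕ).Prime
    · by_cases hi0 : (i : ℕ) = q₀
      · refine (hanti (Nat.zero_le n) i).trans (closure_mono fun g hg => ⟨hg.1, hi0 ▸ hg.2.2⟩)
      · rw [h i hi hi0 _ (hAR n i) (hKA n i) ?_ (hstab i)]
        · exact bot_le
        · exact (isPGroup_closure_of_isNilpotent (R := R) hi).to_le
            ((hanti (Nat.zero_le n) i).trans (closure_mono fun g hg => ⟨hg.1, hg.2.2⟩))
    · exact (hanti (Nat.zero_le n) i).trans ((closure_le _).2 fun g hg => absurd hg.2.1 hi)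
  exact (isPGroup_closure_of_isNilpotent hq₀).to_le ((hsup n).trans hbound)

theorem exists_minAct_quotient [Finite G] [Group.IsSolvable G] {q : ℕ} (hq : q.Prime)
    {K T : Subgroup G} (hTK : T ≤ K) (hKT : K ≤ normalizer (T : Set G)) (hT : IsPGroup q T) {r : G}
    (hr : r ∈ T) (hr1 : r ∉ pcore q G) : ∃ p : ℕ, p.Prime ∧ p ≠ q ∧ ∃ D,
      MinAct p (K.map (QuotientGroup.mk' (pcore q G))) (T.map (QuotientGroup.mk' (pcore q G))) D := by
  have : Fact q.Prime := ⟨hq⟩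
  obtain ⟨p, hp, hpq, v, hv, hvr⟩ := exists_pcore_quot (.of_mem hT hr) hr1
  have : Fact p.Prime := ⟨hp⟩
  obtain ⟨D, -, hD⟩ := exists_minAct (isPGroup_pcore p (G := G ⧸ pcore q G))
    (K := K.map (QuotientGroup.mk' (pcore q G))) (T := T.map (QuotientGroup.mk' (pcore q G)))
    (le_top.trans (normalizer_eq_top _).ge) (map_mono hTK) (map_le_normalizer hKT _)
    (le_closure_of_isPGroup hq hpq (hT.map _))
    (fun hcon => hvr (mem_centralizer_iff.1 (hcon hv) _ (mem_map_of_mem _ hr)))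
  exact ⟨p, hp, hpq, D, hD⟩

end

variable {G : Type u} [Group G] [Finite G] {C : Set G}

theorem Bad.exists_minAct (hC : Bad C) {q : ℕ} (hq : q.Prime) {K T : Subgroup G} {x y z : G}
    (hx : x ∈ C) (hy : y ∈ C) (hz : z ∈ C) (hK : K = closure {x, y, z}) (hTK : T ≤ K)
    (hKT : K ≤ normalizer (T : Set G)) (hT : IsPGroup q T) {a b r : G} (ha : a ∈ C) (hb : b ∈ C)
    (haK : a ∈ K) (hbK : b ∈ K) (hr : r ∈ T) (hrab : r ∈ closure {a, b}) (hr1 : r ≠ 1) :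
    ∃ H : Subgroup G, Group.IsSolvable H ∧ K ≤ H ∧ ∃ p : ℕ, p.Prime ∧ p ≠ q ∧ ∃ D,
      MinAct p ((K.subgroupOf H).map (QuotientGroup.mk' (pcore q H)))
        ((T.subgroupOf H).map (QuotientGroup.mk' (pcore q H))) D := by
  have : Fact q.Prime := ⟨hq⟩
  obtain ⟨w, hw, hwr⟩ := hC.exists_not_inO ha hb hrab (.of_mem hT hr) hr1
  have hsol := hC.solv x hx y hy z hz w hw
  have hKH : K ≤ closure {x, y, z, w} := hK ▸ closure_mono (by intro; simp; tauto)
  refine ⟨closure {x, y, z, w}, hsol, hKH, ?_⟩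
  refine exists_minAct_quotient hq (comap_mono hTK) (subgroupOf_le_normalizer hKT _)
    (hT.comap_of_injective _ (Subgroup.subtype_injective _)) (r := ⟨r, hKH (hTK hr)⟩) hr
    fun hcon => hwr ?_
  refine (inO_of_mem_pcore hcon).mono ((closure_le _).2 ?_)
    (closure_mono (by intro; simp; tauto) hrab)
  rintro _ (rfl | rfl | rfl)
  · exact hKH haK
  · exact hKH hbK
  · exact Subgroup.subset_closure (by simp)

theorem Bad.exists_minAct_of_conn (hC : Bad C) {q : ℕ} (hq : q.Prime) {K T S : Subgroup G}
    {x y z : G} (hx : x ∈ C) (hy : y ∈ C) (hz : z ∈ C) (hK : Conn K x y z) (hTK : T ≤ K)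
    (hKT : K ≤ normalizer (T : Set G)) (hT : IsPGroup q T) (hSK : S ≤ K) (hTS : ⁅T, S⁆ = T)
    (hT1 : T ≠ ⊥) :
    ∃ H : Subgroup G, Group.IsSolvable H ∧ K ≤ H ∧ ∃ p : ℕ, p.Prime ∧ p ≠ q ∧ ∃ D,
      MinAct p ((K.subgroupOf H).map (QuotientGroup.mk' (pcore q H)))
        ((T.subgroupOf H).map (QuotientGroup.mk' (pcore q H))) D := by
  have h1 : ∃ v ∈ T, ⁅x, v⁆ ≠ 1 := by
    by_contra! hcon
    have h2 : K ≤ centralizer (T : Set G) := hK.le_of_normal (le_normalizer_centralizer hKT)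
      (mem_centralizer_iff.2 fun v hv => (commutatorElement_eq_one_iff_mul_comm.1 (hcon v hv)).symm)
    have h3 : ⁅S, T⁆ = ⊥ := commutator_eq_bot_iff_le_centralizer.2 (hSK.trans h2)
    rw [commutator_comm, hTS] at h3
    exact hT1 h3
  obtain ⟨v, hv, hv1⟩ := h1
  have hvx : ⁅x, v⁆ = x * (v * x * v⁻¹)⁻¹ := by rw [commutatorElement_def]; group
  refine hC.exists_minAct hq hx hy hz hK.eq hTK hKT hT hx (hC.conj x hx v) hK.mem₁
    (mul_mem (mul_mem (hTK hv) hK.mem₁) (inv_mem (hTK hv))) (r := ⁅x, v⁆) ?_ ?_ hv1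
  · rw [commutatorElement_def]
    exact mul_mem (conj_mem_of_le_normalizer hKT hK.mem₁ hv) (inv_mem hv)
  · rw [hvx]
    exact mul_mem (Subgroup.subset_closure (by simp)) (inv_mem (Subgroup.subset_closure (by simp)))

end OrderThree

namespace OrderThree
open Subgroup
open scoped commutatorElement

universe u

theorem Conn.lift_pair {G : Type*} [Group G] [Finite G] {Q : Type*} [Group Q] (φ : G →* Q)
    {C : Set G} (hC : ∀ c ∈ C, ∀ g : G, g * c * g⁻¹ ∈ C) {K : Subgroup Q} {x y : Q}
    (h : Conn K x y y) (hx : x ∈ φ '' C) (hy : y ∈ φ '' C) :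
    ∃ (L : Subgroup G) (a b : G), Conn L a b b ∧ a ∈ C ∧ b ∈ C ∧ φ a = x ∧ φ b = y ∧
      L.map φ = K := by
  obtain ⟨a₀, ha₀, hax⟩ := hx
  obtain ⟨b₀, hb₀, hby⟩ := hy
  obtain ⟨⟨a, b⟩, ⟨ha, hb, rfl, rfl⟩, hmin⟩ := Set.exists_min_image
    {t : G × G | t.1 ∈ C ∧ t.2 ∈ C ∧ φ t.1 = x ∧ φ t.2 = y}
    (fun t => Nat.card (closure {t.1, t.2, t.2})) (Set.toFinite _)
    ⟨(a₀, b₀), ha₀, hb₀, hax, hby⟩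
  simp only at *
  have hK : (closure {a, b, b}).map φ = K := by
    rw [h.eq, MonoidHom.map_closure, Set.image_insert_eq, Set.image_pair]
  obtain ⟨k, hk, hky⟩ := h.two
  rw [← hK] at hk
  obtain ⟨k, hk, rfl⟩ := hk
  have haK : a ∈ closure {a, b, b} := Subgroup.subset_closure (by simp)
  have hle : closure {a, k * a * k⁻¹, k * a * k⁻¹} ≤ closure {a, b, b} := by
    rw [closure_le]
    rintro _ (rfl | rfl | rfl)
    · exact haK
    · exact mul_mem (mul_mem hk haK) (inv_mem hk)
    · exact mul_mem (mul_mem hk haK) (inv_mem hk)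
  have h1 : φ (k * a * k⁻¹) = φ b := by rw [hky]; simp
  have heq : closure {a, k * a * k⁻¹, k * a * k⁻¹} = closure {a, b, b} :=
    eq_of_le_of_card_ge hle (hmin (a, k * a * k⁻¹) ⟨ha, hC _ ha _, rfl, h1⟩)
  exact ⟨closure {a, b, b}, a, k * a * k⁻¹, ⟨heq.symm, ⟨k, hk, rfl⟩, ⟨k, hk, rfl⟩⟩,
    ha, hC _ ha _, rfl, h1, hK⟩

section
variable {G : Type*} [Group G] [Finite G] {K : Subgroup G}

theorem nres_eq_bot_of_isPGroup {p : ℕ} (hp : p.Prime) (h : IsPGroup p K) : nres K = ⊥ := by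
  have : Fact p.Prime := ⟨hp⟩
  exact nres_eq_bot_iff.2 h.isNilpotent

theorem Conn.nres_eq_bot {x y z : G} (h : Conn K x y z) (hx : x ^ 3 = 1)
    (h3 : IsPGroup 3 (nres K)) : nres K = ⊥ := by
  have h1 : IsPGroup 3 (zpowers x ⊔ nres K : Subgroup G) :=
    (isPGroup_zpowers (.of_pow_three hx)).to_sup_of_normal_right' h3
      ((zpowers_le.2 h.mem₁).trans (le_normalizer_gam 1 le_normalizer))
  exact nres_eq_bot_of_isPGroup Nat.prime_three (h1.to_le h.le_nres)

end

variable {G : Type u} [Group G] [Finite G] {C : Set G}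

theorem Bad.exists_ht (hC : Bad C) : ∃ m, Ht C m := by
  have h1 : ∀ K : Subgroup G, ∃ n, (∃ x y z, x ∈ C ∧ y ∈ C ∧ z ∈ C ∧ Conn K x y z) →
      gam n K = ⊥ := by
    intro K
    by_cases hK : ∃ x y z, x ∈ C ∧ y ∈ C ∧ z ∈ C ∧ Conn K x y z
    · obtain ⟨x, y, z, hx, hy, hz, hK⟩ := hK
      have := hC.solv x hx y hy z hz z hz
      have : Group.IsSolvable K := isSolvable_of_le (K := closure {x, y, z, z})
        (hK.eq.le.trans (closure_mono (by intro; simp)))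
      obtain ⟨n, hn⟩ := exists_gam_eq_bot (H := K)
      exact ⟨n, fun _ => hn⟩
    · exact ⟨0, fun h => absurd h hK⟩
  choose f hf using h1
  obtain ⟨m, hm⟩ := (Set.finite_range f).bddAbove
  refine ⟨m, fun K x y z hx hy hz hK => ?_⟩
  rw [eq_bot_iff, ← hf K ⟨x, y, z, hx, hy, hz, hK⟩]
  exact gam_antitone (hm ⟨K, rfl⟩)

theorem Bad.eq_three (hC : Bad C) {m : ℕ} (hm : Ht C m) {x y z : G} (hx : x ∈ C) (hy : y ∈ C)
    (hz : z ∈ C) {K T : Subgroup G} (hK : Conn K x y z) {q : ℕ} (hq : q.Prime)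
    (hTm : T ≤ gam (m - 1) K) (hKT : K ≤ normalizer (T : Set G)) (hT : IsPGroup q T)
    (hTS : ⁅T, gam (m - 2) K⁆ = T) (hT1 : T ≠ ⊥) : q = 3 ∧ m ≤ 3 ∧ 2 ∣ Nat.card K ∧ y ≠ z := by
  have hTK := hTm.trans (gam_le _)
  obtain ⟨H, hH, hKH, p, hp, hpq, D, hD⟩ :=
    hC.exists_minAct_of_conn hq hx hy hz hK hTK hKT hT (gam_le _) hTS hT1
  have hsolv : Group.IsSolvable (H ⧸ pcore q H) :=
    Group.isSolvable_of_surjective (QuotientGroup.mk'_surjective _)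
  have hsub : ∀ n, ((gam n K).subgroupOf H).map (QuotientGroup.mk' (pcore q H)) =
      gam n ((K.subgroupOf H).map (QuotientGroup.mk' (pcore q H))) := fun n => by
    rw [gam_subgroupOf hKH, map_gam]
  obtain ⟨h1, h2, h3, h4, -⟩ := hD.eq_three hC.conj hC.cube
    (((NSec.refl hC.conj).subgroup H).image (QuotientGroup.mk' (pcore q H))
      (QuotientGroup.mk'_surjective _)) hm hp hq hpq
    ((hT.comap_of_injective _ H.subtype_injective).map _) ⟨_, hx, rfl⟩ ⟨_, hy, rfl⟩ ⟨_, hz, rfl⟩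
    ((hK.subgroupOf hKH).map _) (by rw [← hsub]; exact map_mono (comap_mono hTm))
    (by rw [← hsub, ← map_commutator]
        exact congrArg _ ((commutator_subgroupOf (hTK.trans hKH)
          ((gam_le (m - 2)).trans hKH)).trans (by rw [hTS]; rfl)))
  refine ⟨h1, h2, h3.trans ?_, ?_⟩
  · refine (card_map_dvd _ _).trans ?_
    rw [Nat.card_congr (subgroupOfEquivOfLe hKH).toEquiv]
  · rintro rfl
    exact h4 rfl

theorem Bad.isPGroup_gam (hC : Bad C) {m : ℕ} (hm : Ht C m) (hm2 : 2 ≤ m) {x y z : G} (hx : x ∈ C)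
    (hy : y ∈ C) (hz : z ∈ C) {K : Subgroup G} (hK : Conn K x y z) : IsPGroup 3 (gam (m - 1) K) := by
  have h1 : gam (m - 1) K = nres (gam (m - 2) K) := by
    rw [← gam_succ]
    congr 1
    omega
  have h2 : nres (gam (m - 1) K) = ⊥ := by
    rw [← gam_succ]
    have := hm K x y z hx hy hz hK
    rwa [show m = m - 1 + 1 by omega] at this
  have : Group.IsNilpotent (gam (m - 1) K) := nres_eq_bot_iff.1 h2
  refine isPGroup_of_forall_commutator (gam_le _) (gam_le (m - 2)) (le_normalizer_gam _ le_normalizer)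
    (le_normalizer_gam _ le_normalizer) ?_ Nat.prime_three fun q hq hq3 T hT hKT hTq hTS => ?_
  · rw [h1]
    exact nres_le_commutator
  · by_contra hT1
    exact hq3 (hC.eq_three hm hx hy hz hK hq hT hKT hTq hTS hT1).1

theorem Bad.gam_pred (hC : Bad C) {m : ℕ} (hm : Ht C m) (hm2 : 2 ≤ m) {x y z : G} (hx : x ∈ C)
    (hy : y ∈ C) (hz : z ∈ C) {K : Subgroup G} (hK : Conn K x y z) (h : gam (m - 1) K ≠ ⊥) :
    m = 3 ∧ 2 ∣ Nat.card K ∧ y ≠ z := by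
  have h1 : gam (m - 1) K = nres (gam (m - 2) K) := by
    rw [← gam_succ]
    congr 1
    omega
  have hTS : ⁅gam (m - 1) K, gam (m - 2) K⁆ = gam (m - 1) K := by
    refine le_antisymm (commutator_le_left ?_) ?_
    · exact (gam_le _).trans (le_normalizer_gam _ le_normalizer)
    · rw [h1]
      exact nres_le_commutator
  have h3 := hC.isPGroup_gam hm hm2 hx hy hz hK
  obtain ⟨-, h4, h5, h6⟩ := hC.eq_three hm hx hy hz hK Nat.prime_three le_rfl
    (le_normalizer_gam _ le_normalizer) h3 hTS h
  refine ⟨?_, h5, h6⟩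
  by_contra hm3
  obtain rfl : m = 2 := by omega
  exact h (hK.nres_eq_bot (hC.cube x hx) h3)

theorem Bad.not_ht_one (hC : Bad C) {x : G} (hx : x ∈ C) (hx1 : x ≠ 1) : ¬ Ht C 1 := by
  intro hm
  have : Fact (Nat.Prime 3) := ⟨Nat.prime_three⟩
  have h1 : ∃ g : G, ¬ IsPGroup 3 (closure {x, g * x * g⁻¹}) := by
    by_contra! hcon
    have h2 := baer_suzuki hcon
    rw [hC.core 3 Nat.prime_three] at h2
    exact hx1 h2
  obtain ⟨g, hg⟩ := h1
  set P := closure {x, g * x * g⁻¹} with hP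
  have hx' := hC.conj x hx g
  have hsolv := hC.solv x hx x hx x hx _ hx'
  have : Group.IsSolvable P := isSolvable_of_le (K := closure {x, x, x, g * x * g⁻¹})
    (closure_mono (by intro; simp))
  have h3 : ∃ c : P, (c : G) ∈ C ∧ c ∉ pcore 3 P := by
    by_contra! hcon
    refine hg (((isPGroup_pcore 3 (G := P)).map P.subtype).to_le ((closure_le _).2 ?_))
    rintro k (hk | hk)
    · rw [hk]
      exact ⟨⟨x, Subgroup.subset_closure (by simp)⟩, hcon _ hx, rfl⟩
    · rw [hk]
      exact ⟨⟨g * x * g⁻¹, Subgroup.subset_closure (by simp)⟩, hcon _ hx', rfl⟩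
  obtain ⟨c, hcC, hc⟩ := h3
  have hc3 : c ^ 3 = 1 := Subtype.ext (hC.cube _ hcC)
  obtain ⟨p, hp, hp3, v, hv, hcv⟩ := exists_pcore_quot (.of_pow_three hc3) hc
  have : Fact p.Prime := ⟨hp⟩
  set c' : P ⧸ pcore 3 P := QuotientGroup.mk' _ c
  have hc3' : c' ^ 3 = 1 := by
    rw [← map_pow, hc3, map_one]
  have hconn := conn_of_isPGroup hp hp3 (isPGroup_pcore p (G := P ⧸ pcore 3 P)) hc3'
    ((normalizer_eq_top _).ge (mem_top _)) hv
  have hE := ((NSec.refl hC.conj).subgroup P).image (QuotientGroup.mk' (pcore 3 P))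
      (QuotientGroup.mk'_surjective _)
  have hcE : c' ∈ QuotientGroup.mk' (pcore 3 P) '' (P.subtype ⁻¹' C) := ⟨c, hcC, rfl⟩
  have h4 := hm.sec hC.conj hE.sec hcE (hE.conj _ hcE v) (hE.conj _ hcE v) hconn
  have : Group.IsNilpotent (closure {c', v * c' * v⁻¹, v * c' * v⁻¹}) := nres_eq_bot_iff.1 h4
  have hcv' : ⁅c', v⁆ = c' * (v * c' * v⁻¹)⁻¹ := by rw [commutatorElement_def]; group
  have h5 : IsPElt p ⁅c', v⁆ := by
    refine .of_mem (isPGroup_pcore p (G := P ⧸ pcore 3 P)) ?_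
    rw [commutatorElement_def]
    exact mul_mem ((pcore_spec p).1.conj_mem v hv c') (inv_mem hv)
  refine hcv (commute_of_isPElt hp Nat.prime_three hp3 (.of_pow_three hc3') h5 ?_)
  refine commute_of_isNilpotent hp Nat.prime_three hp3 ?_ hconn.mem₁ h5 (.of_pow_three hc3')
  change ⁅c', v⁆ ∈ _
  rw [hcv']
  exact mul_mem hconn.mem₁ (inv_mem hconn.mem₂)

theorem Bad.height (hC : Bad C) {x : G} (hx : x ∈ C) (hx1 : x ≠ 1) :
    Ht C 3 ∧ ∃ K x y z, x ∈ C ∧ y ∈ C ∧ z ∈ C ∧ Conn K x y z ∧ gam 2 K ≠ ⊥ := by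
  classical
  have hex := hC.exists_ht
  have hm := Nat.find_spec hex
  have hmin := fun k => Nat.find_min hex (m := k)
  set m := Nat.find hex
  have hm0 : ¬ Ht C 0 := by
    intro h
    have h1 : Conn (closure {x, x, x}) x x x :=
      .of_mem_closure ⟨1, one_mem _, by simp⟩ ⟨1, one_mem _, by simp⟩
    have h2 := h _ x x x hx hx hx h1
    rw [gam_zero] at h2
    have h3 := h1.mem₁
    rw [h2] at h3
    exact hx1 h3
  have hm2 : 2 ≤ m := by
    by_contra hcon
    rcases (show m = 0 ∨ m = 1 by omega) with h | h
    · exact hm0 (h ▸ hm)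
    · exact hC.not_ht_one hx hx1 (h ▸ hm)
  have h1 := hmin (m - 1) (by omega)
  unfold Ht at h1
  push Not at h1
  obtain ⟨K, x, y, z, hx, hy, hz, hK, h2⟩ := h1
  obtain ⟨h3, -⟩ := hC.gam_pred hm hm2 hx hy hz hK h2
  rw [h3] at hm h2
  exact ⟨hm, K, x, y, z, hx, hy, hz, hK, h2⟩

end OrderThree

namespace OrderThree
open Subgroup
open scoped commutatorElement

universe u

section
variable {G : Type u} [Group G] [Finite G] {C : Set G}

theorem Bad.ht_three (hC : Bad C) : Ht C 3 := by
  by_cases h : ∃ x ∈ C, x ≠ 1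
  · obtain ⟨x, hx, hx1⟩ := h
    exact (hC.height hx hx1).1
  · push Not at h
    intro K x y z hx hy hz hK
    rw [eq_bot_iff]
    refine (gam_le 3).trans (hK.le ?_ ?_ ?_)
    · rw [h x hx]; exact one_mem _
    · rw [h y hy]; exact one_mem _
    · rw [h z hz]; exact one_mem _

theorem Bad.two_dvd_card (hC : Bad C) {K : Subgroup G} {x y z : G} (hx : x ∈ C) (hy : y ∈ C)
    (hz : z ∈ C) (hK : Conn K x y z) (h : gam 2 K ≠ ⊥) : 2 ∣ Nat.card K :=
  (hC.gam_pred hC.ht_three (by norm_num) hx hy hz hK h).2.1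

variable {Q : Type*} [Group Q] [Finite Q] {E : Set Q}

theorem Bad.isPGroup_gam_sec (hC : Bad C) (hE : IsSec C E) {K : Subgroup Q} {x y z : Q} (hx : x ∈ E)
    (hy : y ∈ E) (hz : z ∈ E) (hK : Conn K x y z) : IsPGroup 3 (gam 2 K) := by
  obtain ⟨M, _, i, φ, hi, hD⟩ := hE
  have : Finite M := Finite.of_injective i hi
  obtain ⟨L, a, b, c, hL, ha, hb, hc, -, -, -, rfl⟩ := hK.lift φ (C := i ⁻¹' C)
    (fun c hc g => by simpa using hC.conj _ hc (i g)) (hD hx) (hD hy) (hD hz)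
  have h1 := hC.isPGroup_gam hC.ht_three (by norm_num) ha hb hc (hL.map i)
  rw [← map_gam] at h1 ⊢
  exact (h1.of_equiv ((gam 2 L).equivMapOfInjective i hi).symm).map φ

theorem Bad.gam_two_pair (hC : Bad C) (hE : IsSec C E) {K : Subgroup Q} {x y : Q} (hx : x ∈ E)
    (hy : y ∈ E) (hK : Conn K x y y) : gam 2 K = ⊥ := by
  obtain ⟨M, _, i, φ, hi, hD⟩ := hE
  have : Finite M := Finite.of_injective i hi
  obtain ⟨L, a, b, hL, ha, hb, -, -, rfl⟩ := hK.lift_pair φ (C := i ⁻¹' C)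
    (fun c hc g => by simpa using hC.conj _ hc (i g)) (hD hx) (hD hy)
  have h1 : gam 2 (L.map i) = ⊥ := by
    by_contra h
    exact (hC.gam_pred hC.ht_three (by norm_num) ha hb hb (hL.map i) h).2.2 rfl
  rw [← map_gam, map_eq_bot_iff_of_injective _ hi] at h1
  rw [← map_gam, h1, Subgroup.map_bot]

end

section
variable {G : Type*} [Group G]

theorem pow_card_mul_card_eq_one {A B : Subgroup G} (h : A ≤ normalizer (B : Set G)) {g : G}
    (hg : g ∈ A ⊔ B) : g ^ (Nat.card A * Nat.card B) = 1 := by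
  obtain ⟨a, ha, b, hb, rfl⟩ := exists_of_mem_sup h hg
  have key : ∀ n : ℕ, ∃ c ∈ B, (a * b) ^ n = a ^ n * c := by
    intro n
    induction n with
    | zero => exact ⟨1, one_mem _, by simp⟩
    | succ n ih =>
      obtain ⟨c, hc, hn⟩ := ih
      refine ⟨a⁻¹ * c * a⁻¹⁻¹ * b,
        mul_mem (conj_mem_of_le_normalizer h (inv_mem ha) hc) hb, ?_⟩
      rw [pow_succ, hn, pow_succ]
      group
  obtain ⟨c, hc, hn⟩ := key (Nat.card A)
  have h1 : a ^ Nat.card A = 1 := congrArg Subtype.val (pow_card_eq_one' (x := (⟨a, ha⟩ : A)))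
  have h2 : c ^ Nat.card B = 1 := congrArg Subtype.val (pow_card_eq_one' (x := (⟨c, hc⟩ : B)))
  rw [pow_mul, hn, h1, one_mul, h2]

variable [Finite G]

/-- A fixed-point-free action of an element of order three on an abelian group. -/
theorem exists_conj_eq_of_abelian {p : ℕ} (hp : p.Prime) (hp3 : p ≠ 3) {R : Subgroup G}
    (hR : IsPGroup p R) (hab : R ≤ centralizer (R : Set G)) {x : G} (hx : x ^ 3 = 1)
    (hxR : zpowers x ≤ normalizer (R : Set G)) (hRx : R ≤ ⁅R, zpowers x⁆) {r : G} (hr : r ∈ R) :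
    ∃ g ∈ R, g * x⁻¹ * g⁻¹ = x⁻¹ * r := by
  have hx' : x * x * x = 1 := by rw [← hx, pow_succ, pow_two]
  have hxm : ∀ a ∈ R, x * a * x⁻¹ ∈ R := fun a ha =>
    conj_mem_of_le_normalizer hxR (mem_zpowers x) ha
  have comm : ∀ a ∈ R, ∀ b ∈ R, a * b = b * a := fun a ha b hb =>
    mem_centralizer_iff.1 (hab hb) a ha
  let cx : R →* R :=
    { toFun := fun a => ⟨x * a * x⁻¹, hxm a a.2⟩
      map_one' := Subtype.ext (by simp)
      map_mul' := fun a b => Subtype.ext (by simp [mul_assoc]) }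
  have norm : ∀ a ∈ R, a * (x * a * x⁻¹) * (x * (x * a * x⁻¹) * x⁻¹) = 1 := by
    let N : R →* R :=
      { toFun := fun a => a * cx a * cx (cx a)
        map_one' := by simp
        map_mul' := fun a b => by
          have hc : ∀ a b : R, a * b = b * a := fun a b => Subtype.ext (comm a a.2 b b.2)
          simp only [map_mul]
          calc a * b * (cx a * cx b) * (cx (cx a) * cx (cx b))
              = a * (b * cx a) * (cx b * cx (cx a)) * cx (cx b) := by group
            _ = a * (cx a * b) * (cx (cx a) * cx b) * cx (cx b) := by
              rw [hc b, hc (cx b) (cx (cx a))]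
            _ = a * cx a * (b * cx (cx a)) * cx b * cx (cx b) := by group
            _ = a * cx a * (cx (cx a) * b) * cx b * cx (cx b) := by rw [hc b (cx (cx a))]
            _ = a * cx a * cx (cx a) * (b * cx b * cx (cx b)) := by group }
    have hN : ∀ a, N (cx a) = N a := by
      intro a
      have h3 : cx (cx (cx a)) = a := Subtype.ext (by
        change x * (x * (x * a * x⁻¹) * x⁻¹) * x⁻¹ = a
        calc x * (x * (x * (a : G) * x⁻¹) * x⁻¹) * x⁻¹ =
            (x * x * x) * a * (x * x * x)⁻¹ := by group
          _ = a := by rw [hx']; simp)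
      change cx a * cx (cx a) * cx (cx (cx a)) = a * cx a * cx (cx a)
      rw [h3]
      exact Subtype.ext (by
        have := comm (cx a * cx (cx a) : R) (cx a * cx (cx a) : R).2 a a.2
        simpa [mul_assoc] using this)
    have hker : R ≤ (N.ker).map R.subtype := by
      refine hRx.trans ((commutator_le).2 fun a ha k hk => ?_)
      have hpow : ∀ n : ℕ, ∀ a : R, ∃ b : R, (b : G) = x ^ n * a * (x ^ n)⁻¹ ∧ N b = N a := by
        intro n
        induction n with
        | zero => exact fun a => ⟨a, by simp, rfl⟩
        | succ n ih =>
          intro a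
          obtain ⟨b, hb, hb'⟩ := ih a
          refine ⟨cx b, ?_, (hN b).trans hb'⟩
          change x * b * x⁻¹ = _
          rw [hb, pow_succ']
          group
      obtain ⟨n, rfl⟩ := Submonoid.mem_powers_iff _ _ |>.1
        ((isOfFinOrder_of_finite x).mem_powers_iff_mem_zpowers.2 hk)
      obtain ⟨b, hb, hb'⟩ := hpow n ⟨a, ha⟩
      refine ⟨⟨a, ha⟩ * b⁻¹, ?_, ?_⟩
      · rw [SetLike.mem_coe, MonoidHom.mem_ker, map_mul, map_inv, hb', mul_inv_cancel]
      · change a * (b : G)⁻¹ = _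
        rw [hb, commutatorElement_def]
        group
    intro a ha
    obtain ⟨b, hb, rfl⟩ := hker ha
    exact congrArg Subtype.val hb
  let F : R → R := fun g => ⟨x * g * x⁻¹ * (g : G)⁻¹, mul_mem (hxm g g.2) (inv_mem g.2)⟩
  have hF : Function.Injective F := by
    intro a b hab'
    have h1 : x * a * x⁻¹ * (a : G)⁻¹ = x * b * x⁻¹ * (b : G)⁻¹ := congrArg Subtype.val hab'
    have h2 : x * ((b : G)⁻¹ * a) * x⁻¹ = (b : G)⁻¹ * a := by
      have h3 : x * a * x⁻¹ = x * b * x⁻¹ * ((b : G)⁻¹ * a) := by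
        rw [← mul_assoc, ← h1]; group
      calc x * ((b : G)⁻¹ * a) * x⁻¹ = (x * b * x⁻¹)⁻¹ * (x * a * x⁻¹) := by group
        _ = _ := by rw [h3]; group
    have h4 := norm _ (mul_mem (inv_mem b.2) a.2)
    rw [h2, h2] at h4
    have h5 : (b : G)⁻¹ * a = 1 := by
      refine IsPElt.eq_one hp Nat.prime_three hp3 (.of_mem hR (mul_mem (inv_mem b.2) a.2))
        (.of_pow_three ?_)
      rw [← h4, pow_succ, pow_two]
    exact Subtype.ext (inv_mul_eq_one.1 h5).symm
  obtain ⟨g, hg⟩ := (Finite.injective_iff_surjective.1 hF) ⟨r, hr⟩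
  have hg' : x * g * x⁻¹ * (g : G)⁻¹ = r := congrArg Subtype.val hg
  exact ⟨g, g.2, by rw [← hg']; group⟩

end

end OrderThree

namespace OrderThree
open Subgroup
open scoped commutatorElement

universe u

section
variable {G : Type*} [Group G] [Finite G]

theorem prime_dvd_card_sup {A B P : Subgroup G} (h : A ≤ normalizer (B : Set G)) (hP : P ≤ A ⊔ B)
    {r : ℕ} (hr : r.Prime) (hrP : r ∣ Nat.card P) : r ∣ Nat.card A ∨ r ∣ Nat.card B := by
  have : Fact r.Prime := ⟨hr⟩
  obtain ⟨g, hg⟩ := exists_prime_orderOf_dvd_card' r hrP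
  have h1 := pow_card_mul_card_eq_one h (hP g.2)
  rw [← hr.dvd_mul, ← hg, ← Subgroup.orderOf_coe]
  exact orderOf_dvd_of_pow_eq_one h1

theorem prime_eq_of_dvd_card {A : Subgroup G} {p r : ℕ} (hp : p.Prime) (hr : r.Prime)
    (hA : IsPGroup p A) (h : r ∣ Nat.card A) : r = p := by
  have : Fact p.Prime := ⟨hp⟩
  obtain ⟨n, hn⟩ := hA.exists_card_eq
  rw [hn] at h
  exact (Nat.prime_dvd_prime_iff_eq hr hp).1 (hr.dvd_of_dvd_pow h)

end

theorem MinAct.exists_section {G : Type u} [Group G] [Finite G] {H P R : Subgroup G} (hPH : P ≤ H)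
    (hRP : R ≤ P) {p s : ℕ} (hp : p.Prime) (hs : s.Prime) (hsp : s ≠ p) (hR : IsPGroup p R)
    {D : Subgroup (H ⧸ pcore p H)}
    (h : MinAct s ((P.subgroupOf H).map (QuotientGroup.mk' (pcore p H)))
      ((R.subgroupOf H).map (QuotientGroup.mk' (pcore p H))) D) :
    ∃ (M : Type u) (_ : Group M) (_ : Finite M) (i : M →* G), Function.Injective i ∧
      (∀ r : ℕ, r.Prime → r ∣ Nat.card M → r = p ∨ r = s ∨ r ∣ Nat.card P) ∧
      ∃ (Q : Type u) (_ : Group Q) (_ : Finite Q) (φ : M →* Q) (ι : P →* M),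
        Function.Surjective φ ∧ i.comp ι = P.subtype ∧ ∃ U : Subgroup Q, U.Normal ∧
        Irr s (φ.comp ι).range ((R.subgroupOf P).map (φ.comp ι)) U := by
  have hR' : IsPGroup p ((R.subgroupOf H).map (QuotientGroup.mk' (pcore p H))) :=
    (hR.of_injective (subgroupOfEquivOfLe (hRP.trans hPH)).toMonoidHom
      (subgroupOfEquivOfLe (hRP.trans hPH)).injective).map _
  obtain ⟨N, hDN, hKN, hNKD, Q, _, _, f, hf, -, hirr, hnorm⟩ := h.exists_irr hs hp hsp hR'
  let N0 : Subgroup H := N.comap (QuotientGroup.mk' (pcore p H))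
  have hPN : ∀ g (hg : g ∈ P), (⟨g, hPH hg⟩ : H) ∈ N0 := fun g hg =>
    hKN (mem_map_of_mem _ (mem_subgroupOf.2 hg))
  let ι : P →* N0 :=
    { toFun := fun g => ⟨⟨g, hPH g.2⟩, hPN g g.2⟩
      map_one' := rfl
      map_mul' := fun _ _ => rfl }
  let φ : N0 →* Q := f.comp ((QuotientGroup.mk' (pcore p H)).subgroupComap N)
  refine ⟨N0, inferInstance, inferInstance, H.subtype.comp N0.subtype,
    H.subtype_injective.comp N0.subtype_injective, ?_, Q, inferInstance, inferInstance, φ, ι,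
    hf.comp (MonoidHom.subgroupComap_surjective_of_surjective _ _
      (QuotientGroup.mk'_surjective _)), rfl, _, hnorm, ?_⟩
  · intro r hr hrM
    have : Fact r.Prime := ⟨hr⟩
    obtain ⟨g, hg⟩ := exists_prime_orderOf_dvd_card' r hrM
    have h1 := pow_card_mul_card_eq_one h.norm (hNKD g.2)
    rw [← map_pow, QuotientGroup.mk'_apply, QuotientGroup.eq_one_iff] at h1
    have h2 := congrArg Subtype.val (pow_card_eq_one' (x := (⟨_, h1⟩ : pcore p H)))
    have h3 : (g : H) ^ ((Nat.card ((P.subgroupOf H).map (QuotientGroup.mk' (pcore p H))) *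
        Nat.card D) * Nat.card (pcore p H)) = 1 := by rw [pow_mul]; exact h2
    have h4 := orderOf_dvd_of_pow_eq_one h3
    rw [Subgroup.orderOf_coe, hg, hr.dvd_mul, hr.dvd_mul] at h4
    rcases h4 with (h4 | h4) | h4
    · right; right
      refine h4.trans ((Subgroup.card_map_dvd _ _).trans ?_)
      rw [Nat.card_congr (subgroupOfEquivOfLe hPH).toEquiv]
    · exact Or.inr (Or.inl (prime_eq_of_dvd_card hs hr h.isPGroup h4))
    · exact Or.inl (prime_eq_of_dvd_card hp hr (isPGroup_pcore p) h4)
  · have e1 : (((P.subgroupOf H).map (QuotientGroup.mk' (pcore p H))).subgroupOf N).map f =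
        (φ.comp ι).range := by
      ext v
      constructor
      · rintro ⟨w, ⟨k, hk, hkw⟩, rfl⟩
        exact ⟨⟨k, hk⟩, congrArg f (Subtype.ext hkw)⟩
      · rintro ⟨k, rfl⟩
        exact ⟨_, ⟨⟨k, hPH k.2⟩, k.2, rfl⟩, rfl⟩
    have e2 : (((R.subgroupOf H).map (QuotientGroup.mk' (pcore p H))).subgroupOf N).map f =
        (R.subgroupOf P).map (φ.comp ι) := by
      ext v
      constructor
      · rintro ⟨w, ⟨k, hk, hkw⟩, rfl⟩
        exact ⟨⟨k, hRP hk⟩, hk, congrArg f (Subtype.ext hkw)⟩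
      · rintro ⟨k, hk, rfl⟩
        exact ⟨_, ⟨⟨k, hPH k.2⟩, hk, rfl⟩, rfl⟩
    rw [e1, e2] at hirr
    exact hirr

theorem Bad.exists_pair_section {G : Type u} [Group G] [Finite G] {C : Set G} (hC : Bad C) {p : ℕ}
    (hp : p.Prime) (hp3 : p ≠ 3) {R : Subgroup G} {x : G} (hx : x ∈ C)
    (h : MinAct p (zpowers x) (zpowers x) R) :
    ∃ (P : Subgroup G) (y : G), y ∈ C ∧ Conn P x y y ∧ R ≤ P ∧ P ≤ zpowers x ⊔ R ∧
      P ≤ normalizer (R : Set G) ∧ (∃ t ∈ R, y = t * x * t⁻¹) ∧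
      ∃ (M : Type u) (_ : Group M) (_ : Finite M) (i : M →* G) (s : ℕ), Function.Injective i ∧
      s.Prime ∧ s ≠ p ∧
      (∀ r : ℕ, r.Prime → r ∣ Nat.card M → r = p ∨ r = s ∨ r ∣ Nat.card P) ∧
      ∃ (Q : Type u) (_ : Group Q) (_ : Finite Q) (φ : M →* Q) (ι : P →* M),
        Function.Surjective φ ∧ i.comp ι = P.subtype ∧ ∃ U : Subgroup Q, U.Normal ∧
        Irr s (φ.comp ι).range ((R.subgroupOf P).map (φ.comp ι)) U := by
  have hx3 := hC.cube x hx
  have hxR : x ∈ normalizer (R : Set G) := h.norm (mem_zpowers x)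
  obtain ⟨t, ht, htx⟩ : ∃ t ∈ R, ⁅x, t⁆ ≠ 1 := by
    by_contra! h1
    refine h.ne fun t ht => mem_centralizer_iff.2 ?_
    rintro _ ⟨k, rfl⟩
    have h2 : Commute x t := commutatorElement_eq_one_iff_commute.1 (h1 t ht)
    exact h2.zpow_left k
  have hr : ⁅x, t⁆ ∈ R := by
    rw [commutatorElement_def]
    exact mul_mem (conj_mem_of_le_normalizer h.norm (mem_zpowers x) ht) (inv_mem ht)
  set y := t * x * t⁻¹ with hy
  set P := closure {x, y, y} with hP
  have hconn : Conn P x y y := conn_of_isPGroup hp hp3 h.isPGroup hx3 hxR ht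
  have hrxy : ⁅x, t⁆ ∈ closure {x, y} := by
    have h1 : ⁅x, t⁆ = x * y⁻¹ := by rw [hy, commutatorElement_def]; group
    rw [h1]
    exact mul_mem (Subgroup.subset_closure (by simp)) (inv_mem (Subgroup.subset_closure (by simp)))
  have hrP : ⁅x, t⁆ ∈ P := closure_mono (by intro; simp) hrxy
  have hPR : P ≤ zpowers x ⊔ R := by
    rw [hP, closure_le]
    have h1 : x ∈ zpowers x ⊔ R := mem_sup_left (mem_zpowers x)
    have h2 : y ∈ zpowers x ⊔ R :=
      mul_mem (mul_mem (mem_sup_right ht) h1) (inv_mem (mem_sup_right ht))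
    rintro k (hk | hk | hk) <;> rw [hk] <;> assumption
  have hPn : P ≤ normalizer (R : Set G) := hPR.trans (sup_le h.norm le_normalizer)
  have hRP : R ≤ P := by
    by_contra hn
    have h1 := h.min (P ⊓ R) inf_le_right
      (le_normalizer_inf ((zpowers_le.2 hconn.mem₁).trans le_normalizer) h.norm)
      (fun h => hn (inf_eq_right.1 h)) (mem_inf.2 ⟨hrP, hr⟩)
    have h2 : Commute ⁅x, t⁆ x := (mem_centralizer_iff.1 h1 x (mem_zpowers x)).symm
    exact htx (commutatorElement_eq_one_iff_commute.2
      (commute_of_isPElt hp Nat.prime_three hp3 (.of_pow_three hx3) (.of_mem h.isPGroup hr) h2))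
  have hyC : y ∈ C := hC.conj x hx t
  obtain ⟨H, hH, hPH, s, hs, hsp, D, hD⟩ := hC.exists_minAct hp hx hyC hyC hP hRP hPn h.isPGroup
    hx hyC hconn.mem₁ hconn.mem₂ hr hrxy htx
  obtain ⟨M, i1, i2, i, hi, hM, hQ⟩ := hD.exists_section hPH hRP hp hs hsp h.isPGroup
  exact ⟨P, y, hyC, hconn, hRP, hPR, hPn, ⟨t, ht, hy⟩, M, i1, i2, i, s, hi, hs, hsp, hM, hQ⟩

end OrderThree

namespace OrderThree
open Subgroup
open scoped commutatorElement

universe u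

section
variable {U : Type*} [CommGroup U] [Finite U]

theorem card_sup_mul_card_inf (A B : Subgroup U) :
    Nat.card (A ⊔ B : Subgroup U) * Nat.card (A ⊓ B : Subgroup U) = Nat.card A * Nat.card B := by
  have h1 := B.relIndex_sup_right (H := A)
  have h2 := Subgroup.relIndex_mul_relIndex ⊥ B (A ⊔ B) bot_le le_sup_right
  have h3 := Subgroup.relIndex_mul_relIndex ⊥ (A ⊓ B) A bot_le inf_le_left
  rw [inf_comm, inf_relIndex_right] at h3
  simp only [relIndex_bot_left] at h2 h3
  rw [← h2, ← h3, h1, inf_comm]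
  ring

theorem range_inf_range_eq_bot {α β : U →* U} (h1 : α.ker ⊔ β.ker = ⊤) (h2 : α.ker ⊓ β.ker = ⊥)
    (h3 : α.range ⊔ β.range = ⊤) : α.range ⊓ β.range = ⊥ := by
  have e1 := card_sup_mul_card_inf α.ker β.ker
  have e2 := card_sup_mul_card_inf α.range β.range
  have e3 := α.ker.index_mul_card
  have e4 := β.ker.index_mul_card
  rw [index_ker] at e3 e4
  rw [h1, h2] at e1
  rw [h3] at e2
  simp only [Subgroup.card_top, Subgroup.card_bot, mul_one] at e1 e2
  rw [← Subgroup.card_eq_one]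
  have hpos : 0 < Nat.card U := Nat.card_pos
  refine Nat.eq_of_mul_eq_mul_left (Nat.mul_pos hpos hpos) ?_
  calc Nat.card U * Nat.card U * Nat.card (α.range ⊓ β.range : Subgroup U)
      = (Nat.card U * Nat.card (α.range ⊓ β.range : Subgroup U)) * Nat.card U := by ring
    _ = (Nat.card α.range * Nat.card α.ker) * (Nat.card β.range * Nat.card β.ker) := by
        rw [e2, e1]; ring
    _ = _ := by rw [e3, e4, mul_one]

end

section
variable {Q : Type*} [Group Q]

/-- The endomorphism `u ↦ ⁅x, u⁆` of an abelian subgroup normalized by `x`. -/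
def commHom {U : Subgroup Q} (hU : U ≤ centralizer (U : Set Q)) {x : Q}
    (hx : ∀ u ∈ U, x * u * x⁻¹ ∈ U) : U →* U where
  toFun u := ⟨x * u * x⁻¹ * (u : Q)⁻¹, mul_mem (hx u u.2) (inv_mem u.2)⟩
  map_one' := Subtype.ext (by simp)
  map_mul' a b := Subtype.ext (by
    have h := mem_centralizer_iff.1 (hU (mul_mem (hx b b.2) (inv_mem b.2))) _ (inv_mem a.2)
    change x * (a * b : Q) * x⁻¹ * (a * b : Q)⁻¹ =
      x * a * x⁻¹ * (a : Q)⁻¹ * (x * b * x⁻¹ * (b : Q)⁻¹)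
    rw [mul_assoc _ (a : Q)⁻¹, h]
    group)

variable {U : Subgroup Q} (hU : U ≤ centralizer (U : Set Q)) {x : Q}
  (hx : ∀ u ∈ U, x * u * x⁻¹ ∈ U)

theorem mem_ker_commHom {u : U} : u ∈ (commHom hU hx).ker ↔ x * u = u * x := by
  rw [MonoidHom.mem_ker]
  refine Subtype.ext_iff.trans ?_
  change x * u * x⁻¹ * (u : Q)⁻¹ = 1 ↔ _
  rw [mul_inv_eq_one, mul_inv_eq_iff_eq_mul]

theorem Irr.exists_conn [Finite Q] {s : ℕ} {K T : Subgroup Q} (h : Irr s K T U)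
    (hn : U.Normal) {y : Q} (hK : Conn K x y y) :
    ∃ u ∈ U, ∃ L, K ≤ L ∧ U ≤ L ∧ Conn L x y (u * x * u⁻¹) := by
  obtain ⟨u, hu, hux⟩ : ∃ u ∈ U, x * u ≠ u * x := by
    by_contra! hc
    have h1 : K ≤ centralizer U := by
      rw [hK.eq, closure_le]
      have hx1 : x ∈ centralizer U := mem_centralizer_iff.2 fun u hu => (hc u hu).symm
      obtain ⟨k, -, hk⟩ := hK.two
      have hy1 : y ∈ centralizer U := by
        rw [hk]
        exact (inferInstance : (centralizer (U : Set Q)).Normal).conj_mem x hx1 k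
      rintro g (hg | hg | hg) <;> rw [hg] <;> assumption
    refine h.ne (eq_bot_iff.2 fun u hu => h.cop.le (mem_inf.2 ⟨hu, mem_centralizer_iff.2 ?_⟩))
    exact fun t ht => (mem_centralizer_iff.1 (h1 (h.le ht)) u hu).symm
  have hKL : K ≤ closure {x, y, u * x * u⁻¹} := by
    rw [hK.eq]
    exact closure_mono (by rintro g (hg | hg | hg) <;> rw [hg] <;> simp)
  have hxL : x ∈ closure {x, y, u * x * u⁻¹} := hKL hK.mem₁
  have hzL : u * x * u⁻¹ ∈ closure {x, y, u * x * u⁻¹} := Subgroup.subset_closure (by simp)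
  have hUL : U ≤ closure {x, y, u * x * u⁻¹} := by
    rcases h.irr (closure {x, y, u * x * u⁻¹} ⊓ U) inf_le_right
      (le_normalizer_inf (hKL.trans le_normalizer) h.norm) with h1 | h1
    · have h2 : x⁻¹ * (u * x * u⁻¹) ∈ closure {x, y, u * x * u⁻¹} ⊓ U := by
        refine mem_inf.2 ⟨mul_mem (inv_mem hxL) hzL, ?_⟩
        have h3 := mul_mem (hn.conj_mem u hu x⁻¹) (inv_mem hu)
        have h4 : x⁻¹ * (u * x * u⁻¹) = x⁻¹ * u * x⁻¹⁻¹ * u⁻¹ := by group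
        rwa [h4]
      rw [h1, mem_bot, inv_mul_eq_one, eq_mul_inv_iff_mul_eq] at h2
      exact absurd h2 hux
    · exact inf_eq_right.1 h1
  refine ⟨u, hu, _, hKL, hUL, Conn.of_mem_closure ?_ ⟨u, hUL hu, rfl⟩⟩
  obtain ⟨k, hk, hky⟩ := hK.two
  exact ⟨k, hKL hk, hky⟩

theorem Irr.pair_not_abelian [Finite Q] {s p : ℕ} (hs : s.Prime) (hp : p.Prime) (hsp : s ≠ p)
    (hp3 : p ≠ 3) {K T : Subgroup Q} (h : Irr s K T U) (hT : IsPGroup p T) {t y : Q}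
    (hx3 : x ^ 3 = 1) (ht : t ∈ T) (hy : y = t * x * t⁻¹) (hK : Conn K x y y)
    (hTx : T ≤ ⁅T, zpowers x⁆)
    (hyp : ∀ a ∈ U, ∀ b ∈ U, ¬ U ≤ closure {a * x * a⁻¹, b * y * b⁻¹, b * y * b⁻¹}) :
    ¬ T ≤ centralizer (T : Set Q) := by
  intro hab
  have hxK := hK.mem₁
  have hyK := hK.mem₂
  have hxU : ∀ u ∈ U, x * u * x⁻¹ ∈ U := fun u hu => conj_mem_of_le_normalizer h.norm hxK hu
  have hyU : ∀ u ∈ U, y * u * y⁻¹ ∈ U := fun u hu => conj_mem_of_le_normalizer h.norm hyK hu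
  let _ : CommGroup U :=
    { (inferInstance : Group U) with
      mul_comm := fun a b => Subtype.ext (mem_centralizer_iff.1 (h.comm b.2) a a.2) }
  set α := commHom h.comm hxU with hα
  set β := commHom h.comm hyU with hβ
  have hfix : ∀ u ∈ U, x * u = u * x → y * u = u * y → u = 1 := by
    intro u hu h1 h2
    have h3 : K ≤ centralizer {u} := by
      rw [hK.eq, closure_le]
      rintro g (hg | hg | hg) <;> rw [hg] <;> exact mem_centralizer_singleton_iff.2 (by assumption)
    exact h.cop.le (mem_inf.2 ⟨hu, mem_centralizer_iff.2 fun g hg =>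
      mem_centralizer_singleton_iff.1 (h3 (h.le hg))⟩)
  have h1 : α.ker ⊔ β.ker = ⊤ := by
    rw [eq_top_iff]
    rintro ⟨v, hv⟩ -
    obtain ⟨u, hu, h1, h2, -⟩ := h.simultaneous hs hp hsp hT hK.eq hv (one_mem U) (one_mem U)
      (hyp v hv 1 (one_mem U))
    have e1 : (⟨v, hv⟩ : U) = ((⟨u, hu⟩ : U)⁻¹ * ⟨v, hv⟩) * ⟨u, hu⟩ :=
      Subtype.ext (by
        have := mem_centralizer_iff.1 (h.comm hv) u hu
        change v = u⁻¹ * v * u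
        rw [mul_assoc, ← this]; group)
    rw [e1]
    refine mul_mem (mem_sup_left ((mem_ker_commHom _ _).2 ?_))
      (mem_sup_right ((mem_ker_commHom _ _).2 ?_))
    · change x * (u⁻¹ * v) = u⁻¹ * v * x
      have e2 : x = u⁻¹ * (u * x * u⁻¹) * u := by group
      calc x * (u⁻¹ * v) = u⁻¹ * (u * x * u⁻¹) * v := by group
        _ = _ := by rw [← h1]; group
    · change y * u = u * y
      rw [one_mul, inv_one, mul_one] at h2
      exact eq_mul_inv_iff_mul_eq.1 h2
  have h2 : α.ker ⊓ β.ker = ⊥ := by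
    rw [eq_bot_iff]
    rintro ⟨u, hu⟩ ⟨h1, h2⟩
    exact Subtype.ext (hfix u hu ((mem_ker_commHom _ _).1 h1) ((mem_ker_commHom _ _).1 h2))
  have hne : ∃ u ∈ U, x * u = u * x ∧ u ≠ 1 := by
    by_contra! hc
    have h3 : α.ker = ⊥ := by
      rw [eq_bot_iff]
      exact fun u hu => Subtype.ext (hc u u.2 ((mem_ker_commHom _ _).1 hu))
    rw [h3, bot_sup_eq] at h1
    have h4 : ∀ u ∈ U, y * u = u * y := fun u hu =>
      (mem_ker_commHom h.comm hyU (u := ⟨u, hu⟩)).1 (h1.ge (mem_top _))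
    refine h.ne (eq_bot_iff.2 fun u hu => hc u hu ?_)
    have h5 := h4 _ (conj_mem_of_le_normalizer h.norm (h.le ht) hu)
    have h6 : x * u = t⁻¹ * (y * (t * u * t⁻¹)) * t := by rw [hy]; group
    rw [h6, h5, hy]; group
  have h3 : α.range ⊔ β.range = ⊤ := by
    set W := (α.range ⊔ β.range).map U.subtype with hW
    have hWU : W ≤ U := by
      rintro _ ⟨u, -, rfl⟩; exact u.2
    have hm : ∀ u ∈ U, x * u * x⁻¹ * u⁻¹ ∈ W ∧ y * u * y⁻¹ * u⁻¹ ∈ W := fun u hu =>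
      ⟨⟨α ⟨u, hu⟩, mem_sup_left ⟨_, rfl⟩, rfl⟩, ⟨β ⟨u, hu⟩, mem_sup_right ⟨_, rfl⟩, rfl⟩⟩
    have hKW : K ≤ normalizer (W : Set Q) := by
      rw [hK.eq, closure_le]
      have hg : ∀ g, (∀ u ∈ U, g * u * g⁻¹ * u⁻¹ ∈ W) → g ∈ normalizer (W : Set Q) := by
        intro g hg
        refine mem_normalizer_fintype fun w hw => ?_
        have h4 := mul_mem (hg w (hWU hw)) hw
        rwa [inv_mul_cancel_right] at h4
      rintro g (h | h | h) <;> rw [h]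
      exacts [hg x fun u hu => (hm u hu).1, hg y fun u hu => (hm u hu).2,
        hg y fun u hu => (hm u hu).2]
    rcases h.irr W hWU hKW with h4 | h4
    · refine absurd (eq_bot_iff.2 fun u hu => hfix u hu ?_ ?_) h.ne
      · have := (hm u hu).1
        rwa [h4, mem_bot, mul_inv_eq_one, mul_inv_eq_iff_eq_mul] at this
      · have := (hm u hu).2
        rwa [h4, mem_bot, mul_inv_eq_one, mul_inv_eq_iff_eq_mul] at this
    · rw [eq_top_iff]
      rintro u -
      obtain ⟨v, hv, hvu⟩ := h4.ge u.2
      rwa [← Subtype.ext hvu]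
  have h4 := range_inf_range_eq_bot h1 h2 h3
  obtain ⟨w, hw, hxw, hw1⟩ := hne
  have hxT : zpowers x ≤ normalizer (T : Set Q) := (zpowers_le.2 hxK).trans h.normT
  have hxt : x⁻¹ * y ∈ T := by
    have e1 : x⁻¹ * y = x⁻¹ * t * x⁻¹⁻¹ * t⁻¹ := by rw [hy]; group
    rw [e1]
    exact mul_mem (conj_mem_of_le_normalizer hxT (inv_mem (mem_zpowers x)) ht) (inv_mem ht)
  obtain ⟨g, hg, hgx⟩ := exists_conj_eq_of_abelian hp hp3 hT hab hx3 hxT hTx hxt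
  have hgx' : x * y = g * x⁻¹ * g⁻¹ := by
    have hx2 : x⁻¹ = x * x := inv_eq_of_mul_eq_one_left (by rw [← hx3, pow_succ, pow_two])
    rw [hgx, ← mul_assoc, ← mul_inv_rev, ← hx2, inv_inv]
  set v := g * w * g⁻¹ with hv
  have hvU : v ∈ U := conj_mem_of_le_normalizer h.norm (h.le hg) hw
  have hvxy : x * y * v = v * (x * y) := by
    have e1 : x⁻¹ * w = w * x⁻¹ := by
      rw [inv_mul_eq_iff_eq_mul, ← mul_assoc, hxw, mul_inv_cancel_right]
    calc x * y * v = g * (x⁻¹ * w) * g⁻¹ := by rw [hgx', hv]; group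
      _ = v * (x * y) := by rw [e1, hgx', hv]; group
  have e1 : α (⟨x⁻¹ * v * x, by
      simpa using conj_mem_of_le_normalizer h.norm (inv_mem hxK) hvU⟩ : U)⁻¹ = β ⟨v, hvU⟩ := by
    refine Subtype.ext ?_
    change x * (x⁻¹ * v * x)⁻¹ * x⁻¹ * (x⁻¹ * v * x)⁻¹⁻¹ = y * v * y⁻¹ * v⁻¹
    calc x * (x⁻¹ * v * x)⁻¹ * x⁻¹ * (x⁻¹ * v * x)⁻¹⁻¹ = v⁻¹ * (x⁻¹ * (v * (x * y)) * y⁻¹) := by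
          group
      _ = v⁻¹ * (y * v * y⁻¹) := by rw [← hvxy]; group
      _ = _ := mem_centralizer_iff.1 (h.comm (inv_mem hvU)) _ (hyU v hvU) |>.symm
  have e2 : β ⟨v, hvU⟩ = 1 := by
    have : β ⟨v, hvU⟩ ∈ α.range ⊓ β.range := mem_inf.2 ⟨⟨_, e1⟩, ⟨_, rfl⟩⟩
    rwa [h4, mem_bot] at this
  have hvy : y * v = v * y := (mem_ker_commHom h.comm hyU).1 e2
  have hvx : x * v = v * x := by
    refine mul_right_cancel (b := y) ?_
    calc x * v * y = x * (v * y) := by group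
      _ = x * (y * v) := by rw [hvy]
      _ = x * y * v := by group
      _ = v * x * y := by rw [hvxy]; group
  refine hw1 ?_
  have := hfix v hvU hvx hvy
  rwa [hv, conj_eq_one_iff] at this

end
end OrderThree

namespace OrderThree
open Subgroup
open scoped commutatorElement

universe u

variable {G : Type u} [Group G] [Finite G] {C : Set G}

theorem MinAct.eq_two_and_not_abelian (hC : Bad C) {p : ℕ} (hp : p.Prime) (hp3 : p ≠ 3)
    {R : Subgroup G} {x : G} (hx : x ∈ C) (h : MinAct p (zpowers x) (zpowers x) R) :
    p = 2 ∧ ¬ R ≤ centralizer (R : Set G) := by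
  obtain ⟨P, y, hy, hP, hRP, hPR, hPn, ⟨t, ht, hyt⟩, M, _, _, i, s, hi, hs, hsp, hM, Q, _, _, φ, ι, hφ,
    hι, U, hU, hirr⟩ := hC.exists_pair_section hp hp3 hx h
  have hιP : ∀ g : P, i (ι g) = g := fun g => DFunLike.congr_fun hι g
  set ψ := φ.comp ι with hψ
  set E := φ '' (i ⁻¹' C) with hE
  have hCi : ∀ c ∈ i ⁻¹' C, ∀ g : M, g * c * g⁻¹ ∈ i ⁻¹' C := fun c hc g => by
    simpa using hC.conj _ hc (i g)
  have hsec : NSec C E := by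
    refine ⟨⟨M, inferInstance, i, φ, hi, le_rfl⟩, ?_⟩
    rintro _ ⟨c, hc, rfl⟩ g
    obtain ⟨g, rfl⟩ := hφ g
    exact ⟨g * c * g⁻¹, hCi c hc g, by simp⟩
  have hψE : ∀ g : P, (g : G) ∈ C → ψ g ∈ E := fun g hg =>
    ⟨ι g, by rwa [Set.mem_preimage, hιP], rfl⟩
  set R' := (R.subgroupOf P).map ψ with hR'
  have hK : Conn ψ.range (ψ ⟨x, hP.mem₁⟩) (ψ ⟨y, hP.mem₂⟩) (ψ ⟨y, hP.mem₂⟩) := by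
    rw [MonoidHom.range_eq_map, ← subgroupOf_self P]
    exact (hP.subgroupOf le_rfl).map ψ
  have hRx : R ≤ ⁅R, zpowers x⁆ := h.comm.ge
  have hxP : zpowers x ≤ P := zpowers_le.2 hP.mem₁
  have hRx' : R' ≤ ⁅R', zpowers (ψ ⟨x, hP.mem₁⟩)⁆ := by
    have e1 : (zpowers x).subgroupOf P = zpowers ⟨x, hP.mem₁⟩ := by
      apply map_injective P.subtype_injective
      rw [subgroupOf_map_subtype, inf_eq_left.2 hxP, MonoidHom.map_zpowers]
      rfl
    rw [hR', ← MonoidHom.map_zpowers, ← map_commutator, ← e1,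
      commutator_subgroupOf hRP hxP]
    exact map_mono (comap_mono hRx)
  have hR'p : IsPGroup p R' := (h.isPGroup.comap_subtype (K := P)).map ψ
  have hRle : R' ≤ ψ.range := map_le_range _ _
  have hgam : R' ≤ gam (2 - 1) ψ.range := by
    rw [gam_one]
    exact le_nres hRle (hRx'.trans (commutator_mono le_rfl (zpowers_le.2 hK.mem₁)))
  refine ⟨?_, fun hab => ?_⟩
  · obtain ⟨u, hu, L, hKL, hUL, hL⟩ := hirr.exists_conn hU hK
    have hUg : U ≤ gam 2 L := hirr.le_gam hgam hKL hUL
    have hxE := hψE ⟨x, hP.mem₁⟩ hx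
    have hyE := hψE ⟨y, hP.mem₂⟩ hy
    have hzE := hsec.conj _ hxE u
    have h3 := hC.isPGroup_gam_sec hsec.sec hxE hyE hzE hL
    have hs3 : s = 3 := by
      by_contra hs3
      refine hirr.ne (eq_bot_iff.2 fun v hv => ?_)
      exact IsPElt.eq_one hs Nat.prime_three hs3 (.of_mem hirr.isPGroup hv) (.of_mem h3 (hUg hv))
    obtain ⟨L0, a, b, c, hL0, ha, hb, hc, -, -, -, hL0L⟩ := hL.lift φ hCi hxE hyE hzE
    have h4 : gam 2 (L0.map i) ≠ ⊥ := by
      rw [← map_gam]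
      intro h5
      rw [map_eq_bot_iff_of_injective _ hi] at h5
      rw [← hL0L, ← map_gam, h5, Subgroup.map_bot] at hUg
      exact hirr.ne (eq_bot_iff.2 hUg)
    have h5 : 2 ∣ Nat.card M :=
      ((hC.two_dvd_card ha hb hc (hL0.map i) h4).trans (Subgroup.card_map_dvd _ _)).trans
        (card_subgroup_dvd_card _)
    rcases hM 2 Nat.prime_two h5 with h6 | h6 | h6
    · exact h6.symm
    · omega
    · rcases prime_dvd_card_sup h.norm hPR Nat.prime_two h6 with h7 | h7
      · exfalso
        rw [Nat.card_zpowers] at h7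
        have := h7.trans (orderOf_dvd_of_pow_eq_one (hC.cube x hx))
        omega
      · exact (prime_eq_of_dvd_card hp Nat.prime_two h.isPGroup h7).symm
  · refine hirr.pair_not_abelian hs hp hsp hp3 hR'p (t := ψ ⟨t, hRP ht⟩) ?_
      ⟨_, ht, rfl⟩ ?_ hK hRx' ?_ ?_
    · rw [← map_pow]
      have : (⟨x, hP.mem₁⟩ : P) ^ 3 = 1 := Subtype.ext (hC.cube x hx)
      rw [this, map_one]
    · rw [← map_mul, ← map_inv, ← map_mul]
      exact congrArg ψ (Subtype.ext hyt)
    · intro a ha b hb hle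
      obtain ⟨hL, hKL⟩ := hK.of_le_closure ha hb hb hle
      have h1 := hirr.le_gam hgam hKL hle
      rw [hC.gam_two_pair hsec.sec (hsec.conj _ (hψE _ hx) a) (hsec.conj _ (hψE _ hy) b) hL,
        le_bot_iff] at h1
      exact hirr.ne h1
    · rintro _ ⟨a, ha, rfl⟩
      refine mem_centralizer_iff.2 ?_
      rintro _ ⟨b, hb, rfl⟩
      rw [← map_mul, ← map_mul]
      exact congrArg ψ (Subtype.ext (mem_centralizer_iff.1 (hab ha) b hb))

theorem Bad.normal_pgroup (hC : Bad C) {p : ℕ} (hp : p.Prime) (hp3 : p ≠ 3) {R : Subgroup G}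
    (hR : IsPGroup p R) {x : G} (hx : x ∈ C) (hxR : x ∈ normalizer (R : Set G))
    (hRx : ¬ R ≤ centralizer {x}) : p = 2 ∧ ¬ R ≤ centralizer (R : Set G) := by
  have : Fact p.Prime := ⟨hp⟩
  have h3 : IsPElt 3 x := .of_pow_three (hC.cube x hx)
  obtain ⟨D, hDR, hD⟩ := OrderThree.exists_minAct (K := zpowers x) (T := zpowers x) hR (zpowers_le.2 hxR)
    le_rfl le_normalizer (le_closure_of_isPGroup Nat.prime_three hp3 (isPGroup_zpowers h3))
    (fun h => hRx fun r hr => mem_centralizer_singleton_iff.2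
      (mem_centralizer_iff.1 (h hr) x (mem_zpowers x)).symm)
  obtain ⟨h1, h2⟩ := hD.eq_two_and_not_abelian hC hp hp3 hx
  exact ⟨h1, fun h => h2 ((hDR.trans h).trans (centralizer_le hDR))⟩

end OrderThree

namespace OrderThree
open Subgroup
open scoped commutatorElement

universe u

section
variable {G : Type*} [Group G] [Finite G]

theorem exists_pow_isPElt {p : ℕ} (hp : p.Prime) {Q : Type*} [Group Q] (φ : G →* Q) {g : G}
    (h : IsPElt p (φ g)) : ∃ e : ℕ, IsPElt p (g ^ e) ∧ φ (g ^ e) = φ g := by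
  obtain ⟨a, m, hm, hk⟩ := Nat.exists_eq_pow_mul_and_not_dvd (orderOf_pos g).ne' p hp.ne_one
  have hco : (p ^ a).Coprime m := Nat.Coprime.pow_left a ((Nat.Prime.coprime_iff_not_dvd hp).2 hm)
  obtain ⟨e, he1, he2⟩ := Nat.chineseRemainder hco 1 0
  refine ⟨e, ⟨a, ?_⟩, ?_⟩
  · rw [← pow_mul]
    refine orderOf_dvd_iff_pow_eq_one.1 ?_
    rw [hk, mul_comm]
    exact mul_dvd_mul ((Nat.modEq_zero_iff_dvd).1 he2) dvd_rfl
  · obtain ⟨k, hk'⟩ := h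
    have h1 : orderOf (φ g) ∣ p ^ a := by
      have h2 : orderOf (φ g) ∣ p ^ k := orderOf_dvd_of_pow_eq_one hk'
      have h3 : orderOf (φ g) ∣ p ^ a * m := by
        rw [← hk]; exact orderOf_map_dvd φ g
      exact ((Nat.Coprime.pow_left k ((Nat.Prime.coprime_iff_not_dvd hp).2 hm)).coprime_dvd_left
        h2).dvd_of_dvd_mul_right h3
    rw [map_pow, ← pow_one (φ g), ← pow_mul, one_mul, pow_eq_pow_iff_modEq]
    exact he1.of_dvd h1

end

variable {G : Type u} [Group G] [Finite G] {C : Set G}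

theorem Bad.section_pgroup (hC : Bad C) {M : Type u} [Group M] {i : M →* G}
    (hi : Function.Injective i) {Q : Type u} [Group Q] [Finite Q] {φ : M →* Q}
    (hφ : Function.Surjective φ) {p : ℕ} (hp : p.Prime) (hp3 : p ≠ 3) {R : Subgroup Q} (hR : IsPGroup p R) {x : M} (hx : i x ∈ C)
    (hxR : φ x ∈ normalizer (R : Set Q)) (hRx : ¬ R ≤ centralizer {φ x}) :
    p = 2 ∧ (IsPGroup 3 φ.ker → ¬ R ≤ centralizer (R : Set Q)) := by
  have : Fact p.Prime := ⟨hp⟩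
  have : Finite M := Finite.of_injective i hi
  have hx3 : φ x ^ 3 = 1 := by
    have h1 : x ^ 3 = 1 := hi (by rw [map_pow, map_one]; exact hC.cube _ hx)
    rw [← map_pow, h1, map_one]
  have hpx : IsPElt 3 (φ x) := .of_pow_three hx3
  obtain ⟨t, ht, htx⟩ : ∃ t ∈ R, ⁅φ x, t⁆ ≠ 1 := by
    by_contra! h1
    exact hRx fun t ht => mem_centralizer_singleton_iff.2
      (commutatorElement_eq_one_iff_mul_comm.1 (h1 t ht)).symm
  have hrR : ⁅φ x, t⁆ ∈ R := by
    rw [commutatorElement_def]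
    exact mul_mem (conj_mem_of_le_normalizer (zpowers_le.2 hxR) (mem_zpowers _) ht) (inv_mem ht)
  have hK := conn_of_isPGroup hp hp3 hR hx3 hxR ht
  set y := t * φ x * t⁻¹ with hy
  set K := closure {φ x, y, y} with hKdef
  have hrK : ⁅φ x, t⁆ ∈ K := by
    have h1 : ⁅φ x, t⁆ = φ x * y⁻¹ := by rw [hy, commutatorElement_def]; group
    rw [h1]
    exact mul_mem hK.mem₁ (inv_mem hK.mem₂)
  have hxK : zpowers (φ x) ≤ K := zpowers_le.2 hK.mem₁
  obtain ⟨D, hDR, hD⟩ := OrderThree.exists_minAct (K := zpowers (φ x)) (T := zpowers (φ x))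
    (V := R ⊓ K) (hR.to_le inf_le_left)
    (le_normalizer_inf (zpowers_le.2 hxR) (hxK.trans le_normalizer))
    le_rfl le_normalizer (le_closure_of_isPGroup Nat.prime_three hp3 (isPGroup_zpowers hpx))
    (fun h => htx (commutatorElement_eq_one_iff_commute.2 (commute_of_isPElt hp Nat.prime_three hp3
      hpx (.of_mem hR hrR) (mem_centralizer_iff.1 (h (mem_inf.2 ⟨hrR, hrK⟩)) _
        (mem_zpowers _)).symm)))
  have hDK : D ≤ nres K := le_nres (hDR.trans inf_le_right)
    (hD.comm.ge.trans (commutator_mono le_rfl hxK))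
  have hCi : ∀ c ∈ i ⁻¹' C, ∀ g : M, g * c * g⁻¹ ∈ i ⁻¹' C := fun c hc g => by
    simpa using hC.conj _ hc (i g)
  have hyC : y ∈ φ '' (i ⁻¹' C) := by
    obtain ⟨t, rfl⟩ := hφ t
    exact ⟨t * x * t⁻¹, hCi x hx t, by simp [hy]⟩
  obtain ⟨L, a, b, hL, ha, hb, hax, -, hLK⟩ := hK.lift_pair φ hCi ⟨x, hx, rfl⟩ hyC
  have hgam : gam 2 L = ⊥ :=
    hC.gam_two_pair ⟨M, inferInstance, i, MonoidHom.id M, hi, fun g hg => ⟨g, hg, rfl⟩⟩ ha hb hL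
  have : Group.IsNilpotent (nres L) := by
    rw [← nres_eq_bot_iff]
    exact hgam
  set N := closure {g | g ∈ nres L ∧ IsPElt p g} ⊓ R.comap φ with hN
  have hNp : IsPGroup p N := (isPGroup_closure_of_isNilpotent hp).to_le inf_le_left
  have hLN : L ≤ normalizer (nres L : Set M) := by
    rw [← gam_one]
    exact le_normalizer_gam 1 le_normalizer
  have haN : a ∈ normalizer (N : Set M) := by
    refine mem_normalizer_fintype fun n hn => mem_inf.2 ⟨?_, ?_⟩
    · refine conj_mem_of_le_normalizer (le_normalizer_closure (H := L) ?_) hL.mem₁ hn.1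
      rintro g hg k ⟨hk, hkp⟩
      exact ⟨conj_mem_of_le_normalizer hLN hg hk, hkp.conj g⟩
    · rw [mem_comap, map_mul, map_mul, map_inv, hax]
      exact conj_mem_of_le_normalizer (zpowers_le.2 hxR) (mem_zpowers _) hn.2
  have hDN : D ≤ N.map φ := by
    intro d hd
    have h1 := hDK hd
    rw [← hLK, ← map_nres] at h1
    obtain ⟨n, hn, rfl⟩ := h1
    obtain ⟨e, he, hen⟩ := exists_pow_isPElt hp φ (.of_mem hD.isPGroup hd)
    refine ⟨n ^ e, mem_inf.2 ⟨Subgroup.subset_closure ⟨pow_mem hn e, he⟩, ?_⟩, hen⟩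
    rw [mem_comap, hen]
    exact (hDR hd).1
  have hNa : ¬ N ≤ centralizer {a} := by
    intro h
    refine hD.ne fun d hd => mem_centralizer_iff.2 ?_
    obtain ⟨n, hn, rfl⟩ := hDN hd
    have h2 : Commute (φ x) (φ n) := by
      rw [← hax]
      exact (Commute.map (mem_centralizer_singleton_iff.1 (h hn)) φ).symm
    rintro _ ⟨k, rfl⟩
    exact h2.zpow_left k
  have hmain := hC.normal_pgroup hp hp3 (hNp.map i) (x := i a) ha
    (by
      refine mem_normalizer_fintype ?_
      rintro _ ⟨n, hn, rfl⟩
      exact ⟨a * n * a⁻¹, conj_mem_of_le_normalizer (zpowers_le.2 haN) (mem_zpowers _) hn,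
        by simp⟩)
    (fun h => hNa fun n hn => mem_centralizer_singleton_iff.2 (hi (by
      rw [map_mul, map_mul]
      exact mem_centralizer_singleton_iff.1 (h ⟨n, hn, rfl⟩))))
  refine ⟨hmain.1, fun h3 hab => hmain.2 ?_⟩
  rintro _ ⟨n, hn, rfl⟩
  refine mem_centralizer_iff.2 ?_
  rintro _ ⟨k, hk, rfl⟩
  rw [← map_mul, ← map_mul]
  refine congrArg i (commutatorElement_eq_one_iff_mul_comm.1 ?_)
  have h4 : ⁅k, n⁆ ∈ φ.ker := by
    rw [MonoidHom.mem_ker, map_commutatorElement, commutatorElement_eq_one_iff_mul_comm]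
    exact mem_centralizer_iff.1 (hab hn.2) _ hk.2
  exact IsPElt.eq_one hp Nat.prime_three hp3
    (.of_mem hNp (mul_mem (mul_mem (mul_mem hk hn) (inv_mem hk)) (inv_mem hn))) (.of_mem h3 h4)

end OrderThree

namespace OrderThree
open Subgroup
open scoped commutatorElement

universe u

/-- Two commuting automorphisms `A`, `B` of order three, with `B` fixed-point-free. -/
theorem exists_fixed_of_cube {U : Type*} [CommGroup U] {A B : U →* U} (hA : ∀ u, A (A (A u)) = u)
    (hB : ∀ u, B (B (B u)) = u) (hAB : ∀ u, A (B u) = B (A u)) (hfix : ∀ u, B u = u → u = 1)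
    {u : U} (hu : u ^ 3 ≠ 1) : ∃ w, w ≠ 1 ∧ (A w = w ∨ A (B w) = w ∨ A (B (B w)) = w) := by
  by_contra! hc
  have hN : ∀ v, v * B v * B (B v) = 1 := by
    intro v
    refine hfix _ ?_
    simp only [map_mul, hB]
    ac_rfl
  have h0 : u * A u * A (A u) = 1 := by
    by_contra h
    refine (hc _ h).1 ?_
    simp only [map_mul, hA]
    ac_rfl
  have h1 : u * A (B u) * A (B (A (B u))) = 1 := by
    by_contra h
    refine (hc _ h).2.1 ?_
    simp only [map_mul, ← hAB, hB, hA]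
    ac_rfl
  have h2 : u * A (B (B u)) * A (B (B (A (B (B u))))) = 1 := by
    by_contra h
    refine (hc _ h).2.2 ?_
    simp only [map_mul, ← hAB, hB, hA]
    ac_rfl
  have h3 := hN (A u)
  have h4 := hN (A (A u))
  simp only [← hAB, hB] at h1 h2 h3 h4
  refine hu ?_
  calc u ^ 3 = u ^ 3 * (A u * A (B u) * A (B (B u))) *
        (A (A u) * A (A (B u)) * A (A (B (B u)))) := by rw [h3, h4]; simp
    _ = (u * A u * A (A u)) * (u * A (B u) * A (A (B (B u)))) *
        (u * A (B (B u)) * A (A (B u))) := by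
      rw [pow_succ, pow_two]
      ac_rfl
    _ = 1 := by rw [h0, h1, h2]; simp

theorem conj_conj_conj {R : Type*} [Group R] {g : R} (hg : g ^ 3 = 1) (v : R) :
    g * (g * (g * v * g⁻¹) * g⁻¹) * g⁻¹ = v := by
  have h : g * (g * (g * v * g⁻¹) * g⁻¹) * g⁻¹ = g ^ 3 * v * (g ^ 3)⁻¹ := by
    rw [pow_succ, pow_two]; group
  rw [h, hg]; simp

theorem mem_normalizer_closure_orbit {R : Type*} [Group R] [Finite R] {y : R} (hy : y ^ 3 = 1)
    (v : R) : y ∈ normalizer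
      (closure {v, y * v * y⁻¹, y * (y * v * y⁻¹) * y⁻¹} : Set R) := by
  refine mem_normalizer_fintype fun n hn => ?_
  change n ∈ (Subgroup.closure _).comap (MulAut.conj y).toMonoidHom
  revert n
  change Subgroup.closure _ ≤ _
  rw [closure_le]
  rintro n (hn | hn | hn) <;> rw [hn]
  · exact Subgroup.subset_closure (by simp)
  · exact Subgroup.subset_closure (by simp)
  · change y * (y * (y * v * y⁻¹) * y⁻¹) * y⁻¹ ∈ Subgroup.closure _
    rw [conj_conj_conj hy]
    exact Subgroup.subset_closure (by simp)

theorem closure_triple_le_centralizer {R : Type*} [Group R] {a b c : R} (k1 : Commute a b)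
    (k2 : Commute b c) (k3 : Commute c a) : closure {a, b, c} ≤ centralizer (closure {a, b, c}) := by
  rw [centralizer_closure, closure_le]
  intro m hm
  refine mem_centralizer_iff.2 fun n hn => ?_
  rcases hm with hm | hm | hm <;> rcases hn with hn | hn | hn <;> rw [hm, hn]
  exacts [k1.symm.eq, k3.eq, k1.eq, k2.symm.eq, k3.symm.eq, k2.eq]

theorem exists_commute_of_cube {R : Type*} [Group R] {U : Subgroup R} (hU : U ≤ centralizer U)
    {a r : R} (haU : ∀ u ∈ U, a * u * a⁻¹ ∈ U) (hrU : ∀ u ∈ U, r * u * r⁻¹ ∈ U) (ha : a ^ 3 = 1)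
    (hr : r ^ 3 = 1) (har : a * r = r * a) (hfix : ∀ u ∈ U, r * u = u * r → u = 1) {u : R}
    (hu : u ∈ U) (hu3 : u ^ 3 ≠ 1) : ∃ w ∈ U, w ≠ 1 ∧ ∃ i : ℕ, a * r ^ i * w = w * (a * r ^ i) := by
  let _ : CommGroup U := { (inferInstance : Group U) with
    mul_comm := fun v w => Subtype.ext (mem_centralizer_iff.1 (hU w.2) v v.2) }
  let A : U →* U := MonoidHom.mk' (fun u => ⟨a * u * a⁻¹, haU u u.2⟩) fun v w =>
    Subtype.ext (by change a * (v * w : R) * a⁻¹ = a * v * a⁻¹ * (a * w * a⁻¹); group)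
  let B : U →* U := MonoidHom.mk' (fun u => ⟨r * u * r⁻¹, hrU u u.2⟩) fun v w =>
    Subtype.ext (by change r * (v * w : R) * r⁻¹ = r * v * r⁻¹ * (r * w * r⁻¹); group)
  have hrai : r⁻¹ * a⁻¹ = a⁻¹ * r⁻¹ := by rw [← mul_inv_rev, har, mul_inv_rev]
  obtain ⟨w, hw1, hw⟩ := exists_fixed_of_cube (A := A) (B := B)
    (fun v => Subtype.ext (conj_conj_conj ha (v : R))) (fun v => Subtype.ext (conj_conj_conj hr (v : R)))
    (fun v => Subtype.ext (by
      change a * (r * v * r⁻¹) * a⁻¹ = r * (a * v * a⁻¹) * r⁻¹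
      calc a * (r * v * r⁻¹) * a⁻¹ = (a * r) * v * (r⁻¹ * a⁻¹) := by group
        _ = (r * a) * v * (a⁻¹ * r⁻¹) := by rw [har, hrai]
        _ = _ := by group))
    (fun v hv => Subtype.ext (hfix v v.2 (mul_inv_eq_iff_eq_mul.1 (congrArg Subtype.val hv))))
    (u := ⟨u, hu⟩) (fun h => hu3 (congrArg Subtype.val h))
  refine ⟨w, w.2, fun h => hw1 (Subtype.ext h), ?_⟩
  rcases hw with hw | hw | hw
  · refine ⟨0, ?_⟩
    have h := congrArg Subtype.val hw
    change a * w * a⁻¹ = (w : R) at h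
    simpa using mul_inv_eq_iff_eq_mul.1 h
  · refine ⟨1, ?_⟩
    have h := congrArg Subtype.val hw
    change a * (r * w * r⁻¹) * a⁻¹ = (w : R) at h
    rw [pow_one]
    refine mul_inv_eq_iff_eq_mul.1 ?_
    conv_rhs => rw [← h]
    simp only [mul_inv_rev, mul_assoc]
  · refine ⟨2, ?_⟩
    have h := congrArg Subtype.val hw
    change a * (r * (r * w * r⁻¹) * r⁻¹) * a⁻¹ = (w : R) at h
    refine mul_inv_eq_iff_eq_mul.1 ?_
    rw [pow_two]
    conv_rhs => rw [← h]
    simp only [mul_inv_rev, mul_assoc]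

theorem MinAct.false_of_central {Q : Type u} [Group Q] [Finite Q] {K T D : Subgroup Q}
    (h : MinAct 2 K T D) (hZ : K ≤ centralizer (D ⊓ centralizer (T : Set Q) : Subgroup Q))
    {a y r : Q} (ha : a ∈ K) (hy : y ∈ K) (hr : T = zpowers r) (ha3 : a ^ 3 = 1) (hr3 : r ^ 3 = 1)
    (hy3 : y ^ 3 = 1) (har : a * r = r * a) (hyr : y * r = r * y) (hya : y * a * y⁻¹ = a * r)
    (hab : ∀ R ≤ D, y ∈ normalizer (R : Set Q) → R ≤ centralizer R → R ≤ centralizer {y}) :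
    False := by
  have hT : IsPGroup 3 T := by
    rw [hr]; exact isPGroup_zpowers (.of_pow_three hr3)
  have hrT : r ∈ T := by rw [hr]; exact mem_zpowers r
  have hrK : r ∈ K := h.le hrT
  set Z := D ⊓ centralizer (T : Set Q) with hZdef
  have hDa : ∀ g ∈ K, ∀ d ∈ D, g * d * g⁻¹ ∈ D := fun g hg d hd =>
    conj_mem_of_le_normalizer h.norm hg hd
  have hZK : ∀ z ∈ Z, ∀ g ∈ K, g * z = z * g := fun z hz g hg =>
    (mem_centralizer_iff.1 (hZ hg) z hz).symm
  have hZD : ∀ z ∈ Z, ∀ d ∈ D, z * d = d * z := fun z hz d hd =>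
    (mem_centralizer_iff.1 (h.cent hz) d hd).symm
  have hDD : ∀ d ∈ D, ∀ e ∈ D, ⁅d, e⁆ ∈ Z := fun d hd e he =>
    mem_inf.2 ⟨mul_mem (mul_mem (mul_mem hd he) (inv_mem hd)) (inv_mem he),
      h.der (commutator_mem_commutator hd he)⟩
  have hcop : ∀ d ∈ D, ⁅r, d⁆ ∈ Z → d ∈ Z := by
    intro d hd hrd
    have hpow : ∀ n : ℕ, ⁅r ^ n, d⁆ ∈ Z := by
      intro n
      induction n with
      | zero => simp
      | succ n ih =>
        have h1 : ⁅r ^ (n + 1), d⁆ = r ^ n * ⁅r, d⁆ * (r ^ n)⁻¹ * ⁅r ^ n, d⁆ := by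
          simp only [commutatorElement_def]; group
        rw [h1, hZK _ hrd _ (pow_mem hrK n)]
        simpa using mul_mem hrd ih
    refine mem_inf.2 ⟨hd, h.cop d hd fun t ht => ?_⟩
    rw [hr, ← mem_powers_iff_mem_zpowers] at ht
    obtain ⟨n, rfl⟩ := ht
    exact (mem_inf.1 (hpow n)).2
  obtain ⟨δ, hδD, hδZ, haδ⟩ : ∃ δ ∈ D, δ ∉ Z ∧ ⁅a, δ⁆ ∈ Z := by
    obtain ⟨M, hDM, hKM, -, R, _, _, f, -, hker, hI, -⟩ :=
      h.exists_irr Nat.prime_two Nat.prime_three (by norm_num) hT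
    have hmemK : ∀ g (hg : g ∈ K), f ⟨g, hKM hg⟩ ∈ (K.subgroupOf M).map f := fun g hg =>
      mem_map_of_mem f (mem_subgroupOf.2 hg)
    have hpow : ∀ g : M, (g : Q) ^ 3 = 1 → f g ^ 3 = 1 := fun g hg => by
      rw [← map_pow, show g ^ 3 = 1 from Subtype.ext hg, map_one]
    obtain ⟨⟨u, hu⟩, hu1⟩ := Subgroup.ne_bot_iff_exists_ne_one.1 hI.ne
    have hu3 : u ^ 3 ≠ 1 := by
      rw [pow_succ, hI.pow u hu, one_mul]
      exact fun h => hu1 (Subtype.ext h)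
    obtain ⟨w, hw, hw1, i, hi⟩ := exists_commute_of_cube (a := f ⟨a, hKM ha⟩) (r := f ⟨r, hKM hrK⟩)
      hI.comm (fun v hv => conj_mem_of_le_normalizer hI.norm (hmemK a ha) hv)
      (fun v hv => conj_mem_of_le_normalizer hI.norm (hmemK r hrK) hv) (hpow _ ha3) (hpow _ hr3)
      (by rw [← map_mul, ← map_mul]; exact congrArg f (Subtype.ext har))
      (fun v hv hrv => by
        rw [← mem_bot, ← hI.cop]
        refine mem_inf.2 ⟨hv, ?_⟩
        have h1 : (T.subgroupOf M).map f ≤ centralizer {v} := by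
          rintro _ ⟨t, ht, rfl⟩
          have ht1 : (t : Q) ∈ zpowers r := by rw [← hr]; exact mem_subgroupOf.1 ht
          obtain ⟨k, hk⟩ := mem_zpowers_iff.1 ht1
          have ht2 : t = ⟨r, hKM hrK⟩ ^ k := Subtype.ext (by rw [← hk]; rfl)
          rw [ht2, map_zpow]
          exact zpow_mem (mem_centralizer_singleton_iff.2 hrv) k
        exact mem_centralizer_iff.2 fun t ht => mem_centralizer_singleton_iff.1 (h1 ht)) hu hu3
    obtain ⟨ε, hε, rfl⟩ := hw
    have hεD : (ε : Q) ∈ D := mem_subgroupOf.1 hε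
    have hyi : ∀ n : ℕ, y ^ n * a * (y ^ n)⁻¹ = a * r ^ n := by
      intro n
      induction n with
      | zero => simp
      | succ n ih =>
        have h1 : y ^ (n + 1) * a * (y ^ (n + 1))⁻¹ = y * (y ^ n * a * (y ^ n)⁻¹) * y⁻¹ := by
          rw [pow_succ']; group
        have h2 : y * r ^ n = r ^ n * y := (Commute.pow_right hyr n : Commute y (r ^ n)).eq
        rw [h1, ih]
        calc y * (a * r ^ n) * y⁻¹ = y * a * y⁻¹ * (y * r ^ n) * y⁻¹ := by group
          _ = a * (r * r ^ n) := by rw [hya, h2]; group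
          _ = _ := by rw [pow_succ']
    have hZε : ⁅a * r ^ i, (ε : Q)⁆ ∈ Z := by
      have h1 : ⁅(⟨a, hKM ha⟩ * ⟨r, hKM hrK⟩ ^ i : M), ε⁆ ∈ f.ker := by
        rw [MonoidHom.mem_ker, map_commutatorElement, map_mul, map_pow,
          commutatorElement_eq_one_iff_mul_comm]
        exact hi
      rw [hker] at h1
      exact mem_subgroupOf.1 h1
    have hεZ : (ε : Q) ∉ Z := fun hz => hw1 (by
      rw [← MonoidHom.mem_ker, hker]
      exact mem_subgroupOf.2 hz)
    have hyiK : (y ^ i)⁻¹ ∈ K := inv_mem (pow_mem hy i)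
    refine ⟨(y ^ i)⁻¹ * ε * (y ^ i)⁻¹⁻¹, hDa _ hyiK _ hεD, fun hz => hεZ ?_, ?_⟩
    · have h1 := hZK _ hz _ (pow_mem hy i)
      have h2 : (ε : Q) = (y ^ i)⁻¹ * ε * (y ^ i)⁻¹⁻¹ := by
        rw [← mul_right_cancel_iff (a := y ^ i), ← h1]; group
      rw [h2]
      exact hz
    · have h1 : a = (y ^ i)⁻¹ * (a * r ^ i) * (y ^ i)⁻¹⁻¹ := by rw [← hyi]; group
      have h2 : ⁅a, (y ^ i)⁻¹ * (ε : Q) * (y ^ i)⁻¹⁻¹⁆ =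
          (y ^ i)⁻¹ * ⁅a * r ^ i, (ε : Q)⁆ * (y ^ i)⁻¹⁻¹ := by
        conv_lhs => rw [h1]
        rw [conjugate_commutatorElement]
      rw [h2, hZK _ hZε _ hyiK, mul_inv_cancel_right]
      exact hZε
  have hZc : ∀ z ∈ Z, ∀ g ∈ K, g * z * g⁻¹ = z := fun z hz g hg => by
    rw [hZK z hz g hg]; group
  have key : ∀ ε ∈ D, ⁅a * r, ε⁆ ∈ Z → δ * ε = ε * δ := by
    intro ε hε haε
    have hstep : ∀ ε ∈ D, ⁅a * r, ε⁆ ∈ Z → ⁅δ, r * ε * r⁻¹⁆ = ⁅δ, ε⁆ := by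
      intro ε hε haε
      have hc := hZc _ (hDD δ hδD _ (hDa r hrK ε hε)) a ha
      have e1 : a * ⁅δ, r * ε * r⁻¹⁆ * a⁻¹ = ⁅⁅a, δ⁆ * δ, ⁅a * r, ε⁆ * ε⁆ := by
        simp only [commutatorElement_def]; group
      rw [← hc, e1]
      have z1 := hZD _ haδ δ hδD
      have z2 := hZD _ haδ ε hε
      have z3 := hZD _ haε δ hδD
      have z4 := hZD _ haδ _ (mem_inf.1 haε).1
      generalize ⁅a, δ⁆ = u at *
      generalize ⁅a * r, ε⁆ = v at *
      have z5 := hZD _ haε ε hε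
      have hu : Commute u (δ * (v * ε)) := by
        have : Commute u δ := z1
        exact this.mul_right ((show Commute u v from z4).mul_right z2)
      have hv : Commute v δ := z3
      calc ⁅u * δ, v * ε⁆ = u * (δ * (v * ε)) * δ⁻¹ * u⁻¹ * (v * ε)⁻¹ := by
            simp only [commutatorElement_def]; group
        _ = δ * v * ε * (u * δ⁻¹ * u⁻¹) * (v * ε)⁻¹ := by rw [hu.eq]; group
        _ = (δ * v) * ε * δ⁻¹ * ε⁻¹ * v⁻¹ := by
            rw [(show Commute u δ from z1).inv_right.eq]; group
        _ = v * ⁅δ, ε⁆ * v⁻¹ := by rw [← hv.eq]; simp only [commutatorElement_def]; group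
        _ = ⁅δ, ε⁆ := by
            rw [← hZD _ (hDD δ hδD ε hε) v (mem_inf.1 haε).1]; group
    have hε1 := hDa r hrK ε hε
    have hε2 := hDa r hrK _ hε1
    have haε1 : ⁅a * r, r * ε * r⁻¹⁆ ∈ Z := by
      have e1 : r * ⁅a * r, ε⁆ * r⁻¹ = ⁅r * (a * r) * r⁻¹, r * ε * r⁻¹⁆ := by
        simp only [commutatorElement_def]; group
      have e2 : r * (a * r) * r⁻¹ = a * r := by rw [← mul_assoc, ← har]; group
      rw [← e2, ← e1, hZc _ haε r hrK]
      exact haε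
    have c1 := hstep ε hε haε
    have c2 := hstep _ hε1 haε1
    rw [c1] at c2
    have hmul : ∀ d ∈ D, ∀ e ∈ D, ⁅δ, d * e⁆ = ⁅δ, d⁆ * ⁅δ, e⁆ := by
      intro d hd e he
      have e1 : ⁅δ, d * e⁆ = ⁅δ, d⁆ * (d * ⁅δ, e⁆ * d⁻¹) := by
        simp only [commutatorElement_def]; group
      rw [e1, ← hZD _ (hDD δ hδD e he) d hd]; group
    have hn : ε * (r * ε * r⁻¹) * (r * (r * ε * r⁻¹) * r⁻¹) ∈ Z := by
      refine hcop _ (mul_mem (mul_mem hε hε1) hε2) ?_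
      have e1 : ⁅r, ε * (r * ε * r⁻¹) * (r * (r * ε * r⁻¹) * r⁻¹)⁆ =
          ⁅ε⁻¹, ε * (r * ε * r⁻¹) * (r * (r * ε * r⁻¹) * r⁻¹)⁆ := by
        calc _ = (r * ε * r⁻¹) * (r * (r * ε * r⁻¹) * r⁻¹) * (r * (r * (r * ε * r⁻¹) * r⁻¹) * r⁻¹) *
            (ε * (r * ε * r⁻¹) * (r * (r * ε * r⁻¹) * r⁻¹))⁻¹ := by
              simp only [commutatorElement_def]; group
          _ = _ := by rw [conj_conj_conj hr3]; simp only [commutatorElement_def]; group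
      rw [e1]
      exact hDD _ (inv_mem hε) _ (mul_mem (mul_mem hε hε1) hε2)
    have hcube : ⁅δ, ε⁆ ^ 3 = 1 := by
      have e1 := hmul _ (mul_mem hε hε1) _ hε2
      rw [hmul _ hε _ hε1, c1, c2, (commutatorElement_eq_one_iff_mul_comm).2 (hZD _ hn δ hδD).symm] at e1
      rw [e1, pow_succ, pow_two]
    obtain ⟨k, hk⟩ := h.isPGroup ⟨_, (mem_inf.1 (hDD δ hδD ε hε)).1⟩
    exact commutatorElement_eq_one_iff_mul_comm.1
      (IsPElt.eq_one Nat.prime_two Nat.prime_three (by norm_num) ⟨k, congrArg Subtype.val hk⟩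
        (.of_pow_three hcube))
  have hyD := hDa y hy
  have hδ1 := hyD δ hδD
  have hδ2 := hyD _ hδ1
  have hy4 : y * (y * (y * δ * y⁻¹) * y⁻¹) * y⁻¹ = δ := conj_conj_conj hy3 δ
  have har1 : ⁅a * r, y * δ * y⁻¹⁆ ∈ Z := by
    rw [← hya, ← conjugate_commutatorElement, hZc _ haδ y hy]
    exact haδ
  have k1 : Commute δ (y * δ * y⁻¹) := key _ hδ1 har1
  have k2 : Commute (y * δ * y⁻¹) (y * (y * δ * y⁻¹) * y⁻¹) := k1.map (MulAut.conj y).toMonoidHom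
  have k3 : Commute (y * (y * δ * y⁻¹) * y⁻¹) δ := by
    have := k2.map (MulAut.conj y).toMonoidHom
    change Commute (y * (y * δ * y⁻¹) * y⁻¹) (y * (y * (y * δ * y⁻¹) * y⁻¹) * y⁻¹) at this
    rwa [hy4] at this
  set R := closure {δ, y * δ * y⁻¹, y * (y * δ * y⁻¹) * y⁻¹} with hR
  have hRy : y ∈ normalizer (R : Set Q) := mem_normalizer_closure_orbit hy3 δ
  have hRR : R ≤ centralizer R := closure_triple_le_centralizer k1 k2 k3
  have hRD : R ≤ D := by
    rw [hR, closure_le]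
    rintro n (hn | hn | hn) <;> rw [hn] <;> assumption
  have hyδ := mem_centralizer_singleton_iff.1 (hab R hRD hRy hRR (Subgroup.subset_closure (by simp) : δ ∈ R))
  rw [← hyδ, mul_inv_cancel_right] at har1
  refine hδZ (hcop δ hδD ?_)
  have e1 : a * ⁅r, δ⁆ * a⁻¹ = ⁅a * r, δ⁆ * (⁅a, δ⁆)⁻¹ := by
    simp only [commutatorElement_def]; group
  have e2 := mul_mem har1 (inv_mem haδ)
  rw [← e1] at e2
  have e3 := hZc _ e2 _ (inv_mem ha)
  have e4 : a⁻¹ * (a * ⁅r, δ⁆ * a⁻¹) * a⁻¹⁻¹ = ⁅r, δ⁆ := by group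
  rw [← e4, e3]
  exact e2

end OrderThree

namespace OrderThree
open Subgroup
open scoped commutatorElement

universe u

theorem subgroupOf_closure {G : Type*} [Group G] {H : Subgroup G} {s : Set G}
    (hs : closure s ≤ H) : (closure s).subgroupOf H = closure (H.subtype ⁻¹' s) := by
  refine map_injective H.subtype_injective ?_
  rw [map_subgroupOf_eq_of_le hs, MonoidHom.map_closure, Set.image_preimage_eq_of_subset]
  intro g hg
  exact ⟨⟨g, hs (Subgroup.subset_closure hg)⟩, rfl⟩

variable {G : Type u} [Group G] [Finite G] {C : Set G}

theorem Bad.minAct (hC : Bad C) {M : Type u} [Group M] {i : M →* G} (hi : Function.Injective i)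
    {Q : Type u} [Group Q] [Finite Q] {φ : M →* Q} (hφ : Function.Surjective φ)
    (hker : IsPGroup 3 φ.ker) {p : ℕ} (hp : p.Prime) (hp3 : p ≠ 3) {K T D : Subgroup Q}
    (h : MinAct p K T D) {S : Set M} (hS : ∀ s ∈ S, i s ∈ C) (hK : K = closure (φ '' S)) :
    p = 2 ∧ K ≤ centralizer (D ⊓ centralizer (T : Set Q) : Subgroup Q) ∧
      ∀ s ∈ S, ∀ R ≤ D, φ s ∈ normalizer (R : Set Q) → R ≤ centralizer R →
        R ≤ centralizer {φ s} := by
  have hSK : ∀ s ∈ S, φ s ∈ K := fun s hs => by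
    rw [hK]; exact Subgroup.subset_closure ⟨s, hs, rfl⟩
  have hR : ∀ s ∈ S, ∀ R ≤ D, φ s ∈ normalizer (R : Set Q) → R ≤ centralizer R →
      R ≤ centralizer {φ s} := fun s hs R hRD hsR hRR => by
    by_contra hc
    exact (hC.section_pgroup hi hφ hp hp3 (h.isPGroup.to_le hRD) (hS s hs) hsR hc).2 hker hRR
  refine ⟨?_, ?_, hR⟩
  · by_contra hp2
    refine h.ne ?_
    have h1 : K ≤ centralizer D := by
      rw [hK, closure_le]
      rintro _ ⟨s, hs, rfl⟩
      by_contra hc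
      refine hp2 (hC.section_pgroup hi hφ hp hp3 h.isPGroup (hS s hs) (h.norm (hSK s hs)) ?_).1
      exact fun h2 => hc (mem_centralizer_iff.2 fun d hd =>
        mem_centralizer_singleton_iff.1 (h2 hd))
    exact le_centralizer_iff.1 (h.le.trans h1)
  · have hZ : K ≤ normalizer ((D ⊓ centralizer (T : Set Q) : Subgroup Q) : Set Q) :=
      le_normalizer_inf h.norm (le_normalizer_centralizer h.normT)
    have hZZ : D ⊓ centralizer (T : Set Q) ≤
        centralizer ((D ⊓ centralizer (T : Set Q) : Subgroup Q) : Set Q) :=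
      h.cent.trans (centralizer_le inf_le_left)
    conv_lhs => rw [hK]
    rw [closure_le]
    rintro _ ⟨s, hs, rfl⟩
    exact mem_centralizer_iff.2 fun d hd => mem_centralizer_singleton_iff.1
      (hR s hs _ inf_le_left (hZ (hSK s hs)) hZZ hd)

theorem Bad.commute_of_isPGroup (hC : Bad C) {x y : G} (hx : x ∈ C) (hy : y ∈ C)
    (hP : IsPGroup 3 (closure {x, y})) : Commute x y := by
  induction hn : Nat.card (closure {x, y}) using Nat.strong_induction_on generalizing x y with
  | _ n ih =>
  subst hn
  by_contra hxy
  have : Fact (Nat.Prime 3) := ⟨Nat.prime_three⟩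
  have hx3 := hC.cube x hx
  have hy3 := hC.cube y hy
  have hxP : x ∈ closure {x, y} := Subgroup.subset_closure (by simp)
  have hyP : y ∈ closure {x, y} := Subgroup.subset_closure (by simp)
  obtain ⟨x1, hx1⟩ : ∃ x1, x1 = y * x * y⁻¹ := ⟨_, rfl⟩
  obtain ⟨x2, hx2⟩ : ∃ x2, x2 = y * x1 * y⁻¹ := ⟨_, rfl⟩
  have hx0 : x = y * x2 * y⁻¹ := by rw [hx2, hx1, conj_conj_conj hy3]
  have hx1P : x1 ∈ closure {x, y} := hx1 ▸ mul_mem (mul_mem hyP hxP) (inv_mem hyP)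
  have hx2P : x2 ∈ closure {x, y} := hx2 ▸ mul_mem (mul_mem hyP hx1P) (inv_mem hyP)
  have hx1C : x1 ∈ C := hx1 ▸ hC.conj x hx y
  have hle : closure {x, x1} ≤ closure {x, y} := by
    rw [closure_le]
    rintro g (hg | hg) <;> rw [hg]
    exacts [hxP, hx1P]
  have hyL : y ∉ closure {x, x1} := by
    intro hyL
    have hL : Conn (closure {x, x1}) x x1 x1 := ⟨by simp, ⟨y, hyL, hx1⟩, ⟨y, hyL, hx1⟩⟩
    have h1 := hL.le_nres
    rw [nres_eq_bot_of_isPGroup Nat.prime_three (hP.to_le hle), sup_bot_eq] at h1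
    obtain ⟨k, hk⟩ := mem_zpowers_iff.1 (h1 hyL)
    exact hxy (hk ▸ (Commute.refl x).zpow_right k)
  have k1 : Commute x x1 := by
    refine ih _ ?_ hx hx1C (hP.to_le hle) rfl
    refine lt_of_le_of_ne (Subgroup.card_le_of_le hle) fun he => hyL ?_
    rw [Subgroup.eq_of_le_of_card_ge hle he.ge]
    exact hyP
  have k2 : Commute x1 x2 := by
    have := k1.map (MulAut.conj y).toMonoidHom
    change Commute (y * x * y⁻¹) (y * x1 * y⁻¹) at this
    rwa [← hx1, ← hx2] at this
  have k3 : Commute x2 x := by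
    have := k2.map (MulAut.conj y).toMonoidHom
    change Commute (y * x1 * y⁻¹) (y * x2 * y⁻¹) at this
    rwa [← hx0, ← hx2] at this
  have hx13 := hC.cube _ hx1C
  have hx23 : x2 ^ 3 = 1 := hC.cube _ (hx2 ▸ hC.conj x1 hx1C y)
  have m1 : y * x = x1 * y := by rw [hx1]; group
  have m2 : y * x1 = x2 * y := by rw [hx2]; group
  have m3 : y * x2 = x * y := by rw [hx0]; group
  obtain ⟨a, r, ha, hrP, hr1, ha3, hr3, har, hyr, hxr, hya⟩ : ∃ a r, a ∈ closure {x, y} ∧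
      r ∈ closure {x, y} ∧ r ≠ 1 ∧ a ^ 3 = 1 ∧ r ^ 3 = 1 ∧ Commute a r ∧ Commute y r ∧ Commute x r ∧
      y * a * y⁻¹ = a * r := by
    have hs3 : (x⁻¹ * x1) ^ 3 = 1 := by
      rw [k1.inv_left.mul_pow, inv_pow, hx3, hx13]; simp
    have hs1 : x⁻¹ * x1 ≠ 1 := fun h => hxy (by
      rw [inv_mul_eq_one] at h
      exact (show y * x = x * y by rw [m1, h]).symm)
    by_cases hs : Commute y (x⁻¹ * x1)
    · exact ⟨x, x⁻¹ * x1, hxP, mul_mem (inv_mem hxP) hx1P, hs1, hx3, hs3,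
        (Commute.refl x).inv_right.mul_right k1, hs, (Commute.refl x).inv_right.mul_right k1,
        by rw [← hx1]; group⟩
    · have hys : y * (x⁻¹ * x1) * y⁻¹ = x1⁻¹ * x2 := by rw [hx2, hx1]; group
      have hx11 : x1⁻¹ = x1 * x1 := inv_eq_of_mul_eq_one_left (by rw [← hx13, pow_succ, pow_two])
      have hrs : x⁻¹ * x1 * (x * x1 * x2) = x1⁻¹ * x2 := by
        rw [hx11]
        calc x⁻¹ * x1 * (x * x1 * x2) = x⁻¹ * (x1 * x) * x1 * x2 := by group
          _ = _ := by rw [← k1.eq]; group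
      have kx : Commute x (x * x1 * x2) := ((Commute.refl x).mul_right k1).mul_right k3.symm
      have kx1 : Commute x1 (x * x1 * x2) :=
        (k1.symm.mul_right (Commute.refl x1)).mul_right k2
      refine ⟨x⁻¹ * x1, x * x1 * x2, mul_mem (inv_mem hxP) hx1P, mul_mem (mul_mem hxP hx1P) hx2P,
        fun h => hs ?_, hs3, ?_, kx.inv_left.mul_left kx1, ?_, kx, by rw [hys, hrs]⟩
      · rw [h, mul_one, ← hys] at hrs
        exact (mul_inv_eq_iff_eq_mul.1 hrs.symm)
      · rw [(k3.symm.mul_left k2).mul_pow, k1.mul_pow, hx3, hx13, hx23]; simp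
      · calc y * (x * x1 * x2) = (y * x) * x1 * x2 := by group
          _ = x1 * (y * x1) * x2 := by rw [m1]; group
          _ = x1 * x2 * (y * x2) := by rw [m2]; group
          _ = x1 * (x2 * x) * y := by rw [m3]; group
          _ = (x1 * x) * x2 * y := by rw [k3.eq]; group
          _ = _ := by rw [← k1.eq]
  have hTP : zpowers r ≤ closure {x, y} := by rwa [zpowers_le]
  have hcr : closure {x, y} ≤ centralizer {r} := by
    rw [closure_le]
    rintro g (hg | hg) <;> rw [hg]
    exacts [mem_centralizer_singleton_iff.2 hxr.eq, mem_centralizer_singleton_iff.2 hyr.eq]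
  have hPT : closure {x, y} ≤ normalizer (zpowers r : Set G) := fun g hg =>
    mem_normalizer_fintype fun t ht => by
      obtain ⟨k, rfl⟩ := mem_zpowers_iff.1 ht
      have h1 : Commute g (r ^ k) := (show Commute g r from
        mem_centralizer_singleton_iff.1 (hcr hg)).zpow_right k
      rw [h1.eq, mul_inv_cancel_right]
      exact ht
  obtain ⟨H, -, hPH, p, hp, hp3, D, hD⟩ := hC.exists_minAct Nat.prime_three hx hy hy
    (K := closure {x, y}) (by simp) hTP hPT (isPGroup_zpowers (.of_pow_three hr3)) hx hy hxP hyP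
    (r := r) (mem_zpowers r) hrP hr1
  set φ := QuotientGroup.mk' (pcore 3 H) with hφ
  have hKS : ((closure {x, y}).subgroupOf H).map φ = closure (φ '' (H.subtype ⁻¹' {x, y})) := by
    rw [subgroupOf_closure hPH, MonoidHom.map_closure]
  have hTS : ((zpowers r).subgroupOf H).map φ = zpowers (φ ⟨r, hPH hrP⟩) := by
    have h1 : (zpowers r).subgroupOf H = zpowers ⟨r, hPH hrP⟩ := by
      refine map_injective H.subtype_injective ?_
      rw [map_subgroupOf_eq_of_le (hTP.trans hPH), MonoidHom.map_zpowers]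
      rfl
    rw [h1, MonoidHom.map_zpowers]
  have hker : IsPGroup 3 φ.ker := by
    rw [hφ, QuotientGroup.ker_mk']
    exact isPGroup_pcore 3
  obtain ⟨rfl, hZ, hR⟩ := hC.minAct H.subtype_injective (QuotientGroup.mk'_surjective _) hker hp hp3
    hD (S := H.subtype ⁻¹' {x, y}) (by
      rintro s (hs | hs)
      · rw [show H.subtype s = x from hs]; exact hx
      · rw [show H.subtype s = y from hs]; exact hy) hKS
  have hmem : ∀ g (hg : g ∈ closure {x, y}),
      φ ⟨g, hPH hg⟩ ∈ ((closure {x, y}).subgroupOf H).map φ := fun g hg =>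
    mem_map_of_mem φ (mem_subgroupOf.2 hg)
  have hpow : ∀ g (hg : g ∈ closure {x, y}), g ^ 3 = 1 → φ ⟨g, hPH hg⟩ ^ 3 = 1 := fun g hg hg3 => by
    rw [← map_pow]
    exact (congrArg φ (Subtype.ext hg3)).trans (map_one φ)
  refine hD.false_of_central hZ (hmem a ha) (hmem y hyP) hTS (hpow a ha ha3) (hpow r hrP hr3)
    (hpow y hyP hy3) ?_ ?_ ?_ (hR ⟨y, hPH hyP⟩ (Or.inr rfl))
  · rw [← map_mul, ← map_mul]
    exact congrArg φ (Subtype.ext har.eq)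
  · rw [← map_mul, ← map_mul]
    exact congrArg φ (Subtype.ext hyr.eq)
  · rw [← map_mul, ← map_inv, ← map_mul, ← map_mul]
    exact congrArg φ (Subtype.ext hya)

end OrderThree

namespace OrderThree
open Subgroup
open scoped commutatorElement

universe u

variable {G : Type*} [Group G] [Finite G] {C : Set G}

theorem Bad.commute_map (hC : Bad C) {M : Type*} [Group M] {i : M →* G}
    (hi : Function.Injective i) {Q : Type*} [Group Q] {φ : M →* Q} (hφ : Function.Surjective φ)
    (hQ : IsPGroup 3 Q) {x y : M} (hx : i x ∈ C) (hy : i y ∈ C) : Commute (φ x) (φ y) := by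
  have : Fact (Nat.Prime 3) := ⟨Nat.prime_three⟩
  have : Finite M := Finite.of_injective i hi
  have : Finite Q := Finite.of_surjective φ hφ
  have h3 : ∀ z, i z ∈ C → IsPGroup 3 (zpowers z) := fun z hz =>
    isPGroup_zpowers (.of_pow_three (hi (by rw [map_pow, map_one]; exact hC.cube _ hz)))
  obtain ⟨S, hxS⟩ := (h3 x hx).exists_le_sylow
  obtain ⟨S', hyS⟩ := (h3 y hy).exists_le_sylow
  obtain ⟨g, rfl⟩ := MulAction.exists_smul_eq M S S'
  have hyS1 : g⁻¹ * y * g ∈ S := by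
    have h1 := hyS (mem_zpowers y)
    rw [Sylow.coe_subgroup_smul, mem_pointwise_smul_iff_inv_smul_mem] at h1
    have h2 : (MulAut.conj g)⁻¹ • y = g⁻¹ * y * g := by simp [MulAut.smul_def]
    rwa [h2] at h1
  have hS : (S : Subgroup M).map φ = ⊤ := by
    have h1 := (S.mapSurjective hφ).is_maximal' (Q := ⊤) (hQ.to_subgroup ⊤) le_top
    rw [h1]
    rfl
  obtain ⟨s, hs, hsg⟩ : φ g ∈ (S : Subgroup M).map φ := hS ▸ mem_top _
  have hyS2 : s * (g⁻¹ * y * g) * s⁻¹ ∈ (S : Subgroup M) :=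
    mul_mem (mul_mem hs hyS1) (inv_mem hs)
  have hy2 : φ (s * (g⁻¹ * y * g) * s⁻¹) = φ y := by
    simp only [map_mul, map_inv, hsg]; group
  have hyC : i (s * (g⁻¹ * y * g) * s⁻¹) ∈ C := by
    have h1 : s * (g⁻¹ * y * g) * s⁻¹ = (s * g⁻¹) * y * (s * g⁻¹)⁻¹ := by group
    rw [h1, map_mul, map_mul, map_inv]
    exact hC.conj _ hy _
  have hcl : closure {i x, i (s * (g⁻¹ * y * g) * s⁻¹)} ≤ (S : Subgroup M).map i := by
    rw [closure_le]
    rintro z (hz | hz) <;> rw [hz]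
    exacts [mem_map_of_mem i (hxS (mem_zpowers x)), mem_map_of_mem i hyS2]
  have hc := hC.commute_of_isPGroup hx hyC ((S.isPGroup'.map i).to_le hcl)
  have hc1 : Commute x (s * (g⁻¹ * y * g) * s⁻¹) := hi (by
    exact (map_mul i _ _).trans (hc.eq.trans (map_mul i _ _).symm))
  rw [← hy2]
  exact hc1.map φ

theorem Bad.commute_section (hC : Bad C) {M : Type*} [Group M] {i : M →* G}
    (hi : Function.Injective i) {Q : Type*} [Group Q] {φ : M →* Q} {x y : M} (hx : i x ∈ C)
    (hy : i y ∈ C) (hP : IsPGroup 3 (closure {φ x, φ y})) : Commute (φ x) (φ y) := by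
  have hL : (closure {x, y}).map φ = closure {φ x, φ y} := by
    rw [MonoidHom.map_closure, Set.image_pair]
  have h2 := hC.commute_map (i := i.comp (closure {x, y}).subtype)
    (hi.comp (closure {x, y}).subtype_injective) (φ := φ.subgroupMap (closure {x, y}))
    (φ.subgroupMap_surjective _) (hL ▸ hP) (x := ⟨x, Subgroup.subset_closure (by simp)⟩)
    (y := ⟨y, Subgroup.subset_closure (by simp)⟩) hx hy
  exact congrArg Subtype.val h2.eq

end OrderThree

namespace OrderThree
open Subgroup
open scoped commutatorElement

universe u

section
variable {G : Type*} [Group G]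

theorem isPGroup_closure_pair_of_involutions {r s : G} (hr : r ^ 2 = 1) (hs : s ^ 2 = 1)
    (h : IsPElt 2 (r * s)) : IsPGroup 2 (closure {r, s}) := by
  have hri : r⁻¹ = r := inv_eq_of_mul_eq_one_left (by rw [← hr, pow_two])
  have hsi : s⁻¹ = s := inv_eq_of_mul_eq_one_left (by rw [← hs, pow_two])
  have h1 : zpowers r ≤ normalizer (zpowers (r * s) : Set G) := by
    rw [zpowers_le]
    have h2 : (zpowers (r * s)).map (MulAut.conj r).toMonoidHom = zpowers (r * s) := by
      rw [MonoidHom.map_zpowers]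
      change zpowers (r * (r * s) * r⁻¹) = _
      have h3 : r * (r * s) * r⁻¹ = (r * s)⁻¹ := by
        rw [mul_inv_rev, hsi, hri, ← mul_assoc r r s, ← pow_two, hr, one_mul]
      rw [h3, Subgroup.zpowers_inv]
    exact mem_normalizer_iff_map_conj_eq.2 h2
  have h2 := IsPGroup.to_sup_of_normal_right' (isPGroup_zpowers (p := 2) ⟨1, by simpa using hr⟩)
    (isPGroup_zpowers h) h1
  refine h2.to_le ?_
  rw [closure_le]
  rintro g (hg | hg) <;> rw [hg]
  · exact mem_sup_left (mem_zpowers r)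
  · have h3 : s = r⁻¹ * (r * s) := by group
    have h4 := mul_mem (inv_mem (mem_sup_left (T := zpowers (r * s)) (mem_zpowers r)))
      (mem_sup_right (S := zpowers r) (mem_zpowers (r * s)))
    rwa [← h3] at h4

theorem isPGroup_closure_pair_of_commute {a b : G} (ha : a ^ 3 = 1) (hb : b ^ 3 = 1)
    (h : Commute a b) : IsPGroup 3 (closure {a, b}) := by
  have : Fact (Nat.Prime 3) := ⟨Nat.prime_three⟩
  have h1 : zpowers a ≤ normalizer (zpowers b : Set G) := by
    rw [zpowers_le]
    refine mem_normalizer_iff_map_conj_eq.2 ?_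
    rw [MonoidHom.map_zpowers]
    change zpowers (a * b * a⁻¹) = _
    rw [h.eq, mul_inv_cancel_right]
  refine (IsPGroup.to_sup_of_normal_right' (isPGroup_zpowers (.of_pow_three ha))
    (isPGroup_zpowers (.of_pow_three hb)) h1).to_le ?_
  rw [closure_le]
  rintro g (hg | hg) <;> rw [hg]
  exacts [mem_sup_left (mem_zpowers a), mem_sup_right (mem_zpowers b)]

theorem map_mem_of_mem_closure_pair {H : Subgroup G} {Q : Type*} [Group Q] (φ : H →* Q)
    {a b g : G} (ha : a ∈ H) (hb : b ∈ H) (hg : g ∈ closure {a, b}) (hgH : g ∈ H) {L : Subgroup Q}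
    (h1 : φ ⟨a, ha⟩ ∈ L) (h2 : φ ⟨b, hb⟩ ∈ L) : φ ⟨g, hgH⟩ ∈ L := by
  have h3 : closure {a, b} ≤ (L.comap φ).map H.subtype := by
    rw [closure_le]
    rintro c (hc | hc) <;> rw [hc]
    exacts [⟨_, h1, rfl⟩, ⟨_, h2, rfl⟩]
  obtain ⟨g', hg', rfl⟩ := h3 hg
  exact hg'

theorem exists_odd_inverted [Finite G] {r : G} (hr : r ^ 2 = 1) (hr1 : r ∉ pcore 2 G) :
    ∃ h : G, h ≠ 1 ∧ Odd (orderOf h) ∧ r * h * r⁻¹ = h⁻¹ := by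
  have : Fact (Nat.Prime 2) := ⟨Nat.prime_two⟩
  obtain ⟨g, hg⟩ : ∃ g, ¬ IsPGroup 2 (closure {r, g * r * g⁻¹}) := by
    by_contra! hc
    exact hr1 (baer_suzuki hc)
  obtain ⟨s, hs⟩ : ∃ s, s = g * r * g⁻¹ := ⟨_, rfl⟩
  rw [← hs] at hg
  have hs2 : s ^ 2 = 1 := by rw [hs, conj_pow, hr]; simp
  have hu : ¬ IsPElt 2 (r * s) := fun h => hg (isPGroup_closure_pair_of_involutions hr hs2 h)
  obtain ⟨k, m, hm, hk⟩ :=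
    Nat.exists_eq_pow_mul_and_not_dvd (orderOf_pos (r * s)).ne' 2 (by norm_num)
  have hri : r⁻¹ = r := inv_eq_of_mul_eq_one_left (by rw [← hr, pow_two])
  have hsi : s⁻¹ = s := inv_eq_of_mul_eq_one_left (by rw [← hs2, pow_two])
  refine ⟨(r * s) ^ 2 ^ k, fun h => hu ⟨k, h⟩, ?_, ?_⟩
  · rw [orderOf_pow, hk, Nat.gcd_eq_right (Dvd.intro _ rfl),
      Nat.mul_div_cancel_left _ (by positivity)]
    exact Nat.odd_iff.2 (by omega)
  · rw [← conj_pow, ← inv_pow]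
    congr 1
    rw [mul_inv_rev, hsi, hri, ← mul_assoc r r s, ← pow_two, hr, one_mul]

end

variable {G : Type u} [Group G] [Finite G] {C : Set G}

theorem Bad.false_of_commuting_pairs (hC : Bad C) {x₁ x₂ a₁ a₂ z : G} (hx₁ : x₁ ∈ C) (hx₂ : x₂ ∈ C)
    (ha₁ : a₁ ∈ C) (ha₂ : a₂ ∈ C)
    (hxa : ∀ x ∈ ({x₁, x₂} : Set G), ∀ a ∈ ({a₁, a₂} : Set G), Commute x a) (hz1 : z ≠ 1)
    (hz2 : z ^ 2 = 1) (hzx : z ∈ closure {x₁, x₂}) (hza : z ∈ closure {a₁, a₂}) : False := by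
  have : Fact (Nat.Prime 2) := ⟨Nat.prime_two⟩
  have : Fact (Nat.Prime 3) := ⟨Nat.prime_three⟩
  obtain ⟨h, hh1, hho, hzh⟩ := exists_odd_inverted hz2 (by
    rw [hC.core 2 Nat.prime_two]
    exact hz1)
  set X := closure {x₁, x₂, h * a₁ * h⁻¹, h * a₂ * h⁻¹} with hX
  have hsol : Group.IsSolvable X := hC.solv _ hx₁ _ hx₂ _ (hC.conj _ ha₁ h) _ (hC.conj _ ha₂ h)
  have hxX : closure {x₁, x₂} ≤ X := by
    refine closure_mono ?_
    rintro g (hg | hg) <;> rw [hg] <;> simp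
  have hzX : z ∈ X := hxX hzx
  have haX : ∀ g ∈ closure {a₁, a₂}, h * g * h⁻¹ ∈ X := by
    intro g hg
    have h1 : closure {a₁, a₂} ≤ X.comap (MulAut.conj h).toMonoidHom := by
      rw [closure_le]
      rintro g (hg | hg) <;> rw [hg]
      · exact Subgroup.subset_closure (by simp)
      · exact Subgroup.subset_closure (by simp)
    exact h1 hg
  obtain ⟨n, hn⟩ := hho
  have hpow : (h ^ 2) ^ (n + 1) = h := by
    rw [← pow_mul, show 2 * (n + 1) = orderOf h + 1 by omega, pow_succ, pow_orderOf_eq_one, one_mul]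
  have hhz : h * z * h⁻¹ * z⁻¹ = h ^ 2 := by
    have h1 : h⁻¹ = z * h * z⁻¹ := hzh.symm
    have h2 : z * z = 1 := by rw [← pow_two, hz2]
    have h3 : z⁻¹ * z⁻¹ = 1 := by rw [← mul_inv_rev, h2, inv_one]
    calc h * z * h⁻¹ * z⁻¹ = h * (z * z) * h * (z⁻¹ * z⁻¹) := by rw [h1]; group
      _ = h ^ 2 := by rw [h2, h3, pow_two]; group
  have hhX : h ∈ X := by
    rw [← hpow, ← hhz]
    exact pow_mem (mul_mem (haX z hza) (inv_mem hzX)) _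
  have haX1 : closure {a₁, a₂} ≤ X := fun g hg => by
    have h1 := mul_mem (mul_mem (inv_mem hhX) (haX g hg)) hhX
    have h2 : h⁻¹ * (h * g * h⁻¹) * h = g := by group
    rwa [h2] at h1
  have hz2X : (⟨z, hzX⟩ : X) ∉ pcore 2 X := by
    intro hc
    have h1 := mul_mem ((inferInstance : (pcore 2 X).Normal).conj_mem _ hc ⟨h, hhX⟩) (inv_mem hc)
    have h2 : (⟨h, hhX⟩ : X) ^ 2 ∈ pcore 2 X := by
      have h3 : (⟨h, hhX⟩ : X) ^ 2 = ⟨h, hhX⟩ * ⟨z, hzX⟩ * (⟨h, hhX⟩)⁻¹ * (⟨z, hzX⟩)⁻¹ :=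
        Subtype.ext hhz.symm
      rwa [h3]
    have h4 : IsPElt 2 (h ^ 2) := (IsPElt.of_mem (isPGroup_pcore 2) h2).map X.subtype
    obtain ⟨k, hk⟩ := h4
    have h5 : orderOf h ∣ 2 ^ (k + 1) := orderOf_dvd_of_pow_eq_one (by rw [pow_succ', pow_mul, hk])
    have h6 : (orderOf h).Coprime (2 ^ (k + 1)) := by
      refine Nat.Coprime.pow_right _ ?_
      rw [Nat.coprime_two_right]
      exact ⟨n, hn⟩
    exact hh1 (orderOf_eq_one_iff.1 (h6.eq_one_of_dvd h5))
  obtain ⟨t, ht, ht2, v, hv, hzv⟩ := exists_pcore_quot (q := 2) ⟨1, Subtype.ext (by simpa using hz2)⟩ hz2X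
  set φ := QuotientGroup.mk' (pcore 2 X) with hφ
  set V := pcore t (X ⧸ pcore 2 X) with hV
  have : Fact t.Prime := ⟨ht⟩
  have hx₁X : x₁ ∈ X := hxX (Subgroup.subset_closure (by simp))
  have hx₂X : x₂ ∈ X := hxX (Subgroup.subset_closure (by simp))
  have hker : φ ⟨z, hzX⟩ ∉ centralizer (V : Set (X ⧸ pcore 2 X)) := fun hc =>
    hzv (mem_centralizer_iff.1 hc v hv).symm
  have ht3 : t = 3 := by
    by_contra ht3
    have h1 : ∀ x (hx : x ∈ X), x ∈ C → φ ⟨x, hx⟩ ∈ centralizer (V : Set (X ⧸ pcore 2 X)) := by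
      intro x hx hxC
      by_contra hc
      refine ht2 (hC.section_pgroup X.subtype_injective (QuotientGroup.mk'_surjective (pcore 2 X))
        ht ht3 (isPGroup_pcore t) (x := ⟨x, hx⟩) hxC ?_ fun h2 => hc ?_).1
      · rw [Subgroup.normalizer_eq_top]
        exact mem_top _
      · exact mem_centralizer_iff.2 fun w hw => mem_centralizer_singleton_iff.1 (h2 hw)
    exact hker (map_mem_of_mem_closure_pair φ hx₁X hx₂X hzx hzX (h1 _ _ hx₁) (h1 _ _ hx₂))
  subst ht3
  have ha₁X : a₁ ∈ X := haX1 (Subgroup.subset_closure (by simp))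
  have ha₂X : a₂ ∈ X := haX1 (Subgroup.subset_closure (by simp))
  have hcomm : ∀ x (hx : x ∈ X), x ∈ ({x₁, x₂} : Set G) → x ∈ C → ∀ a (ha : a ∈ X),
      a ∈ ({a₁, a₂} : Set G) → a ∈ C → Commute (φ ⟨x, hx⟩) (v * φ ⟨a, ha⟩ * v⁻¹) := by
    intro x hx hx1 hxC a ha ha1 haC
    obtain ⟨w, hw⟩ := QuotientGroup.mk'_surjective (pcore 2 X) v
    have hcon : φ (w * ⟨a, ha⟩ * w⁻¹) = v * φ ⟨a, ha⟩ * v⁻¹ := by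
      rw [map_mul, map_mul, map_inv, hφ, hw]
    rw [← hcon]
    have hpow : ∀ g (hg : g ∈ X), g ∈ C → φ ⟨g, hg⟩ ^ 3 = 1 := fun g hg hgC => by
      rw [← map_pow, show (⟨g, hg⟩ : X) ^ 3 = 1 from Subtype.ext (hC.cube g hgC), map_one]
    have hP : IsPGroup 3 (closure {φ ⟨x, hx⟩, φ ⟨a, ha⟩}) :=
      isPGroup_closure_pair_of_commute (hpow x hx hxC) (hpow a ha haC)
        ((show Commute (⟨x, hx⟩ : X) ⟨a, ha⟩ from Subtype.ext (hxa x hx1 a ha1).eq).map φ)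
    refine hC.commute_section X.subtype_injective hxC (hC.conj a haC (w : G)) ?_
    refine (hP.to_sup_of_normal_right (isPGroup_pcore 3 : IsPGroup 3 V)).to_le ?_
    rw [closure_le]
    rintro g (hg | hg) <;> rw [hg]
    · exact mem_sup_left (Subgroup.subset_closure (by simp))
    · rw [hcon]
      have hvm : v ∈ closure {φ ⟨x, hx⟩, φ ⟨a, ha⟩} ⊔ V := mem_sup_right hv
      exact mul_mem (mul_mem hvm (mem_sup_left (Subgroup.subset_closure (by simp)))) (inv_mem hvm)
  have hzz : Commute (φ ⟨z, hzX⟩) (v * φ ⟨z, hzX⟩ * v⁻¹) := by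
    have h1 : ∀ a (ha : a ∈ X), a ∈ ({a₁, a₂} : Set G) → a ∈ C →
        Commute (φ ⟨z, hzX⟩) (v * φ ⟨a, ha⟩ * v⁻¹) := fun a ha ha1 haC =>
      mem_centralizer_singleton_iff.1 (map_mem_of_mem_closure_pair φ hx₁X hx₂X hzx hzX
        (mem_centralizer_singleton_iff.2 (hcomm _ hx₁X (by simp) hx₁ a ha ha1 haC).eq)
        (mem_centralizer_singleton_iff.2 (hcomm _ hx₂X (by simp) hx₂ a ha ha1 haC).eq))
    have h2 := map_mem_of_mem_closure_pair φ ha₁X ha₂X hza hzX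
      (L := (centralizer {φ ⟨z, hzX⟩}).comap (MulAut.conj v).toMonoidHom)
      (mem_centralizer_singleton_iff.2 (h1 _ ha₁X (by simp) ha₁).symm.eq)
      (mem_centralizer_singleton_iff.2 (h1 _ ha₂X (by simp) ha₂).symm.eq)
    exact (mem_centralizer_singleton_iff.1 h2).symm
  refine hzv (commute_of_isPElt Nat.prime_three Nat.prime_two (by norm_num)
    (⟨1, ?_⟩ : IsPElt 2 (φ ⟨z, hzX⟩)) (.of_mem (isPGroup_pcore 3 : IsPGroup 3 V) ?_) ?_)
  · rw [← map_pow, show (⟨z, hzX⟩ : X) ^ 2 ^ 1 = 1 from Subtype.ext (by simpa using hz2), map_one]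
  · exact mul_mem ((inferInstance : V.Normal).conj_mem v hv _) (inv_mem hv)
  · have h1 : ⁅φ ⟨z, hzX⟩, v⁆ = φ ⟨z, hzX⟩ * (v * φ ⟨z, hzX⟩ * v⁻¹)⁻¹ := by
      simp only [commutatorElement_def]; group
    change Commute ⁅φ ⟨z, hzX⟩, v⁆ (φ ⟨z, hzX⟩)
    rw [h1]
    exact (Commute.refl _).mul_left hzz.inv_right.symm

end OrderThree

namespace OrderThree
open Subgroup
open scoped commutatorElement

universe u

theorem MinAct.exists_commuting_pairs {Q : Type*} [Group Q] [Finite Q] {K T D : Subgroup Q}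
    (h : MinAct 2 K T D) (hZ : K ≤ centralizer (D ⊓ centralizer (T : Set Q) : Subgroup Q))
    {x e d : Q} (hx : x ∈ K) (hx3 : x ^ 3 = 1) (he : e ∈ T) (hd : d ∈ D)
    (hxa : Commute x (e * x * e⁻¹)) (hxd : ⁅x, d⁆ ∉ centralizer (T : Set Q))
    (h1 : ∀ d ∈ D, ⁅e * x * e⁻¹, ⁅x, d⁆⁆ ∈ centralizer (T : Set Q))
    (h2 : ∀ d ∈ D, ⁅x, ⁅e * x * e⁻¹, d⁆⁆ ∈ centralizer (T : Set Q))
    (hab : ∀ R ≤ D, x ∈ normalizer (R : Set Q) → R ≤ centralizer R → R ≤ centralizer {x}) :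
    Commute x (e * (d * x * d⁻¹) * e⁻¹) ∧ Commute (d * x * d⁻¹) (e * x * e⁻¹) ∧
      Commute (d * x * d⁻¹) (e * (d * x * d⁻¹) * e⁻¹) ∧
      ∃ z ∈ closure {x, d * x * d⁻¹}, z ≠ 1 ∧ z ^ 2 = 1 ∧ Commute e z := by
  set Z := D ⊓ centralizer (T : Set Q) with hZdef
  have heK : e ∈ K := h.le he
  have hDa : ∀ g ∈ K, ∀ d ∈ D, g * d * g⁻¹ ∈ D := fun g hg d hd =>
    conj_mem_of_le_normalizer h.norm hg hd
  have hDc : ∀ g ∈ K, ∀ d ∈ D, ⁅g, d⁆ ∈ D := fun g hg d hd => mul_mem (hDa g hg d hd) (inv_mem hd)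
  have hZK : ∀ z ∈ Z, ∀ g ∈ K, Commute g z := fun z hz g hg =>
    (mem_centralizer_iff.1 (hZ hg) z hz).symm
  have hZD : ∀ z ∈ Z, ∀ d ∈ D, Commute z d := fun z hz d hd =>
    (mem_centralizer_iff.1 (h.cent hz) d hd).symm
  have hDD : ∀ d ∈ D, ∀ e ∈ D, ⁅d, e⁆ ∈ Z := fun d hd e he =>
    mem_inf.2 ⟨mul_mem (mul_mem (mul_mem hd he) (inv_mem hd)) (inv_mem he),
      h.der (commutator_mem_commutator hd he)⟩
  have hmul : ∀ b ∈ D, ∀ d ∈ D, ∀ e ∈ D, ⁅d * e, b⁆ = ⁅d, b⁆ * ⁅e, b⁆ := by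
    intro b hb d hd e he
    have e1 : ⁅d * e, b⁆ = d * ⁅e, b⁆ * d⁻¹ * ⁅d, b⁆ := by
      simp only [commutatorElement_def]; group
    rw [e1, ← (hZD _ (hDD e he b hb) d hd).eq, mul_inv_cancel_right]
    exact (hZD _ (hDD e he b hb) _ (mem_inf.1 (hDD d hd b hb)).1).eq
  have hfix : ∀ g ∈ K, g ^ 3 = 1 → ∀ δ ∈ D, ⁅g, δ⁆ ∈ centralizer (T : Set Q) → Commute g δ := by
    intro g hg hg3 δ hδ hgδ
    exact commute_of_isPElt Nat.prime_two Nat.prime_three (by norm_num) (.of_pow_three hg3)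
      (.of_mem h.isPGroup (hDc g hg δ hδ)) (hZK _ (mem_inf.2 ⟨hDc g hg δ hδ, hgδ⟩) g hg).symm
  obtain ⟨a, ha⟩ : ∃ a, a = e * x * e⁻¹ := ⟨_, rfl⟩
  have haK : a ∈ K := ha ▸ mul_mem (mul_mem heK hx) (inv_mem heK)
  have ha3 : a ^ 3 = 1 := by rw [ha, conj_pow, hx3]; simp
  rw [← ha] at h1 h2 hxa
  obtain ⟨ρ, hρ⟩ : ∃ ρ, ρ = ⁅x, d⁆ := ⟨_, rfl⟩
  obtain ⟨σ, hσ⟩ : ∃ σ, σ = ⁅a, e * d * e⁻¹⁆ := ⟨_, rfl⟩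
  have hdD := hDa e heK d hd
  have hρD : ρ ∈ D := hρ ▸ hDc x hx d hd
  have hσD : σ ∈ D := hσ ▸ hDc a haK _ hdD
  have haρ : Commute a ρ := hfix a haK ha3 ρ hρD (hρ ▸ h1 d hd)
  have hxσ : Commute x σ := hfix x hx hx3 σ hσD (hσ ▸ h2 _ hdD)
  have hx2 : d * x * d⁻¹ = ρ⁻¹ * x := by rw [hρ, commutatorElement_def]; group
  have ha2 : e * (d * x * d⁻¹) * e⁻¹ = σ⁻¹ * a := by rw [hσ, ha, commutatorElement_def]; group
  obtain ⟨ρ₂, hρ₂⟩ : ∃ ρ₂, ρ₂ = x * ρ * x⁻¹ := ⟨_, rfl⟩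
  obtain ⟨ρ₃, hρ₃⟩ : ∃ ρ₃, ρ₃ = x * ρ₂ * x⁻¹ := ⟨_, rfl⟩
  have hρ₂D : ρ₂ ∈ D := hρ₂ ▸ hDa x hx ρ hρD
  have hρ₃D : ρ₃ ∈ D := hρ₃ ▸ hDa x hx ρ₂ hρ₂D
  have hprod : ρ₃ * ρ₂ * ρ = 1 := by
    calc ρ₃ * ρ₂ * ρ = x ^ 3 * d * (x ^ 3)⁻¹ * d⁻¹ := by
          rw [hρ₃, hρ₂, hρ, commutatorElement_def, pow_succ, pow_two]; group
      _ = 1 := by rw [hx3]; group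
  have hIsP : ∀ δ ∈ D, δ ^ 3 = 1 → δ = 1 := fun δ hδ hδ3 =>
    IsPElt.eq_one Nat.prime_two Nat.prime_three (by norm_num) (.of_mem h.isPGroup hδ)
      (.of_pow_three hδ3)
  have hxcon : ∀ δ ∈ D, ⁅x * δ * x⁻¹, σ⁆ = ⁅δ, σ⁆ := fun δ hδ => by
    have e1 : x * ⁅δ, σ⁆ * x⁻¹ = ⁅x * δ * x⁻¹, x * σ * x⁻¹⁆ := by
      simp only [commutatorElement_def]; group
    rw [hxσ.eq, mul_inv_cancel_right, (hZK _ (hDD δ hδ σ hσD) x hx).eq, mul_inv_cancel_right] at e1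
    exact e1.symm
  have hρσ : Commute ρ σ := by
    refine commutatorElement_eq_one_iff_commute.1 (hIsP _ (mem_inf.1 (hDD ρ hρD σ hσD)).1 ?_)
    have e1 := hmul σ hσD _ (mul_mem hρ₃D hρ₂D) ρ hρD
    rw [hmul σ hσD _ hρ₃D _ hρ₂D, hprod, commutatorElement_one_left, hρ₃, hxcon _ hρ₂D, hρ₂,
      hxcon _ hρD] at e1
    rw [pow_succ, pow_two, ← e1]
  rw [ha2, hx2, ← ha]
  refine ⟨hxσ.inv_right.mul_right hxa, haρ.symm.inv_left.mul_left hxa,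
    (hρσ.inv_inv.mul_right haρ.symm.inv_left).mul_left (hxσ.inv_right.mul_right hxa),
    ⁅ρ, ρ₂⁆, ?_, fun hc => hxd ?_, ?_, hZK _ (hDD _ hρD _ hρ₂D) e heK⟩
  · have m1 : x ∈ closure {x, ρ⁻¹ * x} := Subgroup.subset_closure (by simp)
    have m2 : ρ⁻¹ * x ∈ closure {x, ρ⁻¹ * x} := Subgroup.subset_closure (by simp)
    have m3 : ρ ∈ closure {x, ρ⁻¹ * x} := by
      have e1 : ρ = x * (ρ⁻¹ * x)⁻¹ := by group
      have e2 := mul_mem m1 (inv_mem m2)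
      rwa [← e1] at e2
    have m4 : ρ₂ ∈ closure {x, ρ⁻¹ * x} := hρ₂ ▸ mul_mem (mul_mem m1 m3) (inv_mem m1)
    exact mul_mem (mul_mem (mul_mem m3 m4) (inv_mem m3)) (inv_mem m4)
  · have k1 : Commute ρ ρ₂ := commutatorElement_eq_one_iff_commute.1 hc
    have k2 : Commute ρ₂ ρ₃ := by
      have := k1.map (MulAut.conj x).toMonoidHom
      change Commute (x * ρ * x⁻¹) (x * ρ₂ * x⁻¹) at this
      rwa [← hρ₂, ← hρ₃] at this
    have k3 : Commute ρ₃ ρ := by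
      have e1 : ρ₃ = (ρ₂ * ρ)⁻¹ := eq_inv_of_mul_eq_one_left (by rw [← mul_assoc, hprod])
      rw [e1]
      exact (k1.symm.mul_left (Commute.refl ρ)).inv_left
    have hR := hab (closure {ρ, ρ₂, ρ₃}) (by
      rw [closure_le]
      rintro n (hn | hn | hn) <;> rw [hn] <;> assumption)
      (by rw [hρ₃, hρ₂]; exact mem_normalizer_closure_orbit hx3 ρ)
      (closure_triple_le_centralizer k1 k2 k3)
    have hρx := mem_centralizer_singleton_iff.1 (hR (Subgroup.subset_closure (by simp) :
      ρ ∈ closure {ρ, ρ₂, ρ₃}))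
    have e2 : ρ₂ = ρ := by rw [hρ₂, ← hρx, mul_inv_cancel_right]
    have e3 : ρ₃ = ρ := by rw [hρ₃, e2, ← hρx, mul_inv_cancel_right]
    rw [e2, e3] at hprod
    have e4 : ρ = 1 := hIsP ρ hρD (by rw [pow_succ, pow_two, hprod])
    rw [← hρ, e4]
    exact one_mem _
  · have e1 := hmul ρ₂ hρ₂D ρ hρD ρ hρD
    have e2 : ρ * ρ ∈ Z := mem_inf.2 ⟨mul_mem hρD hρD, by rw [← pow_two]; exact h.pow ρ hρD⟩
    rw [commutatorElement_eq_one_iff_commute.2 (hZD _ e2 _ hρ₂D)] at e1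
    rw [pow_two, ← e1]

end OrderThree

namespace OrderThree
open Subgroup
open scoped commutatorElement

universe u

theorem pow_eq_of_commute_of_ker {H Q : Type*} [Group H] [Group Q] (φ : H →* Q)
    (hker : IsPGroup 3 φ.ker) {w w' : H} (hww : Commute w w') (hφ : φ w = φ w')
    (hw1 : φ w ≠ 1) (hw2 : φ w ^ 2 = 1) : ∃ n : ℕ, w ^ n = w' ^ n ∧ w ^ n ≠ 1 ∧ (w ^ n) ^ 2 = 1 := by
  obtain ⟨n₁, hn₁⟩ := IsPElt.of_mem hker (show w⁻¹ * w' ∈ φ.ker by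
    rw [MonoidHom.mem_ker, map_mul, map_inv, hφ, inv_mul_cancel])
  obtain ⟨n₂, hn₂⟩ := IsPElt.of_mem hker (show w ^ 2 ∈ φ.ker by
    rw [MonoidHom.mem_ker, map_pow, hw2])
  refine ⟨3 ^ (n₁ + n₂), ?_, fun hc => hw1 ?_, ?_⟩
  · rw [← inv_mul_eq_one, ← inv_pow, ← hww.inv_left.mul_pow, pow_add, pow_mul, hn₁, one_pow]
  · refine IsPElt.eq_one Nat.prime_two Nat.prime_three (by norm_num) (⟨1, by simpa using hw2⟩)
      ⟨n₁ + n₂, ?_⟩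
    rw [← map_pow, hc, map_one]
  · rw [← pow_mul, mul_comm, pow_mul, pow_add, mul_comm (3 ^ n₁), pow_mul, hn₂, one_pow]

variable {G : Type u} [Group G] [Finite G] {C : Set G}

theorem Bad.commute_of_commute_map (hC : Bad C) {H : Subgroup G} {Q : Type*} [Group Q]
    {φ : H →* Q} (hker : IsPGroup 3 φ.ker) {u v : H} (hu : (u : G) ∈ C) (hv : (v : G) ∈ C)
    (h : Commute (φ u) (φ v)) : Commute (u : G) v := by
  have hpow : ∀ g : H, (g : G) ∈ C → φ g ^ 3 = 1 := fun g hg => by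
    rw [← map_pow, show g ^ 3 = 1 from Subtype.ext (hC.cube g hg), map_one]
  have h1 : IsPGroup 3 ((closure {φ u, φ v}).comap φ) :=
    (isPGroup_closure_pair_of_commute (hpow u hu) (hpow v hv) h).comap_of_ker_isPGroup φ hker
  refine hC.commute_of_isPGroup hu hv ((h1.map H.subtype).to_le ?_)
  rw [closure_le]
  rintro g (hg | hg) <;> rw [hg]
  · exact ⟨u, Subgroup.subset_closure (by simp), rfl⟩
  · exact ⟨v, Subgroup.subset_closure (by simp), rfl⟩

theorem Bad.eq_one (hC : Bad C) {c : G} (hc : c ∈ C) : c = 1 := by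
  by_contra hc1
  obtain ⟨hm, K, x, y, z, hx, hy, hz, hK, hT1⟩ := hC.height hc hc1
  have : Fact (Nat.Prime 3) := ⟨Nat.prime_three⟩
  have hT : IsPGroup 3 (gam 2 K) := hC.isPGroup_gam hm (by norm_num) hx hy hz hK
  have hKT : K ≤ normalizer (gam 2 K : Set G) := le_normalizer_gam _ le_normalizer
  have hTS : ⁅gam 2 K, gam 1 K⁆ = gam 2 K := by
    refine le_antisymm (commutator_le_left ((gam_le 1).trans hKT)) ?_
    conv_lhs => rw [show (2 : ℕ) = 1 + 1 from rfl, gam_succ]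
    rw [show (2 : ℕ) = 1 + 1 from rfl, gam_succ]
    exact nres_le_commutator
  have hTK : gam 2 K ≤ K := gam_le 2
  obtain ⟨H, hH, hKH, p, hp, hp3, D, hD⟩ :=
    hC.exists_minAct_of_conn Nat.prime_three hx hy hz hK hTK hKT hT (gam_le 1) hTS hT1
  have hsolv : Group.IsSolvable (H ⧸ pcore 3 H) :=
    Group.isSolvable_of_surjective (QuotientGroup.mk'_surjective _)
  set φ := QuotientGroup.mk' (pcore 3 H) with hφ
  have hφs : Function.Surjective φ := QuotientGroup.mk'_surjective _
  have hker : IsPGroup 3 φ.ker := by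
    rw [hφ, QuotientGroup.ker_mk']
    exact isPGroup_pcore 3
  have hsub : ∀ n, ((gam n K).subgroupOf H).map φ = gam n ((K.subgroupOf H).map φ) := fun n => by
    rw [gam_subgroupOf hKH, map_gam]
  obtain ⟨-, -, -, -, ⟨d, hd, hxd⟩, e, he, h1, h2⟩ := hD.eq_three hC.conj hC.cube
    (((NSec.refl hC.conj).subgroup H).image φ hφs) hm hp Nat.prime_three hp3
    ((hT.comap_of_injective _ H.subtype_injective).map _) ⟨_, hx, rfl⟩ ⟨_, hy, rfl⟩ ⟨_, hz, rfl⟩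
    ((hK.subgroupOf hKH).map _) (by rw [← hsub]; exact le_rfl)
    (by rw [← hsub, ← map_commutator]
        exact congrArg _ ((commutator_subgroupOf (hTK.trans hKH)
          ((gam_le 1).trans hKH)).trans (by rw [hTS]; rfl)))
  have hKS : (K.subgroupOf H).map φ = closure (φ '' (H.subtype ⁻¹' {x, y, z})) := by
    rw [← MonoidHom.map_closure, ← subgroupOf_closure (hK.eq ▸ hKH), ← hK.eq]
  obtain ⟨rfl, hZ, hR⟩ := hC.minAct H.subtype_injective hφs hker hp hp3
    hD (S := H.subtype ⁻¹' {x, y, z}) (by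
      rintro s (hs | hs | hs)
      · rw [show H.subtype s = x from hs]; exact hx
      · rw [show H.subtype s = y from hs]; exact hy
      · rw [show H.subtype s = z from hs]; exact hz) hKS
  obtain ⟨X, rfl⟩ : ∃ X : H, (X : G) = x := ⟨⟨x, hKH hK.mem₁⟩, rfl⟩
  obtain ⟨E, hE, rfl⟩ := he
  obtain ⟨d, rfl⟩ := hφs d
  have hET : (E : G) ∈ gam 2 K := mem_subgroupOf.1 hE
  have hAC : ((E * X * E⁻¹ : H) : G) ∈ C := hC.conj _ hx E
  have hX2C : ((d * X * d⁻¹ : H) : G) ∈ C := hC.conj _ hx d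
  have hA2C : ((E * (d * X * d⁻¹) * E⁻¹ : H) : G) ∈ C := hC.conj _ hX2C E
  have hXA : Commute (X : G) (E * X * E⁻¹ : H) := by
    refine hC.commute_of_isPGroup hx hAC ((IsPGroup.to_sup_of_normal_right'
      (isPGroup_zpowers (.of_pow_three (hC.cube _ hx))) hT
      ((zpowers_le.2 hK.mem₁).trans hKT)).to_le ?_)
    rw [closure_le]
    have m1 : (X : G) ∈ zpowers (X : G) ⊔ gam 2 K := mem_sup_left (mem_zpowers _)
    have m2 : (E : G) ∈ zpowers (X : G) ⊔ gam 2 K := mem_sup_right hET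
    rintro g (hg | hg) <;> rw [hg]
    exacts [m1, mul_mem (mul_mem m2 m1) (inv_mem m2)]
  obtain ⟨c1, c2, c3, w, hw, hw1, hw2, hew⟩ := hD.exists_commuting_pairs hZ
    (x := φ X) (mem_map_of_mem φ (mem_subgroupOf.2 hK.mem₁))
    (by rw [← map_pow, show X ^ 3 = 1 from Subtype.ext (hC.cube _ hx), map_one])
    (mem_map_of_mem φ hE) hd
    (by
      have h3 : Commute X (E * X * E⁻¹) := Subtype.ext hXA.eq
      simpa using h3.map φ) hxd h1 h2 (hR X (Or.inl rfl))
  have hc1 : Commute (X : G) (E * (d * X * d⁻¹) * E⁻¹ : H) :=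
    hC.commute_of_commute_map hker hx hA2C (by simpa using c1)
  have hc2 : Commute ((d * X * d⁻¹ : H) : G) (E * X * E⁻¹ : H) :=
    hC.commute_of_commute_map hker hX2C hAC (by simpa using c2)
  have hc3 : Commute ((d * X * d⁻¹ : H) : G) (E * (d * X * d⁻¹) * E⁻¹ : H) :=
    hC.commute_of_commute_map hker hX2C hA2C (by simpa using c3)
  obtain ⟨W, hW, rfl⟩ : ∃ W ∈ closure {X, d * X * d⁻¹}, φ W = w := by
    have h3 : (closure {X, d * X * d⁻¹}).map φ = closure {φ X, φ d * φ X * (φ d)⁻¹} := by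
      rw [MonoidHom.map_closure, Set.image_pair, map_mul, map_mul, map_inv]
    rw [← h3] at hw
    exact hw
  have hWA : E * W * E⁻¹ ∈ closure {E * X * E⁻¹, E * (d * X * d⁻¹) * E⁻¹} := by
    have h3 := mem_map_of_mem (MulAut.conj E).toMonoidHom hW
    rw [MonoidHom.map_closure, Set.image_pair] at h3
    exact h3
  have hpairs : ∀ u ∈ ({X, d * X * d⁻¹} : Set H),
      ∀ v ∈ ({E * X * E⁻¹, E * (d * X * d⁻¹) * E⁻¹} : Set H), Commute u v := by
    rintro u (hu | hu) v (hv | hv) <;> rw [hu, hv] <;> refine Subtype.ext ?_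
    exacts [hXA.eq, hc1.eq, hc2.eq, hc3.eq]
  have hWW : Commute W (E * W * E⁻¹) := by
    have h3 : closure {X, d * X * d⁻¹} ≤
        centralizer (closure {E * X * E⁻¹, E * (d * X * d⁻¹) * E⁻¹}) := by
      rw [centralizer_closure, closure_le]
      exact fun u hu => mem_centralizer_iff.2 fun v hv => (hpairs u hu v hv).symm.eq
    exact (mem_centralizer_iff.1 (h3 hW) _ hWA).symm
  obtain ⟨n, hn, hn1, hn2⟩ := pow_eq_of_commute_of_ker φ hker hWW (by
    rw [map_mul, map_mul, map_inv, hew.eq, mul_inv_cancel_right]) hw1 hw2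
  have hmem : ∀ u v g : H, g ∈ closure {u, v} → (g : G) ∈ closure {(u : G), (v : G)} := by
    intro u v g hg
    have h3 := mem_map_of_mem H.subtype hg
    rw [MonoidHom.map_closure, Set.image_pair] at h3
    exact h3
  refine hC.false_of_commuting_pairs hx hX2C hAC hA2C ?_ (fun h3 => hn1 (Subtype.ext h3))
    (congrArg Subtype.val hn2) (hmem _ _ _ (pow_mem hW n)) (hmem _ _ _ (hn ▸ pow_mem hWA n))
  rintro u (hu | hu) v (hv | hv) <;> rw [hu, hv]
  exacts [hXA, hc1, hc2, hc3]

end OrderThree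

namespace OrderThree
open Subgroup

theorem pcore_eq_bot_of_almost_simple {G : Type*} [Group G] [Finite G] {S : Subgroup G}
    (hnorm : S.Normal) (hsimple : IsSimpleGroup S) (hnonab : ¬ ∀ a b : S, a * b = b * a)
    (hcent : centralizer (S : Set G) = ⊥) {p : ℕ} (hp : p.Prime) : pcore p G = ⊥ := by
  have : Fact p.Prime := ⟨hp⟩
  rcases (inferInstance : ((pcore p G).subgroupOf S).Normal).eq_bot_or_eq_top with h | h
  · rw [eq_bot_iff, ← hcent]
    exact fun n hn => mem_centralizer_iff.2 fun s hs =>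
      commute_of_normal_of_disjoint S _ hnorm inferInstance (subgroupOf_eq_bot.1 h).symm s n hs hn
  · have hS : IsPGroup p S := (isPGroup_pcore p).to_le (subgroupOf_eq_top.1 h)
    have : Nontrivial (center S) := hS.center_nontrivial
    rcases (inferInstance : (center S).Normal).eq_bot_or_eq_top with hZ | hZ
    · exact absurd hZ ((nontrivial_iff_ne_bot _).1 this)
    · exact absurd (fun a b => (mem_center_iff.1 (hZ ▸ mem_top b) a)) hnonab

end OrderThree

theorem almost_simple_order_three_nonsolvable_four_gen
    (G : Type*) [Group G] [Finite G] (S : Subgroup G)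
    (hnorm : S.Normal) (hsimple : IsSimpleGroup S)
    (hnonab : ¬ ∀ a b : S, a * b = b * a)
    (hcent : Subgroup.centralizer (S : Set G) = ⊥)
    (x : G) (hx : orderOf x = 3) :
    ∃ g₁ g₂ g₃ : G,
      ¬ IsSolvable ↥(Subgroup.closure
        ({x, g₁⁻¹ * x * g₁, g₂⁻¹ * x * g₂, g₃⁻¹ * x * g₃} : Set G)) := by
  by_contra! hcon
  have hC : OrderThree.Bad {y | ∃ g : G, g⁻¹ * x * g = y} := by
    refine ⟨?_, ?_, ?_, fun p hp =>
      OrderThree.pcore_eq_bot_of_almost_simple hnorm hsimple hnonab hcent hp⟩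
    · rintro _ ⟨g, rfl⟩ h
      exact ⟨g * h⁻¹, by group⟩
    · rintro _ ⟨g, rfl⟩
      have h := conj_pow (i := 3) (a := g⁻¹) (b := x)
      rw [inv_inv] at h
      rw [h, ← hx, pow_orderOf_eq_one]
      simp
    · rintro _ ⟨a, rfl⟩ _ ⟨b, rfl⟩ _ ⟨c, rfl⟩ _ ⟨d, rfl⟩
      have : Group.IsSolvable (Subgroup.closure {x, (b * a⁻¹)⁻¹ * x * (b * a⁻¹),
          (c * a⁻¹)⁻¹ * x * (c * a⁻¹), (d * a⁻¹)⁻¹ * x * (d * a⁻¹)}) := hcon _ _ _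
      have h := Group.isSolvable_of_surjective
        ((MulAut.conj a⁻¹).toMonoidHom.subgroupMap_surjective (Subgroup.closure {x,
          (b * a⁻¹)⁻¹ * x * (b * a⁻¹), (c * a⁻¹)⁻¹ * x * (c * a⁻¹), (d * a⁻¹)⁻¹ * x * (d * a⁻¹)}))
      rw [MonoidHom.map_closure, Set.image_insert_eq, Set.image_insert_eq, Set.image_pair] at h
      have hconj : ∀ g, (MulAut.conj a⁻¹).toMonoidHom ((g * a⁻¹)⁻¹ * x * (g * a⁻¹)) =
          g⁻¹ * x * g := fun g => by simp [mul_assoc]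
      have hself : (MulAut.conj a⁻¹).toMonoidHom x = a⁻¹ * x * a := by simp
      rwa [hconj, hconj, hconj, hself] at h
  have h1 : x = 1 := hC.eq_one ⟨1, by group⟩
  rw [h1, orderOf_one] at hx
  norm_num at hx
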